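/- Let X be a smooth irreducible projective surface over an algebraically closed field of characteristic 0, and let φ : X → ℙ^N (N ≥ 4) be an uncrumpled map whose image Y = φ(X) is ruled by lines. Then X is a ℙ¹-bundle over a smooth curve, and φ maps each fiber of the ruling to a line in ℙ^N. -/

import Mathlib

/-!
Common framework: classical projective varieties over an algebraically closed
field, formalized via `Projectivization`.
-/

open MvPolynomial Module Set Filter

namespace PinchPaper

variable (k : Type) [Field k]

/-- The classical points of projective `N`-space over `k`. -/
abbrev Pr (N : ℕ) := Projectivization k (Fin (N + 1) → k)

variable {k}

/-- A (homogeneous) polynomial vanishes at a point of projective space. -/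
def Vanishes {N : ℕ} (f : MvPolynomial (Fin (N + 1)) k) (p : Pr k N) : Prop :=
  ∀ (v : Fin (N + 1) → k) (hv : v ≠ 0), Projectivization.mk k v hv = p → eval v f = 0

/-- Zariski-closed (projective algebraic) subsets of projective space: common zero
loci of families of homogeneous polynomials. -/
def IsAlgSet {N : ℕ} (Z : Set (Pr k N)) : Prop :=
  ∃ S : Set (MvPolynomial (Fin (N + 1)) k),
    (∀ f ∈ S, ∃ d, f.IsHomogeneous d) ∧ Z = {p | ∀ f ∈ S, Vanishes f p}

/-- A projective variety: a nonempty algebraic set which is irreducible. -/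
def IsVariety {N : ℕ} (Z : Set (Pr k N)) : Prop :=
  IsAlgSet Z ∧ Z.Nonempty ∧
    ∀ Z₁ Z₂ : Set (Pr k N), IsAlgSet Z₁ → IsAlgSet Z₂ → Z ⊆ Z₁ ∪ Z₂ → Z ⊆ Z₁ ∨ Z ⊆ Z₂

/-- `Z` has dimension `n`, via lengths of chains of subvarieties. -/
def HasDim {N : ℕ} (Z : Set (Pr k N)) (n : ℕ) : Prop :=
  Order.krullDim {W : Set (Pr k N) // IsVariety W ∧ W ⊆ Z} = (n : ℕ∞)

/-- The polynomials vanishing identically on `Z` (as a `k`-submodule). -/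
noncomputable def vanishingIdeal {N : ℕ} (Z : Set (Pr k N)) :
    Submodule k (MvPolynomial (Fin (N + 1)) k) :=
  ⨅ p ∈ Z, LinearMap.ker (MvPolynomial.aeval (R := k) (Projectivization.rep p)).toLinearMap

/-- The Hilbert function of the homogeneous coordinate ring of `Z`. -/
noncomputable def hilb {N : ℕ} (Z : Set (Pr k N)) (m : ℕ) : ℕ :=
  finrank k (↥(homogeneousSubmodule (Fin (N + 1)) k m) ⧸
    (Submodule.comap (homogeneousSubmodule (Fin (N + 1)) k m).subtype (vanishingIdeal Z)))

/-- `Z` (of dimension `n`) has degree `d`: the Hilbert polynomial of `Z` has degree `n`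
and leading coefficient `d / n!`. -/
def HasDegree {N : ℕ} (Z : Set (Pr k N)) (n d : ℕ) : Prop :=
  ∃ P : Polynomial ℚ, P.degree = (n : ℕ) ∧ P.leadingCoeff * (n.factorial : ℚ) = (d : ℚ) ∧
    ∀ᶠ m : ℕ in atTop, (hilb Z m : ℚ) = P.eval (m : ℚ)

/-- A curve `B` has (arithmetic, hence for smooth curves geometric) genus `g`:
its Hilbert polynomial is `P(m) = d·m + (1 - g)`. -/
def HasGenus {N : ℕ} (B : Set (Pr k N)) (g : ℕ) : Prop :=
  ∃ d : ℕ, ∀ᶠ m : ℕ in atTop, (hilb B m : ℤ) = d * m + 1 - g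

/-- A line in projective space: the set of points lying in a 2-dimensional linear subspace. -/
def IsLine {N : ℕ} (L : Set (Pr k N)) : Prop :=
  ∃ W : Submodule k (Fin (N + 1) → k), finrank k W = 2 ∧
    L = {p | Projectivization.submodule p ≤ W}

/-- A 2-plane in projective space. -/
def Is2Plane {N : ℕ} (L : Set (Pr k N)) : Prop :=
  ∃ W : Submodule k (Fin (N + 1) → k), finrank k W = 3 ∧
    L = {p | Projectivization.submodule p ≤ W}

/-- `Y` is non-degenerate: no nonzero linear form vanishes on it. -/
def Nondegenerate {N : ℕ} (Y : Set (Pr k N)) : Prop :=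
  ∀ f : MvPolynomial (Fin (N + 1)) k, f.IsHomogeneous 1 → (∀ p ∈ Y, Vanishes f p) → f = 0

/-- `Y` is ruled by lines: it contains infinitely many lines (equivalently, its Fano
scheme of lines is positive-dimensional). -/
def RuledByLines {N : ℕ} (Y : Set (Pr k N)) : Prop :=
  {L : Set (Pr k N) | IsLine L ∧ L ⊆ Y}.Infinite

/-- The differential of `f` at `v`, as a linear functional. -/
noncomputable def diffAt {N : ℕ} (f : MvPolynomial (Fin (N + 1)) k) (v : Fin (N + 1) → k) :
    (Fin (N + 1) → k) →ₗ[k] k :=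
  ∑ j, eval v (pderiv j f) • (LinearMap.proj j : (Fin (N + 1) → k) →ₗ[k] k)

/-- The affine cone over the embedded Zariski tangent space of `Z` at `p`. -/
noncomputable def embTangent {N : ℕ} (Z : Set (Pr k N)) (p : Pr k N) :
    Submodule k (Fin (N + 1) → k) :=
  ⨅ f ∈ {f : MvPolynomial (Fin (N + 1)) k |
      (∃ d, f.IsHomogeneous d) ∧ ∀ q ∈ Z, Vanishes f q},
    LinearMap.ker (diffAt f (Projectivization.rep p))

/-- A smooth projective surface (embedded in some projective space). -/
def IsSmoothSurface {N : ℕ} (Z : Set (Pr k N)) : Prop :=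
  IsVariety Z ∧ HasDim Z 2 ∧ ∀ p ∈ Z, finrank k (embTangent Z p) = 3

/-- A smooth projective curve. -/
def IsSmoothCurve {N : ℕ} (Z : Set (Pr k N)) : Prop :=
  IsVariety Z ∧ HasDim Z 1 ∧ ∀ p ∈ Z, finrank k (embTangent Z p) = 2

/-- `F` is a local homogeneous representation of `φ` near `p ∈ X`. -/
def LocalRep {M N : ℕ} (X : Set (Pr k M)) (φ : Pr k M → Pr k N) (p : Pr k M)
    (F : Fin (N + 1) → MvPolynomial (Fin (M + 1)) k) : Prop :=
  (∃ d, ∀ i, (F i).IsHomogeneous d) ∧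
  (fun i => eval (Projectivization.rep p) (F i)) ≠ 0 ∧
  ∀ q ∈ X, ∀ (v : Fin (M + 1) → k) (hv : v ≠ 0), Projectivization.mk k v hv = q →
    ∀ hFv : (fun i => eval v (F i)) ≠ 0,
      φ q = Projectivization.mk k (fun i => eval v (F i)) hFv

/-- `φ` is a morphism on the projective set `X`: locally given by homogeneous polynomials. -/
def IsMorphismOn {M N : ℕ} (X : Set (Pr k M)) (φ : Pr k M → Pr k N) : Prop :=
  ∀ p ∈ X, ∃ F, LocalRep X φ p F

/-- The Jacobian of a tuple of polynomials at `v`, as a linear map. -/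
noncomputable def jacobian {M N : ℕ} (F : Fin (N + 1) → MvPolynomial (Fin (M + 1)) k)
    (v : Fin (M + 1) → k) : (Fin (M + 1) → k) →ₗ[k] (Fin (N + 1) → k) :=
  Matrix.mulVecLin (Matrix.of fun i j => eval v (pderiv j (F i)))

/-- `φ` (defined on the surface `X`) is ramified at `p`: its differential has rank ≤ 1,
i.e. the image of the affine tangent cone has rank ≤ 2. -/
def RamifiedAt {M N : ℕ} (X : Set (Pr k M)) (φ : Pr k M → Pr k N) (p : Pr k M) : Prop :=
  ∀ F, LocalRep X φ p F →
    finrank k ((embTangent X p).map (jacobian F (Projectivization.rep p))) ≤ 2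

/-- The ramification locus of `φ` on `X`. -/
def RamLocus {M N : ℕ} (X : Set (Pr k M)) (φ : Pr k M → Pr k N) : Set (Pr k M) :=
  {p | p ∈ X ∧ RamifiedAt X φ p}

/-- `φ` is unramified at `p` (injective differential on Zariski tangent spaces). -/
def UnramifiedAt {M N : ℕ} (X : Set (Pr k M)) (φ : Pr k M → Pr k N) (p : Pr k M) : Prop :=
  ∀ F, LocalRep X φ p F → ∀ w ∈ embTangent X p,
    jacobian F (Projectivization.rep p) w ∈
      Submodule.span k {(fun i => eval (Projectivization.rep p) (F i))} →
    w ∈ Submodule.span k {Projectivization.rep p}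

/-- `φ` is a closed embedding on `X`: injective, closed image, unramified, and the
embedded tangent spaces of the image match those of `X`. -/
def IsClosedEmbeddingOn {M N : ℕ} (X : Set (Pr k M)) (φ : Pr k M → Pr k N) : Prop :=
  InjOn φ X ∧ IsAlgSet (φ '' X) ∧ (∀ p ∈ X, UnramifiedAt X φ p) ∧
    ∀ p ∈ X, finrank k (embTangent (φ '' X) (φ p)) = finrank k (embTangent X p)

/-- `φ` is generically injective on `X` (i.e. birational onto its image). -/
def GenericallyInjectiveOn {M N : ℕ} (X : Set (Pr k M)) (φ : Pr k M → Pr k N) : Prop :=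
  ∃ Z : Set (Pr k M), IsAlgSet Z ∧ ¬ X ⊆ Z ∧ InjOn φ (X \ Z)

/-- An uncrumpled map: a morphism with non-degenerate image, birational onto its
image, with finite ramification locus. -/
def Uncrumpled {M N : ℕ} (X : Set (Pr k M)) (φ : Pr k M → Pr k N) : Prop :=
  IsMorphismOn X φ ∧ Nondegenerate (φ '' X) ∧ GenericallyInjectiveOn X φ ∧
    (RamLocus X φ).Finite

/-- The ramification locus of the composite of `φ` with the linear projection given by
the matrix `L`; ramification means the image of the affine tangent cone has rank ≤ `r`. -/
def ProjRamLocus {M N T : ℕ} (X : Set (Pr k M)) (φ : Pr k M → Pr k N)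
    (L : Matrix (Fin T) (Fin (N + 1)) k) (r : ℕ) : Set (Pr k M) :=
  {p | p ∈ X ∧ ∀ F, LocalRep X φ p F →
    finrank k ((embTangent X p).map
      ((Matrix.mulVecLin L).comp (jacobian F (Projectivization.rep p)))) ≤ r}

/-- A property holds for a general matrix: it holds on a nonempty Zariski-open set. -/
def ForGenericMatrix {a b : ℕ} (P : Matrix (Fin a) (Fin b) k → Prop) : Prop :=
  ∃ G : MvPolynomial (Fin a × Fin b) k, G ≠ 0 ∧
    ∀ L : Matrix (Fin a) (Fin b) k, eval (fun ij => L ij.1 ij.2) G ≠ 0 → P L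

/-- A property holds for a general vector. -/
def ForGenericVector {b : ℕ} (P : (Fin b → k) → Prop) : Prop :=
  ∃ G : MvPolynomial (Fin b) k, G ≠ 0 ∧ ∀ a : Fin b → k, eval a G ≠ 0 → P a

/-- A property holds for a general point of `X`: it holds away from a proper closed subset. -/
def ForGeneralPointOn {M : ℕ} (X : Set (Pr k M)) (P : Pr k M → Prop) : Prop :=
  ∃ Z : Set (Pr k M), IsAlgSet Z ∧ ¬ X ⊆ Z ∧ ∀ x ∈ X \ Z, P x

/-- The pinch point scheme length: `𝔓(φ) = n` iff the composition of `φ` with a general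
linear projection to `ℙ³` has exactly `n` pinch (ramification) points.  (By
[Eisenbud–Harris, 12.6] this equals `deg (6ζ² + 4ζK + K² − c₂)`.) -/
def HasPinch {M N : ℕ} (X : Set (Pr k M)) (φ : Pr k M → Pr k N) (n : ℕ) : Prop :=
  ForGenericMatrix (fun L : Matrix (Fin 4) (Fin (N + 1)) k =>
    (∀ p ∈ X, L.mulVec (Projectivization.rep (φ p)) ≠ 0) ∧
    (ProjRamLocus X φ L 2).ncard = n ∧ (ProjRamLocus X φ L 2).Finite)

/-- A rational normal scroll in `ℙ^N`: a smooth non-degenerate surface of minimal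
degree `N − 1` which is ruled by lines. -/
def IsRationalNormalScroll {N : ℕ} (Y : Set (Pr k N)) : Prop :=
  IsSmoothSurface Y ∧ Nondegenerate Y ∧ RuledByLines Y ∧ HasDegree Y 2 (N - 1)

/-- The exceptional fiber of `β` over `x`. -/
def ExcFiber {M' M : ℕ} (Xt : Set (Pr k M')) (β : Pr k M' → Pr k M) (x : Pr k M) :
    Set (Pr k M') := {q | q ∈ Xt ∧ β q = x}

/-- `β : X̃ → X` is the blow-up of the surface `X` at the (smooth) point `x`:
a birational morphism which is an isomorphism away from `x`, whose fiber over `x`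
is an irreducible curve, smooth along that fiber. -/
def IsBlowupAt {M' M : ℕ} (Xt : Set (Pr k M')) (X : Set (Pr k M))
    (β : Pr k M' → Pr k M) (x : Pr k M) : Prop :=
  x ∈ X ∧ IsVariety Xt ∧ HasDim Xt 2 ∧ IsMorphismOn Xt β ∧ β '' Xt = X ∧
    InjOn β {q | q ∈ Xt ∧ β q ≠ x} ∧
    IsVariety (ExcFiber Xt β x) ∧ HasDim (ExcFiber Xt β x) 1 ∧
    ∀ q ∈ ExcFiber Xt β x, finrank k (embTangent Xt q) = 3

/-- `φ̃ : X̃ → ℙ^{N'}` resolves the inner projection of `φ : X → ℙ^N` from `y = φ x`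
(via the blow-up `β : X̃ → X` and with projection given by a linear map `L` whose
kernel is the line of `y`). -/
def ResolvesInnerProj {M M' N N' : ℕ} (X : Set (Pr k M)) (φ : Pr k M → Pr k N)
    (x : Pr k M) (Xt : Set (Pr k M')) (β : Pr k M' → Pr k M)
    (φt : Pr k M' → Pr k N') (L : (Fin (N + 1) → k) →ₗ[k] (Fin (N' + 1) → k)) : Prop :=
  IsMorphismOn Xt φt ∧ LinearMap.ker L = Projectivization.submodule (φ x) ∧
    ∀ q ∈ Xt, β q ≠ x → ∀ (v : Fin (N + 1) → k) (hv : v ≠ 0),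
      Projectivization.mk k v hv = φ (β q) → ∀ hLv : L v ≠ 0,
        φt q = Projectivization.mk k (L v) hLv

/-- The standard quadratic (Veronese) monomials. -/
def veroneseVec (v : Fin 3 → k) : Fin 6 → k :=
  ![v 0 * v 0, v 0 * v 1, v 0 * v 2, v 1 * v 1, v 1 * v 2, v 2 * v 2]

/-- The image of the Veronese embedding `ℙ² → ℙ⁵`. -/
def veroneseImage (k : Type) [Field k] : Set (Pr k 5) :=
  {p | ∃ (v : Fin 3 → k) (hv : veroneseVec v ≠ 0), p = Projectivization.mk k (veroneseVec v) hv}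

/-- `Y` is (projectively equivalent to) the Veronese surface in `ℙ⁵`
(the existence of the linear isomorphism forces `N = 5`). -/
def IsVeroneseSurface {N : ℕ} (Y : Set (Pr k N)) : Prop :=
  ∃ σ : (Fin 6 → k) ≃ₗ[k] (Fin (N + 1) → k),
    Y = Projectivization.map σ.toLinearMap σ.injective '' veroneseImage k

/-- `Y ⊂ ℙ^N` is linearly normal: it is not an isomorphic linear projection of a
non-degenerate variety in `ℙ^{N+1}`. -/
def LinearlyNormal {N : ℕ} (Y : Set (Pr k N)) : Prop :=
  ¬ ∃ (Y' : Set (Pr k (N + 1))) (π : Pr k (N + 1) → Pr k N)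
      (L : (Fin (N + 1 + 1) → k) →ₗ[k] (Fin (N + 1) → k)),
      IsVariety Y' ∧ Nondegenerate Y' ∧
      (∀ q ∈ Y', ∀ (v : Fin (N + 1 + 1) → k) (hv : v ≠ 0),
        Projectivization.mk k v hv = q →
          ∃ hLv : L v ≠ 0, π q = Projectivization.mk k (L v) hLv) ∧
      π '' Y' = Y ∧ InjOn π Y' ∧
      ∀ q ∈ Y', Disjoint (LinearMap.ker L) (embTangent Y' q)

/-- A del Pezzo surface of degree `d` in `ℙ^N`: a smooth non-degenerate linearly normal
surface of degree `d` (for `d = N` this characterizes anticanonically embedded del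
Pezzo surfaces). -/
def IsDelPezzoOfDegree {N : ℕ} (Y : Set (Pr k N)) (d : ℕ) : Prop :=
  IsSmoothSurface Y ∧ Nondegenerate Y ∧ LinearlyNormal Y ∧ HasDegree Y 2 d

/-- `F` is isomorphic to `ℙ¹` (as a projective variety). -/
def IsIsoToP1 {M : ℕ} (F : Set (Pr k M)) : Prop :=
  ∃ ψ : Pr k 1 → Pr k M, IsMorphismOn Set.univ ψ ∧ Set.BijOn ψ Set.univ F ∧
    ∃ ψ' : Pr k M → Pr k 1, IsMorphismOn F ψ' ∧ ∀ t, ψ' (ψ t) = t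

/-- `ρ : X → B` exhibits `X` as a `ℙ¹`-bundle over the curve `B`
(all fibers are isomorphic to `ℙ¹`). -/
def IsP1Bundle {M m : ℕ} (X : Set (Pr k M)) (B : Set (Pr k m))
    (ρ : Pr k M → Pr k m) : Prop :=
  IsMorphismOn X ρ ∧ ρ '' X = B ∧ ∀ b ∈ B, IsIsoToP1 {p | p ∈ X ∧ ρ p = b}

/-- The hyperplane cut out by the linear form with coefficients `a`. -/
def hyperplaneOf {N : ℕ} (a : Fin (N + 1) → k) : Set (Pr k N) :=
  {p | Vanishes (∑ i, MvPolynomial.C (a i) * MvPolynomial.X i) p}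

/-- A rational normal curve of degree `N` in `ℙ^N`: a non-degenerate curve of degree `N`. -/
def IsRationalNormalCurve {N : ℕ} (C : Set (Pr k N)) : Prop :=
  IsVariety C ∧ HasDim C 1 ∧ Nondegenerate C ∧ HasDegree C 1 N

/-- The Gauss degree `γ₁` of an embedded curve `X ⊂ ℙ^N`: the number of ramification
points of a general linear projection `X → ℙ¹`. -/
def HasGaussDegree {N : ℕ} (X : Set (Pr k N)) (γ : ℕ) : Prop :=
  ForGenericMatrix (fun L : Matrix (Fin 2) (Fin (N + 1)) k =>
    (∀ p ∈ X, L.mulVec (Projectivization.rep p) ≠ 0) ∧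
    (ProjRamLocus X id L 1).ncard = γ ∧ (ProjRamLocus X id L 1).Finite)

section

variable {M N : ℕ}

section LocalAlgebra

theorem natCast_two_le_krullDim {α : Type*} [Preorder α] {a b c : α} (hab : a < b) (hbc : b < c) :
    ((2 : ℕ) : WithBot ℕ∞) ≤ Order.krullDim α :=
  Order.le_krullDim_iff.2 ⟨LTSeries.mk 2 ![a, b, c]
    (Fin.strictMono_iff_lt_succ.2 (by simp [Fin.forall_fin_succ, hab, hbc])), rfl⟩

theorem natCast_three_le_krullDim {α : Type*} [Preorder α] {a b c d : α} (hab : a < b)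
    (hbc : b < c) (hcd : c < d) : ((3 : ℕ) : WithBot ℕ∞) ≤ Order.krullDim α :=
  Order.le_krullDim_iff.2 ⟨LTSeries.mk 3 ![a, b, c, d]
    (Fin.strictMono_iff_lt_succ.2 (by simp [Fin.forall_fin_succ, hab, hbc, hcd])), rfl⟩

theorem isPrincipal_of_principal_maximalIdeal {R : Type*} [CommRing R] [IsLocalRing R]
    [IsNoetherianRing R] (y : R) (h : IsLocalRing.maximalIdeal R = Ideal.span {y})
    (Q : Ideal R) [hQ : Q.IsPrime] : Q = ⊥ ∨ Q = IsLocalRing.maximalIdeal R := by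
  by_cases hy : y ∈ Q
  · right
    exact le_antisymm (IsLocalRing.le_maximalIdeal hQ.ne_top)
      (h ▸ (Ideal.span_singleton_le_iff_mem Q).2 hy)
  · left
    refine Submodule.eq_bot_of_le_smul_of_le_jacobson_bot (IsLocalRing.maximalIdeal R) Q
      (IsNoetherian.noetherian Q) ?_ (IsLocalRing.maximalIdeal_le_jacobson _)
    intro q hq
    have hq' : q ∈ IsLocalRing.maximalIdeal R := IsLocalRing.le_maximalIdeal hQ.ne_top hq
    rw [h, Ideal.mem_span_singleton] at hq'
    obtain ⟨c, rfl⟩ := hq'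
    have hc : c ∈ Q := (hQ.mem_or_mem hq).resolve_left hy
    exact Ideal.mul_mem_mul (h ▸ Ideal.mem_span_singleton_self y) hc

theorem isIntegrallyClosed_of_maximalIdeal_eq_span_pair {R : Type*} [CommRing R] [IsDomain R]
    [IsLocalRing R] [IsNoetherianRing R] (x y : R)
    (h : IsLocalRing.maximalIdeal R = Ideal.span {x, y}) (P : Ideal R) [hP : P.IsPrime]
    (hP0 : P ≠ ⊥) (hPm : P ≠ IsLocalRing.maximalIdeal R) : IsIntegrallyClosed R := by
  classical
  wlog hx : x ∉ P generalizing x y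
  · refine this y x (by rw [h, Set.pair_comm]) fun hy => hPm ?_
    refine le_antisymm (IsLocalRing.le_maximalIdeal hP.ne_top) ?_
    rw [h, Ideal.span_le]
    rintro z (rfl | rfl)
    · simpa using hx
    · exact hy
  have hxm : x ∈ IsLocalRing.maximalIdeal R := h ▸ Ideal.subset_span (by simp)
  let S := R ⧸ Ideal.span {x}
  have hxtop : Ideal.span {x} ≠ ⊤ := fun ht =>
    (IsLocalRing.mem_maximalIdeal x).1 hxm (Ideal.span_singleton_eq_top.1 ht)
  have : Nontrivial S := Ideal.Quotient.nontrivial_iff.2 hxtop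
  let π : R →+* S := Ideal.Quotient.mk _
  have hπ : Function.Surjective π := Ideal.Quotient.mk_surjective
  have : IsLocalRing S := IsLocalRing.of_surjective' π hπ
  have hπx : π x = 0 := Ideal.Quotient.eq_zero_iff_mem.2 (Ideal.mem_span_singleton_self x)
  have hmS : IsLocalRing.maximalIdeal S = Ideal.span {π y} := by
    have : IsLocalHom π := .of_surjective π hπ
    have h1 : (IsLocalRing.maximalIdeal R).map π = IsLocalRing.maximalIdeal S := by
      apply le_antisymm
      · exact ((IsLocalRing.local_hom_TFAE π).out 0 2).1 ‹IsLocalHom π›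
      · intro s hs
        obtain ⟨r, rfl⟩ := hπ s
        refine Ideal.mem_map_of_mem π ?_
        rw [IsLocalRing.mem_maximalIdeal] at hs ⊢
        exact fun hr => hs (hr.map π)
    rw [← h1, h, Ideal.map_span, Set.image_pair, hπx, Ideal.span_insert_zero]
  have hprime := fun (Q : Ideal S) (hQ : Q.IsPrime) =>
    isPrincipal_of_principal_maximalIdeal (π y) hmS Q
  have : IsPrincipalIdealRing S := IsPrincipalIdealRing.of_prime fun Q hQ => by
    rcases hprime Q hQ with h1 | h1
    · exact h1 ▸ inferInstance
    · exact ⟨π y, h1.trans hmS⟩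
  have key : ∀ Q : Ideal R, Q.IsPrime → Q ≠ IsLocalRing.maximalIdeal R → Q.IsPrincipal := by
    intro Q hQ hQm
    by_cases hxQ : x ∈ Q
    · have hker : RingHom.ker π ≤ Q := by
        rw [Ideal.mk_ker]; exact (Ideal.span_singleton_le_iff_mem Q).2 hxQ
      have := Ideal.map_isPrime_of_surjective hπ hker
      have hcomap : (Q.map π).comap π = Q := by
        rw [Ideal.comap_map_of_surjective' π hπ]
        exact sup_eq_left.2 hker
      rcases hprime (Q.map π) inferInstance with h1 | h1
      · refine ⟨x, ?_⟩
        rw [← hcomap, h1]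
        exact Ideal.mk_ker
      · exfalso
        apply hQm
        refine le_antisymm (IsLocalRing.le_maximalIdeal hQ.ne_top) fun z hz => ?_
        rw [← hcomap, h1, Ideal.mem_comap, IsLocalRing.mem_maximalIdeal]
        intro hu
        have : IsLocalHom π := .of_surjective π hπ
        exact (IsLocalRing.mem_maximalIdeal z).1 hz (isUnit_of_map_unit π z hu)
    · obtain ⟨g, hg⟩ := (IsPrincipalIdealRing.principal (Q.map π)).1
      have hgm : g ∈ Q.map π := hg ▸ Ideal.mem_span_singleton_self g
      obtain ⟨f, hfQ, rfl⟩ := (Ideal.mem_map_iff_of_surjective π hπ).1 hgm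
      refine ⟨f, le_antisymm ?_ ((Ideal.span_singleton_le_iff_mem Q).2 hfQ)⟩
      refine Submodule.le_of_le_smul_of_le_jacobson_bot (I := Ideal.span {x})
        (IsNoetherian.noetherian Q) ?_ ?_
      · exact ((Ideal.span_singleton_le_iff_mem _).2 hxm).trans
          (IsLocalRing.maximalIdeal_le_jacobson _)
      · intro q hq
        have h1 : π q ∈ Q.map π := Ideal.mem_map_of_mem π hq
        rw [hg] at h1
        obtain ⟨s, hs⟩ := Ideal.mem_span_singleton.1 h1
        obtain ⟨r, rfl⟩ := hπ s
        have h2 : q - f * r ∈ Ideal.span {x} := by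
          rw [← Ideal.Quotient.eq_zero_iff_mem]
          change π (q - f * r) = 0
          rw [map_sub, hs, map_mul, sub_self]
        obtain ⟨t, ht⟩ := Ideal.mem_span_singleton.1 h2
        have htQ : t ∈ Q := by
          have : x * t ∈ Q := ht ▸ Q.sub_mem hq (Q.mul_mem_right _ hfQ)
          exact (hQ.mem_or_mem this).resolve_left hxQ
        have : q = f * r + x * t := by rw [← ht]; ring
        rw [this]
        exact Submodule.add_mem_sup (Ideal.mem_span_singleton.2 (dvd_mul_right _ _))
          (Ideal.mul_mem_mul (Ideal.mem_span_singleton_self x) htQ)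
  have : UniqueFactorizationMonoid R := by
    rw [UniqueFactorizationMonoid.iff_exists_prime_mem_of_isPrime]
    have aux : ∀ I : Ideal R, I ≠ ⊥ → I.IsPrime → I ≠ IsLocalRing.maximalIdeal R →
        ∃ z ∈ I, Prime z := by
      intro I hI hI' hm
      obtain ⟨z, hz⟩ := (key I hI' hm).1
      have hz0 : z ≠ 0 := by rintro rfl; apply hI; rw [hz]; simp
      have hz' : I = Ideal.span {z} := hz
      refine ⟨z, hz' ▸ Ideal.mem_span_singleton_self z, ?_⟩
      rw [← Ideal.span_singleton_prime hz0, ← hz']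
      exact hI'
    intro I hI hI'
    by_cases hm : I = IsLocalRing.maximalIdeal R
    · obtain ⟨z, hz, hz'⟩ := aux P hP0 hP hPm
      exact ⟨z, hm ▸ IsLocalRing.le_maximalIdeal hP.ne_top hz, hz'⟩
    · exact aux I hI hI' hm
  infer_instance

theorem exists_prime_lt_of_isMaximal {k A : Type*} [Field k] [IsAlgClosed k] [CommRing A]
    [IsDomain A] [Algebra k A] [Algebra.FiniteType k A] (P₁ P₂ : Ideal A) [P₁.IsPrime]
    [P₂.IsPrime] (h₁ : ⊥ < P₁) (h₂ : P₁ < P₂) (m : Ideal A) [hm : m.IsMaximal] :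
    ∃ P : Ideal A, P.IsPrime ∧ ⊥ < P ∧ P < m := by
  obtain ⟨s, g, hinj, hintegral⟩ := exists_integral_inj_algHom_of_fg k A
  letI : Algebra (MvPolynomial (Fin s) k) A := g.toRingHom.toAlgebra
  have : Algebra.IsIntegral (MvPolynomial (Fin s) k) A := ⟨hintegral⟩
  have : FaithfulSMul (MvPolynomial (Fin s) k) A := (faithfulSMul_iff_algebraMap_injective (MvPolynomial (Fin s) k) A).2 hinj
  have hn : (m.under (MvPolynomial (Fin s) k)).IsMaximal := Ideal.isMaximal_comap_of_isIntegral_of_isMaximal m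
  have hp₁ : (⊥ : Ideal (MvPolynomial (Fin s) k)) < P₁.under (MvPolynomial (Fin s) k) := by
    rw [bot_lt_iff_ne_bot]
    intro h
    exact h₁.ne' (Ideal.eq_bot_of_comap_eq_bot h)
  have hp₂ : P₁.under (MvPolynomial (Fin s) k) < P₂.under (MvPolynomial (Fin s) k) := Ideal.IsIntegral.comap_lt_comap h₂
  have hs : 2 ≤ s := by
    have h := natCast_two_le_krullDim (α := PrimeSpectrum (MvPolynomial (Fin s) k))
      (a := ⟨⊥, Ideal.isPrime_bot⟩) (b := ⟨P₁.under _, inferInstance⟩)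
      (c := ⟨P₂.under _, inferInstance⟩) hp₁ hp₂
    have h' : Order.krullDim (PrimeSpectrum (MvPolynomial (Fin s) k)) = (s : ℕ) := by
      have := MvPolynomial.ringKrullDim_of_isNoetherianRing (R := k) (ι := Fin s)
      rw [ringKrullDim_eq_zero_of_field, zero_add] at this
      simpa [ringKrullDim] using this
    rw [h'] at h
    have h3 : ((2 : ℕ) : WithBot ℕ∞) ≤ (s : ℕ) := h
    exact_mod_cast h3
  obtain ⟨a, ha⟩ := MvPolynomial.isMaximal_iff_eq_vanishingIdeal_singleton.1 hn
  have mem_n : ∀ f : MvPolynomial (Fin s) k, f ∈ m.under (MvPolynomial (Fin s) k) ↔ eval a f = 0 := by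
    intro f
    rw [ha, MvPolynomial.mem_vanishingIdeal_singleton_iff]
    rfl
  let i₀ : Fin s := ⟨0, by omega⟩
  let i₁ : Fin s := ⟨1, by omega⟩
  have hi : i₁ ≠ i₀ := by simp [i₀, i₁]
  let θ : MvPolynomial (Fin s) k →ₐ[k] MvPolynomial (Fin s) k := aeval (Function.update X i₀ (C (a i₀)))
  let Q : Ideal (MvPolynomial (Fin s) k) := RingHom.ker θ
  have hQ : Q.IsPrime := RingHom.ker_isPrime _
  have hQ0 : Q ≠ ⊥ := by
    intro h
    have h1 : (X i₀ - C (a i₀) : MvPolynomial (Fin s) k) ∈ Q := by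
      simp [Q, RingHom.mem_ker, θ, algebraMap_eq]
    rw [h, Ideal.mem_bot, sub_eq_zero] at h1
    have := congrArg (eval (Function.update a i₀ (a i₀ + 1))) h1
    simp at this
  have hQn : Q < m.under (MvPolynomial (Fin s) k) := by
    refine lt_of_le_of_ne ?_ ?_
    · intro f hf
      rw [mem_n]
      have h1 : ∀ f : MvPolynomial (Fin s) k, eval a (θ f) = eval a f := by
        intro f
        have : ((aeval a : MvPolynomial (Fin s) k →ₐ[k] k).comp θ) = aeval a := by
          apply MvPolynomial.algHom_ext
          intro i
          by_cases hi : i = i₀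
          · subst hi; simp [θ]
          · simp [θ, hi]
        have h2 := congrArg (fun g => g f) this
        exact h2
      rw [← h1, (RingHom.mem_ker).1 hf, map_zero]
    · intro h
      have h1 : (X i₁ - C (a i₁) : MvPolynomial (Fin s) k) ∈ Q := by rw [h, mem_n]; simp
      simp only [Q, RingHom.mem_ker, map_sub, θ, aeval_X, Function.update_of_ne hi,
        aeval_C, algebraMap_eq, sub_eq_zero] at h1
      have := congrArg (eval (Function.update a i₁ (a i₁ + 1))) h1
      simp at this
  have hlo : m.LiesOver (m.under (MvPolynomial (Fin s) k)) := ⟨rfl⟩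
  obtain ⟨P, hPm, hP, hPQ⟩ := Ideal.exists_ideal_lt_liesOver_of_lt m hQn
  refine ⟨P, hP, ?_, hPm⟩
  rw [bot_lt_iff_ne_bot]
  rintro rfl
  apply hQ0
  rw [hPQ.over]
  exact Ideal.comap_bot_of_injective _ hinj

end LocalAlgebra

open TensorProduct in
/-- Two field extensions of a field embed in a common one. -/
theorem exists_common_extension {K : Type} {A C : Type} [Field K] [Field A] [Field C]
    (f : K →+* A) (g : K →+* C) :
    ∃ (Ω : Type) (_ : Field Ω) (i : A →+* Ω) (j : C →+* Ω), i.comp f = j.comp g := by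
  letI := f.toAlgebra
  letI := g.toAlgebra
  obtain ⟨m, hm⟩ := Ideal.exists_maximal (A ⊗[K] C)
  letI : Field ((A ⊗[K] C) ⧸ m) := Ideal.Quotient.field m
  refine ⟨(A ⊗[K] C) ⧸ m, inferInstance,
    (Ideal.Quotient.mk m).comp (Algebra.TensorProduct.includeLeft (S := K)).toRingHom,
    (Ideal.Quotient.mk m).comp (Algebra.TensorProduct.includeRight (R := K)).toRingHom, ?_⟩
  ext x
  simp only [RingHom.comp_apply]
  congr 1
  have h1 := (Algebra.TensorProduct.includeLeft (R := K) (S := K) (A := A) (B := C)).commutes x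
  have h2 := (Algebra.TensorProduct.includeRight (R := K) (A := A) (B := C)).commutes x
  exact h1.trans h2.symm

/-- In characteristic zero, an element of an extension `E / L` outside `L` is separated by two
embeddings of `E` over `L`. -/
theorem exists_two_embeddings {L E : Type} [Field L] [Field E] [CharZero L] [Algebra L E] (u : E)
    (hu : u ∉ (algebraMap L E).range) :
    ∃ (Ω : Type) (_ : Field Ω) (i₁ i₂ : E →+* Ω),
      i₁.comp (algebraMap L E) = i₂.comp (algebraMap L E) ∧ i₁ u ≠ i₂ u := by
  let K := IntermediateField.adjoin L {u}
  have huK : u ∈ K := IntermediateField.mem_adjoin_simple_self L u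
  obtain ⟨C, hC, j₁, j₂, hj, hne⟩ : ∃ (C : Type) (_ : Field C) (j₁ j₂ : K →+* C),
      j₁.comp (algebraMap L K) = j₂.comp (algebraMap L K) ∧ j₁ ⟨u, huK⟩ ≠ j₂ ⟨u, huK⟩ := by
    by_cases halg : IsAlgebraic L u
    · let C := AlgebraicClosure K
      have : Algebra.IsAlgebraic L K :=
        IntermediateField.isAlgebraic_adjoin_simple halg.isIntegral
      have : Algebra.IsAlgebraic L C := Algebra.IsAlgebraic.trans L K C
      have : IsAlgClosure L C := ⟨inferInstance, inferInstance⟩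
      have : IsGalois L C := {}
      have hnb : algebraMap K C ⟨u, huK⟩ ∉ (⊥ : IntermediateField L C) := by
        intro h
        obtain ⟨a, ha⟩ := IntermediateField.mem_bot.1 h
        rw [IsScalarTower.algebraMap_apply L K C] at ha
        have := (algebraMap K C).injective ha
        exact hu ⟨a, congrArg Subtype.val this⟩
      rw [InfiniteGalois.mem_bot_iff_fixed] at hnb
      push Not at hnb
      obtain ⟨σ, hσ⟩ := hnb
      refine ⟨C, inferInstance, algebraMap K C, (σ : C →+* C).comp (algebraMap K C), ?_, hσ.symm⟩
      ext x
      have : algebraMap K C (algebraMap L K x) = algebraMap L C x :=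
        (IsScalarTower.algebraMap_apply L K C x).symm
      simp [this]
    · have htr : Transcendental L u := halg
      have htr' : Transcendental L (u + 1) := by
        intro h
        apply halg
        have := h.sub (isAlgebraic_one (R := L) (A := E))
        simpa using this
      let e := RatFunc.algEquivOfTranscendental u htr
      let e' := RatFunc.algEquivOfTranscendental (u + 1) htr'
      let θ : K →ₐ[L] E := ((IntermediateField.adjoin L {u + 1}).val.comp
        e'.toAlgHom).comp e.symm.toAlgHom
      refine ⟨E, inferInstance, K.val, θ, ?_, ?_⟩
      · ext x
        exact ((K.val).commutes x).trans (θ.commutes x).symm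
      · have : e.symm ⟨u, huK⟩ = algebraMap (Polynomial L) (RatFunc L) Polynomial.X := by
          rw [AlgEquiv.symm_apply_eq]
          ext
          simp [e, RatFunc.algEquivOfTranscendental_algebraMap]
        change u ≠ ((e' (e.symm ⟨u, huK⟩)) : E)
        rw [this]
        simp [e', RatFunc.algEquivOfTranscendental_algebraMap]
  obtain ⟨Ω₁, _, a, b, hab⟩ := exists_common_extension (algebraMap K E) j₁
  obtain ⟨Ω₂, _, c, d, hcd⟩ := exists_common_extension (algebraMap K E) (b.comp j₂)
  refine ⟨Ω₂, inferInstance, d.comp a, c, ?_, ?_⟩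
  · ext x
    have h1 := RingHom.congr_fun hab (algebraMap L K x)
    have h2 := RingHom.congr_fun hcd (algebraMap L K x)
    have h3 := RingHom.congr_fun hj x
    simp only [RingHom.comp_apply] at h1 h2 h3 ⊢
    rw [IsScalarTower.algebraMap_apply L K E, h1, h2, h3]
  · have h1 := RingHom.congr_fun hab ⟨u, huK⟩
    have h2 := RingHom.congr_fun hcd ⟨u, huK⟩
    simp only [RingHom.comp_apply] at h1 h2 ⊢
    change a u = _ at h1
    change c u = _ at h2
    rw [h1, h2]
    exact fun h => hne (b.injective (d.injective h))

/-- Homomorphisms to an algebraically closed field extend generically to finitely generated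
overdomains. -/
theorem exists_generic_extension {k A B : Type} [Field k] [IsAlgClosed k] [CommRing A]
    [IsNoetherianRing A] [IsDomain A] [CommRing B] [IsDomain B] [Algebra k A] [Algebra k B]
    [Algebra A B] [IsScalarTower k A B] [Algebra.FiniteType k B] [Algebra.FiniteType A B]
    (hinj : Function.Injective (algebraMap A B)) :
    ∃ a : A, a ≠ 0 ∧ ∀ χ : A →ₐ[k] k, χ a ≠ 0 →
      ∃ χ' : B →ₐ[k] k, ∀ x, χ' (algebraMap A B x) = χ x := by
  have hfp : (algebraMap A B).FinitePresentation := by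
    rw [RingHom.finitePresentation_algebraMap]
    exact Algebra.FinitePresentation.of_finiteType.1 inferInstance
  obtain ⟨S, hS⟩ := PrimeSpectrum.exists_constructibleSetData_iff.2
    (PrimeSpectrum.isConstructible_range_comap hfp)
  have hbot : (⊥ : PrimeSpectrum A) ∈ S.toSet := by
    rw [hS]
    refine ⟨⊥, ?_⟩
    ext x
    simp [PrimeSpectrum.comap_asIdeal, (map_eq_zero_iff _ hinj)]
  simp only [PrimeSpectrum.ConstructibleSetData.toSet, mem_iUnion] at hbot
  obtain ⟨D, hDS, hD⟩ := hbot
  have hD1 : ∀ i, D.g i = 0 := fun i => by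
    have := hD.1 (mem_range_self i)
    simpa using this
  have hD2 : D.f ≠ 0 := fun h => hD.2 (by simp [h])
  refine ⟨D.f, hD2, fun χ hχ => ?_⟩
  have hker : (RingHom.ker χ).IsMaximal :=
    RingHom.ker_isMaximal_of_surjective _ fun c => ⟨algebraMap k A c, by simp⟩
  have hmem : (⟨RingHom.ker χ, hker.isPrime⟩ : PrimeSpectrum A) ∈
      range (PrimeSpectrum.comap (algebraMap A B)) := by
    rw [← hS]
    simp only [PrimeSpectrum.ConstructibleSetData.toSet, mem_iUnion]
    refine ⟨D, hDS, ?_, ?_⟩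
    · rintro _ ⟨i, rfl⟩
      simp [hD1 i]
    · intro h
      exact hχ (by simpa using h)
  obtain ⟨q, hq⟩ := hmem
  obtain ⟨m, hm, hqm⟩ := q.asIdeal.exists_le_maximal q.2.ne_top
  letI : Field (B ⧸ m) := Ideal.Quotient.field m
  have : Module.Finite k (B ⧸ m) := finite_of_finite_type_of_isJacobsonRing _ _
  have hbij := IsAlgClosed.algebraMap_bijective_of_isIntegral (k := k) (K := B ⧸ m)
  let e := AlgEquiv.ofBijective (Algebra.ofId k (B ⧸ m)) hbij
  refine ⟨e.symm.toAlgHom.comp (Ideal.Quotient.mkₐ k m), fun x => ?_⟩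
  have hx : x - algebraMap k A (χ x) ∈ RingHom.ker χ := by simp
  have hx2 : algebraMap A B (x - algebraMap k A (χ x)) ∈ m := by
    apply hqm
    have : RingHom.ker χ = Ideal.comap (algebraMap A B) q.asIdeal :=
      (congrArg PrimeSpectrum.asIdeal hq).symm
    rw [this] at hx
    exact hx
  have hx3 : Ideal.Quotient.mk m (algebraMap A B x) = algebraMap k (B ⧸ m) (χ x) := by
    rw [map_sub, ← IsScalarTower.algebraMap_apply k A B] at hx2
    rw [← Ideal.Quotient.eq] at hx2
    exact hx2
  change e.symm (Ideal.Quotient.mk m (algebraMap A B x)) = χ x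
  rw [AlgEquiv.symm_apply_eq, hx3]
  rfl

theorem aeval_mul_of_isHomogeneous {σ k K : Type} [CommRing k] [CommRing K] [Algebra k K]
    {f : MvPolynomial σ k} {d : ℕ} (hf : f.IsHomogeneous d) (c : K) (v : σ → K) :
    aeval (fun i => c * v i) f = c ^ d * aeval v f := by
  rw [aeval_def, aeval_def, eval₂_eq, eval₂_eq, Finset.mul_sum]
  refine Finset.sum_congr rfl fun m hm => ?_
  have hd := hf.degree_eq_sum_deg_support hm
  simp only [mul_pow, Finset.prod_mul_distrib, Finset.prod_pow_eq_pow_sum]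
  rw [show ∑ i ∈ m.support, m i = d from hd.symm]
  ring

theorem eval_smul_of_isHomogeneous {σ k : Type} [CommRing k]
    {f : MvPolynomial σ k} {d : ℕ} (hf : f.IsHomogeneous d) (c : k) (v : σ → k) :
    eval (c • v) f = c ^ d * eval v f :=
  aeval_mul_of_isHomogeneous hf c v

/-- Homogenization of `f` in degree `d` with respect to a linear form `l`. -/
noncomputable def homogenizeBy {σ k : Type} [CommRing k] (l : MvPolynomial σ k) (d : ℕ)
    (f : MvPolynomial σ k) : MvPolynomial σ k :=
  ∑ j ∈ Finset.range (d + 1), l ^ (d - j) * homogeneousComponent j f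

theorem isHomogeneous_homogenizeBy {σ k : Type} [CommRing k] {l : MvPolynomial σ k}
    (hl : l.IsHomogeneous 1) (d : ℕ) (f : MvPolynomial σ k) :
    (homogenizeBy l d f).IsHomogeneous d := by
  refine IsHomogeneous.sum _ _ _ fun j hj => ?_
  have hj' : j ≤ d := Nat.lt_succ_iff.1 (Finset.mem_range.1 hj)
  have := (hl.pow (d - j)).mul (homogeneousComponent_isHomogeneous j f)
  rwa [one_mul, Nat.sub_add_cancel hj'] at this

theorem aeval_homogenizeBy {σ k K : Type} [CommRing k] [Field K] [Algebra k K]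
    {l : MvPolynomial σ k} {d : ℕ} {f : MvPolynomial σ k} (hf : f.totalDegree ≤ d)
    (v : σ → K) (hv : aeval v l ≠ 0) :
    aeval v (homogenizeBy l d f) = aeval v l ^ d * aeval (fun i => v i / aeval v l) f := by
  have hsum : f = ∑ j ∈ Finset.range (d + 1), homogeneousComponent j f := by
    conv_lhs => rw [← sum_homogeneousComponent f]
    refine Finset.sum_subset (Finset.range_mono (by lia)) fun j _ hj => ?_
    exact homogeneousComponent_eq_zero _ _ (by simpa using hj)
  conv_rhs => rw [hsum]
  rw [homogenizeBy, map_sum, map_sum, Finset.mul_sum]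
  refine Finset.sum_congr rfl fun j hj => ?_
  have hj' : j ≤ d := Nat.lt_succ_iff.1 (Finset.mem_range.1 hj)
  have h := aeval_mul_of_isHomogeneous (homogeneousComponent_isHomogeneous j f)
    (aeval v l)⁻¹ v
  have h2 : (fun i => (aeval v l)⁻¹ * v i) = fun i => v i / aeval v l := by
    ext i; rw [div_eq_inv_mul]
  rw [h2] at h
  rw [h, map_mul, map_pow, ← mul_assoc]
  congr 1
  rw [inv_pow, ← div_eq_mul_inv, eq_div_iff (pow_ne_zero _ hv), ← pow_add, Nat.sub_add_cancel hj']

/-- Either `u₁ / u₂` is a homogeneous function of degree zero in the ratios of the `a i`, or a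
general point of the zero locus of `I` shares these ratios with another point where `u₁ / u₂`
takes a different value. -/
theorem ratio_mem_or_exists_separated {k σ ι : Type} [Field k] [IsAlgClosed k] [CharZero k]
    [Finite σ] (I : Ideal (MvPolynomial σ k)) [hI : I.IsPrime] (a : ι → MvPolynomial σ k)
    (i₀ : ι) (ha : a i₀ ∉ I) (u₁ u₂ c : MvPolynomial σ k) (hu₂ : u₂ ∉ I) (hc : c ∉ I) :
    (∃ (e : ℕ) (P Q : MvPolynomial ι k), P.IsHomogeneous e ∧ Q.IsHomogeneous e ∧
      aeval a Q ∉ I ∧ u₁ * aeval a Q - u₂ * aeval a P ∈ I) ∨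
    ∃ c' : MvPolynomial σ k, c' ∉ I ∧ ∀ x : σ → k, (∀ f ∈ I, eval x f = 0) → eval x c' ≠ 0 →
      ∃ x' : σ → k, (∀ f ∈ I, eval x' f = 0) ∧ eval x' c ≠ 0 ∧
        eval x' u₁ * eval x u₂ ≠ eval x u₁ * eval x' u₂ ∧
        ∀ i, eval x (a i) * eval x' (a i₀) = eval x' (a i) * eval x (a i₀) := by
  let A := MvPolynomial σ k ⧸ I
  let E := FractionRing A
  let π : MvPolynomial σ k →ₐ[k] E :=
    (IsScalarTower.toAlgHom k A E).comp (Ideal.Quotient.mkₐ k I)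
  have hπ : ∀ f, π f = 0 ↔ f ∈ I := by
    intro f
    change algebraMap A E (Ideal.Quotient.mk I f) = 0 ↔ _
    rw [map_eq_zero_iff _ (IsFractionRing.injective A E), Ideal.Quotient.eq_zero_iff_mem]
  let r : ι → E := fun i => π (a i) / π (a i₀)
  have hb : π (a i₀) ≠ 0 := fun h => ha ((hπ _).1 h)
  have hu : π u₂ ≠ 0 := fun h => hu₂ ((hπ _).1 h)
  have hc0 : π c ≠ 0 := fun h => hc ((hπ _).1 h)
  let L := IntermediateField.adjoin k (range r)
  by_cases hmem : π u₁ / π u₂ ∈ L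
  · left
    obtain ⟨p, q, hpq⟩ := (IntermediateField.mem_adjoin_range_iff k r _).1 hmem
    let d := max p.totalDegree q.totalDegree
    have key : ∀ f : MvPolynomial ι k, f.totalDegree ≤ d →
        π (aeval a (homogenizeBy (X i₀) d f)) = π (a i₀) ^ d * aeval r f := by
      intro f hf
      have h1 := aeval_homogenizeBy (K := E) (l := X i₀) hf (fun i => π (a i)) (by simpa using hb)
      simp only [aeval_X] at h1
      rw [← h1]
      have := AlgHom.congr_fun (comp_aeval (R := k) a π) (homogenizeBy (X i₀) d f)
      exact this
    have hHom := fun f : MvPolynomial ι k => isHomogeneous_homogenizeBy (isHomogeneous_X k i₀) d f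
    by_cases hq : aeval r q = 0
    · have h0 : π u₁ = 0 := by
        rw [hq, div_zero, div_eq_zero_iff] at hpq
        exact hpq.resolve_right hu
      refine ⟨0, 0, 1, isHomogeneous_zero _ _ _, isHomogeneous_one _ _, ?_, ?_⟩
      · rw [map_one]
        exact fun h => hI.ne_top ((Ideal.eq_top_iff_one _).2 h)
      · simpa using (hπ _).1 h0
    · refine ⟨d, _, _, hHom p, hHom q, ?_, ?_⟩
      · rw [← hπ, key q (le_max_right _ _)]
        exact mul_ne_zero (pow_ne_zero _ hb) hq
      · rw [← hπ, map_sub, map_mul, map_mul, key q (le_max_right _ _), key p (le_max_left _ _)]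
        rw [div_eq_div_iff hu hq] at hpq
        linear_combination (π (a i₀)) ^ d * hpq
  · right
    obtain ⟨Ω, _, i₁, i₂, hi, hne⟩ := exists_two_embeddings (L := L) (E := E) (π u₁ / π u₂)
      (by
        rintro ⟨x, hx⟩
        exact hmem (hx ▸ x.2))
    letI : Algebra k Ω := (i₁.comp (algebraMap k E)).toAlgebra
    let j₁ : E →ₐ[k] Ω := { i₁ with commutes' := fun x => rfl }
    let j₂ : E →ₐ[k] Ω := { i₂ with
      commutes' := fun x => by
        have := RingHom.congr_fun hi (algebraMap k L x)
        exact this.symm }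
    have hj : ∀ i, j₁ (r i) = j₂ (r i) := fun i =>
      RingHom.congr_fun hi ⟨r i, IntermediateField.subset_adjoin _ _ (mem_range_self i)⟩
    have hne' : j₁ (π u₁ / π u₂) ≠ j₂ (π u₁ / π u₂) := hne
    let δ : Ω := j₂ (π c) * (j₂ (π u₁) * j₁ (π u₂) - j₁ (π u₁) * j₂ (π u₂))
    have hδ : δ ≠ 0 := by
      refine mul_ne_zero ((map_ne_zero j₂).2 hc0) fun h => hne' ?_
      rw [map_div₀, map_div₀, div_eq_div_iff ((map_ne_zero j₁).2 hu) ((map_ne_zero j₂).2 hu)]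
      linear_combination -h
    let G : Set Ω := range (fun s : σ => j₁ (π (X s))) ∪ range (fun s : σ => j₂ (π (X s))) ∪ {δ⁻¹}
    let B := Algebra.adjoin k G
    have hG : G.Finite := ((finite_range _).union (finite_range _)).union (finite_singleton _)
    have hBfg : Algebra.FiniteType k B :=
      (Subalgebra.fg_iff_finiteType B).1 ⟨hG.toFinset, by simp [B]⟩
    have hB1 : ∀ f, j₁ (π f) ∈ B := by
      intro f
      induction f using MvPolynomial.induction_on with
      | C x =>
        have : j₁ (π (C x)) = algebraMap k Ω x := by
          rw [← algebraMap_eq, AlgHom.commutes, AlgHom.commutes]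
        rw [this]; exact B.algebraMap_mem x
      | add p q hp hq => rw [map_add, map_add]; exact B.add_mem hp hq
      | mul_X p s hp =>
        rw [map_mul, map_mul]
        exact B.mul_mem hp (Algebra.subset_adjoin (Or.inl (Or.inl ⟨s, rfl⟩)))
    have hB2 : ∀ f, j₂ (π f) ∈ B := by
      intro f
      induction f using MvPolynomial.induction_on with
      | C x =>
        have : j₂ (π (C x)) = algebraMap k Ω x := by
          rw [← algebraMap_eq, AlgHom.commutes, AlgHom.commutes]
        rw [this]; exact B.algebraMap_mem x
      | add p q hp hq => rw [map_add, map_add]; exact B.add_mem hp hq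
      | mul_X p s hp =>
        rw [map_mul, map_mul]
        exact B.mul_mem hp (Algebra.subset_adjoin (Or.inl (Or.inr ⟨s, rfl⟩)))
    let g₁ : A →ₐ[k] B := (j₁.comp (IsScalarTower.toAlgHom k A E)).codRestrict B (by
      intro x
      obtain ⟨f, rfl⟩ := Ideal.Quotient.mk_surjective x
      exact hB1 f)
    let g₂ : MvPolynomial σ k →ₐ[k] B := (j₂.comp π).codRestrict B hB2
    letI : Algebra A B := g₁.toRingHom.toAlgebra
    have hst : IsScalarTower k A B := IsScalarTower.of_algebraMap_eq fun x => (g₁.commutes x).symm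
    have hfin : Algebra.FiniteType A B := Algebra.FiniteType.of_restrictScalars_finiteType k A B
    have hinj : Function.Injective (algebraMap A B) := by
      intro x y hxy
      have : j₁ (algebraMap A E x) = j₁ (algebraMap A E y) := congrArg Subtype.val hxy
      exact IsFractionRing.injective A E (j₁.toRingHom.injective this)
    obtain ⟨c0, hc0', hext⟩ := exists_generic_extension (k := k) hinj
    obtain ⟨c', rfl⟩ := Ideal.Quotient.mk_surjective c0
    refine ⟨c', fun h => hc0' (Ideal.Quotient.eq_zero_iff_mem.2 h), fun x hx hxc => ?_⟩
    let χ : A →ₐ[k] k := Ideal.Quotient.liftₐ I (aeval x) (fun f hf => hx f hf)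
    have hχ : ∀ f, χ (Ideal.Quotient.mk I f) = eval x f := fun f => rfl
    obtain ⟨χ', hχ'⟩ := hext χ (by rw [hχ]; exact hxc)
    let x' : σ → k := fun s => χ' (g₂ (X s))
    have hx' : ∀ f, eval x' f = χ' (g₂ f) := by
      intro f
      have : (aeval x' : MvPolynomial σ k →ₐ[k] k) = χ'.comp g₂ := by
        ext s
        simp [x']
      exact AlgHom.congr_fun this f
    have hx1 : ∀ f, χ' ⟨j₁ (π f), hB1 f⟩ = eval x f := fun f => by
      rw [← hχ, ← hχ']
      rfl
    have hx2 : ∀ f, χ' ⟨j₂ (π f), hB2 f⟩ = eval x' f := fun f => (hx' f).symm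
    have hδB : δ⁻¹ ∈ B := Algebra.subset_adjoin (Or.inr rfl)
    have hprod : χ' (⟨j₂ (π c), hB2 c⟩ * (⟨j₂ (π u₁), hB2 u₁⟩ * ⟨j₁ (π u₂), hB1 u₂⟩ -
        ⟨j₁ (π u₁), hB1 u₁⟩ * ⟨j₂ (π u₂), hB2 u₂⟩)) * χ' ⟨δ⁻¹, hδB⟩ = 1 := by
      rw [← map_mul, ← map_one χ']
      congr 1
      exact Subtype.ext (mul_inv_cancel₀ hδ)
    rw [map_mul, map_sub, map_mul, map_mul, hx1, hx1, hx2, hx2, hx2] at hprod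
    have hnz := left_ne_zero_of_mul_eq_one hprod
    refine ⟨x', fun f hf => ?_, left_ne_zero_of_mul hnz,
      sub_ne_zero.1 (right_ne_zero_of_mul hnz), fun i => ?_⟩
    · rw [← hx2]
      have : (⟨j₂ (π f), hB2 f⟩ : B) = 0 := Subtype.ext (by
        change j₂ (π f) = 0
        rw [(hπ f).2 hf, map_zero])
      rw [this, map_zero]
    · rw [← hx1, ← hx1, ← hx2, ← hx2, ← map_mul, ← map_mul]
      congr 1
      apply Subtype.ext
      change j₁ (π (a i)) * j₂ (π (a i₀)) = j₂ (π (a i)) * j₁ (π (a i₀))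
      have := hj i
      simp only [r, map_div₀] at this
      rwa [div_eq_div_iff ((map_ne_zero j₁).2 hb) ((map_ne_zero j₂).2 hb)] at this

/-- An ideal without nontrivial zeros contains all forms of large degree. -/
theorem exists_forall_isHomogeneous_mem {k ι : Type} [Field k] [IsAlgClosed k] [Finite ι]
    (I : Ideal (MvPolynomial ι k)) (h : ∀ q : ι → k, (∀ f ∈ I, eval q f = 0) → q = 0) :
    ∃ D₀, ∀ D, D₀ ≤ D → ∀ g : MvPolynomial ι k, g.IsHomogeneous D → g ∈ I := by
  have hle : idealOfVars ι k ≤ I.radical := by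
    rw [← vanishingIdeal_zeroLocus_eq_radical (K := k), Ideal.span_le]
    rintro _ ⟨i, rfl⟩ q hq
    have : q = 0 := h q hq
    simp [this]
  obtain ⟨n, hn⟩ := Ideal.exists_pow_le_of_le_radical_of_fg_radical hle
    (IsNoetherian.noetherian _)
  refine ⟨n, fun D hD g hg => hn ?_⟩
  rw [mem_pow_idealOfVars_iff]
  intro x hx
  rw [Finsupp.degree_apply, ← hg.degree_eq_sum_deg_support hx]
  exact hD

theorem homogeneousComponent_linear_mul {k ι : Type} [CommRing k] {l : MvPolynomial ι k} {n : ℕ}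
    (hl : l.IsHomogeneous n) (D : ℕ) (g : MvPolynomial ι k) :
    homogeneousComponent (n + D) (l * g) = l * homogeneousComponent D g := by
  conv_lhs => rw [← sum_homogeneousComponent g, Finset.mul_sum, map_sum]
  have : ∀ j, homogeneousComponent (n + D) (l * homogeneousComponent j g) =
      if j = D then l * homogeneousComponent D g else 0 := by
    intro j
    rw [homogeneousComponent_of_mem (hl.mul (homogeneousComponent_isHomogeneous j g))]
    by_cases h : j = D
    · simp [h]
    · rw [if_neg h, if_neg (by omega)]
  simp only [this, Finset.sum_ite_eq', Finset.mem_range]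
  split_ifs with h
  · rfl
  · rw [homogeneousComponent_eq_zero _ _ (by omega), mul_zero]

section
attribute [local instance] MvPolynomial.gradedAlgebra

theorem aeval_homogeneousComponent_eq_zero_of_mem_span {S K ι : Type} [CommRing S] [CommRing K]
    [Algebra S K] (r : ι → K) {f : MvPolynomial ι S}
    (hf : f ∈ Ideal.span {g : MvPolynomial ι S | (∃ d, g.IsHomogeneous d) ∧ aeval r g = 0})
    (D : ℕ) : aeval r (homogeneousComponent D f) = 0 := by
  have h1 := homogeneousComponent_mem_of_mem (Ideal.homogeneous_span (homogeneousSubmodule ι S)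
    {g : MvPolynomial ι S | (∃ d, g.IsHomogeneous d) ∧ aeval r g = 0}
    (fun x hx => hx.1)) hf D
  have h2 : Ideal.span {g : MvPolynomial ι S | (∃ d, g.IsHomogeneous d) ∧ aeval r g = 0} ≤
      RingHom.ker (aeval r : MvPolynomial ι S →ₐ[S] K) := by
    rw [Ideal.span_le]
    exact fun g hg => hg.2
  exact h2 h1

end

open IsLocalRing in
/-- Extension of a rational map at a normal point: if the fibre of the closure of its graph over
the point does not meet the hyperplane `l = 0`, then the coordinates divided by `l` are regular. -/
theorem isRegular_of_fibre_avoids {k S K ι : Type} [Field k] [IsAlgClosed k] [CommRing S]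
    [IsDomain S] [IsLocalRing S] [IsNoetherianRing S] [IsIntegrallyClosed S] [Algebra k S]
    [Field K] [Algebra S K] [IsFractionRing S K] [Finite ι] (res : S →ₐ[k] k)
    (hres : RingHom.ker res = maximalIdeal S) (r : ι → K) (hr : r ≠ 0) (l : ι → k)
    (h : ∀ q : ι → k, (∀ (d : ℕ) (f : MvPolynomial ι S), f.IsHomogeneous d → aeval r f = 0 →
      eval q (MvPolynomial.map (res : S →+* k) f) = 0) → ∑ᶠ i, l i * q i = 0 → q = 0) :
    (∑ᶠ i, algebraMap S K (algebraMap k S (l i)) * r i) ≠ 0 ∧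
    ∀ i, r i / (∑ᶠ i, algebraMap S K (algebraMap k S (l i)) * r i) ∈ (algebraMap S K).range := by
  have := Fintype.ofFinite ι
  simp only [finsum_eq_sum_of_fintype] at h ⊢
  set ρ : S →+* k := (res : S →+* k) with hρ
  have hρsurj : Function.Surjective ρ := fun c => ⟨algebraMap k S c, by simp [hρ]⟩
  set L : MvPolynomial ι S := ∑ i, C (algebraMap k S (l i)) * X i with hL
  have hLhom : L.IsHomogeneous 1 :=
    IsHomogeneous.sum _ _ _ fun i _ => isHomogeneous_C_mul_X _ _
  have hLr : aeval r L = ∑ i, algebraMap S K (algebraMap k S (l i)) * r i := by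
    simp [hL]
  rw [← hLr]
  set 𝔍 := Ideal.span {g : MvPolynomial ι S | (∃ d, g.IsHomogeneous d) ∧ aeval r g = 0} with h𝔍
  have hmapsurj : Function.Surjective (MvPolynomial.map (σ := ι) ρ) := map_surjective _ hρsurj
  set J := Ideal.map (MvPolynomial.map (σ := ι) ρ) (𝔍 ⊔ Ideal.span {L}) with hJ
  have hmapL : MvPolynomial.map ρ L = ∑ i, C (l i) * X i := by
    simp [hL, hρ]
  obtain ⟨D, hD⟩ := exists_forall_isHomogeneous_mem J (by
    intro q hq
    apply h q
    · intro d f hf hfr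
      exact hq _ (Ideal.mem_map_of_mem _ (Ideal.mem_sup_left (Ideal.subset_span ⟨⟨d, hf⟩, hfr⟩)))
    · have := hq _ (Ideal.mem_map_of_mem _ (Ideal.mem_sup_right (Ideal.mem_span_singleton_self L)))
      rw [hmapL] at this
      simpa using this)
  let Nn : ℕ → Submodule S K := fun n =>
    (homogeneousSubmodule ι S n).map (aeval r : MvPolynomial ι S →ₐ[S] K).toLinearMap
  have hmem : ∀ n f, f.IsHomogeneous n → aeval r f ∈ Nn n := fun n f hf => ⟨f, hf, rfl⟩
  have hfg : ∀ n, (Nn n).FG := fun n => (homogeneousSubmodule_fg ι S n).map _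
  have hker : ∀ n (f : MvPolynomial ι S), f.IsHomogeneous n → MvPolynomial.map ρ f = 0 →
      aeval r f ∈ maximalIdeal S • Nn n := by
    intro n f hf hf0
    conv => rw [f.as_sum, map_sum]
    refine Submodule.sum_mem _ fun m hm => ?_
    have h1 : monomial m (coeff m f) = coeff m f • monomial m (1 : S) := by
      rw [smul_monomial, smul_eq_mul, mul_one]
    rw [h1, map_smul]
    refine Submodule.smul_mem_smul ?_ (hmem n _ (isHomogeneous_monomial _ ?_))
    · rw [← hres]
      have := congrArg (coeff m) hf0
      rw [coeff_map, coeff_zero] at this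
      exact this
    · rw [Finsupp.degree_apply]; exact (hf.degree_eq_sum_deg_support hm).symm
  let μ : K →ₗ[S] K := LinearMap.mulLeft S (aeval r L)
  have hstep : Nn (1 + D) ≤ (Nn D).map μ ⊔ maximalIdeal S • Nn (1 + D) := by
    rintro _ ⟨G, hG, rfl⟩
    have hG' : G.IsHomogeneous (1 + D) := hG
    have hm := hD (1 + D) (by omega) (MvPolynomial.map ρ G) (hG'.map ρ)
    obtain ⟨F, hF, hFG⟩ := (Ideal.mem_map_iff_of_surjective _ hmapsurj).1 hm
    obtain ⟨f, hf, g, hg, rfl⟩ := Submodule.mem_sup.1 hF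
    obtain ⟨g, rfl⟩ := Ideal.mem_span_singleton'.1 hg
    have hcomp : ∀ n (p : MvPolynomial ι S), MvPolynomial.map ρ (homogeneousComponent n p) =
        homogeneousComponent n (MvPolynomial.map ρ p) := by
      intro n p
      ext m
      simp only [coeff_map, coeff_homogeneousComponent]
      split_ifs <;> simp
    have hE : MvPolynomial.map ρ (G - homogeneousComponent (1 + D) f -
        L * homogeneousComponent D g) = 0 := by
      rw [map_sub, map_sub, ← homogeneousComponent_linear_mul hLhom, hcomp, hcomp,
        sub_sub, ← map_add, ← map_add, mul_comm L g, hFG, ← hcomp]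
      rw [homogeneousComponent_eq_self hG', sub_self]
    have hEh : (G - homogeneousComponent (1 + D) f -
        L * homogeneousComponent D g).IsHomogeneous (1 + D) :=
      (hG'.sub (homogeneousComponent_isHomogeneous _ _)).sub
        (hLhom.mul (homogeneousComponent_isHomogeneous _ _))
    have h1 := hker _ _ hEh hE
    have h2 := aeval_homogeneousComponent_eq_zero_of_mem_span r hf (1 + D)
    rw [map_sub, map_sub, h2, sub_zero, map_mul] at h1
    have h3 : aeval r L * aeval r (homogeneousComponent D g) ∈ (Nn D).map μ :=
      ⟨_, hmem _ _ (homogeneousComponent_isHomogeneous _ _), rfl⟩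
    have := Submodule.add_mem_sup h3 h1
    rwa [add_sub_cancel] at this
  have hle : Nn (1 + D) ≤ (Nn D).map μ :=
    Submodule.le_of_le_smul_of_le_jacobson_bot (hfg _)
      (by rw [IsLocalRing.jacobson_eq_maximalIdeal _ bot_ne_top]) hstep
  obtain ⟨i₀, hi₀⟩ := Function.ne_iff.1 hr
  have hLne : aeval r L ≠ 0 := by
    intro h0
    obtain ⟨y, -, hy⟩ := hle (hmem _ (X i₀ ^ (1 + D)) (isHomogeneous_X_pow _ _))
    have : μ y = 0 := by simp [μ, h0]
    rw [this, map_pow, aeval_X] at hy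
    exact pow_ne_zero _ hi₀ hy.symm
  refine ⟨hLne, fun i => ?_⟩
  have hintegral : IsIntegral S (r i / aeval r L) := by
    refine isIntegral_of_smul_mem_submodule (M := K) (Nn D) ?_ (hfg D) _ ?_
    · rw [Submodule.ne_bot_iff]
      exact ⟨_, hmem _ (X i₀ ^ D) (isHomogeneous_X_pow _ _), by
        rw [map_pow, aeval_X]; exact pow_ne_zero _ hi₀⟩
    · rintro _ ⟨G, hG, rfl⟩
      have hG' : G.IsHomogeneous D := hG
      obtain ⟨y, hy, hy2⟩ := hle (hmem _ (X i * G) ((isHomogeneous_X _ _).mul hG'))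
      have : (r i / aeval r L) • (aeval r G) = y := by
        have hy2' : aeval r L * y = r i * aeval r G := by
          rw [map_mul, aeval_X] at hy2
          exact hy2
        rw [smul_eq_mul, div_mul_eq_mul_div, div_eq_iff hLne, ← hy2', mul_comm]
      change (r i / aeval r L) • (aeval r G) ∈ _
      rw [this]
      exact hy
  exact IsIntegrallyClosed.algebraMap_eq_of_integral hintegral

section Basics

/-- The restriction of a polynomial to the line through the origin spanned by `v`. -/
noncomputable def radial {σ : Type} (v : σ → k) (f : MvPolynomial σ k) : Polynomial k :=
  aeval (fun i => Polynomial.C (v i) * Polynomial.X) f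

theorem eval_radial {σ : Type} (v : σ → k) (f : MvPolynomial σ k) (c : k) :
    (radial v f).eval c = eval (c • v) f := by
  have := AlgHom.congr_fun (comp_aeval (R := k) (fun i => Polynomial.C (v i) * Polynomial.X)
    (Polynomial.aeval c : Polynomial k →ₐ[k] k)) f
  rw [AlgHom.comp_apply, Polynomial.coe_aeval_eq_eval] at this
  have h2 : (fun i => (Polynomial.C (v i) * Polynomial.X).eval c) = c • v := by
    funext i
    simp only [Polynomial.eval_mul, Polynomial.eval_C, Polynomial.eval_X, Pi.smul_apply,
      smul_eq_mul]
    ring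
  rw [h2] at this
  exact this

theorem radial_eq_sum {σ : Type} (v : σ → k) (f : MvPolynomial σ k) :
    radial v f = ∑ d ∈ Finset.range (f.totalDegree + 1),
      Polynomial.C (eval v (homogeneousComponent d f)) * Polynomial.X ^ d := by
  conv_lhs => rw [radial, ← sum_homogeneousComponent f, map_sum]
  refine Finset.sum_congr rfl fun d _ => ?_
  have h1 : (fun i => Polynomial.C (v i) * Polynomial.X) =
      fun i => Polynomial.X * (fun i => Polynomial.C (v i)) i := by ext1 i; exact mul_comm _ _
  rw [h1, aeval_mul_of_isHomogeneous (homogeneousComponent_isHomogeneous d f), mul_comm]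
  congr 1
  have := AlgHom.congr_fun (comp_aeval (R := k) v (Algebra.ofId k (Polynomial k)))
    (homogeneousComponent d f)
  exact this.symm

theorem coeff_radial {σ : Type} (v : σ → k) (f : MvPolynomial σ k) (d : ℕ) :
    (radial v f).coeff d = eval v (homogeneousComponent d f) := by
  rw [radial_eq_sum, Polynomial.finset_sum_coeff]
  simp only [Polynomial.coeff_C_mul, Polynomial.coeff_X_pow, mul_ite, mul_one, mul_zero,
    Finset.sum_ite_eq, Finset.mem_range]
  split_ifs with h
  · rfl
  · rw [homogeneousComponent_eq_zero _ _ (by omega), map_zero]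

theorem vanishes_mk {f : MvPolynomial (Fin (N + 1)) k} {v : Fin (N + 1) → k} (hv : v ≠ 0) :
    Vanishes f (Projectivization.mk k v hv) ↔ ∀ c : k, c ≠ 0 → eval (c • v) f = 0 := by
  constructor
  · intro h c hc
    refine h (c • v) (smul_ne_zero hc hv) ?_
    rw [Projectivization.mk_eq_mk_iff']
    exact ⟨c, rfl⟩
  · intro h w hw hwv
    rw [Projectivization.mk_eq_mk_iff'] at hwv
    obtain ⟨a, rfl⟩ := hwv
    exact h a (fun h0 => hw (by simp [h0]))

theorem vanishes_mk_of_isHomogeneous {f : MvPolynomial (Fin (N + 1)) k} {d : ℕ}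
    (hf : f.IsHomogeneous d) {v : Fin (N + 1) → k} (hv : v ≠ 0) :
    Vanishes f (Projectivization.mk k v hv) ↔ eval v f = 0 := by
  rw [vanishes_mk]
  constructor
  · intro h; simpa using h 1 one_ne_zero
  · intro h c _
    rw [eval_smul_of_isHomogeneous hf, h, mul_zero]

theorem radial_eq_zero_iff [Infinite k] {σ : Type} {f : MvPolynomial σ k} {v : σ → k} :
    radial v f = 0 ↔ ∀ c : k, c ≠ 0 → eval (c • v) f = 0 := by
  constructor
  · intro h c _
    rw [← eval_radial, h, Polynomial.eval_zero]
  · intro h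
    refine Polynomial.eq_zero_of_infinite_isRoot _ (Set.Infinite.mono (s := {0}ᶜ) ?_ ?_)
    · intro c hc
      exact (eval_radial v f c).trans (h c hc)
    · exact (Set.finite_singleton (0 : k)).infinite_compl

theorem vanishes_mk_iff_radial [Infinite k] {f : MvPolynomial (Fin (N + 1)) k}
    {v : Fin (N + 1) → k} (hv : v ≠ 0) :
    Vanishes f (Projectivization.mk k v hv) ↔ radial v f = 0 := by
  rw [vanishes_mk, radial_eq_zero_iff]

theorem vanishes_iff_homogeneousComponent [Infinite k] {f : MvPolynomial (Fin (N + 1)) k}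
    {p : Pr k N} : Vanishes f p ↔ ∀ d, Vanishes (homogeneousComponent d f) p := by
  induction p using Projectivization.ind with
  | h v hv =>
  rw [vanishes_mk_iff_radial, Polynomial.ext_iff]
  refine forall_congr' fun d => ?_
  rw [vanishes_mk_of_isHomogeneous (homogeneousComponent_isHomogeneous d f) hv, coeff_radial, Polynomial.coeff_zero]

theorem vanishes_mul [Infinite k] {f g : MvPolynomial (Fin (N + 1)) k} {p : Pr k N} :
    Vanishes (f * g) p ↔ Vanishes f p ∨ Vanishes g p := by
  induction p using Projectivization.ind with
  | h v hv =>
  simp only [vanishes_mk_iff_radial]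
  rw [radial, map_mul, mul_eq_zero]
  rfl

theorem isAlgSet_setOf_vanishes [Infinite k] (S : Set (MvPolynomial (Fin (N + 1)) k)) :
    IsAlgSet {p : Pr k N | ∀ f ∈ S, Vanishes f p} := by
  refine ⟨{g | ∃ f ∈ S, ∃ d, g = homogeneousComponent d f}, ?_, ?_⟩
  · rintro _ ⟨f, -, d, rfl⟩
    exact ⟨d, homogeneousComponent_isHomogeneous d f⟩
  · ext p
    simp only [mem_setOf_eq]
    constructor
    · rintro h _ ⟨f, hf, d, rfl⟩
      exact vanishes_iff_homogeneousComponent.1 (h f hf) d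
    · intro h f hf
      exact vanishes_iff_homogeneousComponent.2 fun d => h _ ⟨f, hf, d, rfl⟩

/-- The ideal of polynomials vanishing on (the cone over) `Z`. -/
def coneIdeal (Z : Set (Pr k N)) : Ideal (MvPolynomial (Fin (N + 1)) k) where
  carrier := {f | ∀ p ∈ Z, Vanishes f p}
  add_mem' := fun {f g} hf hg p hp v hv hvp => by
    rw [map_add, hf p hp v hv hvp, hg p hp v hv hvp, add_zero]
  zero_mem' := fun p _ v _ _ => map_zero _
  smul_mem' := fun c f hf p hp v hv hvp => by
    rw [smul_eq_mul, map_mul, hf p hp v hv hvp, mul_zero]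

theorem mem_coneIdeal' {Z : Set (Pr k N)} {f : MvPolynomial (Fin (N + 1)) k} :
    f ∈ coneIdeal Z ↔ ∀ (v : Fin (N + 1) → k) (hv : v ≠ 0), Projectivization.mk k v hv ∈ Z →
      eval v f = 0 :=
  ⟨fun h v hv hZ => h _ hZ v hv rfl, fun h p hp v hv hvp => h v hv (hvp ▸ hp)⟩

theorem IsAlgSet.mem_iff {Z : Set (Pr k N)} (hZ : IsAlgSet Z) {p : Pr k N} :
    p ∈ Z ↔ ∀ f ∈ coneIdeal Z, Vanishes f p := by
  constructor
  · intro hp f hf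
    exact hf p hp
  · intro h
    obtain ⟨S, -, rfl⟩ := hZ
    exact fun f hf => h f fun q hq => hq f hf

theorem IsAlgSet.exists_of_notMem {Z : Set (Pr k N)} (hZ : IsAlgSet Z) {p : Pr k N} (hp : p ∉ Z) :
    ∃ f d, f.IsHomogeneous d ∧ f ∈ coneIdeal Z ∧ ¬ Vanishes f p := by
  obtain ⟨S, hS, rfl⟩ := hZ
  simp only [mem_setOf_eq, not_forall] at hp
  obtain ⟨f, hf, hfp⟩ := hp
  obtain ⟨d, hd⟩ := hS f hf
  exact ⟨f, d, hd, fun q hq => hq f hf, hfp⟩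

theorem IsAlgSet.subset_iff {Z W : Set (Pr k N)} (hZ : IsAlgSet Z) :
    W ⊆ Z ↔ coneIdeal Z ≤ coneIdeal W := by
  constructor
  · intro h f hf p hp
    exact hf p (h hp)
  · intro h p hp
    exact hZ.mem_iff.2 fun f hf => h hf p hp

theorem isAlgSet_union {Z W : Set (Pr k N)} (hZ : IsAlgSet Z) (hW : IsAlgSet W) :
    IsAlgSet (Z ∪ W) := by
  obtain ⟨S, hS, rfl⟩ := hZ
  obtain ⟨T, hT, rfl⟩ := hW
  refine ⟨{h | ∃ f ∈ S, ∃ g ∈ T, h = f * g}, ?_, ?_⟩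
  · rintro _ ⟨f, hf, g, hg, rfl⟩
    obtain ⟨d, hd⟩ := hS f hf
    obtain ⟨e, he⟩ := hT g hg
    exact ⟨d + e, hd.mul he⟩
  · ext p
    simp only [mem_union, mem_setOf_eq]
    constructor
    · rintro (h | h) _ ⟨f, hf, g, hg, rfl⟩ v hv hvp
      · rw [map_mul, h f hf v hv hvp, zero_mul]
      · rw [map_mul, h g hg v hv hvp, mul_zero]
    · intro h
      by_contra! hcon
      obtain ⟨⟨f, hf, hfp⟩, ⟨g, hg, hgp⟩⟩ := hcon
      induction p using Projectivization.ind with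
      | h v hv =>
      obtain ⟨d, hd⟩ := hS f hf
      obtain ⟨e, he⟩ := hT g hg
      rw [vanishes_mk_of_isHomogeneous hd] at hfp
      rw [vanishes_mk_of_isHomogeneous he] at hgp
      have := h _ ⟨f, hf, g, hg, rfl⟩ v hv rfl
      rw [map_mul] at this
      exact mul_ne_zero hfp hgp this

/-- The Zariski topology on projective space. -/
instance zariskiTopology : TopologicalSpace (Pr k N) :=
  TopologicalSpace.ofClosed {Z | IsAlgSet Z}
    ⟨{1}, by simpa using ⟨0, isHomogeneous_one _ _⟩, by
      ext p
      induction p using Projectivization.ind with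
      | h v hv => simpa [vanishes_mk hv] using ⟨(1 : k), one_ne_zero⟩⟩
    (by
      intro A hA
      refine ⟨{f | ∃ Z ∈ A, f ∈ coneIdeal Z ∧ ∃ d, f.IsHomogeneous d}, ?_, ?_⟩
      · rintro f ⟨_, _, _, h⟩
        exact h
      · ext p
        simp only [mem_sInter, mem_setOf_eq]
        constructor
        · rintro h f ⟨Z, hZ, hf, -⟩
          exact hf p (h Z hZ)
        · intro h Z hZ
          by_contra hp
          obtain ⟨f, d, hd, hf, hfp⟩ := (hA hZ : IsAlgSet Z).exists_of_notMem hp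
          exact hfp (h f ⟨Z, hZ, hf, d, hd⟩))
    (fun A hA B hB => isAlgSet_union hA hB)

theorem isClosed_iff {Z : Set (Pr k N)} : IsClosed Z ↔ IsAlgSet Z := by
  rw [← isOpen_compl_iff]
  change Zᶜᶜ ∈ {Z | IsAlgSet Z} ↔ _
  rw [compl_compl]
  rfl

theorem isVariety_iff {Z : Set (Pr k N)} : IsVariety Z ↔ IsClosed Z ∧ IsIrreducible Z := by
  rw [IsVariety, isClosed_iff]
  refine and_congr_right fun hZ => and_congr_right fun hne => ?_
  rw [isPreirreducible_iff_isClosed_union_isClosed]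
  simp only [isClosed_iff]

theorem IsVariety.isClosed {Z : Set (Pr k N)} (h : IsVariety Z) : IsClosed Z :=
  (isVariety_iff.1 h).1

theorem IsVariety.isIrreducible {Z : Set (Pr k N)} (h : IsVariety Z) : IsIrreducible Z :=
  (isVariety_iff.1 h).2

theorem isClosed_setOf_vanishes [Infinite k] (f : MvPolynomial (Fin (N + 1)) k) :
    IsClosed {p : Pr k N | Vanishes f p} := by
  have := isAlgSet_setOf_vanishes {f} (N := N)
  rw [← isClosed_iff] at this
  simpa using this

instance noetherianSpace_pr : TopologicalSpace.NoetherianSpace (Pr k N) := by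
  refine ((TopologicalSpace.noetherianSpace_TFAE (Pr k N)).out 0 1).2 ?_
  refine ⟨Subrelation.wf (r := InvImage (· > ·) (fun Z : TopologicalSpace.Closeds (Pr k N) =>
    coneIdeal (Z : Set (Pr k N)))) ?_ (InvImage.wf _ (wellFounded_gt))⟩
  intro Z W h
  change coneIdeal (W : Set (Pr k N)) < coneIdeal (Z : Set (Pr k N))
  have hZ := isClosed_iff.1 Z.isClosed
  have hW := isClosed_iff.1 W.isClosed
  rw [lt_iff_le_not_ge, ← hW.subset_iff, ← hZ.subset_iff]
  exact lt_iff_le_not_ge.1 h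

/-- The equation expressing that `v` is proportional to `w`. -/
theorem eq_mk_of_proportional {v w : Fin (N + 1) → k} (hv : v ≠ 0) (hw : w ≠ 0)
    (h : ∀ i j, v i * w j = w i * v j) : Projectivization.mk k v hv = Projectivization.mk k w hw := by
  obtain ⟨j, hj⟩ := Function.ne_iff.1 hw
  rw [Projectivization.mk_eq_mk_iff']
  refine ⟨v j / w j, ?_⟩
  ext i
  have hj' : w j ≠ 0 := hj
  simp only [Pi.smul_apply, smul_eq_mul]
  rw [div_mul_eq_mul_div, div_eq_iff hj', h i j, mul_comm]

theorem proportional_of_mk_eq {v w : Fin (N + 1) → k} {hv : v ≠ 0} {hw : w ≠ 0}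
    (h : Projectivization.mk k v hv = Projectivization.mk k w hw) (i j : Fin (N + 1)) :
    v i * w j = w i * v j := by
  rw [Projectivization.mk_eq_mk_iff'] at h
  obtain ⟨a, rfl⟩ := h
  simp only [Pi.smul_apply, smul_eq_mul]
  ring

theorem mk_eq_mk_iff_proportional {v w : Fin (N + 1) → k} {hv : v ≠ 0} {hw : w ≠ 0} :
    Projectivization.mk k v hv = Projectivization.mk k w hw ↔ ∀ i j, v i * w j = w i * v j :=
  ⟨proportional_of_mk_eq, eq_mk_of_proportional hv hw⟩

instance t1Space_pr : T1Space (Pr k N) := by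
  refine ⟨fun p => ?_⟩
  induction p using Projectivization.ind with
  | h w hw =>
  rw [isClosed_iff]
  refine ⟨{f | ∃ i j, f = C (w j) * X i - C (w i) * X j}, ?_, ?_⟩
  · rintro _ ⟨i, j, rfl⟩
    exact ⟨1, (isHomogeneous_C_mul_X _ _).sub (isHomogeneous_C_mul_X _ _)⟩
  · ext p
    induction p using Projectivization.ind with
    | h v hv =>
    rw [mem_singleton_iff, mk_eq_mk_iff_proportional, mem_setOf_eq]
    constructor
    · rintro h _ ⟨i, j, rfl⟩
      rw [vanishes_mk_of_isHomogeneous ((isHomogeneous_C_mul_X _ _).sub (isHomogeneous_C_mul_X _ _))]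
      simp only [map_sub, map_mul, eval_C, eval_X]
      linear_combination h i j
    · intro h i j
      have := h _ ⟨i, j, rfl⟩
      rw [vanishes_mk_of_isHomogeneous ((isHomogeneous_C_mul_X _ _).sub (isHomogeneous_C_mul_X _ _))] at this
      simp only [map_sub, map_mul, eval_C, eval_X] at this
      linear_combination this

theorem IsVariety.isPrime [Infinite k] {Z : Set (Pr k N)} (hZ : IsVariety Z) :
    (coneIdeal Z).IsPrime := by
  have hirr := (isPreirreducible_iff_isClosed_union_isClosed.1 hZ.isIrreducible.2)
  refine ⟨fun h => ?_, fun {f g} hfg => ?_⟩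
  · obtain ⟨p, hp⟩ := hZ.2.1
    have h1 : (1 : MvPolynomial (Fin (N + 1)) k) ∈ coneIdeal Z := h ▸ Submodule.mem_top
    have := h1 p hp p.rep p.rep_nonzero p.mk_rep
    simp at this
  · refine hirr _ _ (isClosed_setOf_vanishes f) (isClosed_setOf_vanishes g) ?_
    intro p hp
    exact vanishes_mul.1 (hfg p hp)

theorem isVariety_singleton (p : Pr k N) : IsVariety {p} :=
  isVariety_iff.2 ⟨isClosed_singleton, isIrreducible_singleton⟩

/-- A finite irreducible set is a point. -/
theorem eq_singleton_of_finite {Z : Set (Pr k N)} (hZ : IsIrreducible Z) (hfin : Z.Finite) :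
    ∃ p, Z = {p} := by
  obtain ⟨p, hp⟩ := hZ.1
  refine ⟨p, ?_⟩
  have := isPreirreducible_iff_isClosed_union_isClosed.1 hZ.2 {p} (Z \ {p}) isClosed_singleton
    (hfin.subset diff_subset).isClosed (by intro q hq; by_cases h : q = p <;> simp [h, hq])
  rcases this with h | h
  · exact (subset_antisymm h (by simpa using hp))
  · exact absurd rfl (h hp).2

/-- An infinite closed set contains an infinite variety. -/
theorem exists_infinite_variety {Z : Set (Pr k N)} (hZ : IsClosed Z) (hinf : Z.Infinite) :
    ∃ E, IsVariety E ∧ E ⊆ Z ∧ E.Infinite := by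
  obtain ⟨S, hS, hcl, hirr, rfl⟩ :=
    TopologicalSpace.NoetherianSpace.exists_finite_set_isClosed_irreducible hZ
  by_contra! h
  refine hinf (hS.sUnion fun E hE => ?_)
  exact h E (isVariety_iff.2 ⟨hcl E hE, hirr E hE⟩) (subset_sUnion_of_mem hE)

end Basics

section Morphisms

variable {m : ℕ}

/-- The value of a tuple of polynomials at a vector. -/
noncomputable def tup {σ ι : Type} (F : ι → MvPolynomial σ k) (v : σ → k) : ι → k :=
  fun i => eval v (F i)

theorem tup_apply {σ ι : Type} (F : ι → MvPolynomial σ k) (v : σ → k) (i : ι) :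
    tup F v i = eval v (F i) := rfl

theorem eval_aeval_tup {σ ι : Type} (F : ι → MvPolynomial σ k) (v : σ → k)
    (g : MvPolynomial ι k) : eval v (aeval F g) = eval (tup F v) g := by
  have := AlgHom.congr_fun (comp_aeval (R := k) F (aeval v : MvPolynomial σ k →ₐ[k] k)) g
  exact this

theorem tup_smul {σ ι : Type} {F : ι → MvPolynomial σ k} {d : ℕ}
    (hF : ∀ i, (F i).IsHomogeneous d) (c : k) (v : σ → k) : tup F (c • v) = c ^ d • tup F v := by
  ext i
  exact eval_smul_of_isHomogeneous (hF i) c v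

/-- `F` is a tuple of forms of the same degree representing `φ` wherever it does not vanish. -/
def Rep (X : Set (Pr k M)) (φ : Pr k M → Pr k N)
    (F : Fin (N + 1) → MvPolynomial (Fin (M + 1)) k) : Prop :=
  (∃ d, ∀ i, (F i).IsHomogeneous d) ∧
  ∀ (v : Fin (M + 1) → k) (hv : v ≠ 0), Projectivization.mk k v hv ∈ X →
    ∀ hFv : tup F v ≠ 0, φ (Projectivization.mk k v hv) = Projectivization.mk k (tup F v) hFv

theorem tup_ne_zero_of_mk_eq {ι : Type} {F : ι → MvPolynomial (Fin (M + 1)) k} {d : ℕ}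
    (hF : ∀ i, (F i).IsHomogeneous d) {v w : Fin (M + 1) → k} {hv : v ≠ 0} {hw : w ≠ 0}
    (h : Projectivization.mk k v hv = Projectivization.mk k w hw) (hFw : tup F w ≠ 0) :
    tup F v ≠ 0 := by
  rw [Projectivization.mk_eq_mk_iff'] at h
  obtain ⟨a, rfl⟩ := h
  rw [tup_smul hF]
  have ha : a ≠ 0 := fun h0 => hv (by simp [h0])
  exact smul_ne_zero (pow_ne_zero _ ha) hFw

theorem localRep_mk_iff {X : Set (Pr k M)} {φ : Pr k M → Pr k N} {v : Fin (M + 1) → k} {hv : v ≠ 0}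
    {F : Fin (N + 1) → MvPolynomial (Fin (M + 1)) k} :
    LocalRep X φ (Projectivization.mk k v hv) F ↔ Rep X φ F ∧ tup F v ≠ 0 := by
  constructor
  · rintro ⟨⟨d, hd⟩, h1, h2⟩
    refine ⟨⟨⟨d, hd⟩, fun w hw hwX hFw => h2 _ hwX w hw rfl hFw⟩, ?_⟩
    exact tup_ne_zero_of_mk_eq (hv := hv) (hw := Projectivization.rep_nonzero _) hd
      (Projectivization.mk_rep _).symm h1
  · rintro ⟨⟨⟨d, hd⟩, h1⟩, h2⟩
    refine ⟨⟨d, hd⟩, ?_, ?_⟩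
    · exact tup_ne_zero_of_mk_eq (hv := Projectivization.rep_nonzero _) (hw := hv) hd
        (Projectivization.mk_rep _) h2
    · rintro q hq w hw rfl hFw
      exact h1 w hw hq hFw

theorem localRep_iff {X : Set (Pr k M)} {φ : Pr k M → Pr k N} {p : Pr k M}
    {F : Fin (N + 1) → MvPolynomial (Fin (M + 1)) k} :
    LocalRep X φ p F ↔ Rep X φ F ∧ tup F p.rep ≠ 0 := by
  conv_lhs => rw [← p.mk_rep]
  exact localRep_mk_iff

theorem isMorphismOn_iff {X : Set (Pr k M)} {φ : Pr k M → Pr k N} :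
    IsMorphismOn X φ ↔ ∀ (v : Fin (M + 1) → k) (hv : v ≠ 0), Projectivization.mk k v hv ∈ X →
      ∃ F, Rep X φ F ∧ tup F v ≠ 0 := by
  constructor
  · intro h v hv hX
    obtain ⟨F, hF⟩ := h _ hX
    exact ⟨F, localRep_mk_iff.1 hF⟩
  · intro h p hp
    induction p using Projectivization.ind with
    | h v hv =>
    obtain ⟨F, hF⟩ := h v hv hp
    exact ⟨F, localRep_mk_iff.2 hF⟩

theorem Rep.mono {X Z : Set (Pr k M)} {φ : Pr k M → Pr k N}
    {F : Fin (N + 1) → MvPolynomial (Fin (M + 1)) k} (h : Rep X φ F) (hZ : Z ⊆ X) : Rep Z φ F :=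
  ⟨h.1, fun v hv hvZ => h.2 v hv (hZ hvZ)⟩

theorem IsMorphismOn.mono {X Z : Set (Pr k M)} {φ : Pr k M → Pr k N} (h : IsMorphismOn X φ)
    (hZ : Z ⊆ X) : IsMorphismOn Z φ := by
  rw [isMorphismOn_iff] at h ⊢
  intro v hv hvZ
  obtain ⟨F, hF, hFv⟩ := h v hv (hZ hvZ)
  exact ⟨F, hF.mono hZ, hFv⟩

theorem Rep.comp {X : Set (Pr k M)} {Z : Set (Pr k N)} {φ : Pr k M → Pr k N}
    {ψ : Pr k N → Pr k m} {F : Fin (N + 1) → MvPolynomial (Fin (M + 1)) k}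
    {G : Fin (m + 1) → MvPolynomial (Fin (N + 1)) k} (hF : Rep X φ F) (hG : Rep Z ψ G)
    (hφ : MapsTo φ X Z) : ∃ H, Rep X (ψ ∘ φ) H ∧ ∀ v, tup F v ≠ 0 → tup H v = tup G (tup F v) := by
  obtain ⟨⟨d, hd⟩, hF⟩ := hF
  obtain ⟨⟨e, he⟩, hG⟩ := hG
  by_cases h0 : ∃ i, e = 0 ∧ G i ≠ 0
  · obtain ⟨i, rfl, hi⟩ := h0
    have hconst : ∀ j w, eval w (G j) = coeff 0 (G j) := by
      intro j w
      have : G j = C (coeff 0 (G j)) := by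
        rw [← homogeneousComponent_zero, homogeneousComponent_eq_self (he j)]
      conv_lhs => rw [this, eval_C]
    have hGtup : ∀ w w', tup G w = tup G w' := fun w w' => by
      ext j; rw [tup_apply, tup_apply, hconst, hconst]
    refine ⟨fun j => C (coeff 0 (G j)), ⟨⟨0, fun j => isHomogeneous_C _ _⟩, ?_⟩, ?_⟩
    · intro v hv hvX hHv
      obtain ⟨w, hw, hwe⟩ : ∃ (w : Fin (N + 1) → k) (hw : w ≠ 0),
          φ (Projectivization.mk k v hv) = Projectivization.mk k w hw :=
        ⟨_, Projectivization.rep_nonzero _, (Projectivization.mk_rep _).symm⟩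
      have hGw : tup G w = tup (fun j => C (coeff 0 (G j)) : _ → MvPolynomial (Fin (M + 1)) k) v := by
        ext j; rw [tup_apply, tup_apply, hconst, eval_C]
      have hZ := hφ hvX
      rw [hwe] at hZ
      rw [Function.comp_apply, hwe, hG w hw hZ (hGw ▸ hHv)]
      congr 1
    · intro v _
      ext j; rw [tup_apply, tup_apply, hconst, eval_C]
  · refine ⟨fun j => aeval F (G j), ⟨⟨d * e, fun j => (he j).aeval F hd⟩, ?_⟩, ?_⟩
    · intro v hv hvX hHv
      have hH : tup (fun j => aeval F (G j)) v = tup G (tup F v) := by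
        ext j; exact eval_aeval_tup F v (G j)
      have hFv : tup F v ≠ 0 := by
        intro hz
        apply hHv
        rw [hH]
        ext j
        rw [tup_apply, hz]
        by_cases hj : G j = 0
        · simp [hj]
        · have hpos : e ≠ 0 := fun he0 => h0 ⟨j, he0, hj⟩
          have := eval_smul_of_isHomogeneous (he j) (0 : k) 0
          simpa [hpos] using this
      have h1 := hF v hv hvX hFv
      have hZ := hφ hvX
      rw [h1] at hZ
      rw [Function.comp_apply, h1, hG _ hFv hZ (hH ▸ hHv)]
      congr 1
      exact hH.symm
    · intro v _
      ext j; exact eval_aeval_tup F v (G j)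

theorem IsMorphismOn.comp {X : Set (Pr k M)} {Z : Set (Pr k N)} {φ : Pr k M → Pr k N}
    {ψ : Pr k N → Pr k m} (hφ : IsMorphismOn X φ) (hψ : IsMorphismOn Z ψ) (h : MapsTo φ X Z) :
    IsMorphismOn X (ψ ∘ φ) := by
  rw [isMorphismOn_iff] at hφ hψ ⊢
  intro v hv hvX
  obtain ⟨F, hF, hFv⟩ := hφ v hv hvX
  have hZ := h hvX
  rw [hF.2 v hv hvX hFv] at hZ
  obtain ⟨G, hG, hGv⟩ := hψ _ hFv hZ
  obtain ⟨H, hH, hHe⟩ := hF.comp hG h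
  exact ⟨H, hH, by rw [hHe v hFv]; exact hGv⟩

theorem isMorphismOn_id (X : Set (Pr k M)) : IsMorphismOn X id := by
  rw [isMorphismOn_iff]
  intro v hv _
  have h : ∀ w : Fin (M + 1) → k, tup (fun i => MvPolynomial.X i : _ → MvPolynomial (Fin (M + 1)) k) w = w := by
    intro w; ext i; simp [tup_apply]
  refine ⟨fun i => MvPolynomial.X i, ⟨⟨1, fun i => isHomogeneous_X _ _⟩, ?_⟩, ?_⟩
  · intro w hw _ hFw
    simp only [id]
    congr 1
    exact (h w).symm
  · rwa [h v]

variable [Infinite k]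

theorem isOpen_setOf_not_vanishes (f : MvPolynomial (Fin (N + 1)) k) :
    IsOpen {p : Pr k N | ¬ Vanishes f p} :=
  (isClosed_setOf_vanishes f).isOpen_compl

theorem not_vanishes_mk {f : MvPolynomial (Fin (N + 1)) k} {v : Fin (N + 1) → k} {hv : v ≠ 0}
    (h : eval v f ≠ 0) : ¬ Vanishes f (Projectivization.mk k v hv) :=
  fun h' => h (h' v hv rfl)

theorem IsMorphismOn.continuousOn {X : Set (Pr k M)} {φ : Pr k M → Pr k N}
    (h : IsMorphismOn X φ) : ContinuousOn φ X := by
  rw [isMorphismOn_iff] at h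
  rw [continuousOn_iff]
  intro p hp t ht hpt
  induction p using Projectivization.ind with
  | h v hv =>
  obtain ⟨F, hF, hFv⟩ := h v hv hp
  have hpt' : φ (Projectivization.mk k v hv) ∉ tᶜ := fun h => h hpt
  obtain ⟨f, d, hd, hf, hfp⟩ := (isClosed_iff.1 ht.isClosed_compl).exists_of_notMem hpt'
  rw [hF.2 v hv hp hFv, vanishes_mk_of_isHomogeneous hd] at hfp
  obtain ⟨i, hi⟩ := Function.ne_iff.1 hFv
  refine ⟨{q | ¬ Vanishes (F i * aeval F f) q}, isOpen_setOf_not_vanishes _, ?_, ?_⟩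
  · refine not_vanishes_mk ?_
    rw [map_mul, eval_aeval_tup]
    exact mul_ne_zero hi hfp
  · rintro q ⟨hq, hqX⟩
    induction q using Projectivization.ind with
    | h w hw =>
    obtain ⟨e, he⟩ := hF.1
    have hhom : (F i * aeval F f).IsHomogeneous (e + e * d) := (he i).mul (hd.aeval F he)
    simp only [mem_setOf_eq] at hq
    rw [vanishes_mk_of_isHomogeneous hhom, map_mul, eval_aeval_tup] at hq
    have hFw : tup F w ≠ 0 := fun h0 => hq (by
      rw [show eval w (F i) = tup F w i from rfl, h0]; simp)
    rw [mem_preimage, hF.2 w hw hqX hFw]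
    by_contra hcon
    apply hq
    have := (mem_coneIdeal'.1 hf) _ hFw hcon
    rw [this, mul_zero]

/-- The locus where two morphisms agree is closed. -/
theorem isClosed_setOf_eq {X : Set (Pr k M)} (hX : IsClosed X) {φ ψ : Pr k M → Pr k N}
    (hφ : IsMorphismOn X φ) (hψ : IsMorphismOn X ψ) : IsClosed {p | p ∈ X ∧ φ p = ψ p} := by
  rw [isMorphismOn_iff] at hφ hψ
  rw [← isOpen_compl_iff, isOpen_iff_forall_mem_open]
  intro p hp
  by_cases hpX : p ∈ X
  · have hne : φ p ≠ ψ p := fun h => hp ⟨hpX, h⟩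
    induction p using Projectivization.ind with
    | h v hv =>
    obtain ⟨F, hF, hFv⟩ := hφ v hv hpX
    obtain ⟨G, hG, hGv⟩ := hψ v hv hpX
    rw [hF.2 v hv hpX hFv, hG.2 v hv hpX hGv, Ne, mk_eq_mk_iff_proportional] at hne
    push Not at hne
    obtain ⟨i, j, hij⟩ := hne
    refine ⟨{q | ¬ Vanishes (F i * G j - G i * F j) q}, ?_, isOpen_setOf_not_vanishes _, ?_⟩
    · rintro q hq ⟨hqX, hqe⟩
      induction q using Projectivization.ind with
      | h w hw =>
      apply hq
      obtain ⟨d, hd⟩ := hF.1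
      obtain ⟨e, he⟩ := hG.1
      have hhom : (F i * G j - G i * F j).IsHomogeneous (d + e) := by
        exact ((hd i).mul (he j)).sub (add_comm e d ▸ (he i).mul (hd j))
      rw [vanishes_mk_of_isHomogeneous hhom]
      simp only [map_sub, map_mul]
      by_cases hFw : tup F w = 0
      · have h1 : ∀ i, eval w (F i) = 0 := fun i => congrFun hFw i
        simp [h1]
      by_cases hGw : tup G w = 0
      · have h1 : ∀ i, eval w (G i) = 0 := fun i => congrFun hGw i
        simp [h1]
      rw [hF.2 w hw hqX hFw, hG.2 w hw hqX hGw, mk_eq_mk_iff_proportional] at hqe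
      have := hqe i j
      simp only [tup_apply] at this
      rw [this, sub_self]
    · refine not_vanishes_mk ?_
      simp only [map_sub, map_mul]
      exact sub_ne_zero.2 hij
  · exact ⟨Xᶜ, fun q hq h => hq h.1, hX.isOpen_compl, hpX⟩

theorem eqOn_of_eqOn_diff {X : Set (Pr k M)} (hX : IsVariety X) {φ ψ : Pr k M → Pr k N}
    (hφ : IsMorphismOn X φ) (hψ : IsMorphismOn X ψ) {Z : Set (Pr k M)} (hZ : IsClosed Z)
    (hXZ : ¬ X ⊆ Z) (h : ∀ p ∈ X, p ∉ Z → φ p = ψ p) : EqOn φ ψ X := by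
  have h1 := isPreirreducible_iff_isClosed_union_isClosed.1 hX.isIrreducible.2 _ Z
    (isClosed_setOf_eq hX.isClosed hφ hψ) hZ (by
      intro p hp
      by_cases hpZ : p ∈ Z
      · exact Or.inr hpZ
      · exact Or.inl ⟨hp, h p hp hpZ⟩)
  intro p hp
  exact ((h1.resolve_right hXZ) hp).2

omit [Infinite k] in
/-- Gluing: pairwise proportional tuples of forms define a morphism. -/
theorem exists_morphism_of_tuples (X : Set (Pr k M))
    (S : Set (Fin (N + 1) → MvPolynomial (Fin (M + 1)) k))
    (hhom : ∀ F ∈ S, ∃ d, ∀ i, (F i).IsHomogeneous d)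
    (hprop : ∀ F ∈ S, ∀ G ∈ S, ∀ (v : Fin (M + 1) → k) (hv : v ≠ 0),
      Projectivization.mk k v hv ∈ X → ∀ i j, eval v (F i) * eval v (G j) =
        eval v (G i) * eval v (F j))
    (hne : ∀ (v : Fin (M + 1) → k) (hv : v ≠ 0), Projectivization.mk k v hv ∈ X →
      ∃ F ∈ S, tup F v ≠ 0) :
    ∃ φ : Pr k M → Pr k N, IsMorphismOn X φ ∧ ∀ F ∈ S, Rep X φ F := by
  classical
  let φ : Pr k M → Pr k N := fun p =>
    if h : ∃ F ∈ S, tup F p.rep ≠ 0 then Projectivization.mk k _ h.choose_spec.2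
    else Projectivization.mk k (fun _ => 1) (by
      intro h0; exact one_ne_zero (congrFun h0 0))
  have hrep : ∀ F ∈ S, Rep X φ F := by
    intro F hF
    refine ⟨hhom F hF, fun v hv hvX hFv => ?_⟩
    set p := Projectivization.mk k v hv with hp
    obtain ⟨d, hd⟩ := hhom F hF
    have hFp : tup F p.rep ≠ 0 := tup_ne_zero_of_mk_eq (hv := p.rep_nonzero) (hw := hv) hd
      p.mk_rep hFv
    have hex : ∃ F ∈ S, tup F p.rep ≠ 0 := ⟨F, hF, hFp⟩
    have h1 : φ p = Projectivization.mk k _ hex.choose_spec.2 := dif_pos hex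
    have h2 : Projectivization.mk k (tup F v) hFv = Projectivization.mk k _ hFp := by
      obtain ⟨a, ha⟩ := (Projectivization.mk_eq_mk_iff' k _ _ hv p.rep_nonzero).1 p.mk_rep.symm
      rw [Projectivization.mk_eq_mk_iff']
      refine ⟨a ^ d, ?_⟩
      rw [← tup_smul hd, ha]
    rw [h1, h2]
    refine eq_mk_of_proportional _ _ fun i j => ?_
    exact hprop _ hex.choose_spec.1 F hF _ p.rep_nonzero (by rw [p.mk_rep]; exact hvX) i j
  refine ⟨φ, ?_, hrep⟩
  rw [isMorphismOn_iff]
  intro v hv hvX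
  obtain ⟨F, hF, hFv⟩ := hne v hv hvX
  exact ⟨F, hrep F hF, hFv⟩

end Morphisms

section Dimension

variable {m : ℕ}

/-- A variety of dimension one, in terms of its proper closed subsets. -/
structure IsCurve (E : Set (Pr k N)) : Prop where
  isVariety : IsVariety E
  infinite : E.Infinite
  finite_of_ssubset : ∀ Z, IsClosed Z → Z ⊂ E → Z.Finite

theorem exists_ssubset_variety {E : Set (Pr k N)} (hinf : E.Infinite) :
    ∃ p, IsVariety ({p} : Set (Pr k N)) ∧ {p} ⊂ E := by
  obtain ⟨p, hp⟩ := hinf.nonempty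
  refine ⟨p, isVariety_singleton p, ?_⟩
  rw [ssubset_iff_subset_ne]
  exact ⟨by simpa using hp, fun h => hinf (h ▸ finite_singleton p)⟩

theorem infinite_of_ssubset {V W : Set (Pr k N)} (hV : V.Nonempty) (hW : IsVariety W)
    (h : V ⊂ W) : W.Infinite := by
  intro hfin
  obtain ⟨p, rfl⟩ := eq_singleton_of_finite hW.isIrreducible hfin
  rcases (subset_singleton_iff_eq.1 h.1) with h1 | h1
  · exact hV.ne_empty h1
  · exact h.2 h1.ge

theorem isCurve_of_hasDim_two {X E : Set (Pr k N)} (hdim : HasDim X 2)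
    (hX : IsVariety X) (hE : IsVariety E) (hinf : E.Infinite) (hEX : E ⊂ X) : IsCurve E := by
  refine ⟨hE, hinf, fun Z hZ hZE => ?_⟩
  by_contra hZinf
  obtain ⟨E', hE', hE'Z, hE'inf⟩ := exists_infinite_variety hZ hZinf
  obtain ⟨p, hp, hpE'⟩ := exists_ssubset_variety hE'inf
  have hE'E : E' ⊂ E := hE'Z.trans_ssubset hZE
  have := natCast_three_le_krullDim
    (α := {W : Set (Pr k N) // IsVariety W ∧ W ⊆ X})
    (a := ⟨{p}, hp, (hpE'.trans (hE'E.trans hEX)).subset⟩)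
    (b := ⟨E', hE', (hE'E.trans hEX).subset⟩) (c := ⟨E, hE, hEX.subset⟩)
    (d := ⟨X, hX, Subset.rfl⟩) hpE' hE'E hEX
  rw [hdim] at this
  have h2 : ((3 : ℕ) : WithBot ℕ∞) ≤ ((2 : ℕ) : WithBot ℕ∞) := this
  norm_cast at h2

theorem exists_curve_ssubset {X : Set (Pr k N)} (hdim : HasDim X 2) (hX : IsVariety X) :
    ∃ E, IsCurve E ∧ E ⊂ X := by
  have h2 : ((2 : ℕ) : WithBot ℕ∞) ≤ Order.krullDim {W : Set (Pr k N) // IsVariety W ∧ W ⊆ X} :=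
    hdim.ge
  obtain ⟨s, hs⟩ := Order.le_krullDim_iff.1 h2
  have h01 : s ⟨0, by omega⟩ < s ⟨1, by omega⟩ := s.strictMono (by simp [Fin.lt_def])
  have h12 : s ⟨1, by omega⟩ < s ⟨2, by omega⟩ := s.strictMono (by simp [Fin.lt_def])
  have hss : (s ⟨1, by omega⟩).1 ⊂ X := lt_of_lt_of_le (b := (s ⟨2, by omega⟩).1) h12 (s ⟨2, by omega⟩).2.2
  exact ⟨_, isCurve_of_hasDim_two hdim hX (s ⟨1, by omega⟩).2.1
    (infinite_of_ssubset (s ⟨0, by omega⟩).2.1.2.1 (s ⟨1, by omega⟩).2.1 h01) hss, hss⟩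

/-- Finitely many curves lie in a proper closed subset of a surface. -/
theorem finite_curves {X : Set (Pr k N)} (hdim : HasDim X 2) (hX : IsVariety X)
    {Z : Set (Pr k N)} (hZ : IsClosed Z) (hZX : Z ⊂ X) :
    {E | IsVariety E ∧ E.Infinite ∧ E ⊆ Z}.Finite := by
  obtain ⟨S, hS, hcl, hirr, rfl⟩ :=
    TopologicalSpace.NoetherianSpace.exists_finite_set_isClosed_irreducible hZ
  refine hS.subset fun E ⟨hE, hinf, hES⟩ => ?_
  lift S to Finset (Set (Pr k N)) using hS
  obtain ⟨C, hCS, hEC⟩ := isIrreducible_iff_sUnion_isClosed.1 hE.isIrreducible S hcl hES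
  have hCX : C ⊂ X := (subset_sUnion_of_mem hCS).trans_ssubset hZX
  have hC := isCurve_of_hasDim_two hdim hX (isVariety_iff.2 ⟨hcl C hCS, hirr C hCS⟩)
    (hinf.mono hEC) hCX
  by_contra hne
  refine hinf (hC.finite_of_ssubset E hE.isClosed (ssubset_iff_subset_ne.2 ⟨hEC, ?_⟩))
  rintro rfl
  exact hne hCS

theorem IsCurve.hasDim {B : Set (Pr k N)} (hB : IsCurve B) : HasDim B 1 := by
  apply le_antisymm
  · refine iSup_le fun s => ?_
    by_contra hlt
    have hs : 2 ≤ s.length := by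
      by_contra h
      exact hlt (by exact_mod_cast (by omega : s.length ≤ 1))
    have h01 : s ⟨0, by omega⟩ < s ⟨1, by omega⟩ := s.strictMono (by simp [Fin.lt_def])
    have h12 : s ⟨1, by omega⟩ < s ⟨2, by omega⟩ := s.strictMono (by simp [Fin.lt_def])
    have hss : (s ⟨1, by omega⟩).1 ⊂ B := lt_of_lt_of_le (b := (s ⟨2, by omega⟩).1) h12 (s ⟨2, by omega⟩).2.2
    exact infinite_of_ssubset (s ⟨0, by omega⟩).2.1.2.1 (s ⟨1, by omega⟩).2.1 h01
      (hB.finite_of_ssubset _ (s ⟨1, by omega⟩).2.1.isClosed hss)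
  · obtain ⟨p, hp, hpB⟩ := exists_ssubset_variety hB.infinite
    have : (⟨{p}, hp, hpB.subset⟩ : {W : Set (Pr k N) // IsVariety W ∧ W ⊆ B}) <
      ⟨B, hB.isVariety, Subset.rfl⟩ := hpB
    exact Order.le_krullDim_iff.2 ⟨LTSeries.mk 1
      ![(⟨{p}, hp, hpB.subset⟩ : {W : Set (Pr k N) // IsVariety W ∧ W ⊆ B}),
        ⟨B, hB.isVariety, Subset.rfl⟩]
      (Fin.strictMono_iff_lt_succ.2 (by simp [Fin.forall_fin_succ, this])), rfl⟩

theorem infinite_of_hasDim_two {X : Set (Pr k N)} (hdim : HasDim X 2) (hX : IsVariety X) :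
    X.Infinite := by
  obtain ⟨E, hE, hEX⟩ := exists_curve_ssubset hdim hX
  exact hE.infinite.mono hEX.subset

end Dimension

section Charts

/-- The linear form with coefficients `l`. -/
noncomputable def linForm {σ : Type} [Fintype σ] (l : σ → k) : MvPolynomial σ k :=
  ∑ i, C (l i) * X i

theorem eval_linForm {σ : Type} [Fintype σ] (l v : σ → k) : eval v (linForm l) = ∑ i, l i * v i := by
  simp [linForm]

theorem isHomogeneous_linForm {σ : Type} [Fintype σ] (l : σ → k) : (linForm l).IsHomogeneous 1 :=
  IsHomogeneous.sum _ _ _ fun i _ => isHomogeneous_C_mul_X _ _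

/-- The ideal of the affine chart `l = 1` of the cone over `Z`. -/
def chartIdeal (Z : Set (Pr k M)) (l : Fin (M + 1) → k) : Ideal (MvPolynomial (Fin (M + 1)) k) where
  carrier := {f | ∀ (v : Fin (M + 1) → k) (hv : v ≠ 0), Projectivization.mk k v hv ∈ Z →
    eval v (linForm l) = 1 → eval v f = 0}
  add_mem' := fun {f g} hf hg v hv hZ hl => by rw [map_add, hf v hv hZ hl, hg v hv hZ hl, add_zero]
  zero_mem' := fun v _ _ _ => map_zero _
  smul_mem' := fun c f hf v hv hZ hl => by rw [smul_eq_mul, map_mul, hf v hv hZ hl, mul_zero]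

variable {Z : Set (Pr k M)} {l : Fin (M + 1) → k} {f : MvPolynomial (Fin (M + 1)) k}

theorem mem_chartIdeal : f ∈ chartIdeal Z l ↔ ∀ (v : Fin (M + 1) → k) (hv : v ≠ 0),
    Projectivization.mk k v hv ∈ Z → eval v (linForm l) = 1 → eval v f = 0 := Iff.rfl

theorem coneIdeal_le_chartIdeal : coneIdeal Z ≤ chartIdeal Z l :=
  fun _ hf v hv hZ _ => mem_coneIdeal'.1 hf v hv hZ

theorem chartIdeal_anti {W : Set (Pr k M)} (h : W ⊆ Z) : chartIdeal Z l ≤ chartIdeal W l :=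
  fun _ hf v hv hW hl => hf v hv (h hW) hl

theorem linForm_sub_one_mem : linForm l - 1 ∈ chartIdeal Z l :=
  fun v hv hZ hl => by rw [map_sub, hl, map_one, sub_self]

theorem mk_smul_eq {v : Fin (M + 1) → k} (hv : v ≠ 0) {c : k} (hc : c ≠ 0) :
    Projectivization.mk k (c • v) (smul_ne_zero hc hv) = Projectivization.mk k v hv := by
  rw [Projectivization.mk_eq_mk_iff']
  exact ⟨c, rfl⟩

theorem mem_chartIdeal_iff_of_isHomogeneous {d : ℕ} (hf : f.IsHomogeneous d) :
    f ∈ chartIdeal Z l ↔ linForm l * f ∈ coneIdeal Z := by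
  rw [mem_coneIdeal']
  constructor
  · intro h v hv hZ
    rw [map_mul]
    by_cases hl : eval v (linForm l) = 0
    · rw [hl, zero_mul]
    · have hc := inv_ne_zero hl
      have := h ((eval v (linForm l))⁻¹ • v) (smul_ne_zero hc hv) (by rwa [mk_smul_eq hv hc]) (by
        rw [eval_smul_of_isHomogeneous (isHomogeneous_linForm l), pow_one, inv_mul_cancel₀ hl])
      rw [eval_smul_of_isHomogeneous hf] at this
      rw [(mul_eq_zero.1 this).resolve_left (pow_ne_zero _ hc), mul_zero]
  · intro h v hv hZ hl
    have := h v hv hZ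
    rwa [map_mul, hl, one_mul] at this

theorem eval_homogenizeBy_linForm {d : ℕ} (hf : f.totalDegree ≤ d) {v : Fin (M + 1) → k}
    (hl : eval v (linForm l) = 1) : eval v (homogenizeBy (linForm l) d f) = eval v f := by
  have h1 : aeval v (linForm l) = (1 : k) := hl
  have := aeval_homogenizeBy (K := k) hf v (by rw [h1]; exact one_ne_zero)
  rw [h1, one_pow, one_mul] at this
  simpa using this

theorem mem_chartIdeal_iff_homogenizeBy {d : ℕ} (hf : f.totalDegree ≤ d) :
    f ∈ chartIdeal Z l ↔ homogenizeBy (linForm l) d f ∈ chartIdeal Z l := by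
  simp only [mem_chartIdeal]
  refine forall_congr' fun v => forall_congr' fun hv => forall_congr' fun _ =>
    forall_congr' fun hl => ?_
  rw [eval_homogenizeBy_linForm hf hl]

variable [Infinite k]

theorem chartIdeal_isPrime (hZ : IsVariety Z) (hl : linForm l ∉ coneIdeal Z) :
    (chartIdeal Z l).IsPrime := by
  have hp := hZ.isPrime
  refine ⟨fun h => ?_, fun {f g} hfg => ?_⟩
  · have h1 : (1 : MvPolynomial (Fin (M + 1)) k) ∈ chartIdeal Z l := h ▸ Submodule.mem_top
    rw [mem_chartIdeal_iff_of_isHomogeneous (isHomogeneous_one _ _), mul_one] at h1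
    exact hl h1
  · have hF := isHomogeneous_homogenizeBy (isHomogeneous_linForm l) f.totalDegree f
    have hG := isHomogeneous_homogenizeBy (isHomogeneous_linForm l) g.totalDegree g
    rw [mem_chartIdeal_iff_homogenizeBy (f := f) le_rfl,
      mem_chartIdeal_iff_homogenizeBy (f := g) le_rfl, mem_chartIdeal_iff_of_isHomogeneous hF,
      mem_chartIdeal_iff_of_isHomogeneous hG]
    have h1 : homogenizeBy (linForm l) f.totalDegree f * homogenizeBy (linForm l) g.totalDegree g ∈
        chartIdeal Z l := by
      intro v hv hvZ hlv
      rw [map_mul, eval_homogenizeBy_linForm le_rfl hlv, eval_homogenizeBy_linForm le_rfl hlv,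
        ← map_mul]
      exact hfg v hv hvZ hlv
    rw [mem_chartIdeal_iff_of_isHomogeneous (hF.mul hG)] at h1
    rcases hp.mem_or_mem ((hp.mem_or_mem h1).resolve_left hl) with h | h
    · exact Or.inl (Ideal.mul_mem_left _ _ h)
    · exact Or.inr (Ideal.mul_mem_left _ _ h)

theorem mem_coneIdeal_of_mem_chartIdeal (hZ : IsVariety Z) (hl : linForm l ∉ coneIdeal Z) {d : ℕ}
    (hf : f.IsHomogeneous d) (h : f ∈ chartIdeal Z l) : f ∈ coneIdeal Z :=
  (hZ.isPrime.mem_or_mem ((mem_chartIdeal_iff_of_isHomogeneous hf).1 h)).resolve_left hl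

omit [Infinite k] in
theorem mem_chart_of_forall (hZ : IsClosed Z) {v : Fin (M + 1) → k}
    (h : ∀ f ∈ chartIdeal Z l, eval v f = 0) :
    ∃ hv : v ≠ 0, Projectivization.mk k v hv ∈ Z ∧ eval v (linForm l) = 1 := by
  have hl : eval v (linForm l) = 1 := by
    have := h _ linForm_sub_one_mem
    rwa [map_sub, map_one, sub_eq_zero] at this
  have hv : v ≠ 0 := by
    rintro rfl
    rw [eval_linForm] at hl
    simp at hl
  refine ⟨hv, ?_, hl⟩
  by_contra hvZ
  obtain ⟨f, d, hd, hf, hfp⟩ := (isClosed_iff.1 hZ).exists_of_notMem hvZ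
  rw [vanishes_mk_of_isHomogeneous hd] at hfp
  exact hfp (h f (coneIdeal_le_chartIdeal hf))

/-- The maximal ideal of a point. -/
noncomputable def pointIdeal {σ : Type} (v : σ → k) : Ideal (MvPolynomial σ k) := RingHom.ker (eval v)

omit [Infinite k] in
theorem mem_pointIdeal {σ : Type} {v : σ → k} {f : MvPolynomial σ k} :
    f ∈ pointIdeal v ↔ eval v f = 0 := RingHom.mem_ker

omit [Infinite k] in
theorem pointIdeal_isMaximal {σ : Type} (v : σ → k) : (pointIdeal v).IsMaximal :=
  RingHom.ker_isMaximal_of_surjective _ fun c => ⟨C c, by simp⟩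

omit [Infinite k] in
theorem chartIdeal_le_pointIdeal {v : Fin (M + 1) → k} (hv : v ≠ 0)
    (hZ : Projectivization.mk k v hv ∈ Z) (hl : eval v (linForm l) = 1) :
    chartIdeal Z l ≤ pointIdeal v := fun _ hf => hf v hv hZ hl

theorem _root_.Ideal.map_quotientMk_lt {R : Type*} [CommRing R] {I P Q : Ideal R} (hI : I ≤ P) (hPQ : P < Q) :
    P.map (Ideal.Quotient.mk I) < Q.map (Ideal.Quotient.mk I) := by
  refine lt_of_le_not_ge (Ideal.map_mono hPQ.le) fun h => hPQ.not_ge ?_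
  have := Ideal.comap_mono (f := Ideal.Quotient.mk I) h
  rwa [Ideal.comap_map_mk hI, Ideal.comap_map_mk (hI.trans hPQ.le)] at this

/-- A linear form which is nonzero at two given nonzero vectors. -/
theorem exists_linForm_ne_zero {n : ℕ} (S : Set (Fin n → k)) (hS : S.Finite) (h0 : 0 ∉ S) :
    ∃ l : Fin n → k, ∀ v ∈ S, eval v (linForm l) ≠ 0 := by
  have : Finite S := hS
  obtain ⟨g, hg⟩ := Module.exists_dual_forall_apply_ne_zero (K := k) (fun v : S => v.1)
    (fun v h => h0 (h ▸ v.2))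
  refine ⟨fun i => g (Pi.single i 1), fun v hv => ?_⟩
  have h1 : g v ≠ 0 := hg ⟨v, hv⟩
  rw [eval_linForm]
  convert h1 using 1
  have hv' : v = ∑ i, v i • (Pi.single i 1 : Fin n → k) := by
    simpa using ((Pi.basisFun k (Fin n)).sum_repr v).symm
  conv_rhs => rw [hv', map_sum]
  exact Finset.sum_congr rfl fun i _ => by rw [map_smul, smul_eq_mul, mul_comm]

end Charts

section SurfaceChart

variable [IsAlgClosed k] {X : Set (Pr k M)}

/-- Every point of a surface has a chart whose coordinate ring admits a nonzero
nonmaximal prime ideal inside the maximal ideal of the point. -/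
theorem exists_chart (hdim : HasDim X 2) (hX : IsVariety X) {v₀ : Fin (M + 1) → k} (hv₀ : v₀ ≠ 0)
    (hp : Projectivization.mk k v₀ hv₀ ∈ X) :
    ∃ l : Fin (M + 1) → k, eval v₀ (linForm l) = 1 ∧
      ∃ P : Ideal (MvPolynomial (Fin (M + 1)) k ⧸ chartIdeal X l), P.IsPrime ∧ ⊥ < P ∧
        P < (pointIdeal v₀).map (Ideal.Quotient.mk (chartIdeal X l)) := by
  have : Infinite k := IsAlgClosed.instInfinite
  obtain ⟨E, hE, hEX⟩ := exists_curve_ssubset hdim hX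
  obtain ⟨q, hq⟩ := hE.infinite.nonempty
  induction q using Projectivization.ind with
  | h v hv =>
  obtain ⟨l', hl'⟩ := exists_linForm_ne_zero (k := k) {v₀, v} (by simp)
    (by simp [hv.symm, hv₀.symm])
  have h0 : eval v₀ (linForm l') ≠ 0 := hl' _ (by simp)
  have h1 : eval v (linForm l') ≠ 0 := hl' _ (by simp)
  set l : Fin (M + 1) → k := (eval v₀ (linForm l'))⁻¹ • l' with hl
  have hlin : ∀ w, eval w (linForm l) = (eval v₀ (linForm l'))⁻¹ * eval w (linForm l') := by
    intro w
    simp only [eval_linForm, hl, Pi.smul_apply, smul_eq_mul, Finset.mul_sum, mul_assoc]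
  have hl0 : eval v₀ (linForm l) = 1 := by rw [hlin, inv_mul_cancel₀ h0]
  have hlv : eval v (linForm l) ≠ 0 := by rw [hlin]; exact mul_ne_zero (inv_ne_zero h0) h1
  refine ⟨l, hl0, ?_⟩
  have hlE : linForm l ∉ coneIdeal E := fun h => hlv (mem_coneIdeal'.1 h v hv hq)
  have hlX : linForm l ∉ coneIdeal X := fun h => hlv (mem_coneIdeal'.1 h v hv (hEX.subset hq))
  have hXp := chartIdeal_isPrime hX hlX
  have hEp := chartIdeal_isPrime hE.isVariety hlE
  set w := (eval v (linForm l))⁻¹ • v with hw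
  have hw0 : w ≠ 0 := smul_ne_zero (inv_ne_zero hlv) hv
  have hwE : Projectivization.mk k w hw0 ∈ E := by rwa [mk_smul_eq hv (inv_ne_zero hlv)]
  have hlw : eval w (linForm l) = 1 := by
    rw [hw, eval_smul_of_isHomogeneous (isHomogeneous_linForm l), pow_one, inv_mul_cancel₀ hlv]
  have hm := pointIdeal_isMaximal v₀
  have hm' := pointIdeal_isMaximal w
  have hXm := chartIdeal_le_pointIdeal hv₀ hp hl0
  have hXE : chartIdeal X l < chartIdeal E l := by
    refine lt_of_le_not_ge (chartIdeal_anti hEX.subset) fun h => hEX.2 ?_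
    rw [(isClosed_iff.1 hE.isVariety.isClosed).subset_iff]
    intro f hf p hpX
    by_contra hfp
    have hpE : p ∉ E := fun h => hfp (hf p h)
    obtain ⟨g, d, hd, hg, hgp⟩ := (isClosed_iff.1 hE.isVariety.isClosed).exists_of_notMem hpE
    exact hgp (mem_coneIdeal_of_mem_chartIdeal hX hlX hd (h (coneIdeal_le_chartIdeal hg)) p hpX)
  have hEw : chartIdeal E l < pointIdeal w := by
    refine lt_of_le_not_ge (chartIdeal_le_pointIdeal hw0 hwE hlw) fun h => hE.infinite ?_
    refine (finite_singleton (Projectivization.mk k w hw0)).subset ?_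
    intro p hpE
    by_contra hpw
    obtain ⟨g, d, hd, hg, hgp⟩ := (isClosed_iff.1 (isClosed_singleton)).exists_of_notMem hpw
    have hgw : g ∈ pointIdeal w := mem_coneIdeal'.1 hg w hw0 rfl
    exact hgp (mem_coneIdeal_of_mem_chartIdeal hE.isVariety hlE hd (h hgw) p hpE)
  have hP1 := Ideal.isPrime_map_quotientMk_of_isPrime hXE.le
  have hP2 := Ideal.isPrime_map_quotientMk_of_isPrime (hXE.le.trans hEw.le)
  have hm2 := (Ideal.map_eq_top_or_isMaximal_of_surjective _
    (Ideal.Quotient.mk_surjective (I := chartIdeal X l)) hm).resolve_left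
      (Ideal.isPrime_map_quotientMk_of_isPrime hXm).ne_top
  refine exists_prime_lt_of_isMaximal (k := k) _ _ ?_ (Ideal.map_quotientMk_lt hXE.le hEw) _
  have := Ideal.map_quotientMk_lt le_rfl hXE
  rwa [Ideal.map_quotient_self] at this

/-- Krull's principal ideal theorem on a surface. -/
theorem exists_curve_through (hdim : HasDim X 2) (hX : IsVariety X) {p : Pr k M} (hp : p ∈ X)
    {d : ℕ} {g : MvPolynomial (Fin (M + 1)) k} (hg : g.IsHomogeneous d) (hgX : g ∉ coneIdeal X)
    (hgp : Vanishes g p) : ∃ E, IsCurve E ∧ p ∈ E ∧ E ⊆ X ∧ g ∈ coneIdeal E := by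
  have : Infinite k := IsAlgClosed.instInfinite
  classical
  have hZ : IsClosed (X ∩ {q | Vanishes g q}) := hX.isClosed.inter (isClosed_setOf_vanishes g)
  obtain ⟨S, hS, hcl, hirr, hSe⟩ :=
    TopologicalSpace.NoetherianSpace.exists_finite_set_isClosed_irreducible hZ
  have hpZ : p ∈ ⋃₀ S := hSe ▸ ⟨hp, hgp⟩
  by_cases hex : ∃ E ∈ S, p ∈ E ∧ E.Infinite
  · obtain ⟨E, hES, hpE, hinf⟩ := hex
    have hEZ : E ⊆ X ∩ {q | Vanishes g q} := hSe ▸ subset_sUnion_of_mem hES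
    refine ⟨E, isCurve_of_hasDim_two hdim hX (isVariety_iff.2 ⟨hcl E hES, hirr E hES⟩) hinf ?_, hpE,
      hEZ.trans inter_subset_left, fun q hq => (hEZ hq).2⟩
    refine ssubset_iff_subset_ne.2 ⟨hEZ.trans inter_subset_left, ?_⟩
    rintro rfl
    exact hgX fun q hq => (hEZ hq).2
  exfalso
  push Not at hex
  set Z' := ⋃₀ {E ∈ S | p ∉ E} with hZ'
  have hZ'cl : IsClosed Z' := by
    rw [hZ', sUnion_eq_biUnion]
    exact (hS.subset (sep_subset _ _)).isClosed_biUnion fun E hE => hcl E hE.1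
  have hpZ' : p ∉ Z' := by
    rintro ⟨E, hE, hpE⟩
    exact hE.2 hpE
  have hcover : ∀ q ∈ X, Vanishes g q → q = p ∨ q ∈ Z' := by
    intro q hq hgq
    obtain ⟨E, hES, hqE⟩ : q ∈ ⋃₀ S := hSe ▸ ⟨hq, hgq⟩
    by_cases hpE : p ∈ E
    · left
      obtain ⟨p', rfl⟩ := eq_singleton_of_finite (hirr E hES) (hex E hES hpE)
      exact (mem_singleton_iff.1 hqE).trans (mem_singleton_iff.1 hpE).symm
    · exact Or.inr ⟨E, ⟨hES, hpE⟩, hqE⟩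
  obtain ⟨f, e, he, hf, hfp⟩ := (isClosed_iff.1 hZ'cl).exists_of_notMem hpZ'
  induction p using Projectivization.ind with
  | h v₀ hv₀ =>
  obtain ⟨l, hl, P, hPp, hP0, hPm⟩ := exists_chart hdim hX hv₀ hp
  rw [vanishes_mk_of_isHomogeneous he] at hfp
  rw [vanishes_mk_of_isHomogeneous hg] at hgp
  let I := chartIdeal X l
  have hlX : linForm l ∉ coneIdeal X := fun h => by
    have := mem_coneIdeal'.1 h v₀ hv₀ hp
    rw [hl] at this
    exact one_ne_zero this
  have hXp : I.IsPrime := chartIdeal_isPrime hX hlX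
  have hXm : I ≤ pointIdeal v₀ := chartIdeal_le_pointIdeal hv₀ hp hl
  have hm := pointIdeal_isMaximal v₀
  have hmp := Ideal.isPrime_map_quotientMk_of_isPrime hXm
  set m := (pointIdeal v₀).map (Ideal.Quotient.mk I) with hmdef
  have hcomap : m.comap (Ideal.Quotient.mk I) = pointIdeal v₀ := Ideal.comap_map_mk hXm
  have hmin : m ∈ (Ideal.span {Ideal.Quotient.mk I g}).minimalPrimes := by
    refine ⟨⟨hmp, ?_⟩, ?_⟩
    · rw [Ideal.span_singleton_le_iff_mem]
      exact Ideal.mem_map_of_mem _ (mem_pointIdeal.2 hgp)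
    · rintro Q ⟨hQ, hgQ⟩ hQm
      rw [Ideal.span_singleton_le_iff_mem] at hgQ
      have hfQ : Ideal.Quotient.mk I f ∉ Q := fun h => by
        have : f ∈ m.comap (Ideal.Quotient.mk I) := hQm h
        rw [hcomap] at this
        exact hfp this
      rw [hmdef, Ideal.map_le_iff_le_comap]
      intro a ha
      have hrad : f * a ∈ (I ⊔ Ideal.span {g}).radical := by
        rw [← MvPolynomial.vanishingIdeal_zeroLocus_eq_radical (K := k),
          MvPolynomial.mem_vanishingIdeal_iff]
        intro v hv
        rw [MvPolynomial.mem_zeroLocus_iff] at hv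
        obtain ⟨hv0, hvX, hlv⟩ := mem_chart_of_forall (l := l) hX.isClosed (v := v) fun f hf => by
          simpa using hv f (Ideal.mem_sup_left hf)
        have hgv : eval v g = 0 := by
          simpa using hv g (Ideal.mem_sup_right (Ideal.mem_span_singleton_self g))
        have goal : eval v (f * a) = 0 := by
          rw [map_mul]
          rcases hcover _ hvX ((vanishes_mk_of_isHomogeneous hg hv0).2 hgv) with h | h
          · rw [Projectivization.mk_eq_mk_iff'] at h
            obtain ⟨c, hc⟩ := h
            have hc1 : c = 1 := by
              rw [← hc, eval_smul_of_isHomogeneous (isHomogeneous_linForm l), hl] at hlv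
              simpa using hlv
            rw [hc1, one_smul] at hc
            rw [← hc, mem_pointIdeal.1 ha, mul_zero]
          · rw [mem_coneIdeal'.1 hf v hv0 h, zero_mul]
        simpa using goal
      obtain ⟨n, hn⟩ := hrad
      have h1 : Ideal.Quotient.mk I ((f * a) ^ n) ∈ Q := by
        obtain ⟨x, hx, y, hy, hxy⟩ := Submodule.mem_sup.1 hn
        rw [← hxy, map_add, Ideal.Quotient.eq_zero_iff_mem.2 hx, zero_add]
        obtain ⟨c, rfl⟩ := Ideal.mem_span_singleton'.1 hy
        rw [map_mul]
        exact Ideal.mul_mem_left _ _ hgQ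
      rw [map_pow, map_mul] at h1
      exact (hQ.mem_or_mem (hQ.mem_of_pow_mem _ h1)).resolve_left hfQ
  have hht := Ideal.height_le_one_of_isPrincipal_of_mem_minimalPrimes _ _ hmin
  have h1 := Ideal.height_add_one_le_of_lt_of_isPrime hP0
  have h2 := Ideal.height_add_one_le_of_lt_of_isPrime hPm
  have h3 : (0 + 1 + 1 : ℕ∞) ≤ 1 :=
    (add_le_add_left ((add_le_add_left zero_le _).trans h1) _).trans (h2.trans hht)
  norm_num at h3

end SurfaceChart

section Tangent

theorem diffAt_apply {n : ℕ} (f : MvPolynomial (Fin (n + 1)) k) (v w : Fin (n + 1) → k) :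
    diffAt f v w = ∑ j, eval v (pderiv j f) * w j := by
  simp [diffAt]

/-- The differential at `v` as a linear map in the polynomial. -/
noncomputable def diffHom (v : Fin (M + 1) → k) :
    MvPolynomial (Fin (M + 1)) k →ₗ[k] Dual k (Fin (M + 1) → k) where
  toFun f := diffAt f v
  map_add' f g := by
    ext; simp [diffAt_apply, add_mul, Finset.sum_add_distrib]
  map_smul' c f := by
    ext; simp [diffAt_apply, Finset.mul_sum, mul_assoc]

theorem diffHom_apply (v : Fin (M + 1) → k) (f : MvPolynomial (Fin (M + 1)) k) :
    diffHom v f = diffAt f v := rfl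

theorem diffAt_mul (f g : MvPolynomial (Fin (M + 1)) k) (v w : Fin (M + 1) → k) :
    diffAt (f * g) v w = eval v f * diffAt g v w + eval v g * diffAt f v w := by
  simp only [diffAt_apply, Derivation.leibniz, map_add, smul_eq_mul, map_mul, Finset.mul_sum,
    ← Finset.sum_add_distrib]
  refine Finset.sum_congr rfl fun i _ => by ring

theorem diffAt_smul_of_isHomogeneous {f : MvPolynomial (Fin (M + 1)) k} {d : ℕ}
    (hf : f.IsHomogeneous d) (c : k) (v w : Fin (M + 1) → k) :
    diffAt f (c • v) w = c ^ (d - 1) * diffAt f v w := by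
  simp only [diffAt_apply, Finset.mul_sum]
  refine Finset.sum_congr rfl fun i _ => ?_
  rw [eval_smul_of_isHomogeneous hf.pderiv, mul_assoc]

theorem diffAt_linForm (l v w : Fin (M + 1) → k) : diffAt (linForm l) v w = ∑ i, l i * w i := by
  classical
  rw [diffAt_apply]
  refine Finset.sum_congr rfl fun i _ => ?_
  simp [linForm, pderiv_X, Pi.single_apply, Finset.sum_ite_eq]

/-- Second order Taylor expansion. -/
theorem sub_taylor_mem (v : Fin (M + 1) → k) (f : MvPolynomial (Fin (M + 1)) k) :
    f - C (eval v f) - ∑ j, C (eval v (pderiv j f)) * (X j - C (v j)) ∈ pointIdeal v ^ 2 := by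
  classical
  induction f using MvPolynomial.induction_on with
  | C a => simp
  | add p q hp hq =>
    convert Ideal.add_mem _ hp hq using 1
    simp only [map_add, add_mul, Finset.sum_add_distrib]
    ring
  | mul_X p i hp =>
    have hXi : X i - C (v i) ∈ pointIdeal v := by simp [mem_pointIdeal]
    set L := ∑ j, C (eval v (pderiv j p)) * (X j - C (v j)) with hL
    have hLm : L ∈ pointIdeal v := by
      refine Ideal.sum_mem _ fun j _ => Ideal.mul_mem_left _ _ ?_
      simp [mem_pointIdeal]
    have h2 : L * (X i - C (v i)) ∈ pointIdeal v ^ 2 := by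
      rw [pow_two]; exact Ideal.mul_mem_mul hLm hXi
    have h3 := Ideal.add_mem _ (Ideal.mul_mem_right (X i) _ hp) h2
    convert h3 using 1
    have hsum : ∑ j, C (eval v (pderiv j (p * X i))) * (X j - C (v j)) =
        C (eval v p) * (X i - C (v i)) + C (v i) * L := by
      have : ∀ j, C (eval v (pderiv j (p * X i))) * (X j - C (v j)) =
          (if j = i then C (eval v p) * (X i - C (v i)) else 0) +
            C (v i) * (C (eval v (pderiv j p)) * (X j - C (v j))) := by
        intro j
        rw [Derivation.leibniz, pderiv_X]
        by_cases h : j = i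
        · subst h
          simp
          ring
        · simp [Pi.single_apply, h, Ne.symm h]
          ring
      simp only [this, Finset.sum_add_distrib, Finset.mul_sum, hL]
      simp
    rw [hsum]
    simp only [map_mul, eval_X]
    ring

theorem mem_pointIdeal_sq {v : Fin (M + 1) → k} {f : MvPolynomial (Fin (M + 1)) k}
    (h0 : eval v f = 0) (h1 : diffAt f v = 0) : f ∈ pointIdeal v ^ 2 := by
  have := sub_taylor_mem v f
  have h2 : ∀ j, eval v (pderiv j f) = 0 := by
    intro j
    have := LinearMap.congr_fun h1 (Pi.single j 1)
    simpa [diffAt_apply, Pi.single_apply] using this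
  simpa [h0, h2] using this

variable {Z : Set (Pr k M)}

theorem mem_embTangent [Infinite k] {v : Fin (M + 1) → k} (hv : v ≠ 0) {w : Fin (M + 1) → k} :
    w ∈ embTangent Z (Projectivization.mk k v hv) ↔ ∀ f ∈ coneIdeal Z, diffAt f v w = 0 := by
  have key : w ∈ embTangent Z (Projectivization.mk k v hv) ↔
      ∀ f, (∃ d, f.IsHomogeneous d) → f ∈ coneIdeal Z → diffAt f v w = 0 := by
    simp only [embTangent, Submodule.mem_iInf, mem_setOf_eq, LinearMap.mem_ker]
    obtain ⟨a, ha⟩ := (Projectivization.mk_eq_mk_iff' k _ _ (Projectivization.rep_nonzero _) hv).1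
      (Projectivization.mk_rep (Projectivization.mk k v hv))
    have ha0 : a ≠ 0 := by
      rintro rfl
      exact Projectivization.rep_nonzero (Projectivization.mk k v hv) (by rw [← ha, zero_smul])
    refine forall_congr' fun f => ?_
    constructor
    · rintro h ⟨d, hd⟩ hf
      have := h ⟨⟨d, hd⟩, hf⟩
      rw [← ha, diffAt_smul_of_isHomogeneous hd] at this
      exact (mul_eq_zero.1 this).resolve_left (pow_ne_zero _ ha0)
    · rintro h ⟨⟨d, hd⟩, hf⟩
      rw [← ha, diffAt_smul_of_isHomogeneous hd, h ⟨d, hd⟩ hf, mul_zero]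
  rw [key]
  refine ⟨fun h f hf => ?_, fun h f _ hf => h f hf⟩
  have h1 : ∀ d, homogeneousComponent d f ∈ coneIdeal Z := fun d p hp =>
    vanishes_iff_homogeneousComponent.1 (hf p hp) d
  have h2 : diffHom v f w = ∑ d ∈ Finset.range (f.totalDegree + 1),
      diffHom v (homogeneousComponent d f) w := by
    conv_lhs => rw [← sum_homogeneousComponent f, map_sum, LinearMap.sum_apply]
  rw [← diffHom_apply, h2]
  exact Finset.sum_eq_zero fun d _ => h _ ⟨d, homogeneousComponent_isHomogeneous d f⟩ (h1 d)

theorem self_mem_embTangent [Infinite k] {v : Fin (M + 1) → k} (hv : v ≠ 0)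
    (hZ : Projectivization.mk k v hv ∈ Z) : v ∈ embTangent Z (Projectivization.mk k v hv) := by
  simp only [embTangent, Submodule.mem_iInf, mem_setOf_eq, LinearMap.mem_ker]
  rintro f ⟨⟨d, hd⟩, hf⟩
  obtain ⟨a, ha⟩ := (Projectivization.mk_eq_mk_iff' k _ _ (Projectivization.rep_nonzero _) hv).1
      (Projectivization.mk_rep (Projectivization.mk k v hv))
  rw [← ha, diffAt_smul_of_isHomogeneous hd, diffAt_apply]
  have hE := congrArg (eval v) hd.sum_X_mul_pderiv
  rw [map_sum] at hE
  have h0 : eval v f = 0 := hf _ hZ v hv rfl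
  have : ∑ j, eval v (pderiv j f) * v j = 0 := by
    rw [map_nsmul, h0, smul_zero] at hE
    rw [← hE]
    exact Finset.sum_congr rfl fun j _ => by rw [map_mul, eval_X, mul_comm]
  rw [this, mul_zero]

/-- Functions on a chart whose differential vanishes on the tangent space are of second order. -/
theorem mem_sq_sup_chartIdeal [Infinite k] {l v : Fin (M + 1) → k} (hv : v ≠ 0)
    (hZ : Projectivization.mk k v hv ∈ Z) (hl : eval v (linForm l) = 1)
    {f : MvPolynomial (Fin (M + 1)) k} (hf0 : eval v f = 0)
    (hf : ∀ w ∈ embTangent Z (Projectivization.mk k v hv), ∑ i, l i * w i = 0 → diffAt f v w = 0) :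
    f ∈ pointIdeal v ^ 2 ⊔ chartIdeal Z l := by
  set W := ((chartIdeal Z l).restrictScalars k).map (diffHom v) with hW
  have h1 : diffHom v f ∈ W.dualCoannihilator.dualAnnihilator := by
    rw [Submodule.mem_dualAnnihilator]
    intro w hw
    rw [Submodule.mem_dualCoannihilator] at hw
    refine hf w ((mem_embTangent hv).2 fun g hg => ?_) ?_
    · exact hw _ ⟨g, coneIdeal_le_chartIdeal hg, rfl⟩
    · have h2 := hw _ ⟨linForm l - 1, linForm_sub_one_mem, rfl⟩
      rw [map_sub, LinearMap.sub_apply, diffHom_apply, diffHom_apply, diffAt_linForm] at h2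
      simpa [diffAt_apply] using h2
  rw [Subspace.dualCoannihilator_dualAnnihilator_eq] at h1
  obtain ⟨g, hg, hgf⟩ := h1
  have h3 : f - g ∈ pointIdeal v ^ 2 := by
    refine mem_pointIdeal_sq ?_ ?_
    · rw [map_sub, hf0, chartIdeal_le_pointIdeal hv hZ hl hg, sub_zero]
    · rw [← diffHom_apply, map_sub, hgf, sub_self]
  rw [← sub_add_cancel f g]
  exact Ideal.add_mem _ (Ideal.mem_sup_left h3) (Ideal.mem_sup_right hg)

/-- An infinite variety has tangent lines. -/
theorem exists_mem_embTangent [Infinite k] {E : Set (Pr k M)} (hE : IsVariety E) (hinf : E.Infinite)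
    {v : Fin (M + 1) → k} (hv : v ≠ 0) (hvE : Projectivization.mk k v hv ∈ E) :
    ∃ w ∈ embTangent E (Projectivization.mk k v hv), w ∉ Submodule.span k {v} := by
  by_contra! hcon
  obtain ⟨l', hl'⟩ := exists_linForm_ne_zero (k := k) {v} (by simp) (by simp [hv.symm])
  have h0 : eval v (linForm l') ≠ 0 := hl' _ (by simp)
  set l : Fin (M + 1) → k := (eval v (linForm l'))⁻¹ • l' with hl
  have hlv : eval v (linForm l) = 1 := by
    have : eval v (linForm l) = (eval v (linForm l'))⁻¹ * eval v (linForm l') := by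
      simp only [eval_linForm, hl, Pi.smul_apply, smul_eq_mul, Finset.mul_sum, mul_assoc]
    rw [this, inv_mul_cancel₀ h0]
  have hlE : linForm l ∉ coneIdeal E := fun h => by
    have := mem_coneIdeal'.1 h v hv hvE
    rw [hlv] at this
    exact one_ne_zero this
  have hp := chartIdeal_isPrime hE hlE
  set I := chartIdeal E l with hI
  have hIm : I ≤ pointIdeal v := chartIdeal_le_pointIdeal hv hvE hlv
  have hsq : pointIdeal v ≤ pointIdeal v ^ 2 ⊔ I := by
    intro f hf
    refine mem_sq_sup_chartIdeal hv hvE hlv hf fun w hw hlw => ?_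
    obtain ⟨c, rfl⟩ := Submodule.mem_span_singleton.1 (hcon w hw)
    have hc : c = 0 := by
      rw [eval_linForm] at hlv
      have : ∑ i, l i * (c • v) i = c * ∑ i, l i * v i := by
        rw [Finset.mul_sum]
        exact Finset.sum_congr rfl fun i _ => by simp; ring
      rw [this, hlv, mul_one] at hlw
      exact hlw
    simp [hc]
  have hidem : IsIdempotentElem ((pointIdeal v).map (Ideal.Quotient.mk I)) := by
    refine le_antisymm Ideal.mul_le_left ?_
    have := Ideal.map_mono (f := Ideal.Quotient.mk I) hsq
    rwa [Ideal.map_sup, Ideal.map_quotient_self, sup_bot_eq, pow_two, Ideal.map_mul] at this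
  rcases (Ideal.isIdempotentElem_iff_eq_bot_or_top _ (IsNoetherian.noetherian _)).1 hidem with h | h
  · rw [Ideal.map_eq_bot_iff_le_ker, Ideal.mk_ker] at h
    refine hinf ((finite_singleton (Projectivization.mk k v hv)).subset ?_)
    intro p hpE
    by_contra hpv
    obtain ⟨g, d, hd, hg, hgp⟩ := (isClosed_iff.1 (isClosed_singleton)).exists_of_notMem hpv
    have hgv : g ∈ pointIdeal v := mem_coneIdeal'.1 hg v hv rfl
    exact hgp (mem_coneIdeal_of_mem_chartIdeal hE hlE hd (h hgv) p hpE)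
  · have := (pointIdeal_isMaximal v).isPrime
    have := Ideal.isPrime_map_quotientMk_of_isPrime hIm
    exact this.ne_top h

end Tangent

section Normal

variable {X : Set (Pr k M)}

theorem exists_linForm_of_functional (ξ : (Fin (M + 1) → k) →ₗ[k] k) :
    ∃ l : Fin (M + 1) → k, ∀ v, ∑ i, l i * v i = ξ v := by
  refine ⟨fun i => ξ fun j => if i = j then 1 else 0, fun v => ?_⟩
  rw [LinearMap.pi_apply_eq_sum_univ ξ v]
  exact Finset.sum_congr rfl fun i _ => by simp [mul_comm]

theorem exists_eq_combination {V : Type} [AddCommGroup V] [Module k V] [FiniteDimensional k V]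
    (T : Submodule k V) (f : V →ₗ[k] k) {v : V} (hv : v ∈ T) (hfv : f v ≠ 0) (h3 : finrank k T = 3) :
    ∃ (w : Fin 2 → V) (ξ : Fin 2 → V →ₗ[k] k),
      ∀ u ∈ T, f u = 0 → u = ξ 0 u • w 0 + ξ 1 u • w 1 := by
  set K := T ⊓ LinearMap.ker f with hK
  have hK2 : finrank k K = 2 := by
    have h := Submodule.finrank_sup_add_finrank_inf_eq T (LinearMap.ker f)
    have hle : T ⊔ LinearMap.ker f = ⊤ := by
      refine eq_top_iff.2 fun u _ => ?_
      have : u = (f u / f v) • v + (u - (f u / f v) • v) := by abel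
      rw [this]
      refine Submodule.add_mem_sup (T.smul_mem _ hv) ?_
      simp [LinearMap.mem_ker, hfv]
    have hr := LinearMap.finrank_range_add_finrank_ker f
    rw [LinearMap.range_eq_top.2 (LinearMap.surjective fun h0 => hfv (by simp [h0])), finrank_top,
      finrank_self] at hr
    rw [hle, finrank_top, h3, ← hK] at h
    omega
  let b : Basis (Fin 2) k K := finBasisOfFinrankEq k K hK2
  obtain ⟨g, hg⟩ := LinearMap.exists_leftInverse_of_injective K.subtype K.ker_subtype
  refine ⟨fun i => b i, fun i => (b.coord i).comp g, fun u hu hfu => ?_⟩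
  have huK : u ∈ K := ⟨hu, hfu⟩
  have e1 : g u = ⟨u, huK⟩ := LinearMap.congr_fun hg ⟨u, huK⟩
  have e2 := b.sum_repr ⟨u, huK⟩
  rw [Fin.sum_univ_two] at e2
  have e3 := congrArg (Subtype.val) e2
  simp only [LinearMap.comp_apply, e1, Basis.coord_apply]
  exact e3.symm

theorem exists_pointIdeal_le [Infinite k] {l v : Fin (M + 1) → k} (hv : v ≠ 0)
    (hp : Projectivization.mk k v hv ∈ X) (hl : eval v (linForm l) = 1)
    (h3 : finrank k (embTangent X (Projectivization.mk k v hv)) = 3) :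
    ∃ x y : MvPolynomial (Fin (M + 1)) k, x ∈ pointIdeal v ∧ y ∈ pointIdeal v ∧
      pointIdeal v ≤ Ideal.span {x, y} ⊔ (pointIdeal v ^ 2 ⊔ chartIdeal X l) := by
  obtain ⟨w, ξ, hξ⟩ := exists_eq_combination _ (diffAt (linForm l) v) (self_mem_embTangent hv hp)
    (by rw [diffAt_linForm, ← eval_linForm, hl]; exact one_ne_zero) h3
  choose L hL using fun i => exists_linForm_of_functional (ξ i)
  let x : Fin 2 → MvPolynomial (Fin (M + 1)) k := fun i =>
    linForm (L i) - C (eval v (linForm (L i)))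
  have hx : ∀ i, x i ∈ pointIdeal v := fun i => by simp [x, mem_pointIdeal]
  have hdx : ∀ i u, diffHom v (x i) u = ξ i u := fun i u => by
    have h1 : diffHom v (C (eval v (linForm (L i)))) = 0 := by
      ext; simp [diffHom_apply, diffAt_apply]
    have h2 : diffHom v (linForm (L i)) u = ξ i u := by
      rw [diffHom_apply, diffAt_linForm, hL]
    simp only [x, map_sub, LinearMap.sub_apply, h1, h2, LinearMap.zero_apply, sub_zero]
  refine ⟨x 0, x 1, hx 0, hx 1, fun q hq => ?_⟩
  set q' := q - C (diffAt q v (w 0)) * x 0 - C (diffAt q v (w 1)) * x 1 with hq'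
  have hmem : q' ∈ pointIdeal v ^ 2 ⊔ chartIdeal X l := by
    refine mem_sq_sup_chartIdeal hv hp hl ?_ ?_
    · rw [← mem_pointIdeal]
      exact sub_mem (sub_mem hq (Ideal.mul_mem_left _ _ (hx 0))) (Ideal.mul_mem_left _ _ (hx 1))
    · intro u hu hlu
      have e := hξ u hu (by rw [diffAt_linForm]; exact hlu)
      rw [← diffHom_apply, hq', map_sub, map_sub, ← smul_eq_C_mul, ← smul_eq_C_mul, map_smul,
        map_smul, LinearMap.sub_apply, LinearMap.sub_apply, LinearMap.smul_apply,
        LinearMap.smul_apply, hdx, hdx, diffHom_apply]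
      have e' := congrArg (diffAt q v) e
      rw [map_add, map_smul, map_smul] at e'
      rw [e']
      simp only [smul_eq_mul]
      ring
  have : q = (C (diffAt q v (w 0)) * x 0 + C (diffAt q v (w 1)) * x 1) + q' := by
    rw [hq']; ring
  rw [this]
  refine Submodule.add_mem_sup (add_mem ?_ ?_) hmem
  · exact Ideal.mul_mem_left _ _ (Ideal.subset_span (by simp))
  · exact Ideal.mul_mem_left _ _ (Ideal.subset_span (by simp))

theorem isIntegrallyClosed_localization {A : Type} [CommRing A] [IsDomain A] [IsNoetherianRing A]
    (m : Ideal A) [hm : m.IsPrime] (x y : A) (hx : x ∈ m) (hy : y ∈ m)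
    (hxy : m ≤ Ideal.span {x, y} ⊔ m ^ 2) (P : Ideal A) [hP : P.IsPrime] (h0 : ⊥ < P) (h1 : P < m) :
    IsIntegrallyClosed (Localization.AtPrime m) := by
  have : IsDomain (Localization.AtPrime m) :=
    IsLocalization.isDomain_localization m.primeCompl_le_nonZeroDivisors
  have : IsNoetherianRing (Localization.AtPrime m) :=
    IsLocalization.isNoetherianRing m.primeCompl _ inferInstance
  have hmax : m.map (algebraMap A (Localization.AtPrime m)) =
      IsLocalRing.maximalIdeal (Localization.AtPrime m) := Localization.AtPrime.map_eq_maximalIdeal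
  have hle : IsLocalRing.maximalIdeal (Localization.AtPrime m) ≤
      Ideal.span {algebraMap A _ x, algebraMap A _ y} := by
    refine Submodule.le_of_le_smul_of_le_jacobson_bot
      (I := IsLocalRing.maximalIdeal (Localization.AtPrime m)) (IsNoetherian.noetherian _) ?_ ?_
    · rw [IsLocalRing.jacobson_eq_maximalIdeal _ bot_ne_top]
    · have := Ideal.map_mono (f := algebraMap A (Localization.AtPrime m)) hxy
      rwa [Ideal.map_sup, Ideal.map_span, Ideal.map_pow, hmax, image_pair, pow_two] at this
  have heq : IsLocalRing.maximalIdeal (Localization.AtPrime m) =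
      Ideal.span {algebraMap A _ x, algebraMap A _ y} := by
    refine le_antisymm hle ?_
    rw [Ideal.span_le, ← hmax]
    rintro _ (rfl | rfl)
    · exact Ideal.mem_map_of_mem _ hx
    · exact Ideal.mem_map_of_mem _ hy
  have hdisj : Disjoint (m.primeCompl : Set A) P :=
    Set.disjoint_left.2 fun a ha haP => ha (h1.le haP)
  have hc := IsLocalization.under_map_of_isPrime_disjoint m.primeCompl (Localization.AtPrime m) hP hdisj
  have := IsLocalization.isPrime_of_isPrime_disjoint m.primeCompl (Localization.AtPrime m) P hP hdisj
  refine isIntegrallyClosed_of_maximalIdeal_eq_span_pair _ _ heq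
    (P.map (algebraMap A (Localization.AtPrime m))) ?_ ?_
  · intro h
    rw [h] at hc
    refine h0.ne ?_
    rw [← hc, Ideal.under, Ideal.comap_bot_of_injective]
    exact IsLocalization.injective _ m.primeCompl_le_nonZeroDivisors
  · intro h
    rw [h, ← hmax, IsLocalization.under_map_of_isPrime_disjoint m.primeCompl (Localization.AtPrime m) hm
      (Set.disjoint_left.2 fun a ha haP => ha haP)] at hc
    exact h1.ne hc.symm

end Normal

section Extend

theorem exists_isFractionRing (S : Type) [CommRing S] [IsDomain S] :
    ∃ (K : Type) (_ : Field K) (_ : Algebra S K), IsFractionRing S K :=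
  ⟨FractionRing S, inferInstance, inferInstance, inferInstance⟩

theorem exists_regular_proportional {k A ι : Type} [Field k] [IsAlgClosed k] [CommRing A] [IsDomain A]
    [IsNoetherianRing A] [Algebra k A] [Fintype ι] (ev : A →ₐ[k] k)
    (m : Ideal A) (hm : RingHom.ker ev = m) [hmp : m.IsPrime]
    [IsIntegrallyClosed (Localization.AtPrime m)] (r : ι → A) (hr : r ≠ 0) (l : ι → k)
    (h : ∀ q : ι → k, (∀ (d : ℕ) (f : MvPolynomial ι A), f.IsHomogeneous d → eval r f = 0 →
      eval q (MvPolynomial.map (ev : A →+* k) f) = 0) → ∑ i, l i * q i = 0 → q = 0) :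
    ∃ a : ι → A, (∃ i, ev (a i) ≠ 0) ∧ ∀ i j, a i * r j = a j * r i := by
  classical
  have hdom : IsDomain (Localization.AtPrime m) :=
    IsLocalization.isDomain_localization m.primeCompl_le_nonZeroDivisors
  have : IsNoetherianRing (Localization.AtPrime m) :=
    IsLocalization.isNoetherianRing m.primeCompl _ inferInstance
  have hev : ∀ a, ev a ≠ 0 ↔ a ∈ m.primeCompl := fun a => by
    rw [Ideal.mem_primeCompl_iff, ← hm]; rfl
  let res : Localization.AtPrime m →ₐ[k] k :=
    IsLocalization.liftAlgHom (M := m.primeCompl) (f := ev)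
      fun y => isUnit_iff_ne_zero.2 ((hev y).2 y.2)
  have hresA : ∀ a, res (algebraMap A _ a) = ev a := fun a => by
    simp [res, IsLocalization.liftAlgHom_apply]
  have hresk : RingHom.ker res = IsLocalRing.maximalIdeal (Localization.AtPrime m) := by
    refine IsLocalRing.eq_maximalIdeal ?_
    exact RingHom.ker_isMaximal_of_surjective _ fun c => ⟨algebraMap k _ c, by simp⟩
  obtain ⟨K, _, _, _⟩ : ∃ (K : Type) (_ : Field K) (_ : Algebra (Localization.AtPrime m) K),
      IsFractionRing (Localization.AtPrime m) K :=
    exists_isFractionRing _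
  have hinj1 : Function.Injective (algebraMap A (Localization.AtPrime m)) :=
    IsLocalization.injective _ m.primeCompl_le_nonZeroDivisors
  have hinj2 : Function.Injective (algebraMap (Localization.AtPrime m) K) :=
    IsFractionRing.injective _ _
  let θ : A →+* K := (algebraMap (Localization.AtPrime m) K).comp (algebraMap A _)
  have hθ : Function.Injective θ := hinj2.comp hinj1
  have hq0 : ∀ q : ι → k, (∀ (d : ℕ) (f : MvPolynomial ι (Localization.AtPrime m)),
      f.IsHomogeneous d → aeval (fun i => θ (r i)) f = 0 →
      eval q (MvPolynomial.map (res : Localization.AtPrime m →+* k) f) = 0) →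
      ∑ᶠ i, l i * q i = 0 → q = 0 := by
    intro q hq hlq
    rw [finsum_eq_sum_of_fintype] at hlq
    refine h q (fun d f hf hfr => ?_) hlq
    have := hq d (MvPolynomial.map (algebraMap A _) f) (hf.map _) ?_
    · rw [MvPolynomial.map_map] at this
      convert this using 4
      ext a
      exact (hresA a).symm
    · rw [aeval_def, eval₂_map]
      have : eval₂ θ (θ ∘ r) f = θ (eval r f) := by
        rw [← eval₂_id, eval₂_comp_left]; simp
      exact this.trans (by rw [hfr, map_zero])
  obtain ⟨hL, hreg⟩ := isRegular_of_fibre_avoids (K := K) res hresk (fun i => θ (r i))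
    (fun h0 => hr (funext fun i => hθ (by simpa using congrFun h0 i))) l hq0
  rw [finsum_eq_sum_of_fintype] at hL hreg
  have hsum : ∑ i, algebraMap (Localization.AtPrime m) K
      (algebraMap k (Localization.AtPrime m) (l i)) * θ (r i) =
      θ (∑ i, algebraMap k A (l i) * r i) := by
    rw [map_sum]
    refine Finset.sum_congr rfl fun i _ => ?_
    rw [map_mul, IsScalarTower.algebraMap_apply k A (Localization.AtPrime m)]
    rfl
  rw [hsum] at hL hreg
  set L := ∑ i, algebraMap k A (l i) * r i with hLdef
  have hL0 : L ≠ 0 := fun h0 => hL (by rw [h0, map_zero])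
  choose s hs using hreg
  obtain ⟨b, hb⟩ := IsLocalization.exist_integer_multiples_of_finite m.primeCompl s
  choose a ha using hb
  have key : ∀ i, (b : A) * r i = a i * L := fun i => hθ (by
    have h1 : θ (r i) = algebraMap _ K (s i) * θ L := by
      rw [hs i, div_mul_cancel₀ _ hL]
    rw [map_mul, map_mul, h1, ← mul_assoc]
    congr 1
    have h2 := congrArg (algebraMap (Localization.AtPrime m) K) (ha i)
    rw [Algebra.smul_def, map_mul] at h2
    exact h2.symm)
  refine ⟨a, ?_, fun i j => ?_⟩
  · by_contra! hcon
    have h1 : (b : A) * L = (∑ i, algebraMap k A (l i) * a i) * L := by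
      rw [Finset.sum_mul, hLdef, Finset.mul_sum]
      refine Finset.sum_congr rfl fun i _ => ?_
      rw [mul_left_comm, key i, mul_assoc]
    have h2 := congrArg ev (mul_right_cancel₀ hL0 h1)
    refine (hev b).2 b.2 ?_
    rw [h2, map_sum]
    exact Finset.sum_eq_zero fun i _ => by rw [map_mul, hcon i, mul_zero]
  · apply mul_right_cancel₀ hL0
    linear_combination r i * key j - r j * key i

end Extend

section Extend

variable {X : Set (Pr k M)}

/-- `f` is a polynomial relation satisfied by `(v, c • r v)` for `v` in the cone over `X` with
`b v ≠ 0`. -/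
def IsRelation (X : Set (Pr k M)) (b : MvPolynomial (Fin (M + 1)) k)
    (r : Fin (N + 1) → MvPolynomial (Fin (M + 1)) k)
    (f : MvPolynomial (Fin (N + 1)) (MvPolynomial (Fin (M + 1)) k)) : Prop :=
  ∀ (v : Fin (M + 1) → k) (hv : v ≠ 0), Projectivization.mk k v hv ∈ X → eval v b ≠ 0 →
    ∀ c : k, c ≠ 0 → eval (c • tup r v) (MvPolynomial.map (eval v) f) = 0

theorem homogeneousComponent_map {R S σ : Type} [CommRing R] [CommRing S] (g : R →+* S)
    (f : MvPolynomial σ R) (d : ℕ) :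
    homogeneousComponent d (MvPolynomial.map g f) =
      MvPolynomial.map g (homogeneousComponent d f) := by
  ext m
  simp only [coeff_homogeneousComponent, coeff_map]
  split_ifs <;> simp

theorem eval_eval_eq {σ τ : Type} (v : σ → k) (r : τ → MvPolynomial σ k)
    (f : MvPolynomial τ (MvPolynomial σ k)) :
    eval v (eval r f) = eval (tup r v) (MvPolynomial.map (eval v) f) := by
  have := eval₂_comp_left (eval v) (RingHom.id _) r f
  rw [eval₂_id] at this
  rw [eval_map, this]
  rfl

theorem IsRelation.eval_homogeneousComponent_mem [Infinite k] (hX : IsVariety X)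
    {b : MvPolynomial (Fin (M + 1)) k} (hb : b ∉ coneIdeal X)
    {r : Fin (N + 1) → MvPolynomial (Fin (M + 1)) k}
    {f : MvPolynomial (Fin (N + 1)) (MvPolynomial (Fin (M + 1)) k)} (hf : IsRelation X b r f)
    (d : ℕ) : eval r (homogeneousComponent d f) ∈ coneIdeal X := by
  refine (hX.isPrime.mem_or_mem (y := b) ?_).resolve_right hb
  rw [mem_coneIdeal']
  intro v hv hvX
  rw [map_mul]
  by_cases h : eval v b = 0
  · rw [h, mul_zero]
  · have h1 := radial_eq_zero_iff.2 (hf v hv hvX h)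
    have h2 := coeff_radial (tup r v) (MvPolynomial.map (eval v) f) d
    rw [h1, Polynomial.coeff_zero, homogeneousComponent_map, ← eval_eval_eq] at h2
    rw [← h2, zero_mul]

theorem exists_extension_at [IsAlgClosed k] (hX : IsSmoothSurface X)
    {b : MvPolynomial (Fin (M + 1)) k} (hb : b ∉ coneIdeal X)
    {r : Fin (N + 1) → MvPolynomial (Fin (M + 1)) k} {e : ℕ} (hr : ∀ i, (r i).IsHomogeneous e)
    (hr0 : ∃ i, r i ∉ coneIdeal X) {v₀ : Fin (M + 1) → k} (hv₀ : v₀ ≠ 0)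
    (hp : Projectivization.mk k v₀ hv₀ ∈ X) (Q : Set (Pr k N)) (hQ : Q.Finite)
    (h : ∀ (q : Fin (N + 1) → k) (hq : q ≠ 0), (∀ f, IsRelation X b r f →
      eval q (MvPolynomial.map (eval v₀) f) = 0) → Projectivization.mk k q hq ∈ Q) :
    ∃ (g : Fin (N + 1) → MvPolynomial (Fin (M + 1)) k) (d : ℕ), (∀ i, (g i).IsHomogeneous d) ∧
      tup g v₀ ≠ 0 ∧ ∀ i j, g i * r j - g j * r i ∈ coneIdeal X := by
  classical
  have hinf : Infinite k := IsAlgClosed.instInfinite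
  obtain ⟨l, hl, P, hP, hP0, hPm⟩ := exists_chart hX.2.1 hX.1 hv₀ hp
  obtain ⟨l', hl'⟩ := exists_linForm_ne_zero (k := k) (Projectivization.rep '' Q) (hQ.image _)
    (by rintro ⟨q, -, hq⟩; exact q.rep_nonzero hq)
  have hlX : linForm l ∉ coneIdeal X := fun h0 => by
    have := mem_coneIdeal'.1 h0 v₀ hv₀ hp
    rw [hl] at this; exact one_ne_zero this
  have hprime := chartIdeal_isPrime hX.1 hlX
  set m := (pointIdeal v₀).map (Ideal.Quotient.mk (chartIdeal X l)) with hm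
  have hpm := (pointIdeal_isMaximal v₀).isPrime
  have hmp : m.IsPrime :=
    Ideal.isPrime_map_quotientMk_of_isPrime (chartIdeal_le_pointIdeal hv₀ hp hl)
  have hIC : IsIntegrallyClosed (Localization.AtPrime m) := by
    obtain ⟨x, y, hx, hy, hxy⟩ := exists_pointIdeal_le hv₀ hp hl (hX.2.2 _ hp)
    refine isIntegrallyClosed_localization m (Ideal.Quotient.mk _ x) (Ideal.Quotient.mk _ y)
      (Ideal.mem_map_of_mem _ hx) (Ideal.mem_map_of_mem _ hy) ?_ P hP0 hPm
    have := Ideal.map_mono (f := Ideal.Quotient.mk (chartIdeal X l)) hxy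
    rwa [Ideal.map_sup, Ideal.map_sup, Ideal.map_quotient_self, sup_bot_eq, Ideal.map_span,
      Ideal.map_pow, image_pair] at this
  let ev : (MvPolynomial (Fin (M + 1)) k ⧸ chartIdeal X l) →ₐ[k] k :=
    Ideal.Quotient.liftₐ _ (aeval v₀) fun f hf => hf v₀ hv₀ hp hl
  have hev : ∀ f, ev (Ideal.Quotient.mk _ f) = eval v₀ f := fun f => rfl
  have hker : RingHom.ker ev = m := by
    ext a
    obtain ⟨f, rfl⟩ := Ideal.Quotient.mk_surjective a
    rw [RingHom.mem_ker, hev, hm, Ideal.mem_map_iff_of_surjective _ Ideal.Quotient.mk_surjective]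
    constructor
    · intro hf; exact ⟨f, hf, rfl⟩
    · rintro ⟨g, hg, hgf⟩
      rw [Ideal.Quotient.eq] at hgf
      have := chartIdeal_le_pointIdeal hv₀ hp hl hgf
      rw [mem_pointIdeal, map_sub, mem_pointIdeal.1 hg, zero_sub, neg_eq_zero] at this
      exact this
  obtain ⟨a, ⟨i₀, hi₀⟩, ha⟩ := exists_regular_proportional ev m hker
    (fun i => Ideal.Quotient.mk _ (r i)) (fun h0 => by
      obtain ⟨i, hi⟩ := hr0
      refine hi (mem_coneIdeal_of_mem_chartIdeal hX.1 hlX (hr i) ?_)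
      exact Ideal.Quotient.eq_zero_iff_mem.1 (congrFun h0 i)) l' (fun q hq hlq => by
      by_contra hq0
      have hqQ := h q hq0 fun f hf => ?_
      · refine hl' _ ⟨_, hqQ, rfl⟩ ?_
        obtain ⟨c, hc⟩ := Projectivization.exists_smul_eq_mk_rep k q hq0
        rw [← hc, Units.smul_def, eval_smul_of_isHomogeneous (isHomogeneous_linForm l'),
          eval_linForm, hlq, mul_zero]
      · rw [← sum_homogeneousComponent f, map_sum, map_sum]
        refine Finset.sum_eq_zero fun d _ => ?_
        have h1 := hf.eval_homogeneousComponent_mem hX.1 hb d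
        have h2 := hq d (MvPolynomial.map (Ideal.Quotient.mk _) (homogeneousComponent d f))
          ((homogeneousComponent_isHomogeneous d f).map _) (by
            have := Ideal.Quotient.eq_zero_iff_mem.2 (coneIdeal_le_chartIdeal (l := l) h1)
            rw [eval_map]
            rw [← this, ← eval₂_id, eval₂_comp_left]
            rfl)
        rw [MvPolynomial.map_map] at h2
        exact h2)
  choose A hA using fun i => Ideal.Quotient.mk_surjective (a i)
  obtain ⟨d, hd⟩ : ∃ d, ∀ i, (A i).totalDegree ≤ d :=
    ⟨Finset.univ.sup fun i => (A i).totalDegree, fun i =>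
      Finset.le_sup (f := fun i => (A i).totalDegree) (Finset.mem_univ i)⟩
  have hg := fun i => isHomogeneous_homogenizeBy (isHomogeneous_linForm l) d (A i)
  refine ⟨fun i => homogenizeBy (linForm l) d (A i), d, hg, fun h0 => hi₀ ?_, fun i j => ?_⟩
  · have := congrFun h0 i₀
    rw [tup_apply, eval_homogenizeBy_linForm (hd i₀) hl] at this
    rw [← hA, hev]
    exact this
  · refine mem_coneIdeal_of_mem_chartIdeal hX.1 hlX (((hg i).mul (hr j)).sub ((hg j).mul (hr i))) ?_
    intro v hv hvX hlv
    have := ha i j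
    rw [← hA, ← hA, ← map_mul, ← map_mul, Ideal.Quotient.eq] at this
    have := this v hv hvX hlv
    rwa [map_sub, map_mul, map_mul, eval_homogenizeBy_linForm (hd i) hlv,
      eval_homogenizeBy_linForm (hd j) hlv, ← map_mul, ← map_mul, ← map_sub]

/-- A rational map from a smooth surface whose graph has finite fibres is a morphism. -/
theorem exists_morphism_of_finite_fibres [IsAlgClosed k] (hX : IsSmoothSurface X)
    {b : MvPolynomial (Fin (M + 1)) k} (hb : b ∉ coneIdeal X)
    {r : Fin (N + 1) → MvPolynomial (Fin (M + 1)) k} {e : ℕ} (hr : ∀ i, (r i).IsHomogeneous e)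
    (hr0 : ∃ i, r i ∉ coneIdeal X)
    (h : ∀ (v : Fin (M + 1) → k) (hv : v ≠ 0), Projectivization.mk k v hv ∈ X →
      ∃ Q : Set (Pr k N), Q.Finite ∧ ∀ (q : Fin (N + 1) → k) (hq : q ≠ 0),
        (∀ f, IsRelation X b r f → eval q (MvPolynomial.map (eval v) f) = 0) →
          Projectivization.mk k q hq ∈ Q) :
    ∃ ρ : Pr k M → Pr k N, IsMorphismOn X ρ ∧ Rep X ρ r ∧
      ∀ f, IsRelation X b r f → ∀ (v : Fin (M + 1) → k) (hv : v ≠ 0)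
        (w : Fin (N + 1) → k) (hw : w ≠ 0), Projectivization.mk k v hv ∈ X →
          ρ (Projectivization.mk k v hv) = Projectivization.mk k w hw →
            eval w (MvPolynomial.map (eval v) f) = 0 := by
  have hinf : Infinite k := IsAlgClosed.instInfinite
  have hprime := hX.1.isPrime
  obtain ⟨i₀, hi₀⟩ := hr0
  let S : Set (Fin (N + 1) → MvPolynomial (Fin (M + 1)) k) :=
    {g | (∃ d, ∀ i, (g i).IsHomogeneous d) ∧ ∀ i j, g i * r j - g j * r i ∈ coneIdeal X}
  obtain ⟨ρ, hρ, hρS⟩ := exists_morphism_of_tuples X S (fun F hF => hF.1) (by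
      intro F hF G hG v hv hvX i j
      have key : F i * G j - G i * F j ∈ coneIdeal X := by
        refine (hprime.mem_or_mem (y := r i₀) ?_).resolve_right hi₀
        have e1 : (F i * G j - G i * F j) * r i₀ =
            G j * (F i * r i₀ - F i₀ * r i) - G i * (F j * r i₀ - F i₀ * r j)
              + F i₀ * (G j * r i - G i * r j) := by ring
        rw [e1]
        exact add_mem (sub_mem (Ideal.mul_mem_left _ _ (hF.2 _ _)) (Ideal.mul_mem_left _ _ (hF.2 _ _)))
          (Ideal.mul_mem_left _ _ (hG.2 _ _))
      have := mem_coneIdeal'.1 key v hv hvX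
      rw [map_sub, map_mul, map_mul, sub_eq_zero] at this
      exact this) (by
      intro v hv hvX
      obtain ⟨Q, hQ, hQ'⟩ := h v hv hvX
      obtain ⟨g, d, hd, hg0, hg⟩ := exists_extension_at hX hb hr ⟨i₀, hi₀⟩ hv hvX Q hQ hQ'
      exact ⟨g, ⟨⟨d, hd⟩, hg⟩, hg0⟩)
  refine ⟨ρ, hρ, hρS r ⟨⟨e, hr⟩, fun i j => ?_⟩, ?_⟩
  · rw [mul_comm, sub_self]; exact zero_mem _
  intro f hf v hv w hw hvX hvw
  obtain ⟨Q, hQ, hQ'⟩ := h v hv hvX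
  obtain ⟨g, d, hd, hg0, hg⟩ := exists_extension_at hX hb hr ⟨i₀, hi₀⟩ hv hvX Q hQ hQ'
  rw [(hρS g ⟨⟨d, hd⟩, hg⟩).2 v hv hvX hg0, eq_comm, Projectivization.mk_eq_mk_iff'] at hvw
  obtain ⟨c, rfl⟩ := hvw
  rw [← sum_homogeneousComponent f, map_sum, map_sum]
  refine Finset.sum_eq_zero fun n _ => ?_
  have h1 := hf.eval_homogeneousComponent_mem hX.1 hb n
  have hhom := (homogeneousComponent_isHomogeneous n f)
  rw [eval_smul_of_isHomogeneous (hhom.map _), ← eval_eval_eq]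
  refine mul_eq_zero_of_right _ ?_
  suffices hmem : eval g (homogeneousComponent n f) ∈ coneIdeal X from mem_coneIdeal'.1 hmem v hv hvX
  refine (hprime.mem_or_mem (x := r i₀ ^ n) ?_).resolve_left fun h0 => hi₀ (hprime.mem_of_pow_mem _ h0)
  rw [← eval_smul_of_isHomogeneous hhom]
  have h2 : g i₀ ^ n * eval r (homogeneousComponent n f) ∈ coneIdeal X := Ideal.mul_mem_left _ _ h1
  rw [← eval_smul_of_isHomogeneous hhom] at h2
  have h3 : ∀ x y : Fin (N + 1) → MvPolynomial (Fin (M + 1)) k,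
      (∀ i, x i - y i ∈ coneIdeal X) → eval x (homogeneousComponent n f) ∈ coneIdeal X →
        eval y (homogeneousComponent n f) ∈ coneIdeal X := by
    intro x y hxy hx
    rw [← Ideal.Quotient.eq_zero_iff_mem] at hx ⊢
    rw [← hx, ← eval₂_id, ← eval₂_id, eval₂_comp_left, eval₂_comp_left]
    congr 1
    funext i
    exact (Ideal.Quotient.eq.2 (hxy i)).symm
  refine h3 _ _ (fun i => ?_) h2
  simp only [Pi.smul_apply, smul_eq_mul]
  have := hg i₀ i
  rwa [mul_comm (g i)  (r i₀)] at this

end Extend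

section Elimination

variable [IsAlgClosed k] {X : Set (Pr k M)}

/-- The main theorem of elimination theory. -/
theorem exists_eliminant {τ : Type} {n : ℕ} (S : Set (MvPolynomial (Fin n) (MvPolynomial τ k)))
    (hS : ∀ (y : τ → k) (x : Fin n → k) (c : k), c ≠ 0 →
      (∀ f ∈ S, eval x (MvPolynomial.map (eval y) f) = 0) →
        ∀ f ∈ S, eval (c • x) (MvPolynomial.map (eval y) f) = 0)
    (y₀ : τ → k) (h : ∀ x, (∀ f ∈ S, eval x (MvPolynomial.map (eval y₀) f) = 0) → x = 0) :
    ∃ D : MvPolynomial τ k, eval y₀ D ≠ 0 ∧ ∀ (y : τ → k) (x : Fin n → k), x ≠ 0 →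
      (∀ f ∈ S, eval x (MvPolynomial.map (eval y) f) = 0) → eval y D = 0 := by
  classical
  have hinf : Infinite k := IsAlgClosed.instInfinite
  let J : Ideal (MvPolynomial (Fin n) (MvPolynomial τ k)) := Ideal.span S
  have hsurj : Function.Surjective (MvPolynomial.map (σ := Fin n) (eval y₀)) :=
    MvPolynomial.map_surjective _ fun c => ⟨C c, by simp⟩
  obtain ⟨D, hD⟩ := exists_forall_isHomogeneous_mem (J.map (MvPolynomial.map (eval y₀)))
    (fun q hq => h q fun f hf => hq _ (Ideal.mem_map_of_mem _ (Ideal.subset_span hf)))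
  have hJ : ∀ y x, (∀ f ∈ S, eval x (MvPolynomial.map (eval y) f) = 0) →
      ∀ f ∈ J, eval x (MvPolynomial.map (eval y) f) = 0 := by
    intro y x hx f hf
    have : J ≤ RingHom.ker ((eval x).comp (MvPolynomial.map (eval y))) :=
      Ideal.span_le.2 fun f hf => hx f hf
    exact this hf
  let ι := {m : Fin n →₀ ℕ // m.degree = D}
  have hfin : Finite ι := (Finsupp.finite_of_degree_le D).subset (fun m hm => le_of_eq hm)
  have := Fintype.ofFinite ι
  have hmono : ∀ m : ι, ∃ f ∈ J, MvPolynomial.map (eval y₀) f = monomial m.1 1 := fun m =>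
    (Ideal.mem_map_iff_of_surjective _ hsurj).1 (hD D le_rfl _ (isHomogeneous_monomial _ m.2))
  choose f hfJ hf using hmono
  let A : Matrix ι ι (MvPolynomial τ k) := fun m m' => coeff m'.1 (f m)
  have hA : ∀ y, A.map (eval y) = fun m m' => coeff m'.1 (MvPolynomial.map (eval y) (f m)) := by
    intro y; ext m m'
    rw [coeff_map]; rfl
  refine ⟨A.det, ?_, fun y x hx hxy => ?_⟩
  · have : A.map (eval y₀) = 1 := by
      rw [hA]; ext m m'
      simp only [hf, coeff_monomial, Matrix.one_apply]
      exact if_congr Subtype.ext_iff.symm rfl rfl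
    rw [RingHom.map_det, RingHom.mapMatrix_apply, this, Matrix.det_one]
    exact one_ne_zero
  · rw [RingHom.map_det, RingHom.mapMatrix_apply]
    rw [← Matrix.exists_mulVec_eq_zero_iff]
    refine ⟨fun m => m.1.prod fun i e => x i ^ e, ?_, ?_⟩
    · obtain ⟨i, hi⟩ := Function.ne_iff.1 hx
      intro h0
      have := congrFun h0 ⟨Finsupp.single i D, by simp [Finsupp.degree_single]⟩
      simp at this
      exact hi this.1
    · funext m
      rw [hA]
      have h1 : radial x (MvPolynomial.map (eval y) (f m)) = 0 := radial_eq_zero_iff.2 fun c hc =>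
        hJ y (c • x) (hS y x c hc hxy) _ (hfJ m)
      have h2 := coeff_radial x (MvPolynomial.map (eval y) (f m)) D
      rw [h1, Polynomial.coeff_zero] at h2
      rw [homogeneousComponent_apply, map_sum] at h2
      refine Eq.trans ?_ h2.symm
      simp only [eval_monomial]
      refine (Finset.sum_map Finset.univ (Function.Embedding.subtype _)
        (fun m' => coeff m' (MvPolynomial.map (eval y) (f m)) * m'.prod fun i e => x i ^ e)).symm.trans ?_
      refine (Finset.sum_subset (fun m' hm' => ?_) fun m' hm' hm => ?_).symm
      · rw [Finset.mem_filter] at hm'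
        exact Finset.mem_map.2 ⟨⟨m', hm'.2⟩, Finset.mem_univ _, rfl⟩
      · obtain ⟨⟨m'', h3⟩, -, rfl⟩ := Finset.mem_map.1 hm'
        rw [Finset.mem_filter] at hm
        have : coeff m'' (MvPolynomial.map (eval y) (f m)) = 0 := by
          by_contra h4
          exact hm ⟨mem_support_iff.2 h4, h3⟩
        simp [this]

theorem IsMorphismOn.isClosed_image {φ : Pr k M → Pr k N} (hφ : IsMorphismOn X φ)
    (hX : IsClosed X) : IsClosed (φ '' X) := by
  have hinf : Infinite k := IsAlgClosed.instInfinite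
  have hXa := isClosed_iff.1 hX
  let S : Set (MvPolynomial (Fin (M + 1)) (MvPolynomial (Fin (N + 1)) k)) :=
    (MvPolynomial.map C) '' (coneIdeal X : Set (MvPolynomial (Fin (M + 1)) k)) ∪
    {f | ∃ F, Rep X φ F ∧ ∃ i j, f = C (MvPolynomial.X i) * MvPolynomial.map C (F j) -
      C (MvPolynomial.X j) * MvPolynomial.map C (F i)}
  have hev : ∀ (x : Fin (M + 1) → k) (y : Fin (N + 1) → k) (f : MvPolynomial (Fin (M + 1)) k),
      eval x (MvPolynomial.map (eval y) (MvPolynomial.map C f)) = eval x f := by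
    intro x y f
    rw [MvPolynomial.map_map]
    have : (eval y).comp C = RingHom.id k := by ext; simp
    rw [this, MvPolynomial.map_id]
  have hS : ∀ x y, (∀ f ∈ S, eval x (MvPolynomial.map (eval y) f) = 0) ↔
      (∀ f ∈ coneIdeal X, eval x f = 0) ∧ ∀ F, Rep X φ F → ∀ i j,
        y i * tup F x j = y j * tup F x i := by
    intro x y
    constructor
    · intro h
      refine ⟨fun f hf => ?_, fun F hF i j => ?_⟩
      · rw [← hev x y f]; exact h _ (Or.inl ⟨f, hf, rfl⟩)
      · have := h _ (Or.inr ⟨F, hF, i, j, rfl⟩)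
        simp only [map_sub, map_mul, map_C, eval_C, eval_X, hev] at this
        exact sub_eq_zero.1 this
    · rintro ⟨h1, h2⟩ f (⟨g, hg, rfl⟩ | ⟨F, hF, i, j, rfl⟩)
      · rw [hev]; exact h1 g hg
      · simp only [map_sub, map_mul, map_C, eval_C, eval_X, hev]
        exact sub_eq_zero.2 (h2 F hF i j)
  have hXmem : ∀ x (hx : x ≠ 0), (∀ f ∈ coneIdeal X, eval x f = 0) ↔
      Projectivization.mk k x hx ∈ X := by
    intro x hx
    constructor
    · intro h
      by_contra hxX
      obtain ⟨f, d, hd, hf, hfx⟩ := hXa.exists_of_notMem hxX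
      exact hfx ((vanishes_mk_of_isHomogeneous hd hx).2 (h f hf))
    · intro h f hf; exact mem_coneIdeal'.1 hf x hx h
  have hgraph : ∀ x (hx : x ≠ 0) y (hy : y ≠ 0), (∀ f ∈ S, eval x (MvPolynomial.map (eval y) f) = 0) ↔
      Projectivization.mk k x hx ∈ X ∧
        φ (Projectivization.mk k x hx) = Projectivization.mk k y hy := by
    intro x hx y hy
    rw [hS, hXmem x hx]
    refine and_congr_right fun hxX => ?_
    constructor
    · intro h
      obtain ⟨F, hF, hF0⟩ := isMorphismOn_iff.1 hφ x hx hxX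
      rw [hF.2 x hx hxX hF0]
      refine eq_mk_of_proportional _ _ fun i j => ?_
      rw [mul_comm, h F hF j i, mul_comm]
    · intro h F hF i j
      by_cases hF0 : tup F x = 0
      · simp [hF0]
      · rw [hF.2 x hx hxX hF0] at h
        have := proportional_of_mk_eq h i j
        rw [← this]; exact mul_comm _ _
  have : φ '' X = {p | ∀ f ∈ coneIdeal (φ '' X), Vanishes f p} := by
    refine Set.Subset.antisymm (fun p hp f hf => hf p hp) fun p hp => ?_
    by_contra hpX
    induction p using Projectivization.ind with | h y₀ hy₀ => ?_
    have hS1 : ∀ (y : Fin (N + 1) → k) (x : Fin (M + 1) → k) (c : k), c ≠ 0 →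
        (∀ f ∈ S, eval x (MvPolynomial.map (eval y) f) = 0) →
          ∀ f ∈ S, eval (c • x) (MvPolynomial.map (eval y) f) = 0 := by
      intro y x c hc h
      rw [hS] at h ⊢
      by_cases hx : x = 0
      · subst hx; rw [smul_zero]; exact h
      refine ⟨?_, fun F hF i j => ?_⟩
      · rw [hXmem _ (smul_ne_zero hc hx), mk_smul_eq hx hc, ← hXmem]
        exact h.1
      · obtain ⟨d, hd⟩ := hF.1
        rw [tup_smul hd]
        simp only [Pi.smul_apply, smul_eq_mul]
        linear_combination c ^ d * h.2 F hF i j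
    have hS2 : ∀ x, (∀ f ∈ S, eval x (MvPolynomial.map (eval y₀) f) = 0) → x = 0 := by
      intro x hx
      by_contra hx0
      obtain ⟨h1, h2⟩ := (hgraph x hx0 y₀ hy₀).1 hx
      exact hpX ⟨_, h1, h2⟩
    obtain ⟨D, hD0, hD⟩ := exists_eliminant S hS1 y₀ hS2
    refine hD0 (hp D ?_ y₀ hy₀ rfl)
    rw [mem_coneIdeal']
    rintro y hy ⟨p, hpX, hpy⟩
    induction p using Projectivization.ind with | h x hx => ?_
    exact hD y x hx ((hgraph x hx y hy).2 ⟨hpX, hpy⟩)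
  rw [this, isClosed_iff]
  exact isAlgSet_setOf_vanishes _

end Elimination

/-- The affine cone over `Y`, including the origin. -/
def InCone (Y : Set (Pr k N)) (y : Fin (N + 1) → k) : Prop :=
  ∀ hy : y ≠ 0, Projectivization.mk k y hy ∈ Y

theorem eval_zero_of_mem_coneIdeal [Infinite k] {Y : Set (Pr k N)} (hne : Y.Nonempty)
    {f : MvPolynomial (Fin (N + 1)) k} (hf : f ∈ coneIdeal Y) : eval 0 f = 0 := by
  obtain ⟨p, hp⟩ := hne
  induction p using Projectivization.ind with
  | h v hv =>
    have h1 := (vanishes_mk_iff_radial hv).1 (hf _ hp)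
    have h2 := eval_radial v f 0
    rw [h1] at h2
    simpa using h2.symm

theorem InCone.eval_eq_zero [Infinite k] {Y : Set (Pr k N)} (hne : Y.Nonempty)
    {y : Fin (N + 1) → k} (hy : InCone Y y)
    {f : MvPolynomial (Fin (N + 1)) k} (hf : f ∈ coneIdeal Y) : eval y f = 0 := by
  by_cases h : y = 0
  · rw [h]; exact eval_zero_of_mem_coneIdeal hne hf
  · exact mem_coneIdeal'.1 hf y h (hy h)

theorem inCone_of_forall {Y : Set (Pr k N)} (hY : IsClosed Y)
    {y : Fin (N + 1) → k} (h : ∀ f d, f.IsHomogeneous d → f ∈ coneIdeal Y → eval y f = 0) :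
    InCone Y y := by
  intro hy
  by_contra hp
  obtain ⟨f, d, hf, hfY, hv⟩ := (isClosed_iff.1 hY).exists_of_notMem hp
  exact hv ((vanishes_mk_of_isHomogeneous hf hy).2 (h f d hf hfY))

theorem inCone_iff [Infinite k] {Y : Set (Pr k N)} (hY : IsClosed Y) (hne : Y.Nonempty)
    {y : Fin (N + 1) → k} : InCone Y y ↔ ∀ f ∈ coneIdeal Y, eval y f = 0 :=
  ⟨fun h _ hf => h.eval_eq_zero hne hf, fun h => inCone_of_forall hY fun f _ _ hf => h f hf⟩

theorem InCone.smul {Y : Set (Pr k N)} {y : Fin (N + 1) → k} (hy : InCone Y y) (c : k) :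
    InCone Y (c • y) := by
  intro h
  have hc : c ≠ 0 := fun h0 => h (by rw [h0, zero_smul])
  have hy0 : y ≠ 0 := fun h0 => h (by rw [h0, smul_zero])
  have h1 := hy hy0
  rwa [← mk_smul_eq hy0 hc] at h1

theorem inCone_mk {Y : Set (Pr k N)} {y : Fin (N + 1) → k} {hy : y ≠ 0}
    (h : Projectivization.mk k y hy ∈ Y) : InCone Y y := fun _ => h

/-! ### Varieties and curves under morphisms -/

theorem IsVariety.image [IsAlgClosed k] {X : Set (Pr k M)} {φ : Pr k M → Pr k N}
    (hφ : IsMorphismOn X φ) (hX : IsVariety X) : IsVariety (φ '' X) :=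
  isVariety_iff.2 ⟨hφ.isClosed_image hX.isClosed, hX.isIrreducible.image _ hφ.continuousOn⟩

theorem IsMorphismOn.isClosed_preimage [Infinite k] {X : Set (Pr k M)} {φ : Pr k M → Pr k N}
    (hφ : IsMorphismOn X φ) (hX : IsClosed X) {Z : Set (Pr k N)} (hZ : IsClosed Z) :
    IsClosed (X ∩ φ ⁻¹' Z) :=
  hφ.continuousOn.preimage_isClosed_of_isClosed hX hZ

theorem IsCurve.image [IsAlgClosed k] {X : Set (Pr k M)} {φ : Pr k M → Pr k N}
    (hφ : IsMorphismOn X φ) (hX : IsCurve X) (hinf : (φ '' X).Infinite) : IsCurve (φ '' X) := by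
  refine ⟨hX.isVariety.image hφ, hinf, fun Z hZ hZX => ?_⟩
  have h1 : (X ∩ φ ⁻¹' Z) ⊂ X := by
    refine ⟨inter_subset_left, fun h => hZX.2 ?_⟩
    rintro _ ⟨x, hx, rfl⟩
    exact (h hx).2
  have h2 := hX.finite_of_ssubset _ (hφ.isClosed_preimage hX.isVariety.isClosed hZ) h1
  refine (h2.image φ).subset fun z hz => ?_
  obtain ⟨x, hx, rfl⟩ := hZX.1 hz
  exact ⟨x, ⟨hx, hz⟩, rfl⟩

theorem IsCurve.eq_of_subset {E E' : Set (Pr k N)} (hE' : IsCurve E') (hE : IsClosed E)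
    (hinf : E.Infinite) (h : E ⊆ E') : E = E' := by
  by_contra hne
  exact hinf (hE'.finite_of_ssubset _ hE ⟨h, fun h' => hne (h.antisymm h')⟩)

theorem IsCurve.finite_inter {E : Set (Pr k N)} (hE : IsCurve E) {Z : Set (Pr k N)}
    (hZ : IsClosed Z) (h : ¬ E ⊆ Z) : (E ∩ Z).Finite :=
  hE.finite_of_ssubset _ (hE.isVariety.isClosed.inter hZ)
    ⟨inter_subset_left, fun h' => h fun _ hx => (h' hx).2⟩

/-! ### The projective line -/

theorem finite_setOf_vanishes [Infinite k] {f : MvPolynomial (Fin 2) k} {d : ℕ}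
    (hf : f.IsHomogeneous d) (h0 : f ≠ 0) :
    {p : Pr k 1 | Vanishes f p}.Finite := by
  let q : Polynomial k := aeval ![1, Polynomial.X] f
  have hq : ∀ t, q.eval t = eval ![1, t] f := by
    intro t
    have : (Polynomial.evalRingHom t).comp (aeval (R := k) ![1, (Polynomial.X : Polynomial k)] : MvPolynomial (Fin 2) k →ₐ[k] Polynomial k).toRingHom
        = eval ![1, t] := by
      ext i
      · simp
      · fin_cases i <;> simp
    simpa using RingHom.congr_fun this f
  have hq0 : q ≠ 0 := by
    intro h
    apply h0
    have h1 : (MvPolynomial.X 0 : MvPolynomial (Fin 2) k) * f = 0 := by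
      refine MvPolynomial.funext fun v => ?_
      simp only [map_mul, eval_X, map_zero]
      by_cases hv : v 0 = 0
      · rw [hv, zero_mul]
      · have h2 : v = v 0 • ![1, v 1 / v 0] := by
          ext i
          fin_cases i
          · simp
          · simp; field_simp
        have h3 := hq (v 1 / v 0)
        rw [h, Polynomial.eval_zero] at h3
        rw [show eval v f = eval (v 0 • ![1, v 1 / v 0]) f from by rw [← h2], eval_smul_of_isHomogeneous hf, ← h3, mul_zero, mul_zero]
    exact (mul_eq_zero.1 h1).resolve_left (MvPolynomial.X_ne_zero _)
  have h01 : (![0, 1] : Fin 2 → k) ≠ 0 := fun h => one_ne_zero (congrFun h 1)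
  have h1t : ∀ t : k, (![1, t] : Fin 2 → k) ≠ 0 := fun t h => one_ne_zero (congrFun h 0)
  have hfin : (Set.insert (Projectivization.mk k ![0, 1] h01)
      ((fun t => Projectivization.mk k ![1, t] (h1t t)) '' {t | q.eval t = 0})).Finite :=
    (((Polynomial.finite_setOf_isRoot hq0)).image _).insert _
  refine hfin.subset fun p hp => ?_
  induction p using Projectivization.ind with
  | h v hv =>
    by_cases hv0 : v 0 = 0
    · left
      refine eq_mk_of_proportional hv h01 fun i j => ?_
      fin_cases i <;> fin_cases j <;> simp [hv0]
    · right
      have h2 : Projectivization.mk k v hv = Projectivization.mk k ![1, v 1 / v 0] (h1t _) := by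
        refine eq_mk_of_proportional hv (h1t _) fun i j => ?_
        fin_cases i <;> fin_cases j <;> simp <;> field_simp
      refine ⟨v 1 / v 0, ?_, h2.symm⟩
      rw [mem_setOf_eq, hq]
      rw [mem_setOf_eq, h2] at hp
      exact (vanishes_mk_of_isHomogeneous hf _).1 hp

theorem infinite_univ_pr_one [Infinite k] : (univ : Set (Pr k 1)).Infinite := by
  have h1t : ∀ t : k, (![1, t] : Fin 2 → k) ≠ 0 := fun t h => one_ne_zero (congrFun h 0)
  have hinj : Function.Injective (fun t => (Projectivization.mk k ![1, t] (h1t t) : Pr k 1)) := by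
    intro s t h
    have := proportional_of_mk_eq h 0 1
    simpa using this.symm
  have := Infinite.of_injective _ hinj
  exact Set.infinite_univ

theorem isCurve_univ [Infinite k] : IsCurve (univ : Set (Pr k 1)) := by
  have hfin : ∀ Z : Set (Pr k 1), IsClosed Z → Z ⊂ univ → Z.Finite := by
    intro Z hZ hne
    obtain ⟨p, -, hp⟩ := exists_of_ssubset hne
    obtain ⟨f, d, hf, hfY, hv⟩ := (isClosed_iff.1 hZ).exists_of_notMem hp
    refine (finite_setOf_vanishes hf fun h => hv ?_).subset fun q hq => hfY q hq
    rw [h]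
    exact fun _ _ _ => map_zero _
  refine ⟨⟨isClosed_iff.1 isClosed_univ, infinite_univ_pr_one.nonempty, fun Z₁ Z₂ h₁ h₂ h => ?_⟩,
    infinite_univ_pr_one, hfin⟩
  by_contra! hc
  refine infinite_univ_pr_one (((hfin Z₁ (isClosed_iff.2 h₁) ?_).union
    (hfin Z₂ (isClosed_iff.2 h₂) ?_)).subset h)
  · exact ⟨subset_univ _, hc.1⟩
  · exact ⟨subset_univ _, hc.2⟩

/-! ### Lines -/

/-- The tuple of linear forms parametrizing the line through two points. -/
noncomputable def lineTup (e₀ e₁ : Fin (N + 1) → k) : Fin (N + 1) → MvPolynomial (Fin (1 + 1)) k :=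
  fun i => C (e₀ i) * MvPolynomial.X 0 + C (e₁ i) * MvPolynomial.X 1

theorem tup_lineTup (e₀ e₁ : Fin (N + 1) → k) (s : Fin (1 + 1) → k) :
    tup (lineTup e₀ e₁) s = s 0 • e₀ + s 1 • e₁ := by
  ext i
  simp [tup_apply, lineTup, mul_comm]

theorem isHomogeneous_lineTup (e₀ e₁ : Fin (N + 1) → k) (i : Fin (N + 1)) :
    (lineTup e₀ e₁ i).IsHomogeneous 1 := by
  refine IsHomogeneous.add ?_ ?_
  · simpa using (isHomogeneous_C _ (e₀ i)).mul (isHomogeneous_X k (0 : Fin (1 + 1)))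
  · simpa using (isHomogeneous_C _ (e₁ i)).mul (isHomogeneous_X k (1 : Fin (1 + 1)))

theorem tup_lineTup_ne_zero {e₀ e₁ : Fin (N + 1) → k} (h : LinearIndependent k ![e₀, e₁])
    {s : Fin (1 + 1) → k} (hs : s ≠ 0) : tup (lineTup e₀ e₁) s ≠ 0 := by
  rw [tup_lineTup]
  intro h0
  have := LinearIndependent.pair_iff.1 h _ _ h0
  exact hs (funext fun i => by fin_cases i; exacts [this.1, this.2])

/-- The linear subvariety of projective space given by a subspace. -/
def linSet (W : Submodule k (Fin (N + 1) → k)) : Set (Pr k N) :=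
  {p | Projectivization.submodule p ≤ W}

theorem mk_mem_linSet {W : Submodule k (Fin (N + 1) → k)} {v : Fin (N + 1) → k} {hv : v ≠ 0} :
    Projectivization.mk k v hv ∈ linSet W ↔ v ∈ W := by
  rw [linSet, mem_setOf_eq, Projectivization.submodule_mk, Submodule.span_singleton_le_iff_mem]

theorem exists_lineMap [Infinite k] {e₀ e₁ : Fin (N + 1) → k} (h : LinearIndependent k ![e₀, e₁]) :
    ∃ l : Pr k 1 → Pr k N, IsMorphismOn univ l ∧ InjOn l univ ∧
      (∀ s (hs : s ≠ 0), l (Projectivization.mk k s hs) =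
        Projectivization.mk k _ (tup_lineTup_ne_zero h hs)) ∧
      l '' univ = linSet (Submodule.span k {e₀, e₁}) := by
  obtain ⟨l, hl, hrep⟩ := exists_morphism_of_tuples (univ : Set (Pr k 1)) {lineTup e₀ e₁}
    (by rintro F rfl; exact ⟨1, isHomogeneous_lineTup e₀ e₁⟩)
    (by rintro F rfl G rfl v hv - i j; rfl)
    (fun v hv _ => ⟨_, rfl, tup_lineTup_ne_zero h hv⟩)
  have hl' : ∀ s (hs : s ≠ 0), l (Projectivization.mk k s hs) =
        Projectivization.mk k _ (tup_lineTup_ne_zero h hs) :=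
    fun s hs => (hrep _ rfl).2 s hs trivial _
  refine ⟨l, hl, ?_, hl', ?_⟩
  · intro p _ q _ hpq
    induction p using Projectivization.ind with
    | h s hs =>
    induction q using Projectivization.ind with
    | h t ht =>
      rw [hl', hl', Projectivization.mk_eq_mk_iff'] at hpq
      obtain ⟨a, ha⟩ := hpq
      rw [Projectivization.mk_eq_mk_iff']
      refine ⟨a, ?_⟩
      rw [tup_lineTup, tup_lineTup] at ha
      have h1 : (a * t 0 - s 0) • e₀ + (a * t 1 - s 1) • e₁ = 0 := by
        rw [← sub_eq_zero] at ha
        rw [← ha]; module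
      have := LinearIndependent.pair_iff.1 h _ _ h1
      funext i
      fin_cases i
      · exact sub_eq_zero.1 this.1
      · exact sub_eq_zero.1 this.2
  · ext p
    induction p using Projectivization.ind with
    | h v hv =>
      rw [mk_mem_linSet, Submodule.mem_span_pair]
      constructor
      · rintro ⟨q, -, hq⟩
        induction q using Projectivization.ind with
        | h s hs =>
          rw [hl', eq_comm, Projectivization.mk_eq_mk_iff'] at hq
          obtain ⟨a, ha⟩ := hq
          rw [tup_lineTup] at ha
          exact ⟨a * s 0, a * s 1, by rw [← ha]; module⟩
      · rintro ⟨a, b, hab⟩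
        have hs : (![a, b] : Fin (1 + 1) → k) ≠ 0 := by
          intro h0
          apply hv
          rw [← hab, show a = 0 from congrFun h0 0, show b = 0 from congrFun h0 1]; simp
        refine ⟨Projectivization.mk k _ hs, trivial, ?_⟩
        rw [hl']
        congr 1
        rw [tup_lineTup, ← hab]
        simp

theorem exists_basis_of_finrank_two {W : Submodule k (Fin (N + 1) → k)} (hW : finrank k W = 2) :
    ∃ e₀ e₁, LinearIndependent k ![e₀, e₁] ∧ W = Submodule.span k {e₀, e₁} := by
  let b := Module.finBasisOfFinrankEq k W hW
  refine ⟨b 0, b 1, ?_, ?_⟩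
  · have := b.linearIndependent.map' W.subtype W.ker_subtype
    have h2 : (W.subtype ∘ b : Fin 2 → Fin (N + 1) → k) = ![(b 0 : Fin (N + 1) → k), b 1] := by
      ext i
      fin_cases i <;> rfl
    rwa [h2] at this
  · have := congrArg (Submodule.map W.subtype) b.span_eq
    rw [Submodule.map_span, Submodule.map_top, Submodule.range_subtype] at this
    refine this.symm.trans ?_
    congr 1
    ext v
    simp [Fin.exists_fin_two, eq_comm]

theorem finrank_span_pair_eq_two {e₀ e₁ : Fin (N + 1) → k} (h : LinearIndependent k ![e₀, e₁]) :
    finrank k (Submodule.span k {e₀, e₁}) = 2 := by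
  have := finrank_span_eq_card h
  rw [Matrix.range_cons, Matrix.range_cons, Matrix.range_empty, union_empty,
    Set.singleton_union] at this
  simpa using this

theorem isCurve_linSet [IsAlgClosed k] {W : Submodule k (Fin (N + 1) → k)} (hW : finrank k W = 2) :
    IsCurve (linSet W) := by
  obtain ⟨e₀, e₁, h, rfl⟩ := exists_basis_of_finrank_two hW
  obtain ⟨l, hl, hinj, -, him⟩ := exists_lineMap h
  rw [← him]
  exact isCurve_univ.image hl (infinite_univ_pr_one.image hinj)

theorem linSet_mono {W W' : Submodule k (Fin (N + 1) → k)} (h : W ≤ W') : linSet W ⊆ linSet W' :=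
  fun _ hp => le_trans hp h

theorem linSet_subset_iff {W W' : Submodule k (Fin (N + 1) → k)} : linSet W ⊆ linSet W' ↔ W ≤ W' := by
  refine ⟨fun h v hv => ?_, linSet_mono⟩
  by_cases h0 : v = 0
  · rw [h0]; exact W'.zero_mem
  · exact (mk_mem_linSet (hv := h0)).1 (h (mk_mem_linSet.2 hv))

theorem isClosed_linSet [Infinite k] (W : Submodule k (Fin (N + 1) → k)) : IsClosed (linSet W) := by
  have : linSet W = {p : Pr k N | ∀ f ∈ {f | ∃ l, f = linForm l ∧ ∀ v ∈ W, ∑ i, l i * v i = 0}, Vanishes f p} := by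
    ext p
    induction p using Projectivization.ind with
    | h v hv =>
      rw [mk_mem_linSet, mem_setOf_eq]
      constructor
      · rintro h f ⟨l, rfl, hl⟩
        rw [vanishes_mk_of_isHomogeneous (isHomogeneous_linForm l), eval_linForm]
        exact hl v h
      · intro h
        by_contra hvW
        obtain ⟨ξ, hξ, hW⟩ := Submodule.exists_le_ker_of_notMem hvW
        obtain ⟨l, hl⟩ := exists_linForm_of_functional ξ
        have h1 := h (linForm l) ⟨l, rfl, fun u hu => (hl u).trans (hW hu)⟩
        rw [vanishes_mk_of_isHomogeneous (isHomogeneous_linForm l), eval_linForm, hl] at h1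
        exact hξ h1
  rw [this]
  exact isClosed_iff.2 (isAlgSet_setOf_vanishes _)

theorem linForm_eq_zero_iff [Infinite k] {l : Fin (N + 1) → k} : linForm l = 0 ↔ l = 0 := by
  constructor
  · intro h
    ext i
    have := eval_linForm l (Pi.single i 1)
    rw [h] at this
    simpa [Pi.single_apply] using this.symm
  · rintro rfl
    simp [linForm]

theorem Nondegenerate.not_subset_linSet [Infinite k] {Y : Set (Pr k N)} (hY : Nondegenerate Y)
    {W : Submodule k (Fin (N + 1) → k)} (hW : W ≠ ⊤) : ¬ Y ⊆ linSet W := by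
  intro h
  obtain ⟨ξ, hξ, hW⟩ := Submodule.exists_le_ker_of_lt_top W (lt_top_iff_ne_top.2 hW)
  obtain ⟨l, hl⟩ := exists_linForm_of_functional ξ
  have h1 := hY (linForm l) (isHomogeneous_linForm l) fun p hp => by
    induction p using Projectivization.ind with
    | h v hv =>
      rw [vanishes_mk_of_isHomogeneous (isHomogeneous_linForm l), eval_linForm, hl]
      exact hW (mk_mem_linSet.1 (h hp))
  rw [linForm_eq_zero_iff] at h1
  exact hξ (LinearMap.ext fun v => by rw [← hl, h1]; simp)

theorem jacobian_apply (F : Fin (N + 1) → MvPolynomial (Fin (M + 1)) k) (v w : Fin (M + 1) → k)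
    (i : Fin (N + 1)) : jacobian F v w i = diffAt (F i) v w := by
  rw [diffAt_apply]
  simp [jacobian, Matrix.mulVec, dotProduct]

theorem embTangent_mono {E X : Set (Pr k M)} (h : E ⊆ X) (p : Pr k M) :
    embTangent E p ≤ embTangent X p := by
  refine iInf₂_mono' fun f hf => ⟨f, ⟨hf.1, fun q hq => hf.2 q (h hq)⟩, le_rfl⟩

theorem finrank_map_le_of_mem_ker {V V' : Type} [AddCommGroup V] [Module k V] [FiniteDimensional k V]
    [AddCommGroup V'] [Module k V'] {T : Submodule k V} {n : ℕ} (hT : finrank k T = n + 1)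
    (J : V →ₗ[k] V') {u : V} (hu : u ∈ T) (hu0 : u ≠ 0) (hJ : J u = 0) :
    finrank k (T.map J) ≤ n := by
  have h := LinearMap.finrank_range_add_finrank_ker (J.domRestrict T)
  rw [LinearMap.range_domRestrict, hT] at h
  have hpos : 0 < finrank k (LinearMap.ker (J.domRestrict T)) := by
    have hne : (⟨⟨u, hu⟩, hJ⟩ : LinearMap.ker (J.domRestrict T)) ≠ 0 := fun h0 =>
      hu0 (congrArg (fun x : LinearMap.ker (J.domRestrict T) => (x : T).1) h0)
    have := nontrivial_of_ne _ _ hne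
    exact finrank_pos
  omega

theorem mem_span_of_proportional {y z : Fin (N + 1) → k} (hy : y ≠ 0)
    (h : ∀ i j, z i * y j = z j * y i) : z ∈ Submodule.span k {y} := by
  obtain ⟨j, hj⟩ : ∃ j, y j ≠ 0 := by
    by_contra! h0
    exact hy (funext h0)
  refine Submodule.mem_span_singleton.2 ⟨z j / y j, funext fun i => ?_⟩
  rw [Pi.smul_apply, smul_eq_mul, div_mul_eq_mul_div, div_eq_iff hj, ← h i j]

/-- On a positive-dimensional fibre the map is ramified. -/
theorem finite_fibre [Infinite k] {X : Set (Pr k M)} {φ : Pr k M → Pr k N} (hX : IsSmoothSurface X)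
    (hφ : Uncrumpled X φ) (y : Pr k N) : {x | x ∈ X ∧ φ x = y}.Finite := by
  by_contra hinf
  have hcl : IsClosed {x | x ∈ X ∧ φ x = y} :=
    hφ.1.isClosed_preimage hX.1.isClosed (isClosed_singleton (x := y))
  obtain ⟨E, hE, hEX, hEinf⟩ := exists_infinite_variety hcl hinf
  refine hEinf (hφ.2.2.2.subset fun p hp => ⟨(hEX hp).1, fun F hF => ?_⟩)
  obtain ⟨hF, hF0⟩ := localRep_iff.1 hF
  have hmk := Projectivization.mk_rep p
  set v := p.rep
  have hv : v ≠ 0 := Projectivization.rep_nonzero p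
  have hmk' : Projectivization.mk k v hv = p := hmk
  obtain ⟨w, hw, hwv⟩ := exists_mem_embTangent hE hEinf hv (by rwa [hmk'])
  induction y using Projectivization.ind with
  | h y hy =>
  have hmem : ∀ i j, F i * C (y j) - F j * C (y i) ∈ coneIdeal E := by
    intro i j
    refine mem_coneIdeal'.2 fun u hu huE => ?_
    rw [map_sub, map_mul, map_mul, eval_C, eval_C]
    by_cases h0 : tup F u = 0
    · rw [show eval u (F i) = 0 from congrFun h0 i, show eval u (F j) = 0 from congrFun h0 j]
      ring
    · have h1 := hF.2 u hu (hEX huE).1 h0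
      rw [(hEX huE).2] at h1
      have := proportional_of_mk_eq h1 i j
      simp only [tup_apply] at this
      linear_combination -this
  have hspan : ∀ u ∈ embTangent E p, jacobian F v u ∈ Submodule.span k {y} := by
    intro u hu
    rw [← hmk', mem_embTangent] at hu
    refine mem_span_of_proportional hy fun i j => ?_
    have := hu _ (hmem i j)
    rw [jacobian_apply, jacobian_apply]
    rw [← diffHom_apply, map_sub, LinearMap.sub_apply, diffHom_apply, diffHom_apply, diffAt_mul,
      diffAt_mul] at this
    simp only [eval_C] at this
    have hC : ∀ c : k, diffAt (C c) v u = 0 := fun c => by simp [diffAt_apply]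
    rw [hC, hC] at this
    linear_combination this
  have hvT : v ∈ embTangent E p := by
    have := self_mem_embTangent hv (Z := E) (by rwa [hmk'])
    rwa [hmk'] at this
  rw [hmk'] at hw
  obtain ⟨α, hα⟩ := Submodule.mem_span_singleton.1 (hspan v hvT)
  obtain ⟨β, hβ⟩ := Submodule.mem_span_singleton.1 (hspan w hw)
  have hT := hX.2.2 p (hEX hp).1
  have hle := embTangent_mono (fun x hx => (hEX hx).1 : E ⊆ X) p
  by_cases h0 : α = 0
  · exact finrank_map_le_of_mem_ker hT _ (hle hvT) hv (by rw [← hα, h0, zero_smul])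
  · refine finrank_map_le_of_mem_ker hT _ (u := β • v - α • w)
      (hle (Submodule.sub_mem _ (Submodule.smul_mem _ _ hvT) (Submodule.smul_mem _ _ hw))) ?_ ?_
    · intro h
      refine hwv (Submodule.mem_span_singleton.2 ⟨α⁻¹ * β, ?_⟩)
      rw [mul_smul, sub_eq_zero.1 h, smul_smul, inv_mul_cancel₀ h0, one_smul]
    · rw [map_sub, map_smul, map_smul, ← hα, ← hβ, smul_smul, smul_smul, mul_comm, sub_self]

theorem exists_variety_lift [IsAlgClosed k] {X : Set (Pr k M)} {φ : Pr k M → Pr k N}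
    (hX : IsClosed X) (hφ : IsMorphismOn X φ) {L : Set (Pr k N)} (hL : IsVariety L)
    (hLX : L ⊆ φ '' X) : ∃ E, IsVariety E ∧ E ⊆ X ∧ φ '' E = L := by
  obtain ⟨S, hSfin, hScl, hSirr, hS⟩ :=
    TopologicalSpace.NoetherianSpace.exists_finite_set_isClosed_irreducible
      (hφ.isClosed_preimage hX hL.isClosed)
  have hsub : ∀ E ∈ S, E ⊆ X ∩ φ ⁻¹' L := fun E hE => by
    rw [hS]; exact subset_sUnion_of_mem hE
  obtain ⟨Z, hZ, hLZ⟩ := isIrreducible_iff_sUnion_isClosed.1 hL.isIrreducible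
    ((hSfin.image (fun E => φ '' E)).toFinset) (by
      intro z hz
      simp only [Finite.mem_toFinset] at hz
      obtain ⟨E, hE, rfl⟩ := hz
      exact (hφ.mono fun x hx => (hsub E hE hx).1).isClosed_image (hScl E hE)) (by
      intro y hy
      obtain ⟨x, hx, rfl⟩ := hLX hy
      have : x ∈ ⋃₀ S := by rw [← hS]; exact ⟨hx, hy⟩
      obtain ⟨E, hE, hxE⟩ := this
      exact ⟨φ '' E, by simpa using ⟨E, hE, rfl⟩, x, hxE, rfl⟩)
  simp only [Finite.mem_toFinset] at hZ
  obtain ⟨E, hE, rfl⟩ := hZ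
  refine ⟨E, isVariety_iff.2 ⟨hScl E hE, hSirr E hE⟩, fun x hx => (hsub E hE hx).1, ?_⟩
  refine Subset.antisymm ?_ hLZ
  rintro _ ⟨x, hx, rfl⟩
  exact (hsub E hE hx).2

/-- The two-dimensional subspaces defining lines contained in `Y`. -/
def lines (Y : Set (Pr k N)) : Set (Submodule k (Fin (N + 1) → k)) :=
  {W | finrank k W = 2 ∧ linSet W ⊆ Y}

theorem RuledByLines.infinite_lines {Y : Set (Pr k N)} (h : RuledByLines Y) : (lines Y).Infinite := by
  intro hfin
  refine h ((hfin.image linSet).subset ?_)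
  rintro L ⟨⟨W, hW, rfl⟩, hL⟩
  exact ⟨W, ⟨hW, hL⟩, rfl⟩

/-- The standing hypotheses of the theorem. -/
structure IsRuledMap (X : Set (Pr k M)) (φ : Pr k M → Pr k N) : Prop where
  four_le : 4 ≤ N
  smooth : IsSmoothSurface X
  uncrumpled : Uncrumpled X φ
  ruled : RuledByLines (φ '' X)

namespace IsRuledMap

variable {X : Set (Pr k M)} {φ : Pr k M → Pr k N}

theorem closed (h : IsRuledMap X φ) : IsClosed X := h.smooth.1.isClosed

theorem variety (h : IsRuledMap X φ) : IsVariety X := h.smooth.1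

theorem mor (h : IsRuledMap X φ) : IsMorphismOn X φ := h.uncrumpled.1

theorem variety_image [IsAlgClosed k] (h : IsRuledMap X φ) : IsVariety (φ '' X) :=
  h.variety.image h.mor

theorem ne_top_of_mem_lines (h : IsRuledMap X φ) {W : Submodule k (Fin (N + 1) → k)}
    (hW : finrank k W = 2) : W ≠ ⊤ := by
  rintro rfl
  have := h.four_le
  simp at hW
  omega

theorem exists_curve_lift [IsAlgClosed k] (h : IsRuledMap X φ) {W : Submodule k (Fin (N + 1) → k)}
    (hW : W ∈ lines (φ '' X)) : ∃ E, IsCurve E ∧ E ⊆ X ∧ φ '' E = linSet W := by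
  obtain ⟨E, hE, hEX, hEW⟩ := exists_variety_lift h.closed h.mor (isCurve_linSet hW.1).isVariety hW.2
  refine ⟨E, isCurve_of_hasDim_two h.smooth.2.1 h.variety hE ?_ ⟨hEX, ?_⟩, hEX, hEW⟩
  · intro hfin
    exact (isCurve_linSet hW.1).infinite (hEW ▸ hfin.image φ)
  · intro hXE
    refine h.uncrumpled.2.1.not_subset_linSet (h.ne_top_of_mem_lines hW.1) ?_
    rw [← hEW]
    exact image_mono hXE

theorem subset_of_infinite_lines [IsAlgClosed k] (h : IsRuledMap X φ)
    {S : Set (Submodule k (Fin (N + 1) → k))} (hS : S.Infinite) (hSY : S ⊆ lines (φ '' X))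
    {Z : Set (Pr k N)} (hZ : IsClosed Z) (hSZ : ∀ W ∈ S, linSet W ⊆ Z) : φ '' X ⊆ Z := by
  by_contra hc
  have hlt : X ∩ φ ⁻¹' Z ⊂ X :=
    ⟨inter_subset_left, fun hsub => hc (by rintro _ ⟨x, hx, rfl⟩; exact (hsub hx).2)⟩
  have hfin := finite_curves h.smooth.2.1 h.variety (h.mor.isClosed_preimage h.closed hZ) hlt
  refine hS ?_
  have hfin' := hfin.image (fun E => φ '' E)
  have := (hfin'.preimage (f := linSet) (s := {L | _}) ?_)
  · refine this.subset fun W hW => ?_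
    obtain ⟨E, hE, hEX, hEW⟩ := h.exists_curve_lift (hSY hW)
    refine ⟨E, ⟨hE.isVariety, hE.infinite, fun x hx => ⟨hEX hx, hSZ W hW ?_⟩⟩, hEW⟩
    rw [← hEW]; exact ⟨x, hx, rfl⟩
  · intro W _ W' _ h
    exact le_antisymm (linSet_subset_iff.1 h.subset) (linSet_subset_iff.1 h.superset)

theorem finite_lines_le [IsAlgClosed k] (h : IsRuledMap X φ) {W₀ : Submodule k (Fin (N + 1) → k)}
    (hW : W₀ ≠ ⊤) : {W | W ∈ lines (φ '' X) ∧ W ≤ W₀}.Finite := by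
  by_contra hinf
  exact h.uncrumpled.2.1.not_subset_linSet hW (h.subset_of_infinite_lines hinf (fun W hW => hW.1)
    (isClosed_linSet W₀) fun W hW => linSet_mono hW.2)

end IsRuledMap

theorem homogeneousComponent_mul_of_isHomogeneous {σ R : Type} [CommRing R] {l f : MvPolynomial σ R}
    {n d : ℕ} (hl : l.IsHomogeneous n) :
    homogeneousComponent (n + d) (l * f) = l * homogeneousComponent d f := by
  letI : GradedAlgebra (homogeneousSubmodule σ R) := MvPolynomial.gradedAlgebra
  have h1 := DirectSum.coe_decompose_mul_of_left_mem_of_le (homogeneousSubmodule σ R) (a := l) (b := f)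
    (i := n) (n := n + d) hl (Nat.le_add_right _ _)
  rw [Nat.add_sub_cancel_left] at h1
  exact (decomposition.decompose'_apply _ _).symm.trans
    (h1.trans (congrArg (l * ·) (decomposition.decompose'_apply _ _)))

theorem exists_inverse [IsAlgClosed k] [CharZero k] {X : Set (Pr k M)} (hX : IsVariety X)
    {φ : Pr k M → Pr k N} {F : Fin (N + 1) → MvPolynomial (Fin (M + 1)) k} (hF : Rep X φ F)
    {i₀ : Fin (N + 1)} (hF0 : F i₀ ∉ coneIdeal X) {Z : Set (Pr k M)} (hZ : IsClosed Z)
    (hXZ : ¬ X ⊆ Z) (hinj : InjOn φ (X \ Z)) :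
    ∃ (G : Fin (M + 1) → MvPolynomial (Fin (N + 1)) k) (e : ℕ), (∀ i, (G i).IsHomogeneous e) ∧
      (∀ i j, aeval F (G i) * MvPolynomial.X j - aeval F (G j) * MvPolynomial.X i ∈ coneIdeal X) ∧
      ∃ i, aeval F (G i) ∉ coneIdeal X := by
  have hI := hX.isPrime
  have hne := hX.2.1
  obtain ⟨i₁, hi₁⟩ : ∃ i₁, (MvPolynomial.X i₁ : MvPolynomial (Fin (M + 1)) k) ∉ coneIdeal X := by
    by_contra! hc
    obtain ⟨p, hp⟩ := hne
    induction p using Projectivization.ind with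
    | h v hv => exact hv (funext fun i => by simpa using mem_coneIdeal'.1 (hc i) v hv hp)
  obtain ⟨h, hhZ, hhX⟩ : ∃ h, h ∈ coneIdeal Z ∧ h ∉ coneIdeal X := by
    obtain ⟨p, hp, hpZ⟩ := not_subset.1 hXZ
    obtain ⟨f, d, -, hfY, hv⟩ := (isClosed_iff.1 hZ).exists_of_notMem hpZ
    exact ⟨f, hfY, fun hc => hv (hc p hp)⟩
  have key : ∀ j, ∃ (e : ℕ) (P Q : MvPolynomial (Fin (N + 1)) k), P.IsHomogeneous e ∧
      Q.IsHomogeneous e ∧ aeval F Q ∉ coneIdeal X ∧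
      MvPolynomial.X j * aeval F Q - MvPolynomial.X i₁ * aeval F P ∈ coneIdeal X := by
    intro j
    have hc : h * F i₀ * MvPolynomial.X i₁ ∉ coneIdeal X := fun hc =>
      ((hI.mem_or_mem hc).resolve_right hi₁ |> hI.mem_or_mem).elim hhX hF0
    refine (ratio_mem_or_exists_separated (coneIdeal X) F i₀ hF0 (MvPolynomial.X j)
      (MvPolynomial.X i₁) (h * F i₀ * MvPolynomial.X i₁) hi₁ hc).resolve_right ?_
    rintro ⟨c', hc', H⟩
    have hcc : c' * (h * F i₀ * MvPolynomial.X i₁) ∉ coneIdeal X := fun h' =>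
      (hI.mem_or_mem h').elim hc' hc
    rw [mem_coneIdeal'] at hcc
    push Not at hcc
    obtain ⟨v, hv, hvX, hvc⟩ := hcc
    simp only [map_mul, eval_X, mul_ne_zero_iff] at hvc
    obtain ⟨hc'v, ⟨hhv, hFv⟩, hXv⟩ := hvc
    obtain ⟨v', hv'X, hv'c, hne', hprop⟩ := H v (fun f hf => (inCone_mk hvX).eval_eq_zero hne hf) hc'v
    simp only [map_mul, eval_X, mul_ne_zero_iff] at hv'c
    obtain ⟨⟨hhv', hFv'⟩, hXv'⟩ := hv'c
    have hv' : v' ≠ 0 := fun h0 => hXv' (congrFun h0 i₁)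
    have hv'X := (inCone_iff hX.isClosed hne).2 hv'X hv'
    have ht : tup F v ≠ 0 := fun h0 => hFv (congrFun h0 i₀)
    have ht' : tup F v' ≠ 0 := fun h0 => hFv' (congrFun h0 i₀)
    have hφ : φ (Projectivization.mk k v hv) = φ (Projectivization.mk k v' hv') := by
      rw [hF.2 v hv hvX ht, hF.2 v' hv' hv'X ht']
      refine eq_mk_of_proportional ht ht' fun a b => ?_
      simp only [tup_apply]
      have h1 := hprop a
      have h2 := hprop b
      have : eval v (F i₀) * eval v' (F i₀) * (eval v (F a) * eval v' (F b) - eval v' (F a) * eval v (F b)) = 0 := by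
        linear_combination eval v (F i₀) * eval v' (F b) * h1 - eval v (F i₀) * eval v' (F a) * h2
      exact sub_eq_zero.1 ((mul_eq_zero.1 this).resolve_left (mul_ne_zero hFv hFv'))
    have := hinj ⟨hvX, fun hz => hhv (mem_coneIdeal'.1 hhZ v hv hz)⟩
      ⟨hv'X, fun hz => hhv' (mem_coneIdeal'.1 hhZ v' hv' hz)⟩ hφ
    apply hne'
    simp only [eval_X]
    exact (proportional_of_mk_eq this j i₁).symm
  choose e P Q hP hQ hQI hPQ using key
  let G : Fin (M + 1) → MvPolynomial (Fin (N + 1)) k := fun j => P j * ∏ j' ∈ Finset.univ.erase j, Q j'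
  have hG : ∀ j, MvPolynomial.X i₁ * aeval F (G j) - MvPolynomial.X j * ∏ j', aeval F (Q j') ∈ coneIdeal X := by
    intro j
    have h1 := (coneIdeal X).mul_mem_left (-∏ j' ∈ Finset.univ.erase j, aeval F (Q j')) (hPQ j)
    rw [← Finset.mul_prod_erase _ _ (Finset.mem_univ j)]
    convert h1 using 1
    simp only [G, map_mul, map_prod]
    ring
  have hprod : ∏ j', aeval F (Q j') ∉ coneIdeal X := fun hc => by
    obtain ⟨j, -, hj⟩ := (hI.prod_mem_iff).1 hc
    exact hQI j hj
  refine ⟨G, ∑ j, e j, fun j => ?_, fun i j => ?_, i₁, fun hc => ?_⟩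
  · have h1 : (G j).IsHomogeneous (e j + ∑ j' ∈ Finset.univ.erase j, e j') :=
      (hP j).mul (IsHomogeneous.prod _ _ _ fun j' _ => hQ j')
    rwa [Finset.add_sum_erase _ _ (Finset.mem_univ j)] at h1
  · refine (hI.mem_or_mem (x := MvPolynomial.X i₁) ?_).resolve_left hi₁
    have h1 := (coneIdeal X).sub_mem ((coneIdeal X).mul_mem_left (MvPolynomial.X j) (hG i))
      ((coneIdeal X).mul_mem_left (MvPolynomial.X i) (hG j))
    convert h1 using 1
    ring
  · have h1 := (coneIdeal X).sub_mem ((coneIdeal X).mul_mem_left (MvPolynomial.X i₁) hc) (hG i₁)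
    rw [sub_sub_cancel] at h1
    exact (hI.mem_or_mem h1).elim hi₁ hprod

/-! ### Binary forms -/

theorem dvd_of_eval_eq_zero {f : MvPolynomial (Fin (1 + 1)) k} {d : ℕ} (hf : f.IsHomogeneous d)
    {s : Fin (1 + 1) → k} (hs : s ≠ 0) (h : eval s f = 0) :
    (C (s 1) * MvPolynomial.X 0 - C (s 0) * MvPolynomial.X 1 : MvPolynomial (Fin (1 + 1)) k) ∣ f := by
  set l : MvPolynomial (Fin (1 + 1)) k := C (s 1) * MvPolynomial.X 0 - C (s 0) * MvPolynomial.X 1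
  obtain ⟨i₀, hi₀⟩ : ∃ i, s i ≠ 0 := by
    by_contra! h0
    exact hs (funext h0)
  let π := Ideal.Quotient.mkₐ k (Ideal.span {l})
  have h1 : ∀ i, π (C (s i₀) * MvPolynomial.X i) = π (MvPolynomial.X i₀) * π (C (s i)) := by
    intro i
    rw [← map_mul, ← sub_eq_zero, ← map_sub]
    refine Ideal.Quotient.eq_zero_iff_mem.2 (Ideal.mem_span_singleton.2 ?_)
    fin_cases i₀ <;> fin_cases i
    · exact ⟨0, by simp; ring⟩
    · exact ⟨-1, by simp [l]; ring⟩
    · exact ⟨1, by simp [l]; ring⟩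
    · exact ⟨0, by simp; ring⟩
  have h2 : π (C (s i₀)) ^ d * π f = 0 := by
    have e1 : π f = aeval (fun i => π (MvPolynomial.X i)) f := by
      conv_lhs => rw [← aeval_X_left_apply f]
      rw [← MvPolynomial.comp_aeval_apply]
    rw [e1, ← aeval_mul_of_isHomogeneous hf]
    simp only [← map_mul, h1]
    simp only [map_mul]
    rw [aeval_mul_of_isHomogeneous hf]
    have e2 : aeval (fun i => π (C (s i))) f = π (C (eval s f)) := by
      have := MvPolynomial.comp_aeval_apply (fun i => (C (s i) : MvPolynomial (Fin (1 + 1)) k)) π f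
      rw [← this]
      congr 1
      have := MvPolynomial.comp_aeval_apply s (Algebra.ofId k (MvPolynomial (Fin (1 + 1)) k)) f
      exact this.symm
    rw [e2, h, map_zero, map_zero, mul_zero]
  rw [← map_pow, ← map_mul] at h2
  have h3 := Ideal.mem_span_singleton.1 (Ideal.Quotient.eq_zero_iff_mem.1 h2)
  rw [← map_pow] at h3
  have hu : IsUnit (C (s i₀ ^ d) : MvPolynomial (Fin (1 + 1)) k) :=
    (IsUnit.mk0 _ (pow_ne_zero d hi₀)).map C
  exact (hu.dvd_mul_left).1 h3

theorem exists_primitive_proportional [Infinite k] {ι : Type} (g : ι → MvPolynomial (Fin (1 + 1)) k) {e : ℕ}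
    (hg : ∀ i, (g i).IsHomogeneous e) (hg0 : g ≠ 0) :
    ∃ (ψ : ι → MvPolynomial (Fin (1 + 1)) k) (d : ℕ), (∀ i, (ψ i).IsHomogeneous d) ∧
      (∀ s, s ≠ 0 → tup ψ s ≠ 0) ∧ ∀ i j, ψ i * g j = ψ j * g i := by
  classical
  have hex : ∃ d, ∃ ψ : ι → MvPolynomial (Fin (1 + 1)) k, ψ ≠ 0 ∧ (∀ i, (ψ i).IsHomogeneous d) ∧
      ∀ i j, ψ i * g j = ψ j * g i := ⟨e, g, hg0, hg, fun i j => mul_comm _ _⟩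
  obtain ⟨ψ, hψ0, hψ, hψg⟩ := Nat.find_spec hex
  refine ⟨ψ, Nat.find hex, hψ, fun s hs h0 => ?_, hψg⟩
  obtain ⟨d', hd'⟩ | hd0 : (∃ d', Nat.find hex = 1 + d') ∨ Nat.find hex = 0 := by
    rcases h : Nat.find hex with _ | n
    · exact Or.inr rfl
    · exact Or.inl ⟨n, by omega⟩
  · have hl : (C (s 1) * MvPolynomial.X 0 - C (s 0) * MvPolynomial.X 1 : MvPolynomial (Fin (1 + 1)) k).IsHomogeneous 1 := by
      refine IsHomogeneous.sub ?_ ?_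
      · simpa using (isHomogeneous_C _ (s 1)).mul (isHomogeneous_X k (0 : Fin (1 + 1)))
      · simpa using (isHomogeneous_C _ (s 0)).mul (isHomogeneous_X k (1 : Fin (1 + 1)))
    choose q hq using fun i => dvd_of_eval_eq_zero (hψ i) hs (congrFun h0 i)
    set l : MvPolynomial (Fin (1 + 1)) k := C (s 1) * MvPolynomial.X 0 - C (s 0) * MvPolynomial.X 1
    have hq' : ∀ i, ψ i = l * homogeneousComponent d' (q i) := by
      intro i
      have h1 := homogeneousComponent_mul_of_isHomogeneous (f := q i) (d := d') hl
      rw [← hq i, ← hd', homogeneousComponent_of_mem (hψ i), if_pos rfl] at h1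
      exact h1
    have hl0 : l ≠ 0 := by
      rintro h1
      exact hψ0 (funext fun i => by rw [hq' i, h1, zero_mul]; rfl)
    refine Nat.find_min hex (m := d') (by omega) ⟨fun i => homogeneousComponent d' (q i), ?_,
      fun i => homogeneousComponent_isHomogeneous _ _, fun i j => ?_⟩
    · intro h1
      exact hψ0 (funext fun i => by rw [hq' i, show homogeneousComponent d' (q i) = 0 from congrFun h1 i, mul_zero]; rfl)
    · have h1 := hψg i j
      rw [hq', hq' j, mul_assoc, mul_assoc] at h1
      exact mul_left_cancel₀ hl0 h1
  · refine hψ0 (funext fun i => ?_)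
    have h1 := hψ i
    rw [hd0] at h1
    have h2 := totalDegree_eq_zero_iff_eq_C.1 (Nat.le_zero.1 h1.totalDegree_le)
    have h3 : eval s (ψ i) = 0 := congrFun h0 i
    rw [h2, eval_C] at h3
    rw [h2, h3, map_zero]; rfl

theorem isHomogeneous_aeval_lineTup {e₀ e₁ : Fin (N + 1) → k} {G : MvPolynomial (Fin (N + 1)) k} {e : ℕ}
    (hG : G.IsHomogeneous e) : (aeval (lineTup e₀ e₁) G).IsHomogeneous e := by
  have := hG.aeval (lineTup e₀ e₁) (isHomogeneous_lineTup e₀ e₁)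
  rwa [one_mul] at this

theorem proportional_trans {ι : Type} {a b c : ι → k} (hab : ∀ i j, a i * b j = a j * b i)
    (hbc : ∀ i j, b i * c j = b j * c i) {i₁ : ι} (h : b i₁ ≠ 0) (i j : ι) :
    a i * c j = c i * a j := by
  have : b i₁ * b i₁ * (a i * c j - c i * a j) = 0 := by
    linear_combination b i₁ * c j * hab i i₁ - b i₁ * c i * hab j i₁ +
      a i₁ * b i * hbc i₁ j - a i₁ * b j * hbc i₁ i
  exact sub_eq_zero.1 ((mul_eq_zero.1 this).resolve_left (mul_ne_zero h h))

set_option maxHeartbeats 1000000 in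
/-- Lifting a line along a map which is generically inverted by a tuple of polynomials. -/
theorem exists_lift_line [IsAlgClosed k] {E : Set (Pr k M)} (hE : IsClosed E) {φ : Pr k M → Pr k N}
    (hφ : IsMorphismOn E φ) {G : Fin (M + 1) → MvPolynomial (Fin (N + 1)) k} {e : ℕ}
    (hG : ∀ i, (G i).IsHomogeneous e) {e₀ e₁ : Fin (N + 1) → k} (hli : LinearIndependent k ![e₀, e₁])
    (hprop : ∀ v (hv : v ≠ 0), Projectivization.mk k v hv ∈ E → ∀ w (hw : w ≠ 0),
      φ (Projectivization.mk k v hv) = Projectivization.mk k w hw →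
        ∀ i j, eval w (G i) * v j = eval w (G j) * v i)
    (hG0 : ∃ s : Fin (1 + 1) → k, tup G (tup (lineTup e₀ e₁) s) ≠ 0)
    (him : ∀ (s : Fin (1 + 1) → k) (hs : s ≠ 0),
      Projectivization.mk k (tup (lineTup e₀ e₁) s) (tup_lineTup_ne_zero hli hs) ∈ φ '' E) :
    ∃ (Ψ : Pr k 1 → Pr k M) (ψ : Fin (M + 1) → MvPolynomial (Fin (1 + 1)) k) (d : ℕ),
      (∀ i, (ψ i).IsHomogeneous d) ∧ IsMorphismOn univ Ψ ∧ (∀ p, Ψ p ∈ E) ∧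
      ∀ (s : Fin (1 + 1) → k) (hs : s ≠ 0), (∃ h : tup ψ s ≠ 0,
        Ψ (Projectivization.mk k s hs) = Projectivization.mk k (tup ψ s) h) ∧
        φ (Ψ (Projectivization.mk k s hs)) =
          Projectivization.mk k (tup (lineTup e₀ e₁) s) (tup_lineTup_ne_zero hli hs) := by
  obtain ⟨g, hgdef⟩ : ∃ g : Fin (M + 1) → MvPolynomial (Fin (1 + 1)) k,
      ∀ i, g i = aeval (lineTup e₀ e₁) (G i) := ⟨_, fun _ => rfl⟩
  have hg : ∀ i, (g i).IsHomogeneous e := fun i => by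
    rw [hgdef]; exact isHomogeneous_aeval_lineTup (hG i)
  have htg : ∀ s, tup g s = tup G (tup (lineTup e₀ e₁) s) := fun s => funext fun i => by
    rw [tup_apply, tup_apply, hgdef, eval_aeval_tup]
  obtain ⟨s₀, hs₀⟩ := hG0
  have hg0 : g ≠ 0 := by
    rintro h0
    apply hs₀
    rw [← htg, h0]
    funext i; simp [tup_apply]
  obtain ⟨ψ, d, hψ, hψ0, hψg⟩ := exists_primitive_proportional g hg hg0
  obtain ⟨Ψ, hΨ, hrep⟩ := exists_morphism_of_tuples (univ : Set (Pr k 1)) {ψ}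
    (by rintro F rfl; exact ⟨d, hψ⟩) (by rintro F rfl G rfl v hv - i j; rfl)
    (fun v hv _ => ⟨_, rfl, hψ0 v hv⟩)
  have hΨ' : ∀ (s : Fin (1 + 1) → k) (hs : s ≠ 0), Ψ (Projectivization.mk k s hs) = Projectivization.mk k (tup ψ s) (hψ0 s hs) :=
    fun s hs => (hrep _ rfl).2 s hs trivial _
  obtain ⟨l, hl, -, hl', -⟩ := exists_lineMap hli
  obtain ⟨i₁, hi₁⟩ : ∃ i, g i ≠ 0 := by
    by_contra! h0
    exact hg0 (funext h0)
  have hgood : ∀ p : Pr k 1, ¬ Vanishes (g i₁) p → Ψ p ∈ E ∧ φ (Ψ p) = l p := by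
    intro p hp
    induction p using Projectivization.ind with
    | h s hs =>
      rw [vanishes_mk_of_isHomogeneous (hg i₁)] at hp
      obtain ⟨x, hxE, hx⟩ := him s hs
      induction x using Projectivization.ind with
      | h v hv =>
        have h1 := hprop v hv hxE _ _ hx
        have h2 : Ψ (Projectivization.mk k s hs) = Projectivization.mk k v hv := by
          rw [hΨ']
          refine eq_mk_of_proportional _ hv fun i j => ?_
          have h3 : ∀ i j, eval s (g i) * v j = eval s (g j) * v i := fun i j => by
            rw [hgdef, hgdef, eval_aeval_tup, eval_aeval_tup]; exact h1 i j
          have h4 : ∀ i j, eval s (ψ i) * eval s (g j) = eval s (ψ j) * eval s (g i) := fun i j => by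
            rw [← map_mul, hψg i j, map_mul]
          exact proportional_trans h4 h3 hp i j
        rw [h2, hl', hx]
        exact ⟨hxE, rfl⟩
  have hinf : ({p : Pr k 1 | ¬ Vanishes (g i₁) p}).Infinite := by
    have := infinite_univ_pr_one.diff (finite_setOf_vanishes (hg i₁) hi₁)
    refine this.mono fun p hp => hp.2
  have hEcl : IsClosed (univ ∩ Ψ ⁻¹' E) := hΨ.isClosed_preimage isClosed_univ hE
  have hEuniv := isCurve_univ.eq_of_subset hEcl
    (hinf.mono fun p hp => ⟨trivial, (hgood p hp).1⟩) (subset_univ _)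
  have hΨE : ∀ p, Ψ p ∈ E := fun p => by
    have : p ∈ univ ∩ Ψ ⁻¹' E := by rw [hEuniv]; trivial
    exact this.2
  have hcl2 := isClosed_setOf_eq isClosed_univ (hΨ.comp hφ fun p _ => hΨE p) hl
  have huniv2 := isCurve_univ.eq_of_subset hcl2
    (hinf.mono fun p hp => ⟨trivial, (hgood p hp).2⟩) (subset_univ _)
  refine ⟨Ψ, ψ, d, hψ, hΨ, hΨE, fun s hs => ⟨⟨hψ0 s hs, hΨ' s hs⟩, ?_⟩⟩
  have : Projectivization.mk k s hs ∈ {p | p ∈ univ ∧ (φ ∘ Ψ) p = l p} := by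
    rw [huniv2]; trivial
  exact this.2.trans (hl' s hs)

/-- The chain rule. -/
theorem diffAt_aeval {n : ℕ} (ψ : Fin (M + 1) → MvPolynomial (Fin (n + 1)) k)
    (f : MvPolynomial (Fin (M + 1)) k) (s w : Fin (n + 1) → k) :
    diffAt (aeval ψ f) s w = diffAt f (tup ψ s) (fun i => diffAt (ψ i) s w) := by
  induction f using MvPolynomial.induction_on with
  | C a => simp [diffAt_apply]
  | add p q hp hq =>
    rw [map_add, ← diffHom_apply, ← diffHom_apply, map_add, map_add, LinearMap.add_apply,
      LinearMap.add_apply, diffHom_apply, diffHom_apply, diffHom_apply, diffHom_apply, hp, hq]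
  | mul_X p i hp =>
    rw [map_mul, diffAt_mul, diffAt_mul, hp, aeval_X, eval_aeval_tup]
    simp [diffAt_apply, pderiv_X, Pi.single_apply, tup_apply]

theorem eq_zero_of_forall_eval_ne_zero [Infinite k] {n : ℕ} {f : MvPolynomial (Fin (n + 1)) k}
    (h : ∀ s : Fin (n + 1) → k, s ≠ 0 → eval s f = 0) : f = 0 := by
  have h0 : f * MvPolynomial.X 0 = 0 := MvPolynomial.funext fun s => by
    rw [map_mul, eval_X, map_zero]
    by_cases hs : s = 0
    · rw [hs, Pi.zero_apply, mul_zero]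
    · rw [h s hs, zero_mul]
  exact (mul_eq_zero.1 h0).resolve_right (X_ne_zero 0)

theorem exists_basis_of_mem {W : Submodule k (Fin (N + 1) → k)} (hW : finrank k W = 2)
    {y : Fin (N + 1) → k} (hy : y ≠ 0) (hyW : y ∈ W) :
    ∃ z, LinearIndependent k ![y, z] ∧ W = Submodule.span k {y, z} := by
  obtain ⟨z, hzW, hz⟩ : ∃ z ∈ W, z ∉ Submodule.span k {y} := by
    by_contra! hle
    have := Submodule.finrank_mono (show W ≤ Submodule.span k {y} from hle)
    rw [finrank_span_singleton hy] at this
    omega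
  have hli : LinearIndependent k ![y, z] := by
    rw [LinearIndependent.pair_iff' hy]
    exact fun a ha => hz (Submodule.mem_span_singleton.2 ⟨a, ha⟩)
  refine ⟨z, hli, (Submodule.eq_of_le_of_finrank_eq ?_ ?_).symm⟩
  · rw [Submodule.span_le]
    rintro u (rfl | rfl)
    exacts [hyW, hzW]
  · rw [finrank_span_pair_eq_two hli, hW]

/-- A generically injective map onto its image is inverted by a tuple of forms. -/
theorem IsVariety.exists_inverse_tuple [IsAlgClosed k] [CharZero k] {X : Set (Pr k M)} (hX : IsVariety X)
    {φ : Pr k M → Pr k N} (hφ : IsMorphismOn X φ) (hinj : GenericallyInjectiveOn X φ) :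
    ∃ (G : Fin (M + 1) → MvPolynomial (Fin (N + 1)) k) (e : ℕ), (∀ i, (G i).IsHomogeneous e) ∧
      (∀ v (hv : v ≠ 0), Projectivization.mk k v hv ∈ X → ∀ w (hw : w ≠ 0),
        φ (Projectivization.mk k v hv) = Projectivization.mk k w hw →
          ∀ i j, eval w (G i) * v j = eval w (G j) * v i) ∧
      X ∩ φ ⁻¹' {p | ∀ f ∈ range G, Vanishes f p} ⊂ X := by
  obtain ⟨Z, hZ, hXZ, hinj⟩ := hinj
  obtain ⟨p, hp⟩ := hX.2.1
  have hI := hX.isPrime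
  have hne : ∀ (v : Fin (M + 1) → k) (hv : v ≠ 0), Projectivization.mk k v hv ∈ X →
      ∃ F, Rep X φ F ∧ tup F v ≠ 0 ∧ ∃ i, F i ∉ coneIdeal X := by
    intro v hv hvX
    obtain ⟨F, hF, hFv⟩ := isMorphismOn_iff.1 hφ v hv hvX
    refine ⟨F, hF, hFv, ?_⟩
    by_contra! h0
    exact hFv (funext fun i => mem_coneIdeal'.1 (h0 i) v hv hvX)
  induction p using Projectivization.ind with
  | h v₀ hv₀ =>
  obtain ⟨F, hF, -, i₀, hF0⟩ := hne v₀ hv₀ hp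
  obtain ⟨G, e, hG, hprop, i₁, hi₁⟩ :=
    exists_inverse hX hF hF0 (isClosed_iff.2 hZ) hXZ hinj
  refine ⟨G, e, hG, ?_, inter_subset_left, ?_⟩
  · intro v hv hvX w hw hvw i j
    obtain ⟨F', hF', hF'v, i₂, hi₂⟩ := hne v hv hvX
    have hmem : F i₀ * F' i₂ * (aeval F' (G i) * MvPolynomial.X j - aeval F' (G j) * MvPolynomial.X i)
        ∈ coneIdeal X := by
      refine mem_coneIdeal'.2 fun u hu huX => ?_
      by_cases h0 : tup F u = 0
      · rw [map_mul, map_mul, show eval u (F i₀) = 0 from congrFun h0 i₀]; ring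
      by_cases h0' : tup F' u = 0
      · rw [map_mul, map_mul, show eval u (F' i₂) = 0 from congrFun h0' i₂]; ring
      have h1 := (hF.2 u hu huX h0).symm.trans (hF'.2 u hu huX h0')
      obtain ⟨c, hc⟩ := (Projectivization.mk_eq_mk_iff' k _ _ h0 h0').1 h1
      have hc0 : c ≠ 0 := fun h => h0 (by rw [← hc, h, zero_smul])
      have h2 := mem_coneIdeal'.1 (hprop i j) u hu huX
      simp only [map_sub, map_mul, eval_X, eval_aeval_tup, ← hc,
        eval_smul_of_isHomogeneous (hG _)] at h2 ⊢
      have h3 : c ^ e * (eval (tup F' u) (G i) * u j - eval (tup F' u) (G j) * u i) = 0 := by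
        linear_combination h2
      rw [(mul_eq_zero.1 h3).resolve_left (pow_ne_zero _ hc0), mul_zero]
    have hmem' := (hI.mem_or_mem hmem).resolve_left
      fun h' => (hI.mem_or_mem h').elim hF0 hi₂
    have h2 := mem_coneIdeal'.1 hmem' v hv hvX
    obtain ⟨c, hc⟩ := (Projectivization.mk_eq_mk_iff' k _ _ hw hF'v).1
      (hvw.symm.trans (hF'.2 v hv hvX hF'v))
    simp only [map_sub, map_mul, eval_X, eval_aeval_tup] at h2
    rw [← hc, eval_smul_of_isHomogeneous (hG _), eval_smul_of_isHomogeneous (hG _)]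
    linear_combination c ^ e * h2
  · intro hsub
    have hmem : F i₀ * aeval F (G i₁) ∈ coneIdeal X := by
      refine mem_coneIdeal'.2 fun u hu huX => ?_
      by_cases h0 : tup F u = 0
      · rw [map_mul, show eval u (F i₀) = 0 from congrFun h0 i₀]; ring
      · have h1 := (hsub huX).2 (G i₁) ⟨i₁, rfl⟩
        rw [hF.2 u hu huX h0] at h1
        rw [map_mul, eval_aeval_tup, h1 _ h0 rfl, mul_zero]
    exact (hI.mem_or_mem hmem).elim hF0 hi₁

namespace IsRuledMap

variable {X : Set (Pr k M)} {φ : Pr k M → Pr k N}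

theorem exists_inverse [IsAlgClosed k] [CharZero k] (h : IsRuledMap X φ) :
    ∃ (G : Fin (M + 1) → MvPolynomial (Fin (N + 1)) k) (e : ℕ), (∀ i, (G i).IsHomogeneous e) ∧
      (∀ v (hv : v ≠ 0), Projectivization.mk k v hv ∈ X → ∀ w (hw : w ≠ 0),
        φ (Projectivization.mk k v hv) = Projectivization.mk k w hw →
          ∀ i j, eval w (G i) * v j = eval w (G j) * v i) ∧
      X ∩ φ ⁻¹' {p | ∀ f ∈ range G, Vanishes f p} ⊂ X :=
  h.variety.exists_inverse_tuple h.mor h.uncrumpled.2.2.1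

theorem isClosed_bad [IsAlgClosed k] (h : IsRuledMap X φ) (S : Set (MvPolynomial (Fin (N + 1)) k)) :
    IsClosed (X ∩ φ ⁻¹' {p | ∀ f ∈ S, Vanishes f p}) :=
  h.mor.isClosed_preimage h.closed (isClosed_iff.2 (isAlgSet_setOf_vanishes S))

/-- All but finitely many lines lift to curves not contained in a given proper closed subset. -/
theorem finite_lines_lift_subset [IsAlgClosed k] (h : IsRuledMap X φ) {Z : Set (Pr k M)}
    (hZ : IsClosed Z) (hZX : Z ⊂ X) :
    {W | W ∈ lines (φ '' X) ∧ ∃ E, IsCurve E ∧ E ⊆ Z ∧ φ '' E = linSet W}.Finite := by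
  have hfin := (finite_curves h.smooth.2.1 h.variety hZ hZX).image (fun E => φ '' E)
  refine (hfin.preimage (f := linSet) ?_).subset ?_
  · intro W _ W' _ h
    exact le_antisymm (linSet_subset_iff.1 h.subset) (linSet_subset_iff.1 h.superset)
  · rintro W ⟨-, E, hE, hEZ, hEW⟩
    exact ⟨E, ⟨hE.isVariety, hE.infinite, hEZ⟩, hEW⟩

/-- A lifted line through a point is tangent to the image of the differential. -/
theorem exists_le_map_jacobian [IsAlgClosed k] [CharZero k] (h : IsRuledMap X φ)
    {G : Fin (M + 1) → MvPolynomial (Fin (N + 1)) k} {e : ℕ} (hG : ∀ i, (G i).IsHomogeneous e)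
    (hprop : ∀ v (hv : v ≠ 0), Projectivization.mk k v hv ∈ X → ∀ w (hw : w ≠ 0),
        φ (Projectivization.mk k v hv) = Projectivization.mk k w hw →
          ∀ i j, eval w (G i) * v j = eval w (G j) * v i)
    {W : Submodule k (Fin (N + 1) → k)} (hW : finrank k W = 2) {E : Set (Pr k M)} (hE : IsCurve E)
    (hEX : E ⊆ X) (hEW : φ '' E = linSet W)
    (hEG : ¬ E ⊆ X ∩ φ ⁻¹' {p | ∀ f ∈ range G, Vanishes f p})
    {y : Fin (N + 1) → k} (hy : y ≠ 0) (hyW : y ∈ W) :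
    ∃ x ∈ X, φ x = Projectivization.mk k y hy ∧ ∀ F, Rep X φ F → tup F x.rep ≠ 0 →
      W ≤ (embTangent X x).map (jacobian F x.rep) ⊔ Submodule.span k {y} := by
  obtain ⟨e₁, hli, rfl⟩ := exists_basis_of_mem hW hy hyW
  have hmk : ∀ (s : Fin (1 + 1) → k) (hs : s ≠ 0),
      Projectivization.mk k (tup (lineTup y e₁) s) (tup_lineTup_ne_zero hli hs) ∈ φ '' E := by
    intro s hs
    rw [hEW, mk_mem_linSet, tup_lineTup]
    exact Submodule.mem_span_pair.2 ⟨_, _, rfl⟩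
  obtain ⟨Ψ, ψ, d, hψ, hΨ, hΨE, hΨs⟩ := exists_lift_line hE.isVariety.isClosed (h.mor.mono hEX) hG hli
    (fun v hv hvE => hprop v hv (hEX hvE)) (by
      obtain ⟨p, hpE, hp⟩ := not_subset.1 hEG
      by_contra! h0
      refine hp ⟨hEX hpE, ?_⟩
      rintro _ ⟨i, rfl⟩
      have hpW : φ p ∈ linSet (Submodule.span k {y, e₁}) := hEW ▸ ⟨p, hpE, rfl⟩
      generalize φ p = q at hpW
      induction q using Projectivization.ind with
      | h w hw =>
        rw [mk_mem_linSet, Submodule.mem_span_pair] at hpW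
        obtain ⟨a, b, rfl⟩ := hpW
        rw [vanishes_mk_of_isHomogeneous (hG i)]
        have := congrFun (h0 ![a, b]) i
        rw [tup_lineTup] at this
        exact this) hmk
  have hs₀ : (![1, 0] : Fin (1 + 1) → k) ≠ 0 := fun h0 => one_ne_zero (congrFun h0 0)
  obtain ⟨⟨hv₀, hx⟩, hφx⟩ := hΨs ![1, 0] hs₀
  have hty : tup (lineTup y e₁) ![1, 0] = y := by rw [tup_lineTup]; simp
  set v₀ := tup ψ ![1, 0] with hv₀def
  have hxX : Projectivization.mk k v₀ hv₀ ∈ X := hx ▸ hEX (hΨE _)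
  have hφy : φ (Projectivization.mk k v₀ hv₀) = Projectivization.mk k y hy := by
    rw [← hx, hφx]; congr 1
  refine ⟨Projectivization.mk k v₀ hv₀, hxX, hφy, fun F hF hFx => ?_⟩
  set x := Projectivization.mk k v₀ hv₀ with hxdef
  obtain ⟨m, hFm⟩ := hF.1
  obtain ⟨c, hc⟩ := (Projectivization.mk_eq_mk_iff' k _ _ hv₀ x.rep_nonzero).1
    (hxdef.symm.trans x.mk_rep.symm)
  have hFv₀ : tup F v₀ ≠ 0 := tup_ne_zero_of_mk_eq (hv := hv₀) (hw := x.rep_nonzero) hFm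
    (hxdef.symm.trans x.mk_rep.symm) hFx
  obtain ⟨c', hc'⟩ := (Projectivization.mk_eq_mk_iff' k _ _ hFv₀ hy).1
    ((hF.2 v₀ hv₀ hxX hFv₀).symm.trans hφy)
  have hc'0 : c' ≠ 0 := fun h0 => hFv₀ (by rw [← hc', h0, zero_smul])
  set w' : Fin (M + 1) → k := fun i => diffAt (ψ i) ![1, 0] ![0, 1] with hw'
  have hdiff0 : ∀ f : MvPolynomial (Fin (1 + 1)) k, (∀ s, s ≠ 0 → eval s f = 0) →
      diffAt f ![1, 0] ![0, 1] = 0 := by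
    intro f hf
    rw [eq_zero_of_forall_eval_ne_zero hf, ← diffHom_apply, map_zero, LinearMap.zero_apply]
  have hw'T : w' ∈ embTangent X x := by
    rw [hxdef, mem_embTangent]
    intro f hf
    rw [hv₀def, hw', ← diffAt_aeval]
    refine hdiff0 _ fun s hs => ?_
    obtain ⟨⟨h1, h2⟩, -⟩ := hΨs s hs
    rw [eval_aeval_tup]
    exact mem_coneIdeal'.1 hf _ h1 (h2 ▸ hEX (hΨE _))
  have hrel : ∀ i j, (diffAt (F i) v₀ w' - c' * e₁ i) * y j = (diffAt (F j) v₀ w' - c' * e₁ j) * y i := by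
    intro i j
    have h1 : diffAt (aeval ψ (F i) * lineTup y e₁ j - aeval ψ (F j) * lineTup y e₁ i)
        ![1, 0] ![0, 1] = 0 := by
      refine hdiff0 _ fun s hs => ?_
      obtain ⟨⟨h1, h2⟩, h3⟩ := hΨs s hs
      rw [map_sub, map_mul, map_mul, eval_aeval_tup, eval_aeval_tup]
      by_cases h0 : tup F (tup ψ s) = 0
      · rw [show eval (tup ψ s) (F i) = 0 from congrFun h0 i,
          show eval (tup ψ s) (F j) = 0 from congrFun h0 j]
        ring
      · have h4 := hF.2 _ h1 (h2 ▸ hEX (hΨE _)) h0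
        rw [← h2, h3] at h4
        have := proportional_of_mk_eq h4 i j
        simp only [tup_apply] at this
        linear_combination -this
    have hd : ∀ i, diffAt (lineTup y e₁ i) ![1, 0] ![0, 1] = e₁ i := by
      intro i
      rw [diffAt_apply]
      simp [lineTup, Fin.sum_univ_two, pderiv_X, Pi.single_apply]
    have he : ∀ i, eval ![1, 0] (lineTup y e₁ i) = y i := fun i => congrFun hty i
    have hF' : ∀ i, eval v₀ (F i) = c' * y i := fun i => (congrFun hc' i).symm
    rw [← diffHom_apply, map_sub, LinearMap.sub_apply, diffHom_apply, diffHom_apply, diffAt_mul,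
      diffAt_mul, diffAt_aeval, diffAt_aeval, hd, hd, he, he, eval_aeval_tup, eval_aeval_tup,
      ← hv₀def, ← hw', hF', hF'] at h1
    linear_combination h1
  have hjac : jacobian F v₀ w' ∈ (embTangent X x).map (jacobian F x.rep) := by
    refine ⟨c ^ (m - 1) • w', Submodule.smul_mem _ _ hw'T, ?_⟩
    ext i
    rw [map_smul, Pi.smul_apply, jacobian_apply, jacobian_apply, ← hc,
      diffAt_smul_of_isHomogeneous (hFm i), smul_eq_mul]
  have hmem := mem_span_of_proportional (z := jacobian F v₀ w' - c' • e₁) hy fun i j => by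
    simpa [jacobian_apply] using hrel i j
  rw [Submodule.span_le]
  rintro u (rfl | rfl)
  · exact Submodule.mem_sup_right (Submodule.mem_span_singleton_self _)
  · have h1 : c' • u = jacobian F v₀ w' - (jacobian F v₀ w' - c' • u) := by abel
    have h2 : u = c'⁻¹ • (c' • u) := by rw [smul_smul, inv_mul_cancel₀ hc'0, one_smul]
    rw [h2, h1]
    exact Submodule.smul_mem _ _ (Submodule.sub_mem _ (Submodule.mem_sup_left hjac)
      (Submodule.mem_sup_right hmem))

/-- Only finitely many lines of the surface pass through a given point. -/
theorem finite_lines_through [IsAlgClosed k] [CharZero k] (h : IsRuledMap X φ)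
    {y : Fin (N + 1) → k} (hy : y ≠ 0) : {W | W ∈ lines (φ '' X) ∧ y ∈ W}.Finite := by
  obtain ⟨G, e, hG, hprop, hlt⟩ := h.exists_inverse
  have hfib := finite_fibre h.smooth h.uncrumpled (Projectivization.mk k y hy)
  have hrep : ∀ x : Pr k M, ∃ F, x ∈ X → Rep X φ F ∧ tup F x.rep ≠ 0 := by
    intro x
    by_cases hx : x ∈ X
    · obtain ⟨F, hF⟩ := h.mor x hx
      exact ⟨F, fun _ => localRep_iff.1 hF⟩
    · exact ⟨0, fun h => absurd h hx⟩
  choose F hF using hrep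
  have h1 := h.finite_lines_lift_subset (h.isClosed_bad (range G)) hlt
  have h2 := hfib.biUnion (t := fun x => {W | W ∈ lines (φ '' X) ∧
      W ≤ (embTangent X x).map (jacobian (F x) x.rep) ⊔ Submodule.span k {y}}) (by
    rintro x ⟨hx, -⟩
    refine h.finite_lines_le fun htop => ?_
    have hr := Submodule.finrank_add_le_finrank_add_finrank
      ((embTangent X x).map (jacobian (F x) x.rep)) (Submodule.span k {y})
    have hr1 := Submodule.finrank_map_le (jacobian (F x) x.rep) (embTangent X x)
    rw [h.smooth.2.2 x hx] at hr1
    rw [htop, finrank_top, finrank_span_singleton hy, finrank_fin_fun] at hr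
    have := h.four_le
    omega)
  refine (h1.union h2).subset ?_
  rintro W ⟨hW, hyW⟩
  obtain ⟨E, hE, hEX, hEW⟩ := h.exists_curve_lift hW
  by_cases hEG : E ⊆ X ∩ φ ⁻¹' {p | ∀ f ∈ range G, Vanishes f p}
  · exact Or.inl ⟨hW, E, hE, hEG, hEW⟩
  · obtain ⟨x, hxX, hφx, hx⟩ := h.exists_le_map_jacobian hG hprop hW.1 hE hEX hEW hEG hy hyW
    refine Or.inr (mem_biUnion (x := x) ⟨hxX, hφx⟩ ⟨hW, hx _ (hF x hxX).1 (hF x hxX).2⟩)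

end IsRuledMap

theorem exists_normalized_basis {W : Submodule k (Fin (N + 1) → k)} (hW : finrank k W = 2) :
    ∃ (i j : Fin (N + 1)) (e₀ e₁ : Fin (N + 1) → k), e₀ i = 1 ∧ e₀ j = 0 ∧ e₁ i = 0 ∧ e₁ j = 1 ∧
      W = Submodule.span k {e₀, e₁} := by
  obtain ⟨u, v, hli, rfl⟩ := exists_basis_of_finrank_two hW
  have hu : u ≠ 0 := hli.ne_zero 0
  obtain ⟨i, j, hij⟩ : ∃ i j, v i * u j ≠ v j * u i := by
    by_contra! h0
    have h1 := mem_span_of_proportional hu h0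
    rw [LinearIndependent.pair_iff' hu] at hli
    obtain ⟨a, ha⟩ := Submodule.mem_span_singleton.1 h1
    exact hli a ha
  have hδ : v i * u j - v j * u i ≠ 0 := sub_ne_zero.2 hij
  have h00 : ((v i * u j - v j * u i)⁻¹ • (u j • v - v j • u)) i = 1 := by
    simp only [Pi.smul_apply, Pi.sub_apply, smul_eq_mul]
    rw [mul_comm (u j), inv_mul_cancel₀ hδ]
  have h01 : ((v i * u j - v j * u i)⁻¹ • (u j • v - v j • u)) j = 0 := by
    simp only [Pi.smul_apply, Pi.sub_apply, smul_eq_mul]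
    rw [mul_comm (u j), sub_self, mul_zero]
  have h10 : ((v i * u j - v j * u i)⁻¹ • (v i • u - u i • v)) i = 0 := by
    simp only [Pi.smul_apply, Pi.sub_apply, smul_eq_mul]
    rw [mul_comm (u i) (v i), sub_self, mul_zero]
  have h11 : ((v i * u j - v j * u i)⁻¹ • (v i • u - u i • v)) j = 1 := by
    simp only [Pi.smul_apply, Pi.sub_apply, smul_eq_mul]
    rw [mul_comm (u i), inv_mul_cancel₀ hδ]
  refine ⟨i, j, _, _, h00, h01, h10, h11, ?_⟩
  have hmem : ∀ a b c : k, c • (a • v - b • u) ∈ Submodule.span k {u, v} := fun a b c =>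
    Submodule.smul_mem _ _ (Submodule.sub_mem _
      (Submodule.smul_mem _ _ (Submodule.subset_span (by simp)))
      (Submodule.smul_mem _ _ (Submodule.subset_span (by simp))))
  refine (Submodule.eq_of_le_of_finrank_eq ?_ ?_).symm
  · rw [Submodule.span_le]
    rintro w (rfl | rfl)
    · exact hmem _ _ _
    · have := hmem (-u i) (-v i) (v i * u j - v j * u i)⁻¹
      rwa [show -u i • v - -v i • u = v i • u - u i • v by rw [neg_smul, neg_smul]; abel] at this
  · rw [hW]
    refine finrank_span_pair_eq_two (LinearIndependent.pair_iff.2 fun a b hab => ?_)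
    have ha := congrFun hab i
    have hb := congrFun hab j
    simp only [Pi.add_apply, Pi.smul_apply, smul_eq_mul] at ha hb h00 h01 h10 h11
    rw [h00, h10] at ha
    rw [h01, h11] at hb
    rw [Pi.zero_apply] at ha hb
    exact ⟨by linear_combination ha, by linear_combination hb⟩

/-- An irreducible one-parameter family of lines on `Y`, each with a basis normalized at two
coordinates. -/
structure IsLineFamily (Y : Set (Pr k N)) (i j : Fin (N + 1))
    (I : Ideal (MvPolynomial (Fin (N + 1) ⊕ Fin (N + 1)) k)) : Prop where
  infinite : {t | ∀ f ∈ I, eval t f = 0}.Infinite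
  finite_zeros : ∀ f ∉ I, {t | (∀ g ∈ I, eval t g = 0) ∧ eval t f = 0}.Finite
  inl_i : ∀ t, (∀ f ∈ I, eval t f = 0) → t (Sum.inl i) = 1
  inl_j : ∀ t, (∀ f ∈ I, eval t f = 0) → t (Sum.inl j) = 0
  inr_i : ∀ t, (∀ f ∈ I, eval t f = 0) → t (Sum.inr i) = 0
  inr_j : ∀ t, (∀ f ∈ I, eval t f = 0) → t (Sum.inr j) = 1
  inCone : ∀ t, (∀ f ∈ I, eval t f = 0) → ∀ a b : k, InCone Y (a • t ∘ Sum.inl + b • t ∘ Sum.inr)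

theorem exists_isLineFamily [Infinite k] {Y : Set (Pr k N)} (hY : IsClosed Y) (hne : Y.Nonempty)
    (hinf : (lines Y).Infinite) : ∃ i j I, IsLineFamily Y i j I := by
  let T : Fin (N + 1) → Fin (N + 1) → Set (Fin (N + 1) ⊕ Fin (N + 1) → k) := fun i j =>
    {t | t (Sum.inl i) = 1 ∧ t (Sum.inl j) = 0 ∧ t (Sum.inr i) = 0 ∧ t (Sum.inr j) = 1 ∧
      ∀ a b : k, InCone Y (a • t ∘ Sum.inl + b • t ∘ Sum.inr)}
  obtain ⟨i, j, hT⟩ : ∃ i j, (T i j).Infinite := by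
    by_contra! hfin
    refine hinf ((finite_iUnion fun i => finite_iUnion fun j =>
      (hfin i j).image (fun t => Submodule.span k {t ∘ Sum.inl, t ∘ Sum.inr})).subset ?_)
    intro W hW
    obtain ⟨i, j, e₀, e₁, h1, h2, h3, h4, rfl⟩ := exists_normalized_basis hW.1
    refine mem_iUnion.2 ⟨i, mem_iUnion.2 ⟨j, Sum.elim e₀ e₁, ⟨h1, h2, h3, h4, ?_⟩, rfl⟩⟩
    intro a b h0
    exact hW.2 (mk_mem_linSet.2 (Submodule.mem_span_pair.2 ⟨a, b, rfl⟩))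
  let Z : Ideal (MvPolynomial (Fin (N + 1) ⊕ Fin (N + 1)) k) → Set (Fin (N + 1) ⊕ Fin (N + 1) → k) :=
    fun I => {t | ∀ f ∈ I, eval t f = 0}
  have hex : ({I | Z I ⊆ T i j ∧ (Z I).Infinite} : Set (Ideal _)).Nonempty := by
    refine ⟨MvPolynomial.vanishingIdeal k (T i j), ?_, ?_⟩
    · intro t ht
      have key : ∀ f : MvPolynomial (Fin (N + 1) ⊕ Fin (N + 1)) k,
          (∀ s ∈ T i j, eval s f = 0) → eval t f = 0 := fun f hf =>
        ht f (MvPolynomial.mem_vanishingIdeal_iff.2 fun s hs => by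
          rw [MvPolynomial.aeval_eq_eval]; exact hf s hs)
      refine ⟨?_, ?_, ?_, ?_, ?_⟩
      · have := key (MvPolynomial.X (Sum.inl i) - 1) fun s hs => by simp [hs.1]
        simpa [sub_eq_zero] using this
      · have := key (MvPolynomial.X (Sum.inl j)) fun s hs => by simp [hs.2.1]
        simpa [sub_eq_zero] using this
      · have := key (MvPolynomial.X (Sum.inr i)) fun s hs => by simp [hs.2.2.1]
        simpa [sub_eq_zero] using this
      · have := key (MvPolynomial.X (Sum.inr j) - 1) fun s hs => by simp [hs.2.2.2.1]
        simpa [sub_eq_zero] using this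
      · intro a b
        refine (inCone_iff hY hne).2 fun f hf => ?_
        have htup : ∀ s : Fin (N + 1) ⊕ Fin (N + 1) → k,
            tup (fun l => C a * MvPolynomial.X (Sum.inl l) + C b * MvPolynomial.X (Sum.inr l)) s =
              a • s ∘ Sum.inl + b • s ∘ Sum.inr := fun s => by
          ext l; simp [tup_apply]
        have := key (aeval (fun l => C a * MvPolynomial.X (Sum.inl l) +
          C b * MvPolynomial.X (Sum.inr l)) f) fun s hs => by
            rw [eval_aeval_tup, htup]
            exact (hs.2.2.2.2 a b).eval_eq_zero hne hf
        rwa [eval_aeval_tup, htup] at this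
    · refine hT.mono fun t ht f hf => ?_
      have := MvPolynomial.mem_vanishingIdeal_iff.1 hf t ht
      rwa [MvPolynomial.aeval_eq_eval] at this
  obtain ⟨I, ⟨hIT, hIinf⟩, hmax⟩ := WellFounded.has_min
    (wellFounded_gt (α := Ideal (MvPolynomial (Fin (N + 1) ⊕ Fin (N + 1)) k))) _ hex
  refine ⟨i, j, I, hIinf, ?_, fun t ht => (hIT ht).1, fun t ht => (hIT ht).2.1,
    fun t ht => (hIT ht).2.2.1, fun t ht => (hIT ht).2.2.2.1, fun t ht => (hIT ht).2.2.2.2⟩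
  intro f hf
  by_contra hinf'
  have hle : I ≤ I ⊔ Ideal.span {f} := le_sup_left
  have hfm : f ∈ I ⊔ Ideal.span {f} := Ideal.mem_sup_right (Ideal.mem_span_singleton_self f)
  refine hmax (I ⊔ Ideal.span {f}) ⟨fun t ht => hIT fun g hg => ht g (hle hg), ?_⟩
    (lt_of_le_of_ne hle fun h => hf (h ▸ hfm))
  refine Set.Infinite.mono ?_ hinf'
  rintro t ⟨ht, htf⟩
  have : I ⊔ Ideal.span {f} ≤ RingHom.ker (eval t) :=
    sup_le (fun g hg => ht g hg) ((Ideal.span_singleton_le_iff_mem _).2 htf)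
  exact fun g hg => this hg

namespace IsLineFamily

variable {Y : Set (Pr k N)} {i j : Fin (N + 1)}
  {I : Ideal (MvPolynomial (Fin (N + 1) ⊕ Fin (N + 1)) k)}

theorem linearIndependent (h : IsLineFamily Y i j I) {t} (ht : ∀ f ∈ I, eval t f = 0) :
    LinearIndependent k ![t ∘ Sum.inl, t ∘ Sum.inr] := by
  refine LinearIndependent.pair_iff.2 fun a b hab => ?_
  have ha := congrFun hab i
  have hb := congrFun hab j
  simp only [Pi.add_apply, Pi.smul_apply, smul_eq_mul, Function.comp, h.inl_i t ht, h.inl_j t ht,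
    h.inr_i t ht, h.inr_j t ht] at ha hb
  exact ⟨by simpa using ha, by simpa using hb⟩

theorem mem_lines (h : IsLineFamily Y i j I) {t} (ht : ∀ f ∈ I, eval t f = 0) :
    Submodule.span k {t ∘ Sum.inl, t ∘ Sum.inr} ∈ lines Y := by
  refine ⟨finrank_span_pair_eq_two (h.linearIndependent ht), fun p hp => ?_⟩
  induction p using Projectivization.ind with
  | h v hv =>
    rw [mk_mem_linSet, Submodule.mem_span_pair] at hp
    obtain ⟨a, b, rfl⟩ := hp
    exact h.inCone t ht a b hv

theorem eq_smul_add_smul (h : IsLineFamily Y i j I) {t} (ht : ∀ f ∈ I, eval t f = 0)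
    {y : Fin (N + 1) → k} (hy : y ∈ Submodule.span k {t ∘ Sum.inl, t ∘ Sum.inr}) :
    y = y i • t ∘ Sum.inl + y j • t ∘ Sum.inr := by
  obtain ⟨a, b, rfl⟩ := Submodule.mem_span_pair.1 hy
  simp [h.inl_i t ht, h.inl_j t ht, h.inr_i t ht, h.inr_j t ht]

theorem injOn_span (h : IsLineFamily Y i j I) :
    InjOn (fun t => Submodule.span k {t ∘ Sum.inl, t ∘ Sum.inr}) {t | ∀ f ∈ I, eval t f = 0} := by
  intro t ht s hs hts
  have key : ∀ u ∈ Submodule.span k {t ∘ Sum.inl, t ∘ Sum.inr},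
      u = u i • s ∘ Sum.inl + u j • s ∘ Sum.inr := fun u hu =>
    h.eq_smul_add_smul hs (by rw [show Submodule.span k {t ∘ Sum.inl, t ∘ Sum.inr} = _ from hts] at hu; exact hu)
  have h0 := key (t ∘ Sum.inl) (Submodule.subset_span (by simp))
  have h1 := key (t ∘ Sum.inr) (Submodule.subset_span (by simp))
  simp only [Function.comp_apply, h.inl_i t ht, h.inl_j t ht, h.inr_i t ht, h.inr_j t ht,
    one_smul, zero_smul, add_zero, zero_add] at h0 h1
  funext l
  rcases l with l | l
  exacts [congrFun h0 l, congrFun h1 l]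

end IsLineFamily

/-- A determinantal polynomial testing disjointness of two lines. -/
noncomputable def disjPoly (L : Fin 4 → Fin (N + 1) → k) {τ : Type}
    (c : Fin 4 → Fin (N + 1) → MvPolynomial τ k) : MvPolynomial τ k :=
  Matrix.det (Matrix.of fun r q => ∑ l, C (L r l) * c q l)

theorem eval_disjPoly (L : Fin 4 → Fin (N + 1) → k) {τ : Type}
    (c : Fin 4 → Fin (N + 1) → MvPolynomial τ k) (x : τ → k) :
    eval x (disjPoly L c) =
      Matrix.det (Matrix.of fun r q => ∑ l, L r l * eval x (c q l) : Matrix (Fin 4) (Fin 4) k) := by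
  rw [disjPoly, RingHom.map_det]
  congr 1
  ext r q
  simp [map_sum]

theorem exists_det_ne_zero {c : Fin 4 → Fin (N + 1) → k} (h : LinearIndependent k c) :
    ∃ L : Fin 4 → Fin (N + 1) → k,
      Matrix.det (Matrix.of fun r q => ∑ l, L r l * c q l : Matrix (Fin 4) (Fin 4) k) ≠ 0 := by
  obtain ⟨g, hg⟩ := LinearMap.exists_leftInverse_of_injective (Fintype.linearCombination k c)
    (LinearMap.ker_eq_bot.2 (linearIndependent_iff_injective_fintypeLinearCombination.1 h))
  refine ⟨fun r l => g (fun m => if l = m then 1 else 0) r, ?_⟩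
  have : (Matrix.of fun r q => ∑ l, g (fun m => if l = m then 1 else 0) r * c q l :
      Matrix (Fin 4) (Fin 4) k) = 1 := by
    ext r q
    have h1 := LinearMap.congr_fun hg (Pi.single q 1)
    rw [LinearMap.comp_apply, Fintype.linearCombination_apply_single, one_smul, LinearMap.id_apply,
      LinearMap.pi_apply_eq_sum_univ] at h1
    have h2 := congrFun h1 r
    rw [Finset.sum_apply] at h2
    simp only [Pi.smul_apply, smul_eq_mul] at h2
    rw [Matrix.of_apply, Matrix.one_apply, ← Pi.single_apply, ← h2]
    exact Finset.sum_congr rfl fun l _ => mul_comm _ _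
  rw [this, Matrix.det_one]
  exact one_ne_zero

theorem linearIndependent_of_det_ne_zero {c : Fin 4 → Fin (N + 1) → k} {L : Fin 4 → Fin (N + 1) → k}
    (h : Matrix.det (Matrix.of fun r q => ∑ l, L r l * c q l : Matrix (Fin 4) (Fin 4) k) ≠ 0) :
    LinearIndependent k c := by
  refine Fintype.linearIndependent_iff.2 fun g hg => ?_
  by_contra! hne
  refine h (Matrix.exists_mulVec_eq_zero_iff.1 ⟨g, fun h0 => ?_, ?_⟩)
  · obtain ⟨q, hq⟩ := hne
    exact hq (congrFun h0 q)
  · ext r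
    simp only [Matrix.mulVec, dotProduct, Matrix.of_apply, Pi.zero_apply, Finset.sum_mul]
    rw [Finset.sum_comm]
    refine Finset.sum_eq_zero fun l _ => ?_
    have h1 := congrFun hg l
    simp only [Finset.sum_apply, Pi.smul_apply, smul_eq_mul, Pi.zero_apply] at h1
    calc ∑ q, L r l * c q l * g q = L r l * ∑ q, g q * c q l := by
          rw [Finset.mul_sum]; exact Finset.sum_congr rfl fun q _ => by ring
      _ = 0 := by rw [h1, mul_zero]

theorem linearIndependent_four_iff {a b c d : Fin (N + 1) → k} (hab : LinearIndependent k ![a, b])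
    (hcd : LinearIndependent k ![c, d]) : LinearIndependent k ![a, b, c, d] ↔
      Disjoint (Submodule.span k {a, b}) (Submodule.span k {c, d}) := by
  rw [Submodule.disjoint_def]
  constructor
  · intro h v hv hv'
    obtain ⟨p, q, rfl⟩ := Submodule.mem_span_pair.1 hv
    obtain ⟨r, s, hrs⟩ := Submodule.mem_span_pair.1 hv'
    have := Fintype.linearIndependent_iff.1 h ![p, q, -r, -s] (by
      simp only [Fin.sum_univ_four]
      simp only [Matrix.cons_val]
      rw [neg_smul, neg_smul, add_assoc, ← neg_add, hrs, add_neg_cancel])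
    have h0 := this 0
    have h1 := this 1
    simp only [Matrix.cons_val] at h0 h1
    rw [h0, h1, zero_smul, zero_smul, add_zero]
  · intro h
    refine Fintype.linearIndependent_iff.2 fun g hg => ?_
    simp only [Fin.sum_univ_four] at hg
    simp only [Matrix.cons_val] at hg
    have h1 : g 0 • a + g 1 • b = (-g 2) • c + (-g 3) • d := by
      rw [neg_smul, neg_smul, ← neg_add, eq_neg_iff_add_eq_zero, ← hg]; abel
    have h2 := h _ (Submodule.mem_span_pair.2 ⟨g 0, g 1, rfl⟩)
      (Submodule.mem_span_pair.2 ⟨_, _, h1.symm⟩)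
    have h3 := LinearIndependent.pair_iff.1 hab _ _ h2
    have h4 := LinearIndependent.pair_iff.1 hcd _ _ (h1.symm.trans h2)
    intro q
    fin_cases q
    exacts [h3.1, h3.2, neg_eq_zero.1 h4.1, neg_eq_zero.1 h4.2]

namespace IsRuledMap

variable {X : Set (Pr k M)} {φ : Pr k M → Pr k N}

/-- Among infinitely many lines of the surface there are two disjoint ones. -/
theorem exists_disjoint [IsAlgClosed k] [CharZero k] (h : IsRuledMap X φ)
    {S : Set (Submodule k (Fin (N + 1) → k))} (hS : S.Infinite) (hSY : S ⊆ lines (φ '' X)) :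
    ∃ W₁ ∈ S, ∃ W₂ ∈ S, Disjoint W₁ W₂ := by
  by_contra! hmeet
  have hmeet' : ∀ W₁ ∈ S, ∀ W₂ ∈ S, ∃ v, v ≠ 0 ∧ v ∈ W₁ ∧ v ∈ W₂ := by
    intro W₁ h₁ W₂ h₂
    have := hmeet W₁ h₁ W₂ h₂
    rw [Submodule.disjoint_def] at this
    push Not at this
    obtain ⟨v, hv1, hv2, hv⟩ := this
    exact ⟨v, hv, hv1, hv2⟩
  obtain ⟨W₁, h₁⟩ := hS.nonempty
  obtain ⟨W₂, h₂, hne⟩ := hS.exists_notMem_finite (finite_singleton W₁)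
  obtain ⟨p, hp, hp₁, hp₂⟩ := hmeet' W₁ h₁ W₂ h₂
  have hU : W₁ ⊔ W₂ ≠ ⊤ := by
    intro htop
    have hr := Submodule.finrank_add_le_finrank_add_finrank W₁ W₂
    rw [htop, finrank_top, finrank_fin_fun, (hSY h₁).1, (hSY h₂).1] at hr
    have := h.four_le
    omega
  obtain ⟨W₃, h₃, hW₃⟩ := hS.exists_notMem_finite ((h.finite_lines_through hp).union (h.finite_lines_le hU))
  obtain ⟨a, ha, ha₁, ha₃⟩ := hmeet' W₁ h₁ W₃ h₃
  obtain ⟨b, hb, hb₂, hb₃⟩ := hmeet' W₂ h₂ W₃ h₃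
  have hp₃ : p ∉ W₃ := fun hp₃ => hW₃ (Or.inl ⟨hSY h₃, hp₃⟩)
  have hspan : ∀ u v : Fin (N + 1) → k, u ≠ 0 → v ∈ Submodule.span k {u} → v ≠ 0 →
      u ∈ Submodule.span k {v} := by
    intro u v hu hv hv0
    obtain ⟨c, rfl⟩ := Submodule.mem_span_singleton.1 hv
    have hc : c ≠ 0 := fun h0 => hv0 (by rw [h0, zero_smul])
    exact Submodule.mem_span_singleton.2 ⟨c⁻¹, by rw [smul_smul, inv_mul_cancel₀ hc, one_smul]⟩
  have hgen : ∀ W : Submodule k (Fin (N + 1) → k), finrank k W = 2 → ∀ u v, u ≠ 0 → u ∈ W → v ∈ W →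
      v ∉ Submodule.span k {u} → W = Submodule.span k {u, v} := by
    intro W hW u v hu huW hvW hv
    refine (Submodule.eq_of_le_of_finrank_eq ?_ ?_).symm
    · rw [Submodule.span_le]
      rintro w (rfl | rfl)
      exacts [huW, hvW]
    · rw [finrank_span_pair_eq_two, hW]
      rw [LinearIndependent.pair_iff' hu]
      exact fun c hc => hv (Submodule.mem_span_singleton.2 ⟨c, hc⟩)
  by_cases hab : b ∈ Submodule.span k {a}
  · have hb₁ : b ∈ W₁ := (Submodule.span_singleton_le_iff_mem _ _).2 ha₁ hab
    have hbp : b ∉ Submodule.span k {p} := fun h0 =>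
      hp₃ ((Submodule.span_singleton_le_iff_mem _ _).2 hb₃ (hspan p b hp h0 hb))
    exact hne ((hgen W₂ (hSY h₂).1 p b hp hp₂ hb₂ hbp).trans
      (hgen W₁ (hSY h₁).1 p b hp hp₁ hb₁ hbp).symm)
  · refine hW₃ (Or.inr ⟨hSY h₃, ?_⟩)
    rw [hgen W₃ (hSY h₃).1 a b ha ha₃ hb₃ hab, Submodule.span_le]
    rintro w (rfl | rfl)
    exacts [Submodule.mem_sup_left ha₁, Submodule.mem_sup_right hb₂]

theorem mem_coneIdeal_of_family [IsAlgClosed k] (h : IsRuledMap X φ) {i j : Fin (N + 1)}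
    {I : Ideal (MvPolynomial (Fin (N + 1) ⊕ Fin (N + 1)) k)} (hI : IsLineFamily (φ '' X) i j I)
    {f : MvPolynomial (Fin (N + 1)) k} (hf : ∀ t, (∀ g ∈ I, eval t g = 0) →
      ∀ y ∈ Submodule.span k {t ∘ Sum.inl, t ∘ Sum.inr}, eval y f = 0) : f ∈ coneIdeal (φ '' X) := by
  refine h.subset_of_infinite_lines (hI.infinite.image hI.injOn_span) ?_ (isClosed_setOf_vanishes f) ?_
  · rintro _ ⟨t, ht, rfl⟩
    exact hI.mem_lines ht
  · rintro _ ⟨t, ht, rfl⟩ p hp v hv rfl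
    exact hf t ht v (mk_mem_linSet.1 hp)

/-- A general line of a family meets only finitely many lines of the family. -/
theorem finite_meeting [IsAlgClosed k] [CharZero k] (h : IsRuledMap X φ) {i j : Fin (N + 1)}
    {I : Ideal (MvPolynomial (Fin (N + 1) ⊕ Fin (N + 1)) k)} (hI : IsLineFamily (φ '' X) i j I) :
    ∃ f ∉ I, ∀ t, (∀ g ∈ I, eval t g = 0) → eval t f ≠ 0 →
      {t' | (∀ g ∈ I, eval t' g = 0) ∧ ¬ Disjoint (Submodule.span k {t ∘ Sum.inl, t ∘ Sum.inr})
        (Submodule.span k {t' ∘ Sum.inl, t' ∘ Sum.inr})}.Finite := by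
  obtain ⟨_, ⟨t₁, ht₁, rfl⟩, _, ⟨t₂, ht₂, rfl⟩, hd⟩ :=
    h.exists_disjoint (hI.infinite.image hI.injOn_span) (by
      rintro _ ⟨t, ht, rfl⟩; exact hI.mem_lines ht)
  obtain ⟨L, hL⟩ := exists_det_ne_zero
    ((linearIndependent_four_iff (hI.linearIndependent ht₁) (hI.linearIndependent ht₂)).2 hd)
  let A : (Fin (N + 1) ⊕ Fin (N + 1) → k) →
      MvPolynomial (Fin (N + 1) ⊕ Fin (N + 1)) k := fun t' =>
    disjPoly L ![fun l => MvPolynomial.X (Sum.inl l), fun l => MvPolynomial.X (Sum.inr l),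
      fun l => C (t' (Sum.inl l)), fun l => C (t' (Sum.inr l))]
  let B : (Fin (N + 1) ⊕ Fin (N + 1) → k) →
      MvPolynomial (Fin (N + 1) ⊕ Fin (N + 1)) k := fun t =>
    disjPoly L ![fun l => C (t (Sum.inl l)), fun l => C (t (Sum.inr l)),
      fun l => MvPolynomial.X (Sum.inl l), fun l => MvPolynomial.X (Sum.inr l)]
  have hA : ∀ t t', eval t (A t') = Matrix.det (Matrix.of fun r q => ∑ l, L r l *
      ((![t ∘ Sum.inl, t ∘ Sum.inr, t' ∘ Sum.inl, t' ∘ Sum.inr] : Fin 4 → Fin (N + 1) → k) q l)) := by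
    intro t t'
    rw [eval_disjPoly]
    congr 1
    ext r q
    fin_cases q <;> simp
  have hB : ∀ t t', eval t' (B t) = Matrix.det (Matrix.of fun r q => ∑ l, L r l *
      ((![t ∘ Sum.inl, t ∘ Sum.inr, t' ∘ Sum.inl, t' ∘ Sum.inr] : Fin 4 → Fin (N + 1) → k) q l)) := by
    intro t t'
    rw [eval_disjPoly]
    congr 1
    ext r q
    fin_cases q <;> simp
  refine ⟨A t₂, fun hmem => hL ?_, fun t ht htf => ?_⟩
  · rw [← hA]; exact hmem |> ht₁ _
  · have hBI : B t ∉ I := fun hmem => htf (by rw [hA, ← hB]; exact ht₂ _ hmem)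
    refine (hI.finite_zeros _ hBI).subset ?_
    rintro t' ⟨ht', hnd⟩
    refine ⟨ht', ?_⟩
    by_contra h0
    rw [hB] at h0
    exact hnd ((linearIndependent_four_iff (hI.linearIndependent ht) (hI.linearIndependent ht')).1
      (linearIndependent_of_det_ne_zero h0))

end IsRuledMap

/-! ### The ruling as a rational section -/

/-- The ideal of the cylinder with one free coordinate over the zero locus of `I`. -/
noncomputable def cylinderIdeal {σ : Type} (I : Ideal (MvPolynomial σ k)) :
    Ideal (MvPolynomial (σ ⊕ Unit) k) where
  carrier := {f | ∀ t, (∀ g ∈ I, eval t g = 0) → ∀ z : k, eval (Sum.elim t fun _ => z) f = 0}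
  add_mem' := fun hf hg t ht z => by rw [map_add, hf t ht z, hg t ht z, add_zero]
  zero_mem' := fun _ _ _ => map_zero _
  smul_mem' := fun c f hf t ht z => by rw [smul_eq_mul, map_mul, hf t ht z, mul_zero]

theorem mem_cylinderIdeal {σ : Type} {I : Ideal (MvPolynomial σ k)} {f : MvPolynomial (σ ⊕ Unit) k} :
    f ∈ cylinderIdeal I ↔ ∀ t, (∀ g ∈ I, eval t g = 0) → ∀ z : k,
      eval (Sum.elim t fun _ => z) f = 0 := Iff.rfl

theorem eval_comp_inl_of_forall_cylinderIdeal {σ : Type} {I : Ideal (MvPolynomial σ k)}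
    {x : σ ⊕ Unit → k} (hx : ∀ f ∈ cylinderIdeal I, eval x f = 0) :
    ∀ g ∈ I, eval (x ∘ Sum.inl) g = 0 := by
  intro g hg
  rw [← eval_rename]
  refine hx _ fun t ht z => ?_
  rw [eval_rename, Sum.elim_comp_inl]
  exact ht g hg

theorem eval_slice_left {σ : Type} (f : MvPolynomial (σ ⊕ Unit) k) (t : σ → k) (z : k) :
    eval t (aeval (Sum.elim MvPolynomial.X fun _ => C z : σ ⊕ Unit → MvPolynomial σ k) f) =
      eval (Sum.elim t fun _ => z) f := by
  rw [eval_aeval_tup]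
  congr 2
  ext s
  rcases s with s | s <;> simp [tup_apply]

theorem eval_slice_right {σ : Type} (f : MvPolynomial (σ ⊕ Unit) k) (t : σ → k) (z : k) :
    (aeval (Sum.elim (fun s => Polynomial.C (t s)) fun _ => Polynomial.X :
      σ ⊕ Unit → Polynomial k) f).eval z = eval (Sum.elim t fun _ => z) f := by
  have := AlgHom.congr_fun (comp_aeval (R := k) (Sum.elim (fun s => Polynomial.C (t s))
    fun _ => Polynomial.X : σ ⊕ Unit → Polynomial k) (Polynomial.aeval z : Polynomial k →ₐ[k] k)) f
  rw [AlgHom.comp_apply, Polynomial.coe_aeval_eq_eval] at this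
  rw [this, aeval_eq_eval]
  congr 2
  ext s
  rcases s with s | s <;> simp

theorem finite_slice_zeros {σ : Type} {f : MvPolynomial (σ ⊕ Unit) k} {t : σ → k} {z : k}
    (h : eval (Sum.elim t fun _ => z) f ≠ 0) :
    {z : k | eval (Sum.elim t fun _ => z) f = 0}.Finite := by
  have h0 : (aeval (Sum.elim (fun s => Polynomial.C (t s)) fun _ => Polynomial.X :
      σ ⊕ Unit → Polynomial k) f) ≠ 0 := fun h0 => h (by rw [← eval_slice_right, h0, Polynomial.eval_zero])
  refine (Polynomial.finite_setOf_isRoot h0).subset fun z hz => ?_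
  rw [mem_setOf_eq, Polynomial.IsRoot, eval_slice_right]
  exact hz

namespace IsLineFamily

variable {Y : Set (Pr k N)} {i j : Fin (N + 1)}
  {I : Ideal (MvPolynomial (Fin (N + 1) ⊕ Fin (N + 1)) k)}

theorem finite_slice_zeros_of_notMem (h : IsLineFamily Y i j I)
    {f : MvPolynomial ((Fin (N + 1) ⊕ Fin (N + 1)) ⊕ Unit) k} (hf : f ∉ cylinderIdeal I) :
    {t | (∀ g ∈ I, eval t g = 0) ∧ ¬ {z : k | eval (Sum.elim t fun _ => z) f = 0}.Finite}.Finite := by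
  simp only [mem_cylinderIdeal, not_forall] at hf
  obtain ⟨t, ht, z, hz⟩ := hf
  refine (h.finite_zeros (aeval (Sum.elim MvPolynomial.X fun _ => C z :
    _ → MvPolynomial (Fin (N + 1) ⊕ Fin (N + 1)) k) f) fun hmem => hz ?_).subset ?_
  · rw [← eval_slice_left]; exact ht _ hmem
  · rintro s ⟨hs, hs'⟩
    refine ⟨hs, ?_⟩
    by_contra h0
    rw [eval_slice_left] at h0
    exact hs' (finite_slice_zeros h0)

theorem isPrime_cylinderIdeal [Infinite k] (h : IsLineFamily Y i j I) :
    (cylinderIdeal I).IsPrime := by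
  refine ⟨fun htop => ?_, fun {f g} hfg => ?_⟩
  · obtain ⟨t, ht⟩ := h.infinite.nonempty
    have h1 : (1 : MvPolynomial ((Fin (N + 1) ⊕ Fin (N + 1)) ⊕ Unit) k) ∈ cylinderIdeal I :=
      htop ▸ Submodule.mem_top
    have := h1 t ht 0
    simp at this
  · by_contra! hc
    obtain ⟨t, ht, ht'⟩ := h.infinite.exists_notMem_finite
      ((h.finite_slice_zeros_of_notMem hc.1).union (h.finite_slice_zeros_of_notMem hc.2))
    have h1 : {z : k | eval (Sum.elim t fun _ => z) f = 0}.Finite := by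
      by_contra h0; exact ht' (Or.inl ⟨ht, h0⟩)
    have h2 : {z : k | eval (Sum.elim t fun _ => z) g = 0}.Finite := by
      by_contra h0; exact ht' (Or.inr ⟨ht, h0⟩)
    obtain ⟨z, hz⟩ := (h1.union h2).exists_notMem
    have := hfg t ht z
    rw [map_mul] at this
    exact hz (mul_eq_zero.1 this)

end IsLineFamily

/-- The generic point of the generic line of a family. -/
noncomputable def genericPoint (k : Type) [Field k] (N : ℕ) (l : Fin (N + 1)) :
    MvPolynomial ((Fin (N + 1) ⊕ Fin (N + 1)) ⊕ Unit) k :=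
  MvPolynomial.X (Sum.inl (Sum.inl l)) +
    MvPolynomial.X (Sum.inr ()) * MvPolynomial.X (Sum.inl (Sum.inr l))

theorem tup_genericPoint (t : Fin (N + 1) ⊕ Fin (N + 1) → k) (z : k) :
    tup (genericPoint k N) (Sum.elim t fun _ => z) = t ∘ Sum.inl + z • t ∘ Sum.inr := by
  ext l
  simp [tup_apply, genericPoint]

namespace IsRuledMap

variable {X : Set (Pr k M)} {φ : Pr k M → Pr k N} {i j : Fin (N + 1)}
  {I : Ideal (MvPolynomial (Fin (N + 1) ⊕ Fin (N + 1)) k)}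

theorem exists_coordinate_ratio [IsAlgClosed k] [CharZero k] (h : IsRuledMap X φ)
    (hI : IsLineFamily (φ '' X) i j I) (s : Fin (N + 1) ⊕ Fin (N + 1)) :
    ∃ (e : ℕ) (P Q : MvPolynomial (Fin (N + 1)) k), P.IsHomogeneous e ∧ Q.IsHomogeneous e ∧
      aeval (genericPoint k N) Q ∉ cylinderIdeal I ∧
      MvPolynomial.X (Sum.inl s) * aeval (genericPoint k N) Q - aeval (genericPoint k N) P ∈
        cylinderIdeal I := by
  have := hI.isPrime_cylinderIdeal
  have h1 : (1 : MvPolynomial ((Fin (N + 1) ⊕ Fin (N + 1)) ⊕ Unit) k) ∉ cylinderIdeal I :=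
    (Ideal.ne_top_iff_one _).1 this.ne_top
  have hval : ∀ x : (Fin (N + 1) ⊕ Fin (N + 1)) ⊕ Unit → k, (∀ g ∈ I, eval (x ∘ Sum.inl) g = 0) →
      eval x (genericPoint k N i) = 1 := by
    intro x hx
    have h1 := hI.inl_i _ hx
    have h2 := hI.inr_i _ hx
    simp only [Function.comp] at h1 h2
    simp [genericPoint, h1, h2]
  have hi : genericPoint k N i ∉ cylinderIdeal I := by
    intro hmem
    obtain ⟨t, ht⟩ := hI.infinite.nonempty
    have h0 := hmem t ht 0
    rw [hval _ (by rw [Sum.elim_comp_inl]; exact ht)] at h0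
    exact one_ne_zero h0
  rcases ratio_mem_or_exists_separated (cylinderIdeal I) (genericPoint k N) i hi
    (MvPolynomial.X (Sum.inl s)) 1 1 h1 h1 with ⟨e, P, Q, hP, hQ, hQI, hmem⟩ | ⟨c, hc, hsep⟩
  · exact ⟨e, P, Q, hP, hQ, hQI, by rwa [one_mul] at hmem⟩
  exfalso
  obtain ⟨f, hfI, hf⟩ := h.finite_meeting hI
  obtain ⟨t, ht, ht'⟩ := hI.infinite.exists_notMem_finite
    ((hI.finite_slice_zeros_of_notMem hc).union (hI.finite_zeros f hfI))
  have hcfin : {z : k | eval (Sum.elim t fun _ => z) c = 0}.Finite := by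
    by_contra h0; exact ht' (Or.inl ⟨ht, h0⟩)
  have hft : eval t f ≠ 0 := fun h0 => ht' (Or.inr ⟨ht, h0⟩)
  have hex : ∀ z : k, ∃ t', eval (Sum.elim t fun _ => z) c ≠ 0 → (∀ g ∈ I, eval t' g = 0) ∧ t' ≠ t ∧
      t ∘ Sum.inl + z • t ∘ Sum.inr ∈ Submodule.span k {t' ∘ Sum.inl, t' ∘ Sum.inr} := by
    intro z
    by_cases hz : eval (Sum.elim t fun _ => z) c = 0
    · exact ⟨t, fun h0 => absurd hz h0⟩
    obtain ⟨x', hx', -, hne, hprop⟩ := hsep (Sum.elim t fun _ => z) (fun g hg => hg t ht z) hz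
    have hx'I := eval_comp_inl_of_forall_cylinderIdeal hx'
    refine ⟨x' ∘ Sum.inl, fun _ => ⟨hx'I, fun h0 => hne ?_, ?_⟩⟩
    · have := congrFun h0 s
      simp only [Function.comp] at this
      simp [this]
    · have hx'e : x' = Sum.elim (x' ∘ Sum.inl) fun _ => x' (Sum.inr ()) := by
        ext y; rcases y with y | y <;> rfl
      have h2 : tup (genericPoint k N) (Sum.elim t fun _ => z) = tup (genericPoint k N) x' := by
        ext l
        have := hprop l
        rw [hval x' hx'I, hval (Sum.elim t fun _ => z) (by rw [Sum.elim_comp_inl]; exact ht), mul_one,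
          mul_one] at this
        exact this
      rw [tup_genericPoint, hx'e, tup_genericPoint] at h2
      rw [h2]
      exact Submodule.mem_span_pair.2 ⟨1, x' (Sum.inr ()), by simp⟩
  choose τ hτ using hex
  have hmaps : MapsTo τ {z : k | eval (Sum.elim t fun _ => z) c = 0}ᶜ
      {t' | (∀ g ∈ I, eval t' g = 0) ∧ ¬ Disjoint (Submodule.span k {t ∘ Sum.inl, t ∘ Sum.inr})
        (Submodule.span k {t' ∘ Sum.inl, t' ∘ Sum.inr})} := by
    intro z hz
    refine ⟨(hτ z hz).1, fun hd => ?_⟩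
    rw [Submodule.disjoint_def] at hd
    have h0 := hd _ (Submodule.mem_span_pair.2 ⟨1, z, by rw [one_smul]⟩) (hτ z hz).2.2
    have := congrFun h0 i
    simp [hI.inl_i t ht, hI.inr_i t ht] at this
  obtain ⟨z₁, hz₁, z₂, hz₂, hne, heq⟩ :=
    hcfin.infinite_compl.exists_ne_map_eq_of_mapsTo hmaps (hf t ht hft)
  obtain ⟨ht₁, hne₁, hmem₁⟩ := hτ z₁ hz₁
  have hmem₂ := (hτ z₂ hz₂).2.2
  rw [← heq] at hmem₂
  refine hne₁ (hI.injOn_span ht₁ ht ?_)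
  have hsub : (z₁ - z₂) • t ∘ Sum.inr ∈ Submodule.span k {τ z₁ ∘ Sum.inl, τ z₁ ∘ Sum.inr} := by
    have := Submodule.sub_mem _ hmem₁ hmem₂
    rwa [add_sub_add_left_eq_sub, ← sub_smul] at this
  have hr : t ∘ Sum.inr ∈ Submodule.span k {τ z₁ ∘ Sum.inl, τ z₁ ∘ Sum.inr} :=
    (Submodule.smul_mem_iff _ (sub_ne_zero.2 hne)).1 hsub
  have hl : t ∘ Sum.inl ∈ Submodule.span k {τ z₁ ∘ Sum.inl, τ z₁ ∘ Sum.inr} :=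
    (Submodule.add_mem_iff_left _ (Submodule.smul_mem _ _ hr)).1 hmem₁
  refine (Submodule.eq_of_le_of_finrank_eq ?_ ?_).symm
  · rw [Submodule.span_le]
    rintro w (rfl | rfl)
    exacts [hl, hr]
  · rw [(hI.mem_lines ht).1, (hI.mem_lines ht₁).1]

end IsRuledMap

/-- Polynomials `D`, `E` describing the line of a ruling through a general point of `Y`: the line
through `y` is spanned by the vectors `E(y) / D(y)`, normalized in the coordinates `i` and `j`. -/
structure IsSection (Y : Set (Pr k N)) (i j : Fin (N + 1)) (D : MvPolynomial (Fin (N + 1)) k)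
    (E : Fin (N + 1) ⊕ Fin (N + 1) → MvPolynomial (Fin (N + 1)) k) (e : ℕ) : Prop where
  pos : 0 < e
  homD : D.IsHomogeneous e
  homE : ∀ s, (E s).IsHomogeneous e
  notMem : D ∉ coneIdeal Y
  inl_i : ∀ y, InCone Y y → eval y (E (Sum.inl i)) = eval y D
  inl_j : ∀ y, InCone Y y → eval y (E (Sum.inl j)) = 0
  inr_i : ∀ y, InCone Y y → eval y (E (Sum.inr i)) = 0
  inr_j : ∀ y, InCone Y y → eval y (E (Sum.inr j)) = eval y D
  reconstruct : ∀ y, InCone Y y →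
    y i • tup E y ∘ Sum.inl + y j • tup E y ∘ Sum.inr = eval y D • y
  inCone : ∀ y, InCone Y y → ∀ a b : k, InCone Y (a • tup E y ∘ Sum.inl + b • tup E y ∘ Sum.inr)
  compat : ∀ y, InCone Y y → ∀ (a b : k) (s : Fin (N + 1) ⊕ Fin (N + 1)),
    eval y D * eval (a • tup E y ∘ Sum.inl + b • tup E y ∘ Sum.inr) (E s) =
      eval (a • tup E y ∘ Sum.inl + b • tup E y ∘ Sum.inr) D * eval y (E s)

namespace IsRuledMap

variable {X : Set (Pr k M)} {φ : Pr k M → Pr k N} {i j : Fin (N + 1)}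
  {I : Ideal (MvPolynomial (Fin (N + 1) ⊕ Fin (N + 1)) k)}

theorem exists_coordinate_polynomials [IsAlgClosed k] [CharZero k] (h : IsRuledMap X φ)
    (hI : IsLineFamily (φ '' X) i j I) :
    ∃ (e : ℕ) (D : MvPolynomial (Fin (N + 1)) k)
      (E : Fin (N + 1) ⊕ Fin (N + 1) → MvPolynomial (Fin (N + 1)) k),
      0 < e ∧ D.IsHomogeneous e ∧ (∀ s, (E s).IsHomogeneous e) ∧
      aeval (genericPoint k N) D ∉ cylinderIdeal I ∧
      ∀ s, MvPolynomial.X (Sum.inl s) * aeval (genericPoint k N) D -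
        aeval (genericPoint k N) (E s) ∈ cylinderIdeal I := by
  classical
  have hprime := hI.isPrime_cylinderIdeal
  choose d P Q hP hQ hQI hmem using h.exists_coordinate_ratio hI
  refine ⟨1 + ∑ s, d s, MvPolynomial.X i * ∏ s, Q s,
    fun s => MvPolynomial.X i * (P s * ∏ s' ∈ Finset.univ.erase s, Q s'), by omega,
    (isHomogeneous_X k i).mul (IsHomogeneous.prod _ _ _ fun s _ => hQ s), fun s => ?_, ?_, fun s => ?_⟩
  · rw [← Finset.add_sum_erase _ d (Finset.mem_univ s)]
    exact (isHomogeneous_X k i).mul ((hP s).mul (IsHomogeneous.prod _ _ _ fun s' _ => hQ s'))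
  · rw [map_mul, map_prod]
    intro h0
    rcases hprime.mem_or_mem h0 with h0 | h0
    · rw [aeval_X] at h0
      obtain ⟨t, ht⟩ := hI.infinite.nonempty
      have := h0 t ht 0
      rw [← tup_apply (genericPoint k N), tup_genericPoint] at this
      simp [hI.inl_i t ht] at this
    · obtain ⟨s, -, hs⟩ := (hprime.prod_mem_iff).1 h0
      exact hQI s hs
  · have := Ideal.mul_mem_left (cylinderIdeal I) (aeval (genericPoint k N)
      (MvPolynomial.X i * ∏ s' ∈ Finset.univ.erase s, Q s')) (hmem s)
    rw [← Finset.mul_prod_erase _ Q (Finset.mem_univ s)]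
    simp only [map_mul] at this ⊢
    convert this using 1
    ring

theorem exists_isSection [IsAlgClosed k] [CharZero k] (h : IsRuledMap X φ) :
    ∃ i j D E e, IsSection (φ '' X) i j D E e := by
  have hne : (φ '' X).Nonempty := h.variety_image.2.1
  have hcl : IsClosed (φ '' X) := h.variety_image.isClosed
  obtain ⟨i, j, I, hI⟩ := exists_isLineFamily hcl hne h.ruled.infinite_lines
  obtain ⟨e, D, E, he, hD, hE, hDI, hmem⟩ := h.exists_coordinate_polynomials hI
  have star : ∀ t, (∀ g ∈ I, eval t g = 0) →
      ∀ y ∈ Submodule.span k {t ∘ Sum.inl, t ∘ Sum.inr}, ∀ s, eval y (E s) = t s * eval y D := by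
    intro t ht
    have h1 : ∀ (z : k) s, eval (t ∘ Sum.inl + z • t ∘ Sum.inr) (E s) =
        t s * eval (t ∘ Sum.inl + z • t ∘ Sum.inr) D := by
      intro z s
      have := hmem s t ht z
      rw [map_sub, map_mul, eval_aeval_tup, eval_aeval_tup, tup_genericPoint, eval_X,
        Sum.elim_inl] at this
      exact (sub_eq_zero.1 this).symm
    have h2 : ∀ (a b : k) s, a ≠ 0 → eval (a • t ∘ Sum.inl + b • t ∘ Sum.inr) (E s) =
        t s * eval (a • t ∘ Sum.inl + b • t ∘ Sum.inr) D := by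
      intro a b s ha
      have h3 : a • t ∘ Sum.inl + b • t ∘ Sum.inr =
          a • (t ∘ Sum.inl + (a⁻¹ * b) • t ∘ Sum.inr) := by
        rw [smul_add, smul_smul, mul_inv_cancel_left₀ ha]
      rw [h3, eval_smul_of_isHomogeneous (hE s), eval_smul_of_isHomogeneous hD, h1]
      ring
    intro y hy s
    obtain ⟨a, b, rfl⟩ := Submodule.mem_span_pair.1 hy
    let v : Fin (N + 1) → Polynomial k := fun l =>
      Polynomial.X * Polynomial.C (t (Sum.inl l)) + Polynomial.C (b * t (Sum.inr l))
    have hv : ∀ (g : MvPolynomial (Fin (N + 1)) k) a, (aeval v g).eval a =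
        eval (a • t ∘ Sum.inl + b • t ∘ Sum.inr) g := by
      intro g a
      have := AlgHom.congr_fun (comp_aeval (R := k) v
        (Polynomial.aeval a : Polynomial k →ₐ[k] k)) g
      rw [AlgHom.comp_apply, Polynomial.coe_aeval_eq_eval] at this
      rw [this, aeval_eq_eval]
      congr 2
      ext l
      simp only [v, Polynomial.eval_add, Polynomial.eval_mul, Polynomial.eval_X, Polynomial.eval_C,
        Pi.add_apply, Pi.smul_apply, smul_eq_mul, Function.comp]
    have h0 : aeval v (E s) - Polynomial.C (t s) * aeval v D = 0 := by
      refine Polynomial.eq_zero_of_infinite_isRoot _ ?_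
      refine ((finite_singleton (0 : k)).infinite_compl).mono fun a ha => ?_
      rw [mem_setOf_eq, Polynomial.IsRoot, Polynomial.eval_sub, Polynomial.eval_mul, hv, hv,
        Polynomial.eval_C, h2 a b s ha, sub_self]
    have := congrArg (Polynomial.eval a) h0
    rw [Polynomial.eval_sub, Polynomial.eval_mul, hv, hv, Polynomial.eval_C,
      Polynomial.eval_zero] at this
    exact sub_eq_zero.1 this
  have key : ∀ f : MvPolynomial (Fin (N + 1)) k, (∀ t, (∀ g ∈ I, eval t g = 0) →
      ∀ y ∈ Submodule.span k {t ∘ Sum.inl, t ∘ Sum.inr}, eval y f = 0) →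
      ∀ y, InCone (φ '' X) y → eval y f = 0 := fun f hf y hy =>
    hy.eval_eq_zero hne (h.mem_coneIdeal_of_family hI hf)
  have htup : ∀ t, (∀ g ∈ I, eval t g = 0) →
      ∀ y ∈ Submodule.span k {t ∘ Sum.inl, t ∘ Sum.inr}, ∀ a b : k,
      a • tup E y ∘ Sum.inl + b • tup E y ∘ Sum.inr =
        eval y D • (a • t ∘ Sum.inl + b • t ∘ Sum.inr) := by
    intro t ht y hy a b
    ext l
    simp only [Pi.add_apply, Pi.smul_apply, smul_eq_mul, Function.comp, tup_apply, star t ht y hy]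
    ring
  have hpt : ∀ t, (∀ g ∈ I, eval t g = 0) → ∀ a b c : k,
      c • (a • t ∘ Sum.inl + b • t ∘ Sum.inr) ∈ Submodule.span k {t ∘ Sum.inl, t ∘ Sum.inr} :=
    fun t ht a b c => Submodule.smul_mem _ _ (Submodule.mem_span_pair.2 ⟨a, b, rfl⟩)
  have hev : ∀ (a b : k) (g : MvPolynomial (Fin (N + 1)) k) (y : Fin (N + 1) → k),
      eval y (aeval (fun l => C a * E (Sum.inl l) + C b * E (Sum.inr l)) g) =
        eval (a • tup E y ∘ Sum.inl + b • tup E y ∘ Sum.inr) g := by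
    intro a b g y
    rw [eval_aeval_tup]
    congr 2
    ext l
    simp [tup_apply]
  refine ⟨i, j, D, E, e, he, hD, hE, ?_, ?_, ?_, ?_, ?_, ?_, ?_, ?_⟩
  · intro hDY
    refine hDI fun t ht z => ?_
    rw [eval_aeval_tup, tup_genericPoint]
    have := hI.inCone t ht 1 z
    rw [one_smul] at this
    exact this.eval_eq_zero hne hDY
  · intro y hy
    rw [← sub_eq_zero, ← map_sub]
    refine key _ (fun t ht y hy => ?_) y hy
    rw [map_sub, star t ht y hy, hI.inl_i t ht, one_mul, sub_self]
  · intro y hy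
    refine key _ (fun t ht y hy => ?_) y hy
    rw [star t ht y hy, hI.inl_j t ht, zero_mul]
  · intro y hy
    refine key _ (fun t ht y hy => ?_) y hy
    rw [star t ht y hy, hI.inr_i t ht, zero_mul]
  · intro y hy
    rw [← sub_eq_zero, ← map_sub]
    refine key _ (fun t ht y hy => ?_) y hy
    rw [map_sub, star t ht y hy, hI.inr_j t ht, one_mul, sub_self]
  · intro y hy
    ext l
    have := key (MvPolynomial.X i * E (Sum.inl l) + MvPolynomial.X j * E (Sum.inr l) -
      D * MvPolynomial.X l) (fun t ht y hy => ?_) y hy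
    · simpa [tup_apply, sub_eq_zero] using this
    · simp only [map_sub, map_add, map_mul, eval_X, star t ht y hy]
      have := congrFun (hI.eq_smul_add_smul ht hy) l
      simp only [Pi.add_apply, Pi.smul_apply, smul_eq_mul, Function.comp] at this
      rw [this]
      ring
  · intro y hy a b
    refine inCone_of_forall hcl fun f d hf hfY => ?_
    rw [← hev]
    refine key _ (fun t ht y hy => ?_) y hy
    rw [hev, htup t ht y hy]
    exact ((hI.inCone t ht a b).smul _).eval_eq_zero hne hfY
  · intro y hy a b s
    rw [← hev, ← hev, ← map_mul, ← map_mul, ← sub_eq_zero, ← map_sub]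
    refine key _ (fun t ht y hy => ?_) y hy
    rw [map_sub, map_mul, map_mul, hev, hev, htup t ht y hy, star t ht _ (hpt t ht _ _ _),
      star t ht y hy]
    ring

end IsRuledMap

/-! ### Hyperplanes in general position -/

theorem exists_functional_ne_zero [Infinite k] {n : ℕ} (v : Fin n → k) {Q : Set (Fin n → k)}
    (hQ : Q.Finite) (h : ∀ q ∈ Q, q ∉ Submodule.span k {v}) :
    ∃ ξ : (Fin n → k) →ₗ[k] k, ξ v = 0 ∧ ∀ q ∈ Q, ξ q ≠ 0 := by
  have := hQ.to_subtype
  obtain ⟨ξ, hξ, hξQ⟩ := Module.Dual.exists_forall_mem_ne_zero_of_forall_exists (K := k)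
    (Submodule.dualAnnihilator (Submodule.span k {v})) 
    (fun q : Q => Module.Dual.eval k (Fin n → k) q) fun q => by
      obtain ⟨ξ, hξ, hq⟩ := Submodule.exists_le_ker_of_notMem (h q q.2)
      exact ⟨ξ, (Submodule.mem_dualAnnihilator _).2 fun w hw => hq hw, hξ⟩
  exact ⟨ξ, (Submodule.mem_dualAnnihilator _).1 hξ _ (Submodule.mem_span_singleton_self v),
    fun q hq => hξQ ⟨q, hq⟩⟩

/-- The hyperplane `ξ = 0` contains no line of `Y` and meets the locus `g = 0` in finitely many
points. -/
structure IsGood (Y : Set (Pr k N)) (g : MvPolynomial (Fin (N + 1)) k)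
    (ξ : (Fin (N + 1) → k) →ₗ[k] k) : Prop where
  not_le : ∀ W ∈ lines Y, ¬ W ≤ LinearMap.ker ξ
  finite : {p | p ∈ Y ∧ Vanishes g p ∧ p ∈ linSet (LinearMap.ker ξ)}.Finite

namespace IsRuledMap

variable {X : Set (Pr k M)} {φ : Pr k M → Pr k N}

theorem infinite_image [Infinite k] (h : IsRuledMap X φ) {E : Set (Pr k M)} (hE : E ⊆ X)
    (hinf : E.Infinite) : (φ '' E).Infinite := by
  intro hfin
  refine hinf ((hfin.biUnion fun y _ => finite_fibre h.smooth h.uncrumpled y).subset fun x hx => ?_)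
  exact mem_biUnion (mem_image_of_mem φ hx) ⟨hE hx, rfl⟩

theorem exists_rep_notMem_span [Infinite k] (h : IsRuledMap X φ) {v : Fin (N + 1) → k} (hv : v ≠ 0)
    {E : Set (Pr k M)} (hE : E ⊆ X) (hinf : E.Infinite) :
    ∃ p ∈ φ '' E, p.rep ∉ Submodule.span k {v} := by
  obtain ⟨p, hp, hpv⟩ := (h.infinite_image hE hinf).exists_notMem_finite
    (finite_singleton (Projectivization.mk k v hv))
  refine ⟨p, hp, fun hmem => hpv ?_⟩
  obtain ⟨c, hc⟩ := Submodule.mem_span_singleton.1 hmem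
  rw [mem_singleton_iff, ← p.mk_rep, Projectivization.mk_eq_mk_iff']
  exact ⟨c, hc⟩

theorem finite_inter_preimage [IsAlgClosed k] (h : IsRuledMap X φ) {Z : Set (Pr k M)}
    (hZ : IsClosed Z) (hZX : Z ⊆ X) {ξ : (Fin (N + 1) → k) →ₗ[k] k}
    (hξ : ∀ E, IsVariety E → E.Infinite → E ⊆ Z → ∃ p ∈ φ '' E, ξ p.rep ≠ 0) :
    (Z ∩ φ ⁻¹' linSet (LinearMap.ker ξ)).Finite := by
  by_contra hinf
  have hcl : IsClosed (Z ∩ φ ⁻¹' linSet (LinearMap.ker ξ)) :=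
    (h.mor.mono hZX).isClosed_preimage hZ (isClosed_linSet _)
  obtain ⟨E, hE, hEZ, hEinf⟩ := exists_infinite_variety hcl hinf
  obtain ⟨_, ⟨x, hx, rfl⟩, hp⟩ := hξ E hE hEinf (hEZ.trans inter_subset_left)
  have := (hEZ hx).2
  rw [mem_preimage, ← (φ x).mk_rep, mk_mem_linSet] at this
  exact hp this

theorem exists_hyperplane [IsAlgClosed k] (h : IsRuledMap X φ) {Z : Set (Pr k M)}
    (hZ : IsClosed Z) (hZX : Z ⊂ X) {v : Fin (N + 1) → k} (hv : v ≠ 0)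
    {Q : Set (Fin (N + 1) → k)} (hQ : Q.Finite) (hQv : ∀ q ∈ Q, q ∉ Submodule.span k {v}) :
    ∃ R : Set (Fin (N + 1) → k), R.Finite ∧ Q ⊆ R ∧ (∀ q ∈ R, q ∉ Submodule.span k {v}) ∧
      ∀ ξ : (Fin (N + 1) → k) →ₗ[k] k, (∀ q ∈ R, ξ q ≠ 0) →
        (Z ∩ φ ⁻¹' linSet (LinearMap.ker ξ)).Finite := by
  have hfin := finite_curves h.smooth.2.1 h.variety hZ hZX
  have hex : ∀ E : Set (Pr k M), ∃ p, E ∈ {E | IsVariety E ∧ E.Infinite ∧ E ⊆ Z} →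
      p ∈ φ '' E ∧ p.rep ∉ Submodule.span k {v} := by
    intro E
    by_cases hE : E ∈ {E | IsVariety E ∧ E.Infinite ∧ E ⊆ Z}
    · obtain ⟨p, hp⟩ := h.exists_rep_notMem_span hv (hE.2.2.trans hZX.subset) hE.2.1
      exact ⟨p, fun _ => hp⟩
    · exact ⟨Projectivization.mk k v hv, fun h0 => absurd h0 hE⟩
  choose p hp using hex
  refine ⟨Q ∪ (fun E => (p E).rep) '' {E | IsVariety E ∧ E.Infinite ∧ E ⊆ Z}, hQ.union (hfin.image _),
    subset_union_left, ?_, fun ξ hξ => h.finite_inter_preimage hZ hZX.subset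
      fun E hE hinf hEZ => ⟨p E, (hp E ⟨hE, hinf, hEZ⟩).1, hξ _ (Or.inr ⟨E, ⟨hE, hinf, hEZ⟩, rfl⟩)⟩⟩
  rintro q (hq | ⟨E, hE, rfl⟩)
  exacts [hQv q hq, (hp E hE).2]

/-- Through every point there is a hyperplane in general position, avoiding finitely many other
given points. -/
theorem exists_isGood [IsAlgClosed k] [CharZero k] (h : IsRuledMap X φ)
    {g : MvPolynomial (Fin (N + 1)) k} (hg : g ∉ coneIdeal (φ '' X)) {v : Fin (N + 1) → k}
    (hv : v ≠ 0) {Q : Set (Fin (N + 1) → k)} (hQ : Q.Finite)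
    (hQv : ∀ q ∈ Q, q ∉ Submodule.span k {v}) :
    ∃ ξ : (Fin (N + 1) → k) →ₗ[k] k, IsGood (φ '' X) g ξ ∧ ξ v = 0 ∧ ∀ q ∈ Q, ξ q ≠ 0 := by
  have hZ : X ∩ φ ⁻¹' {p | Vanishes g p} ⊂ X := by
    refine ⟨inter_subset_left, fun hsub => hg ?_⟩
    rintro _ ⟨x, hx, rfl⟩
    exact (hsub hx).2
  obtain ⟨q₀, hq₀⟩ : ∃ q₀, q₀ ∉ Submodule.span k {v} := by
    by_contra! hall
    have h1 := finrank_span_singleton (K := k) hv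
    rw [(Submodule.eq_top_iff'.2 hall), finrank_top, finrank_fin_fun] at h1
    have := h.four_le
    omega
  obtain ⟨R₁, hR₁, hQR₁, hR₁v, hfin₁⟩ := h.exists_hyperplane
    (h.mor.isClosed_preimage h.closed (isClosed_setOf_vanishes g)) hZ hv (hQ.insert q₀) (by
      rintro q (rfl | hq)
      exacts [hq₀, hQv q hq])
  obtain ⟨ξ₁, hξ₁v, hξ₁⟩ := exists_functional_ne_zero v hR₁ hR₁v
  have hZ₁ : X ∩ φ ⁻¹' linSet (LinearMap.ker ξ₁) ⊂ X := by
    refine ⟨inter_subset_left, fun hsub => h.uncrumpled.2.1.not_subset_linSet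
      (W := LinearMap.ker ξ₁) (fun htop => ?_) ?_⟩
    · have : q₀ ∈ LinearMap.ker ξ₁ := htop ▸ Submodule.mem_top
      exact hξ₁ _ (hQR₁ (mem_insert _ _)) this
    · rintro _ ⟨x, hx, rfl⟩
      exact (hsub hx).2
  obtain ⟨R₂, hR₂, -, hR₂v, hfin₂⟩ := h.exists_hyperplane
    (h.mor.isClosed_preimage h.closed (isClosed_linSet _)) hZ₁ hv finite_empty (by simp)
  obtain ⟨ξ₂, hξ₂v, hξ₂⟩ := exists_functional_ne_zero v hR₂ hR₂v
  have hF := hfin₂ ξ₂ hξ₂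
  have hbase : ∀ u : Fin (N + 1) → k, ∀ hu : u ≠ 0, Projectivization.mk k u hu ∈ φ '' X →
      ξ₁ u = 0 → ξ₂ u = 0 → Projectivization.mk k u hu ∈ φ ''
        (X ∩ φ ⁻¹' linSet (LinearMap.ker ξ₁) ∩ φ ⁻¹' linSet (LinearMap.ker ξ₂)) := by
    rintro u hu ⟨x, hx, hxu⟩ h1 h2
    refine ⟨x, ⟨⟨hx, ?_⟩, ?_⟩, hxu⟩
    · rw [mem_preimage, hxu, mk_mem_linSet]; exact h1
    · rw [mem_preimage, hxu, mk_mem_linSet]; exact h2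
  have hlines : {W | W ∈ lines (φ '' X) ∧ ∃ p ∈ φ '' (X ∩ φ ⁻¹' linSet (LinearMap.ker ξ₁) ∩
      φ ⁻¹' linSet (LinearMap.ker ξ₂)), p.rep ∈ W}.Finite := by
    refine ((hF.image φ).biUnion fun p _ => h.finite_lines_through p.rep_nonzero).subset ?_
    rintro W ⟨hW, p, hp, hpW⟩
    exact mem_biUnion hp ⟨hW, hpW⟩
  have hnot : ∀ W ∈ lines (φ '' X), ∃ u ∈ W, ξ₁ u ≠ 0 ∨ ξ₂ u ≠ 0 := by
    intro W hW
    by_contra! h0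
    refine (isCurve_linSet hW.1).infinite ((hF.image φ).subset fun p hp => ?_)
    have hpY := hW.2 hp
    induction p using Projectivization.ind with
    | h u hu =>
      rw [mk_mem_linSet] at hp
      exact hbase u hu hpY (h0 u hp).1 (h0 u hp).2
  have hc₁ : {c : k | ∃ W ∈ lines (φ '' X), W ≤ LinearMap.ker (ξ₁ + c • ξ₂)}.Finite := by
    refine (hlines.biUnion (t := fun W => {c : k | W ≤ LinearMap.ker (ξ₁ + c • ξ₂)})
      fun W hW => ?_).subset ?_
    · refine Set.Subsingleton.finite fun c hc c' hc' => ?_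
      obtain ⟨u, hu, hu'⟩ := hnot W hW.1
      have h1 : ξ₁ u + c * ξ₂ u = 0 := hc hu
      have h2 : ξ₁ u + c' * ξ₂ u = 0 := hc' hu
      by_contra hne
      have h3 : (c - c') * ξ₂ u = 0 := by linear_combination h1 - h2
      have h4 := (mul_eq_zero.1 h3).resolve_left (sub_ne_zero.2 hne)
      rw [h4, mul_zero, add_zero] at h1
      exact hu'.elim (fun h5 => h5 h1) fun h5 => h5 h4
    · rintro c ⟨W, hW, hWc⟩
      refine mem_biUnion (x := W) ⟨hW, ?_⟩ hWc
      obtain ⟨a, b, hab, rfl⟩ := exists_basis_of_finrank_two hW.1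
      obtain ⟨u, hu, huW, hu2⟩ : ∃ u, u ≠ 0 ∧ u ∈ Submodule.span k {a, b} ∧ ξ₂ u = 0 := by
        by_cases hb : ξ₂ b = 0
        · exact ⟨b, hab.ne_zero 1, Submodule.subset_span (by simp), hb⟩
        · refine ⟨ξ₂ b • a + (-ξ₂ a) • b, fun h0 => ?_, Submodule.mem_span_pair.2 ⟨_, _, rfl⟩, ?_⟩
          · exact hb (LinearIndependent.pair_iff.1 hab _ _ h0).1
          · simp only [map_add, map_smul, smul_eq_mul]; ring
      have hu1 : ξ₁ u = 0 := by
        have : ξ₁ u + c * ξ₂ u = 0 := hWc huW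
        rwa [hu2, mul_zero, add_zero] at this
      have hmem := hbase u hu (hW.2 (mk_mem_linSet.2 huW)) hu1 hu2
      refine ⟨_, hmem, ?_⟩
      rw [← mk_mem_linSet (hv := Projectivization.rep_nonzero _), Projectivization.mk_rep, mk_mem_linSet]
      exact huW
  have hc₂ : {c : k | ∃ q ∈ R₁, ξ₁ q + c * ξ₂ q = 0}.Finite := by
    refine (hR₁.biUnion (t := fun q => {c : k | ξ₁ q + c * ξ₂ q = 0}) fun q hq => ?_).subset ?_
    · refine Set.Subsingleton.finite fun c hc c' hc' => ?_
      have h1 : ξ₁ q + c * ξ₂ q = 0 := hc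
      have h2 : ξ₁ q + c' * ξ₂ q = 0 := hc'
      by_contra hne
      have h3 : (c - c') * ξ₂ q = 0 := by linear_combination h1 - h2
      have h4 := (mul_eq_zero.1 h3).resolve_left (sub_ne_zero.2 hne)
      rw [h4, mul_zero, add_zero] at h1
      exact hξ₁ q hq h1
    · rintro c ⟨q, hq, hc⟩
      exact mem_biUnion hq hc
  obtain ⟨c, hc⟩ := (hc₁.union hc₂).exists_notMem
  have hcR : ∀ q ∈ R₁, (ξ₁ + c • ξ₂) q ≠ 0 := fun q hq h0 => hc (Or.inr ⟨q, hq, h0⟩)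
  refine ⟨ξ₁ + c • ξ₂, ⟨fun W hW hle => hc (Or.inl ⟨W, hW, hle⟩), ?_⟩, ?_, fun q hq =>
    hcR q (hQR₁ (mem_insert_of_mem _ hq))⟩
  · refine ((hfin₁ _ hcR).image φ).subset ?_
    rintro _ ⟨⟨x, hx, rfl⟩, h1, h2⟩
    exact ⟨x, ⟨⟨hx, h1⟩, h2⟩, rfl⟩
  · rw [LinearMap.add_apply, LinearMap.smul_apply, hξ₁v, hξ₂v, smul_zero, add_zero]

end IsRuledMap

/-! ### Intersecting the lines of the ruling with a hyperplane -/

/-- The point where the hyperplane `ξ = 0` meets the line of the ruling through a point, as a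
tuple of polynomials. -/
noncomputable def hypTup (E : Fin (N + 1) ⊕ Fin (N + 1) → MvPolynomial (Fin (N + 1)) k)
    (ξ : (Fin (N + 1) → k) →ₗ[k] k) : Fin (N + 1) → MvPolynomial (Fin (N + 1)) k :=
  fun l => (∑ m, C (ξ (Pi.single m 1)) * E (Sum.inr m)) * E (Sum.inl l) -
    (∑ m, C (ξ (Pi.single m 1)) * E (Sum.inl m)) * E (Sum.inr l)

theorem sum_functional_single {n : ℕ} (ξ : (Fin n → k) →ₗ[k] k) (v : Fin n → k) :
    ∑ m, ξ (Pi.single m 1) * v m = ξ v := by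
  rw [LinearMap.pi_apply_eq_sum_univ ξ v]
  refine Finset.sum_congr rfl fun m _ => ?_
  rw [smul_eq_mul, mul_comm]
  congr 2
  ext l
  simp [Pi.single_apply, eq_comm]

theorem tup_hypTup (E : Fin (N + 1) ⊕ Fin (N + 1) → MvPolynomial (Fin (N + 1)) k)
    (ξ : (Fin (N + 1) → k) →ₗ[k] k) (y : Fin (N + 1) → k) :
    tup (hypTup E ξ) y = ξ (tup E y ∘ Sum.inr) • tup E y ∘ Sum.inl +
      (-ξ (tup E y ∘ Sum.inl)) • tup E y ∘ Sum.inr := by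
  ext l
  rw [← sum_functional_single ξ (tup E y ∘ Sum.inr), ← sum_functional_single ξ (tup E y ∘ Sum.inl)]
  simp only [tup_apply, hypTup, map_sub, map_mul, map_sum, eval_C, Pi.add_apply, Pi.smul_apply,
    Function.comp, smul_eq_mul]
  ring

theorem functional_tup_hypTup (E : Fin (N + 1) ⊕ Fin (N + 1) → MvPolynomial (Fin (N + 1)) k)
    (ξ : (Fin (N + 1) → k) →ₗ[k] k) (y : Fin (N + 1) → k) : ξ (tup (hypTup E ξ) y) = 0 := by
  rw [tup_hypTup, map_add, map_smul, map_smul, smul_eq_mul, smul_eq_mul]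
  ring

namespace IsSection

variable {Y : Set (Pr k N)} {i j : Fin (N + 1)} {D : MvPolynomial (Fin (N + 1)) k}
  {E : Fin (N + 1) ⊕ Fin (N + 1) → MvPolynomial (Fin (N + 1)) k} {e : ℕ}

theorem isHomogeneous_hypTup (h : IsSection Y i j D E e) (ξ : (Fin (N + 1) → k) →ₗ[k] k)
    (l : Fin (N + 1)) : (hypTup E ξ l).IsHomogeneous (e + e) := by
  have hs : ∀ s : Fin (N + 1) → Fin (N + 1) ⊕ Fin (N + 1),
      (∑ m, C (ξ (Pi.single m 1)) * E (s m)).IsHomogeneous e := fun s =>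
    IsHomogeneous.sum _ _ _ fun m _ => (h.homE (s m)).C_mul _
  exact ((hs _).mul (h.homE _)).sub ((hs _).mul (h.homE _))

theorem ne_zero (h : IsSection Y i j D E e) {y : Fin (N + 1) → k} (hD : eval y D ≠ 0) : y ≠ 0 := by
  rintro rfl
  have := eval_smul_of_isHomogeneous h.homD 0 (0 : Fin (N + 1) → k)
  rw [zero_pow h.pos.ne', zero_mul, smul_zero] at this
  exact hD this

theorem linearIndependent (h : IsSection Y i j D E e) {y : Fin (N + 1) → k} (hy : InCone Y y)
    (hD : eval y D ≠ 0) : LinearIndependent k ![tup E y ∘ Sum.inl, tup E y ∘ Sum.inr] := by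
  refine LinearIndependent.pair_iff.2 fun a b hab => ?_
  have ha := congrFun hab i
  have hb := congrFun hab j
  simp only [Pi.add_apply, Pi.smul_apply, smul_eq_mul, Function.comp, tup_apply, h.inl_i y hy,
    h.inl_j y hy, h.inr_i y hy, h.inr_j y hy, Pi.zero_apply, mul_zero, add_zero, zero_add,
    mul_eq_zero, hD, or_false] at ha hb
  exact ⟨ha, hb⟩

theorem mem_lines (h : IsSection Y i j D E e) {y : Fin (N + 1) → k} (hy : InCone Y y)
    (hD : eval y D ≠ 0) : Submodule.span k {tup E y ∘ Sum.inl, tup E y ∘ Sum.inr} ∈ lines Y := by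
  refine ⟨finrank_span_pair_eq_two (h.linearIndependent hy hD), fun p hp => ?_⟩
  induction p using Projectivization.ind with
  | h v hv =>
    rw [mk_mem_linSet, Submodule.mem_span_pair] at hp
    obtain ⟨a, b, rfl⟩ := hp
    exact h.inCone y hy a b hv

theorem mem_span (h : IsSection Y i j D E e) {y : Fin (N + 1) → k} (hy : InCone Y y)
    (hD : eval y D ≠ 0) : y ∈ Submodule.span k {tup E y ∘ Sum.inl, tup E y ∘ Sum.inr} := by
  have h1 : eval y D • y ∈ Submodule.span k {tup E y ∘ Sum.inl, tup E y ∘ Sum.inr} := by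
    rw [← h.reconstruct y hy]
    exact Submodule.mem_span_pair.2 ⟨_, _, rfl⟩
  exact (Submodule.smul_mem_iff _ hD).1 h1

theorem tup_hypTup_mem_span (E : Fin (N + 1) ⊕ Fin (N + 1) → MvPolynomial (Fin (N + 1)) k)
    (ξ : (Fin (N + 1) → k) →ₗ[k] k) (y : Fin (N + 1) → k) :
    tup (hypTup E ξ) y ∈ Submodule.span k {tup E y ∘ Sum.inl, tup E y ∘ Sum.inr} := by
  rw [tup_hypTup]
  exact Submodule.mem_span_pair.2 ⟨_, _, rfl⟩

theorem inCone_tup_hypTup (h : IsSection Y i j D E e) (ξ : (Fin (N + 1) → k) →ₗ[k] k)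
    {y : Fin (N + 1) → k} (hy : InCone Y y) : InCone Y (tup (hypTup E ξ) y) := by
  rw [tup_hypTup]
  exact h.inCone y hy _ _

theorem inCone_of_mem_span (h : IsSection Y i j D E e)
    {y z : Fin (N + 1) → k} (hy : InCone Y y)
    (hz : z ∈ Submodule.span k {tup E y ∘ Sum.inl, tup E y ∘ Sum.inr}) : InCone Y z := by
  obtain ⟨a, b, rfl⟩ := Submodule.mem_span_pair.1 hz
  exact h.inCone y hy a b

theorem tup_hypTup_ne_zero (h : IsSection Y i j D E e) {g : MvPolynomial (Fin (N + 1)) k}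
    {ξ : (Fin (N + 1) → k) →ₗ[k] k} (hξ : IsGood Y g ξ) {y : Fin (N + 1) → k} (hy : InCone Y y)
    (hD : eval y D ≠ 0) : tup (hypTup E ξ) y ≠ 0 := by
  intro h0
  rw [tup_hypTup] at h0
  obtain ⟨h1, h2⟩ := LinearIndependent.pair_iff.1 (h.linearIndependent hy hD) _ _ h0
  refine hξ.not_le _ (h.mem_lines hy hD) (Submodule.span_le.2 ?_)
  rintro _ (rfl | rfl)
  exacts [neg_eq_zero.1 h2, h1]

/-- A point of the hyperplane is fixed. -/
theorem exists_tup_hypTup_eq_smul (h : IsSection Y i j D E e) {g : MvPolynomial (Fin (N + 1)) k}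
    {ξ : (Fin (N + 1) → k) →ₗ[k] k} (hξ : IsGood Y g ξ) {y : Fin (N + 1) → k} (hy : InCone Y y)
    (hD : eval y D ≠ 0) (hξy : ξ y = 0) : ∃ c : k, c ≠ 0 ∧ tup (hypTup E ξ) y = c • y := by
  have hT := h.tup_hypTup_ne_zero hξ hy hD
  have hrec := h.reconstruct y hy
  have h0 : y i * ξ (tup E y ∘ Sum.inl) + y j * ξ (tup E y ∘ Sum.inr) = 0 := by
    have := congrArg ξ hrec
    rwa [map_add, map_smul, map_smul, map_smul, hξy, smul_zero] at this
  have hrec' : ∀ l, y i * tup E y (Sum.inl l) + y j * tup E y (Sum.inr l) = eval y D * y l :=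
    fun l => congrFun hrec l
  have hi : y i • tup (hypTup E ξ) y = (ξ (tup E y ∘ Sum.inr) * eval y D) • y := by
    rw [tup_hypTup]
    ext l
    simp only [Pi.smul_apply, Pi.add_apply, smul_eq_mul, Function.comp_apply]
    linear_combination ξ (tup E y ∘ Sum.inr) * hrec' l - tup E y (Sum.inr l) * h0
  have hj : y j • tup (hypTup E ξ) y = (-ξ (tup E y ∘ Sum.inl) * eval y D) • y := by
    rw [tup_hypTup]
    ext l
    simp only [Pi.smul_apply, Pi.add_apply, smul_eq_mul, Function.comp_apply]
    linear_combination -ξ (tup E y ∘ Sum.inl) * hrec' l + tup E y (Sum.inl l) * h0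
  obtain ⟨c, hc⟩ : ∃ c : k, tup (hypTup E ξ) y = c • y := by
    by_cases hyi : y i = 0
    · have hyj : y j ≠ 0 := by
        intro hyj
        rw [hyi, hyj, zero_smul, zero_smul, zero_add] at hrec
        exact smul_ne_zero hD (h.ne_zero hD) hrec.symm
      exact ⟨(y j)⁻¹ * _, by rw [mul_smul, ← hj, inv_smul_smul₀ hyj]⟩
    · exact ⟨(y i)⁻¹ * _, by rw [mul_smul, ← hi, inv_smul_smul₀ hyi]⟩
  refine ⟨c, fun h0 => hT ?_, hc⟩
  rw [hc, h0, zero_smul]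

theorem smul_tup_hypTup_tup_hypTup (h : IsSection Y i j D E e) (ξ ξ' : (Fin (N + 1) → k) →ₗ[k] k)
    {y : Fin (N + 1) → k} (hy : InCone Y y) :
    eval y D ^ 2 • tup (hypTup E ξ) (tup (hypTup E ξ') y) =
      eval (tup (hypTup E ξ') y) D ^ 2 • tup (hypTup E ξ) y := by
  have hc : ∀ s, eval y D * tup E (tup (hypTup E ξ') y) s =
      eval (tup (hypTup E ξ') y) D * tup E y s := by
    intro s
    rw [tup_hypTup E ξ' y]
    exact h.compat y hy _ _ s
  have hl : eval y D • tup E (tup (hypTup E ξ') y) ∘ Sum.inl =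
      eval (tup (hypTup E ξ') y) D • tup E y ∘ Sum.inl := funext fun l => hc (Sum.inl l)
  have hr : eval y D • tup E (tup (hypTup E ξ') y) ∘ Sum.inr =
      eval (tup (hypTup E ξ') y) D • tup E y ∘ Sum.inr := funext fun l => hc (Sum.inr l)
  have hξl := congrArg ξ hl
  have hξr := congrArg ξ hr
  rw [map_smul, map_smul, smul_eq_mul, smul_eq_mul] at hξl hξr
  rw [tup_hypTup E ξ, tup_hypTup E ξ y]
  set z := tup (hypTup E ξ') y
  ext l
  simp only [Pi.smul_apply, Pi.add_apply, smul_eq_mul, Function.comp_apply]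
  linear_combination (eval y D * tup E z (Sum.inl l)) * hξr +
    (eval z D * ξ (tup E y ∘ Sum.inr)) * hc (Sum.inl l) -
    (eval y D * tup E z (Sum.inr l)) * hξl -
    (eval z D * ξ (tup E y ∘ Sum.inl)) * hc (Sum.inr l)

end IsSection

namespace IsRuledMap

variable {X : Set (Pr k M)} {φ : Pr k M → Pr k N} {i j : Fin (N + 1)}
  {D : MvPolynomial (Fin (N + 1)) k}
  {E : Fin (N + 1) ⊕ Fin (N + 1) → MvPolynomial (Fin (N + 1)) k} {e : ℕ}

/-- If the residual points all lay in `g = 0`, finitely many lines would sweep out the surface. -/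
theorem aeval_hypTup_notMem [IsAlgClosed k] [CharZero k] (h : IsRuledMap X φ)
    (hs : IsSection (φ '' X) i j D E e) {g : MvPolynomial (Fin (N + 1)) k} {d : ℕ}
    (hg : g.IsHomogeneous d) {ξ : (Fin (N + 1) → k) →ₗ[k] k} (hξ : IsGood (φ '' X) g ξ) :
    aeval (hypTup E ξ) g ∉ coneIdeal (φ '' X) := by
  intro hmem
  have hne := h.variety_image.2.1
  set S := {p | p ∈ φ '' X ∧ Vanishes g p ∧ p ∈ linSet (LinearMap.ker ξ)} with hS
  have hfin : {W | W ∈ lines (φ '' X) ∧ ∃ p ∈ S, p.rep ∈ W}.Finite := by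
    refine (hξ.finite.biUnion fun p _ => h.finite_lines_through p.rep_nonzero).subset ?_
    rintro W ⟨hW, p, hp, hpW⟩
    exact mem_biUnion hp ⟨hW, hpW⟩
  have hcover : φ '' X ⊆ ⋃₀ (insert {p | Vanishes D p}
      (linSet '' {W | W ∈ lines (φ '' X) ∧ ∃ p ∈ S, p.rep ∈ W})) := by
    intro p hp
    induction p using Projectivization.ind with
    | h y hy =>
    by_cases hD : eval y D = 0
    · exact ⟨_, Or.inl rfl, (vanishes_mk_of_isHomogeneous hs.homD hy).2 hD⟩
    have hyc : InCone (φ '' X) y := inCone_mk hp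
    have hT := hs.tup_hypTup_ne_zero hξ hyc hD
    refine ⟨_, Or.inr ⟨_, ⟨hs.mem_lines hyc hD, Projectivization.mk k _ hT,
      ⟨hs.inCone_tup_hypTup ξ hyc hT, ?_, mk_mem_linSet.2 (functional_tup_hypTup E ξ y)⟩, ?_⟩, rfl⟩,
      mk_mem_linSet.2 (hs.mem_span hyc hD)⟩
    · rw [vanishes_mk_of_isHomogeneous hg, ← eval_aeval_tup]
      exact hyc.eval_eq_zero hne hmem
    · rw [← mk_mem_linSet (hv := Projectivization.rep_nonzero _), Projectivization.mk_rep,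
        mk_mem_linSet]
      exact IsSection.tup_hypTup_mem_span E ξ y
  have hfin' := (hfin.image linSet).insert {p | Vanishes D p}
  obtain ⟨Z, hZ, hYZ⟩ := isIrreducible_iff_sUnion_isClosed.1 h.variety_image.isIrreducible
    hfin'.toFinset (fun Z hZ => by
      rw [Finite.mem_toFinset] at hZ
      rcases hZ with rfl | ⟨W, -, rfl⟩
      exacts [isClosed_setOf_vanishes D, isClosed_linSet W]) (by rwa [Finite.coe_toFinset])
  rw [Finite.mem_toFinset] at hZ
  rcases hZ with rfl | ⟨W, hW, rfl⟩
  · exact hs.notMem fun p hp => hYZ hp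
  · exact h.uncrumpled.2.1.not_subset_linSet (h.ne_top_of_mem_lines hW.1.1) hYZ

end IsRuledMap

/-! ### The projection along the ruling onto a hyperplane section -/

theorem Rep.exists_tup_eq_smul {X : Set (Pr k M)} {φ : Pr k M → Pr k N}
    {F : Fin (N + 1) → MvPolynomial (Fin (M + 1)) k} (hF : Rep X φ F) {v : Fin (M + 1) → k}
    {hv : v ≠ 0} (hvX : Projectivization.mk k v hv ∈ X) {y : Fin (N + 1) → k} {hy : y ≠ 0}
    (h : φ (Projectivization.mk k v hv) = Projectivization.mk k y hy) : ∃ c : k, tup F v = c • y := by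
  by_cases h0 : tup F v = 0
  · exact ⟨0, by rw [h0, zero_smul]⟩
  · have := (hF.2 v hv hvX h0).symm.trans h
    rw [Projectivization.mk_eq_mk_iff'] at this
    obtain ⟨c, hc⟩ := this
    exact ⟨c, hc.symm⟩

theorem IsVariety.exists_rep {X : Set (Pr k M)} (hX : IsVariety X) {φ : Pr k M → Pr k N}
    (hφ : IsMorphismOn X φ) : ∃ F, Rep X φ F ∧ ∃ i, F i ∉ coneIdeal X := by
  obtain ⟨p, hp⟩ := hX.2.1
  induction p using Projectivization.ind with
  | h v hv =>
    obtain ⟨F, hF, hFv⟩ := isMorphismOn_iff.1 hφ v hv hp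
    obtain ⟨i, hi⟩ := Function.ne_iff.1 hFv
    exact ⟨F, hF, i, fun h => hi (mem_coneIdeal'.1 h v hv hp)⟩

theorem Rep.aeval_notMem [Infinite k] {X : Set (Pr k M)} (hX : IsVariety X) {φ : Pr k M → Pr k N}
    (hφ : IsMorphismOn X φ) {F : Fin (N + 1) → MvPolynomial (Fin (M + 1)) k} (hF : Rep X φ F)
    (hF0 : ∃ i, F i ∉ coneIdeal X) {f : MvPolynomial (Fin (N + 1)) k} {d : ℕ}
    (hfd : f.IsHomogeneous d) (hf : f ∉ coneIdeal (φ '' X)) : aeval F f ∉ coneIdeal X := by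
  intro hmem
  obtain ⟨i, hi⟩ := hF0
  have h1 := isPreirreducible_iff_isClosed_union_isClosed.1 hX.isIrreducible.2 _ _
    (hφ.isClosed_preimage hX.isClosed (isClosed_setOf_vanishes f)) (isClosed_setOf_vanishes (F i)) (by
      intro p hp
      induction p using Projectivization.ind with
      | h v hv =>
        obtain ⟨e, he⟩ := hF.1
        by_cases h0 : eval v (F i) = 0
        · exact Or.inr ((vanishes_mk_of_isHomogeneous (he i) hv).2 h0)
        · refine Or.inl ⟨hp, ?_⟩
          have hFv : tup F v ≠ 0 := fun h => h0 (congrFun h i)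
          rw [mem_preimage, hF.2 v hv hp hFv, mem_setOf_eq, vanishes_mk_of_isHomogeneous hfd,
            ← eval_aeval_tup]
          exact mem_coneIdeal'.1 hmem v hv hp)
  rcases h1 with h1 | h1
  · refine hf ?_
    rintro _ ⟨x, hx, rfl⟩
    exact (h1 hx).2
  · exact hi fun p hp => h1 hp

theorem eval_map_aeval {σ τ ι : Type} (v : τ → k) (u : σ → k)
    (H : ι → MvPolynomial σ (MvPolynomial τ k)) (f : MvPolynomial ι k) :
    eval u (MvPolynomial.map (eval v) (aeval H f)) =
      eval (fun l => eval u (MvPolynomial.map (eval v) (H l))) f := by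
  induction f using MvPolynomial.induction_on with
  | C a =>
    rw [aeval_C, eval_C, IsScalarTower.algebraMap_apply k (MvPolynomial τ k), algebraMap_eq,
      algebraMap_eq, map_C, eval_C, eval_C]
  | add p q hp hq => rw [map_add, map_add, map_add, map_add, hp, hq]
  | mul_X p i hp => rw [map_mul, map_mul, map_mul, map_mul, hp, aeval_X, eval_X]

theorem eval_map_map_C {σ τ : Type} (v : τ → k) (u : σ → k) (f : MvPolynomial σ k) :
    eval u (MvPolynomial.map (eval v) (MvPolynomial.map C f)) = eval u f := by
  rw [MvPolynomial.map_map, show (eval v).comp C = RingHom.id k from RingHom.ext fun a => eval_C a,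
    MvPolynomial.map_id]

theorem eval_map_pencil (v u : Fin (M + 1) → k) (a b : k)
    (F' F'' : Fin (N + 1) → MvPolynomial (Fin (M + 1)) k) (f : MvPolynomial (Fin (N + 1)) k) :
    eval u (MvPolynomial.map (eval v)
      (aeval (fun l => C (C a * F' l) + C (C b) * MvPolynomial.map C (F'' l)) f)) =
      eval (a • tup F' v + b • tup F'' u) f := by
  rw [eval_map_aeval]
  refine congrArg (fun w => eval w f) (funext fun l => ?_)
  simp only [map_add, map_mul, map_C, eval_C, eval_map_map_C, Pi.add_apply, Pi.smul_apply,
    smul_eq_mul, tup_apply]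

theorem subsingleton_linSet_inf {W : Submodule k (Fin (N + 1) → k)} (hW : finrank k W = 2)
    {ξ : (Fin (N + 1) → k) →ₗ[k] k} (h : ¬ W ≤ LinearMap.ker ξ) :
    (linSet (W ⊓ LinearMap.ker ξ)).Subsingleton := by
  intro p hp q hq
  have hlt : finrank k ↥(W ⊓ LinearMap.ker ξ) < finrank k W :=
    Submodule.finrank_lt_finrank_of_lt (lt_of_le_of_ne inf_le_left fun h0 => h (inf_eq_left.1 h0))
  rw [hW] at hlt
  obtain ⟨v, hv⟩ := finrank_le_one_iff.1 (Nat.lt_succ_iff.1 hlt)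
  induction p using Projectivization.ind with
  | h a ha =>
  induction q using Projectivization.ind with
  | h b hb =>
    rw [mk_mem_linSet] at hp hq
    obtain ⟨c, hc⟩ := hv ⟨a, hp⟩
    obtain ⟨c', hc'⟩ := hv ⟨b, hq⟩
    replace hc : c • (v : Fin (N + 1) → k) = a := congrArg Subtype.val hc
    replace hc' : c' • (v : Fin (N + 1) → k) = b := congrArg Subtype.val hc'
    refine eq_mk_of_proportional ha hb fun i j => ?_
    rw [← hc, ← hc']
    simp only [Pi.smul_apply, smul_eq_mul]
    ring

/-- `G` defines a rational inverse of `φ`. -/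
structure IsInverse (X : Set (Pr k M)) (φ : Pr k M → Pr k N)
    (G : Fin (M + 1) → MvPolynomial (Fin (N + 1)) k) (e : ℕ) : Prop where
  isHomogeneous : ∀ i, (G i).IsHomogeneous e
  proportional : ∀ v (hv : v ≠ 0), Projectivization.mk k v hv ∈ X → ∀ w (hw : w ≠ 0),
    φ (Projectivization.mk k v hv) = Projectivization.mk k w hw →
      ∀ i j, eval w (G i) * v j = eval w (G j) * v i

/-- `ρ` moves the points of `X` along the ruling to the hyperplane `ξ = 0`. -/
structure IsProjection (X : Set (Pr k M)) (φ : Pr k M → Pr k N) (D : MvPolynomial (Fin (N + 1)) k)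
    (T : Fin (N + 1) → MvPolynomial (Fin (N + 1)) k) (G₀ : MvPolynomial (Fin (N + 1)) k)
    (ξ : (Fin (N + 1) → k) →ₗ[k] k) (ρ : Pr k M → Pr k M) : Prop where
  mor : IsMorphismOn X ρ
  mapsTo : MapsTo ρ X X
  mem_linSet : ∀ x ∈ X, φ (ρ x) ∈ linSet (LinearMap.ker ξ)
  joined : ∀ x ∈ X, ∀ v (hv : v ≠ 0) w (hw : w ≠ 0), φ x = Projectivization.mk k v hv →
    φ (ρ x) = Projectivization.mk k w hw → ∀ a b : k, InCone (φ '' X) (a • v + b • w)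
  eq_of_mk_eq : ∀ x ∈ X, ∀ y (hy : y ≠ 0), φ x = Projectivization.mk k y hy → eval y D ≠ 0 →
    eval (tup T y) G₀ ≠ 0 → ∀ z ∈ X, ∀ hT : tup T y ≠ 0, φ z = Projectivization.mk k (tup T y) hT →
      ρ x = z

namespace IsRuledMap

variable {X : Set (Pr k M)} {φ : Pr k M → Pr k N} {i j : Fin (N + 1)}
  {D : MvPolynomial (Fin (N + 1)) k}
  {E : Fin (N + 1) ⊕ Fin (N + 1) → MvPolynomial (Fin (N + 1)) k} {e d : ℕ}
  {G : Fin (M + 1) → MvPolynomial (Fin (N + 1)) k}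

/-- Finitely many points of `X` can correspond to a given one under the projection. -/
theorem finite_joined [IsAlgClosed k] [CharZero k] (h : IsRuledMap X φ)
    {g : MvPolynomial (Fin (N + 1)) k} {ξ : (Fin (N + 1) → k) →ₗ[k] k} (hξ : IsGood (φ '' X) g ξ)
    {y : Fin (N + 1) → k} (hy : y ≠ 0) :
    {x | x ∈ X ∧ ∃ w, ∃ hw : w ≠ 0, φ x = Projectivization.mk k w hw ∧ ξ w = 0 ∧
      ∀ a b : k, InCone (φ '' X) (a • y + b • w)}.Finite := by
  have hfib : ∀ S : Set (Pr k N), S.Finite → {x | x ∈ X ∧ φ x ∈ S}.Finite := fun S hS =>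
    (hS.biUnion fun z _ => finite_fibre h.smooth h.uncrumpled z).subset fun x hx =>
      mem_biUnion hx.2 ⟨hx.1, rfl⟩
  refine ((hfib _ (finite_singleton (Projectivization.mk k y hy))).union (hfib _
    ((h.finite_lines_through hy).biUnion (t := fun W => linSet (W ⊓ LinearMap.ker ξ)) fun W hW =>
      (subsingleton_linSet_inf hW.1.1 (hξ.not_le W hW.1)).finite))).subset ?_
  rintro x ⟨hx, w, hw, hxw, hξw, hjoin⟩
  by_cases hind : LinearIndependent k ![y, w]
  · refine Or.inr ⟨hx, mem_biUnion (x := Submodule.span k {y, w}) ⟨⟨finrank_span_pair_eq_two hind,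
      fun p hp => ?_⟩, Submodule.subset_span (by simp)⟩ ?_⟩
    · induction p using Projectivization.ind with
      | h v hv =>
        rw [mk_mem_linSet, Submodule.mem_span_pair] at hp
        obtain ⟨a, b, rfl⟩ := hp
        exact hjoin a b hv
    · rw [hxw, mk_mem_linSet]
      exact ⟨Submodule.subset_span (by simp), hξw⟩
  · refine Or.inl ⟨hx, ?_⟩
    rw [LinearIndependent.pair_iff' hy] at hind
    push Not at hind
    obtain ⟨c, hc⟩ := hind
    rw [mem_singleton_iff, hxw, Projectivization.mk_eq_mk_iff']
    exact ⟨c, hc⟩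

theorem exists_isProjection [IsAlgClosed k] [CharZero k] (h : IsRuledMap X φ)
    (hs : IsSection (φ '' X) i j D E e) (hG : IsInverse X φ G d) {i₀ : Fin (M + 1)}
    {ξ : (Fin (N + 1) → k) →ₗ[k] k} (hξ : IsGood (φ '' X) (D * G i₀) ξ) :
    ∃ ρ, IsProjection X φ D (hypTup E ξ) (G i₀) ξ ρ := by
  have hne := h.variety_image.2.1
  have hT := hs.isHomogeneous_hypTup ξ
  obtain ⟨F, hF, hF0⟩ := h.variety.exists_rep h.mor
  obtain ⟨n, hn⟩ := hF.1
  set T := hypTup E ξ with hTdef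
  have hTG : ∀ l, (aeval T (G l)).IsHomogeneous ((e + e) * d) := fun l => (hG.isHomogeneous l).aeval _ hT
  have hb₀ : D * aeval T (G i₀) ∉ coneIdeal (φ '' X) := by
    intro h0
    rcases h.variety_image.isPrime.mem_or_mem h0 with h0 | h0
    · exact hs.notMem h0
    · refine h.aeval_hypTup_notMem hs (hs.homD.mul (hG.isHomogeneous i₀)) hξ ?_
      rw [map_mul]
      exact Ideal.mul_mem_left _ _ h0
  have hb := Rep.aeval_notMem h.variety h.mor hF hF0 (hs.homD.mul (hTG i₀)) hb₀
  rw [map_mul] at hb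
  have hr0 : aeval F (aeval T (G i₀)) ∉ coneIdeal X := fun h0 => hb (Ideal.mul_mem_left _ _ h0)
  have hrF : ∀ F' : Fin (N + 1) → MvPolynomial (Fin (M + 1)) k, ∀ v,
      tup (fun l => aeval F' (aeval T (G l))) v = tup G (tup T (tup F' v)) := by
    intro F' v
    ext l
    rw [tup_apply, eval_aeval_tup, eval_aeval_tup, tup_apply]
  have hgen : ∀ (v : Fin (M + 1) → k) (hv : v ≠ 0), Projectivization.mk k v hv ∈ X →
      eval v (aeval F D * aeval F (aeval T (G i₀))) ≠ 0 → ∀ c : k, c ≠ 0 →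
      ∃ y, ∃ hy : y ≠ 0, φ (Projectivization.mk k v hv) = Projectivization.mk k y hy ∧
        InCone (φ '' X) y ∧ eval y D ≠ 0 ∧ tup F v = y ∧ ∃ hTy : tup T y ≠ 0,
        ∃ hu : c • tup (fun l => aeval F (aeval T (G l))) v ≠ 0,
          Projectivization.mk k _ hu ∈ X ∧
            φ (Projectivization.mk k _ hu) = Projectivization.mk k _ hTy := by
    intro v hv hvX hbv c hc
    rw [map_mul, eval_aeval_tup, eval_aeval_tup, eval_aeval_tup] at hbv
    have hD := left_ne_zero_of_mul hbv
    have hG0 := right_ne_zero_of_mul hbv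
    have hy := hs.ne_zero hD
    have hxy := hF.2 v hv hvX hy
    have hyc : InCone (φ '' X) (tup F v) := inCone_mk (hy := hy) (hxy ▸ mem_image_of_mem φ hvX)
    have hTy : tup T (tup F v) ≠ 0 := hs.tup_hypTup_ne_zero hξ hyc hD
    have hr : tup (fun l => aeval F (aeval T (G l))) v ≠ 0 := by
      rw [hrF]
      exact fun h0 => hG0 (congrFun h0 i₀)
    refine ⟨_, hy, hxy, hyc, hD, rfl, hTy, smul_ne_zero hc hr, ?_⟩
    obtain ⟨z, hzX, hz⟩ := hs.inCone_tup_hypTup ξ hyc hTy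
    rw [mk_smul_eq hr hc]
    suffices hzr : Projectivization.mk k _ hr = z by rw [hzr]; exact ⟨hzX, hz⟩
    induction z using Projectivization.ind with
    | h u hu =>
      refine eq_mk_of_proportional hr hu fun l m => ?_
      rw [hrF]
      simp only [tup_apply]
      linear_combination hG.proportional u hu hzX _ hTy hz l m
  have R1 : ∀ f ∈ coneIdeal X, IsRelation X (aeval F D * aeval F (aeval T (G i₀)))
      (fun l => aeval F (aeval T (G l))) (MvPolynomial.map C f) := by
    intro f hf v hv hvX hbv c hc
    obtain ⟨y, hy, hxy, hyc, hD, hFv, hTy, hu, huX, hφu⟩ := hgen v hv hvX hbv c hc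
    rw [eval_map_map_C]
    exact mem_coneIdeal'.1 hf _ hu huX
  have R2 : ∀ F'', Rep X φ F'' → IsRelation X (aeval F D * aeval F (aeval T (G i₀)))
      (fun l => aeval F (aeval T (G l)))
      (MvPolynomial.map C (∑ m, C (ξ (Pi.single m 1)) * F'' m)) := by
    intro F'' hF'' v hv hvX hbv c hc
    obtain ⟨y, hy, hxy, hyc, hD, hFv, hTy, hu, huX, hφu⟩ := hgen v hv hvX hbv c hc
    obtain ⟨c', hc'⟩ := hF''.exists_tup_eq_smul huX hφu
    rw [eval_map_map_C]
    simp only [map_sum, map_mul, eval_C]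
    refine (sum_functional_single ξ (tup F'' _)).trans ?_
    rw [hc', map_smul, functional_tup_hypTup, smul_zero]
  have R3 : ∀ F' F'', Rep X φ F' → Rep X φ F'' → ∀ a b : k, ∀ f ∈ coneIdeal (φ '' X),
      IsRelation X (aeval F D * aeval F (aeval T (G i₀))) (fun l => aeval F (aeval T (G l)))
        (aeval (fun l => C (C a * F' l) + C (C b) * MvPolynomial.map C (F'' l)) f) := by
    intro F' F'' hF' hF'' a b f hf v hv hvX hbv c hc
    obtain ⟨y, hy, hxy, hyc, hD, hFv, hTy, hu, huX, hφu⟩ := hgen v hv hvX hbv c hc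
    obtain ⟨c', hc'⟩ := hF'.exists_tup_eq_smul hvX hxy
    obtain ⟨c'', hc''⟩ := hF''.exists_tup_eq_smul huX hφu
    rw [eval_map_pencil]
    have hin : InCone (φ '' X) (a • tup F' v + b • tup F'' (c • tup (fun l => aeval F (aeval T (G l))) v)) := by
      rw [hc', hc'']
      refine hs.inCone_of_mem_span hyc (add_mem ?_ ?_)
      · exact Submodule.smul_mem _ _ (Submodule.smul_mem _ _ (hs.mem_span hyc hD))
      · exact Submodule.smul_mem _ _ (Submodule.smul_mem _ _ (IsSection.tup_hypTup_mem_span E ξ y))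
    exact hin.eval_eq_zero hne hf
  have R4 : ∀ F', Rep X φ F' → ∀ l m,
      IsRelation X (aeval F D * aeval F (aeval T (G i₀))) (fun l => aeval F (aeval T (G l)))
        (C (aeval F' (aeval T (G l))) * MvPolynomial.X m -
          C (aeval F' (aeval T (G m))) * MvPolynomial.X l) := by
    intro F' hF' l m v hv hvX hbv c hc
    obtain ⟨y, hy, hxy, hyc, hD, hFv, hTy, hu, huX, hφu⟩ := hgen v hv hvX hbv c hc
    obtain ⟨c', hc'⟩ := hF'.exists_tup_eq_smul hvX hxy
    have h1 : tup (fun l => aeval F' (aeval T (G l))) v =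
        (c' ^ (e + e)) ^ d • tup (fun l => aeval F (aeval T (G l))) v := by
      rw [hrF, hrF, hc', hFv, tup_smul hT, tup_smul hG.isHomogeneous]
    have hl := congrFun h1 l
    have hm := congrFun h1 m
    rw [tup_apply] at hl hm
    rw [map_sub, map_sub, map_mul, map_mul, map_mul, map_mul, map_C, map_C, map_X, map_X, eval_C,
      eval_C, eval_X, eval_X, hl, hm]
    simp only [Pi.smul_apply, smul_eq_mul]
    ring
  have hX1 : ∀ (v q : Fin (M + 1) → k) (hq : q ≠ 0), (∀ f, IsRelation X
      (aeval F D * aeval F (aeval T (G i₀))) (fun l => aeval F (aeval T (G l))) f →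
        eval q (MvPolynomial.map (eval v) f) = 0) → Projectivization.mk k q hq ∈ X := by
    intro v q hq hrel
    refine inCone_of_forall h.closed (fun f d _ hf => ?_) hq
    rw [← eval_map_map_C v]
    exact hrel _ (R1 f hf)
  have hX2 : ∀ (v q : Fin (M + 1) → k), (∀ f, IsRelation X
      (aeval F D * aeval F (aeval T (G i₀))) (fun l => aeval F (aeval T (G l))) f →
        eval q (MvPolynomial.map (eval v) f) = 0) → ∀ F'', Rep X φ F'' → ξ (tup F'' q) = 0 := by
    intro v q hrel F'' hF''
    rw [← sum_functional_single, ← hrel _ (R2 F'' hF''), eval_map_map_C]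
    simp only [map_sum, map_mul, eval_C, tup_apply]
  have hX3 : ∀ (v q : Fin (M + 1) → k), (∀ f, IsRelation X
      (aeval F D * aeval F (aeval T (G i₀))) (fun l => aeval F (aeval T (G l))) f →
        eval q (MvPolynomial.map (eval v) f) = 0) → ∀ F' F'', Rep X φ F' → Rep X φ F'' →
        ∀ a b : k, InCone (φ '' X) (a • tup F' v + b • tup F'' q) := by
    intro v q hrel F' F'' hF' hF'' a b
    refine inCone_of_forall h.variety_image.isClosed fun f d _ hf => ?_
    rw [← hrel _ (R3 F' F'' hF' hF'' a b f hf), eval_map_pencil]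
  obtain ⟨ρ, hρ, -, hrel⟩ := exists_morphism_of_finite_fibres h.smooth hb
    (e := (n * ((e + e) * d))) (fun l => (hTG l).aeval _ hn) ⟨i₀, hr0⟩ (by
      intro v hv hvX
      obtain ⟨F', hF', hFv⟩ := isMorphismOn_iff.1 h.mor v hv hvX
      refine ⟨_, h.finite_joined hξ hFv, fun q hq hrel => ?_⟩
      have hqX := hX1 v q hq hrel
      obtain ⟨F'', hF'', hFq⟩ := isMorphismOn_iff.1 h.mor q hq hqX
      exact ⟨hqX, _, hFq, hF''.2 q hq hqX hFq, hX2 v q hrel F'' hF'', hX3 v q hrel F' F'' hF' hF''⟩)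
  have hmaps : MapsTo ρ X X := by
    intro p hp
    induction p using Projectivization.ind with
    | h v hv =>
      have hq := (ρ (Projectivization.mk k v hv)).mk_rep
      rw [← hq]
      exact hX1 v _ (Projectivization.rep_nonzero _) fun f hf => hrel f hf v hv _ _ hp hq.symm
  refine ⟨ρ, hρ, hmaps, fun p hp => ?_, fun p hp y hy w hw hpy hpw a b => ?_,
    fun p hp y hy hpy hD hG0 z hz hTy hφz => ?_⟩
  all_goals induction p using Projectivization.ind with | h v hv => ?_
  all_goals
    have hq := (ρ (Projectivization.mk k v hv)).mk_rep
    have hqX := hmaps hp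
    set q := (ρ (Projectivization.mk k v hv)).rep
    have hq0 : q ≠ 0 := Projectivization.rep_nonzero _
    have hrelv := fun f hf => hrel f hf v hv q hq0 hp hq.symm
    rw [← hq] at hqX
  · obtain ⟨F'', hF'', hFq⟩ := isMorphismOn_iff.1 h.mor q hq0 hqX
    rw [← hq, hF''.2 q hq0 hqX hFq, mk_mem_linSet]
    exact hX2 v q hrelv F'' hF''
  · obtain ⟨F', hF', hFv⟩ := isMorphismOn_iff.1 h.mor v hv hp
    obtain ⟨F'', hF'', hFq⟩ := isMorphismOn_iff.1 h.mor q hq0 hqX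
    rw [hF'.2 v hv hp hFv, eq_comm, Projectivization.mk_eq_mk_iff'] at hpy
    rw [← hq, hF''.2 q hq0 hqX hFq, eq_comm, Projectivization.mk_eq_mk_iff'] at hpw
    obtain ⟨c', rfl⟩ := hpy
    obtain ⟨c'', rfl⟩ := hpw
    rw [smul_smul, smul_smul]
    exact hX3 v q hrelv F' F'' hF' hF'' _ _
  · obtain ⟨F', hF', hFv⟩ := isMorphismOn_iff.1 h.mor v hv hp
    obtain ⟨c', hc'⟩ := hF'.exists_tup_eq_smul hp hpy
    have hc0 : c' ≠ 0 := fun h0 => hFv (by rw [hc', h0, zero_smul])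
    rw [← hq]
    induction z using Projectivization.ind with
    | h u hu =>
      have h1 : tup (fun l => aeval F' (aeval T (G l))) v = (c' ^ (e + e)) ^ d • tup G (tup T y) := by
        rw [hrF, hc', tup_smul hT, tup_smul hG.isHomogeneous]
      have h2 : ∀ l m, eval (tup T y) (G l) * q m = eval (tup T y) (G m) * q l := by
        intro l m
        have := hrelv _ (R4 F' hF' l m)
        have hl := congrFun h1 l
        have hm := congrFun h1 m
        rw [tup_apply] at hl hm
        rw [map_sub, map_sub, map_mul, map_mul, map_mul, map_mul, map_C, map_C, map_X, map_X, eval_C,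
          eval_C, eval_X, eval_X, hl, hm] at this
        simp only [Pi.smul_apply, smul_eq_mul, tup_apply] at this
        have hpow : (c' ^ (e + e)) ^ d ≠ 0 := pow_ne_zero _ (pow_ne_zero _ hc0)
        refine mul_left_cancel₀ hpow ?_
        linear_combination this
      have h3 := hG.proportional u hu hz _ hTy hφz
      refine eq_mk_of_proportional hq0 hu fun l m => mul_left_cancel₀ hG0 (mul_left_cancel₀ hG0 ?_)
      linear_combination (eval (tup T y) (G i₀) * u m) * h2 i₀ l +
        (eval (tup T y) (G l) * q i₀) * h3 i₀ m - (eval (tup T y) (G i₀) * q m) * h3 i₀ l -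
        (eval (tup T y) (G l) * u i₀) * h2 i₀ m

end IsRuledMap

theorem IsCurve.subset_of_subset_union {E Z S : Set (Pr k N)} (hE : IsCurve E) (hZ : IsClosed Z)
    (hS : S.Finite) (h : E ⊆ Z ∪ S) : E ⊆ Z := by
  by_contra hn
  refine hE.infinite (((hE.finite_inter hZ hn).union hS).subset fun x hx => ?_)
  exact (h hx).imp (fun hz => ⟨hx, hz⟩) id

namespace IsRuledMap

variable {X : Set (Pr k M)} {φ : Pr k M → Pr k N} {i j : Fin (N + 1)}
  {D : MvPolynomial (Fin (N + 1)) k}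
  {E : Fin (N + 1) ⊕ Fin (N + 1) → MvPolynomial (Fin (N + 1)) k} {e d : ℕ}
  {G : Fin (M + 1) → MvPolynomial (Fin (N + 1)) k} {i₀ : Fin (M + 1)}

theorem finite_preimage [Infinite k] (h : IsRuledMap X φ) {S : Set (Pr k N)} (hS : S.Finite) :
    {x | x ∈ X ∧ φ x ∈ S}.Finite :=
  (hS.biUnion fun z _ => finite_fibre h.smooth h.uncrumpled z).subset fun _ hx =>
    mem_biUnion hx.2 ⟨hx.1, rfl⟩

theorem ker_ne_top [Infinite k] (h : IsRuledMap X φ) {g : MvPolynomial (Fin (N + 1)) k}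
    {ξ : (Fin (N + 1) → k) →ₗ[k] k} (hξ : IsGood (φ '' X) g ξ) : LinearMap.ker ξ ≠ ⊤ := by
  obtain ⟨W, hW⟩ := h.ruled.infinite_lines.nonempty
  intro htop
  exact hξ.not_le W hW (htop ▸ le_top)

/-- The hyperplane section of `X` contains a curve through each of its points. -/
theorem exists_curve_linSet [IsAlgClosed k] (h : IsRuledMap X φ) {g : MvPolynomial (Fin (N + 1)) k}
    {ξ : (Fin (N + 1) → k) →ₗ[k] k} (hξ : IsGood (φ '' X) g ξ) {x : Pr k M} (hx : x ∈ X)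
    (hφx : φ x ∈ linSet (LinearMap.ker ξ)) :
    ∃ C, IsCurve C ∧ x ∈ C ∧ C ⊆ X ∧ ∀ p ∈ C, φ p ∈ linSet (LinearMap.ker ξ) := by
  have hform : ∀ v, eval v (linForm fun m => ξ (Pi.single m 1)) = ξ v := fun v => by
    rw [eval_linForm, sum_functional_single]
  have hnot : linForm (fun m => ξ (Pi.single m 1)) ∉ coneIdeal (φ '' X) := by
    intro hmem
    refine Nondegenerate.not_subset_linSet h.uncrumpled.2.1 (h.ker_ne_top hξ) fun p hp => ?_
    induction p using Projectivization.ind with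
    | h v hv =>
      rw [mk_mem_linSet, LinearMap.mem_ker, ← hform]
      exact mem_coneIdeal'.1 hmem v hv hp
  induction x using Projectivization.ind with
  | h v hv =>
    obtain ⟨F, hF, hFv⟩ := isMorphismOn_iff.1 h.mor v hv hx
    obtain ⟨i, hi⟩ := Function.ne_iff.1 hFv
    obtain ⟨n, hn⟩ := hF.1
    have hlX := Rep.aeval_notMem h.variety h.mor hF
      ⟨i, fun h0 => hi (mem_coneIdeal'.1 h0 v hv hx)⟩ (isHomogeneous_linForm _) hnot
    have hhom := (isHomogeneous_linForm fun m => ξ (Pi.single m 1)).aeval _ hn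
    obtain ⟨C, hC, hvC, hCX, hlC⟩ := exists_curve_through h.smooth.2.1 h.variety hx hhom hlX (by
      rw [vanishes_mk_of_isHomogeneous hhom, eval_aeval_tup, hform]
      rwa [hF.2 v hv hx hFv, mk_mem_linSet] at hφx)
    refine ⟨C, hC, hvC, hCX, fun p hp => ?_⟩
    refine (hC.subset_of_subset_union (Z := X ∩ φ ⁻¹' linSet (LinearMap.ker ξ))
      (S := C ∩ {p | Vanishes (F i) p}) (h.mor.isClosed_preimage h.closed (isClosed_linSet _))
      (hC.finite_inter (isClosed_setOf_vanishes _) fun hsub => hi ?_) ?_ hp).2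
    · exact (vanishes_mk_of_isHomogeneous (hn i) hv).1 (hsub hvC)
    · intro p hp
      induction p using Projectivization.ind with
      | h u hu =>
        by_cases h0 : eval u (F i) = 0
        · exact Or.inr ⟨hp, (vanishes_mk_of_isHomogeneous (hn i) hu).2 h0⟩
        · have hFu : tup F u ≠ 0 := fun h1 => h0 (congrFun h1 i)
          refine Or.inl ⟨hCX hp, ?_⟩
          rw [mem_preimage, hF.2 u hu (hCX hp) hFu, mk_mem_linSet, LinearMap.mem_ker, ← hform,
            ← eval_aeval_tup]
          exact mem_coneIdeal'.1 hlC u hu hp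

theorem projection_eq_self [IsAlgClosed k] (h : IsRuledMap X φ) (hs : IsSection (φ '' X) i j D E e)
    (hG : IsInverse X φ G d) {ξ : (Fin (N + 1) → k) →ₗ[k] k} (hξ : IsGood (φ '' X) (D * G i₀) ξ)
    {ρ : Pr k M → Pr k M} (hρ : IsProjection X φ D (hypTup E ξ) (G i₀) ξ ρ) {x : Pr k M}
    (hx : x ∈ X) (hφx : φ x ∈ linSet (LinearMap.ker ξ)) : ρ x = x := by
  obtain ⟨C, hC, hxC, hCX, hCξ⟩ := h.exists_curve_linSet hξ hx hφx
  refine (hC.subset_of_subset_union (Z := {p | p ∈ X ∧ ρ p = id p})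
    (isClosed_setOf_eq h.closed hρ.mor (isMorphismOn_id X)) (h.finite_preimage hξ.finite) ?_ hxC).2
  intro p hp
  have hpX := hCX hp
  have hpξ := hCξ p hp
  by_cases h0 : Vanishes (D * G i₀) (φ p)
  · exact Or.inr ⟨hpX, mem_image_of_mem φ hpX, h0, hpξ⟩
  · refine Or.inl ⟨hpX, ?_⟩
    generalize hy : φ p = y at h0 hpξ
    induction y using Projectivization.ind with
    | h y hy0 =>
      rw [vanishes_mk_of_isHomogeneous (hs.homD.mul (hG.isHomogeneous i₀)), map_mul] at h0
      have hD := left_ne_zero_of_mul h0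
      obtain ⟨c, hc, hTc⟩ := hs.exists_tup_hypTup_eq_smul hξ
        (inCone_mk (hy := hy0) (hy ▸ mem_image_of_mem φ hpX)) hD (mk_mem_linSet.1 hpξ)
      refine hρ.eq_of_mk_eq p hpX y hy0 hy hD ?_ p hpX (by rw [hTc]; exact smul_ne_zero hc hy0) ?_
      · rw [hTc, eval_smul_of_isHomogeneous (hG.isHomogeneous i₀)]
        exact mul_ne_zero (pow_ne_zero _ hc) (right_ne_zero_of_mul h0)
      · rw [hy, ← mk_smul_eq hy0 hc]
        congr 1
        exact hTc.symm

theorem infinite_image_projection [IsAlgClosed k] (h : IsRuledMap X φ)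
    (hs : IsSection (φ '' X) i j D E e)
    (hG : IsInverse X φ G d) {ξ : (Fin (N + 1) → k) →ₗ[k] k} (hξ : IsGood (φ '' X) (D * G i₀) ξ)
    {ρ : Pr k M → Pr k M} (hρ : IsProjection X φ D (hypTup E ξ) (G i₀) ξ ρ) :
    (ρ '' X).Infinite := by
  obtain ⟨x, hx⟩ := h.variety.2.1
  obtain ⟨C, hC, -, hCX, hCξ⟩ := h.exists_curve_linSet hξ (hρ.mapsTo hx) (hρ.mem_linSet x hx)
  exact hC.infinite.mono fun p hp =>
    ⟨p, hCX hp, h.projection_eq_self hs hG hξ hρ (hCX hp) (hCξ p hp)⟩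

theorem projection_comp [IsAlgClosed k] [CharZero k] (h : IsRuledMap X φ)
    (hs : IsSection (φ '' X) i j D E e) (hG : IsInverse X φ G d)
    {ξ ξ' : (Fin (N + 1) → k) →ₗ[k] k} (hξ : IsGood (φ '' X) (D * G i₀) ξ)
    (hξ' : IsGood (φ '' X) (D * G i₀) ξ') {ρ ρ' : Pr k M → Pr k M}
    (hρ : IsProjection X φ D (hypTup E ξ) (G i₀) ξ ρ)
    (hρ' : IsProjection X φ D (hypTup E ξ') (G i₀) ξ' ρ') : EqOn (ρ ∘ ρ') ρ X := by
  obtain ⟨F, hF, hF0⟩ := h.variety.exists_rep h.mor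
  obtain ⟨n, hn⟩ := hF.1
  have hT := hs.isHomogeneous_hypTup ξ
  have hT' := hs.isHomogeneous_hypTup ξ'
  have hg := hs.homD.mul (hG.isHomogeneous i₀)
  have hb₀ : D * (aeval (hypTup E ξ') (D * G i₀) * aeval (hypTup E ξ) (D * G i₀)) ∉
      coneIdeal (φ '' X) := by
    have hI := h.variety_image.isPrime
    intro h0
    rcases hI.mem_or_mem h0 with h0 | h0
    · exact hs.notMem h0
    rcases hI.mem_or_mem h0 with h0 | h0
    · exact h.aeval_hypTup_notMem hs hg hξ' h0
    · exact h.aeval_hypTup_notMem hs hg hξ h0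
  have hhom₀ := hs.homD.mul ((hg.aeval _ hT').mul (hg.aeval _ hT))
  have hhom := hhom₀.aeval _ hn
  have hb := Rep.aeval_notMem h.variety h.mor hF hF0 hhom₀ hb₀
  refine eqOn_of_eqOn_diff h.variety (hρ'.mor.comp hρ.mor hρ'.mapsTo) hρ.mor
    (isClosed_setOf_vanishes _) (fun hsub => hb fun p hp => hsub hp) fun p hp hpb => ?_
  induction p using Projectivization.ind with
  | h v hv =>
    rw [mem_setOf_eq, vanishes_mk_of_isHomogeneous hhom, eval_aeval_tup, map_mul, map_mul,
      eval_aeval_tup, eval_aeval_tup, map_mul, map_mul] at hpb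
    set y := tup F v
    have hD := left_ne_zero_of_mul hpb
    have hb' := left_ne_zero_of_mul (right_ne_zero_of_mul hpb)
    have hb'' := right_ne_zero_of_mul (right_ne_zero_of_mul hpb)
    have hy := hs.ne_zero hD
    have hxy := hF.2 v hv hp hy
    have hyc : InCone (φ '' X) y := inCone_mk (hy := hy) (hxy ▸ mem_image_of_mem φ hp)
    have hTy := hs.tup_hypTup_ne_zero hξ hyc hD
    have hTy' := hs.tup_hypTup_ne_zero hξ' hyc hD
    obtain ⟨z, hz, hφz⟩ := hs.inCone_tup_hypTup ξ hyc hTy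
    obtain ⟨z', hz', hφz'⟩ := hs.inCone_tup_hypTup ξ' hyc hTy'
    have hD' := left_ne_zero_of_mul hb'
    have hmul := hs.smul_tup_hypTup_tup_hypTup ξ ξ' hyc
    have hcc : ∃ c : k, c ≠ 0 ∧ tup (hypTup E ξ) (tup (hypTup E ξ') y) = c • tup (hypTup E ξ) y := by
      refine ⟨(eval y D ^ 2)⁻¹ * eval (tup (hypTup E ξ') y) D ^ 2,
        mul_ne_zero (inv_ne_zero (pow_ne_zero _ hD)) (pow_ne_zero _ hD'), ?_⟩
      rw [mul_smul, ← hmul, inv_smul_smul₀ (pow_ne_zero _ hD)]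
    obtain ⟨c, hc, hcT⟩ := hcc
    rw [Function.comp, hρ'.eq_of_mk_eq _ hp y hy hxy hD (right_ne_zero_of_mul hb') z' hz' hTy' hφz',
      hρ.eq_of_mk_eq _ hp y hy hxy hD (right_ne_zero_of_mul hb'') z hz hTy hφz]
    refine hρ.eq_of_mk_eq z' hz' _ hTy' hφz' hD' ?_ z hz (by rw [hcT]; exact smul_ne_zero hc hTy) ?_
    · rw [hcT, eval_smul_of_isHomogeneous (hG.isHomogeneous i₀)]
      exact mul_ne_zero (pow_ne_zero _ hc) (right_ne_zero_of_mul hb'')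
    · rw [hφz, ← mk_smul_eq hTy hc]
      congr 1
      exact hcT.symm

end IsRuledMap

/-! ### Recognising the projective line -/

theorem exists_lineMap_leftInverse {e₀ e₁ : Fin (N + 1) → k}
    (hli : LinearIndependent k ![e₀, e₁]) :
    ∃ κ : Pr k N → Pr k 1, IsMorphismOn (linSet (Submodule.span k {e₀, e₁})) κ ∧
      ∀ s (hs : s ≠ 0), κ (Projectivization.mk k (tup (lineTup e₀ e₁) s)
        (tup_lineTup_ne_zero hli hs)) = Projectivization.mk k s hs := by
  have hinj := linearIndependent_iff_injective_fintypeLinearCombination.1 hli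
  obtain ⟨g, hg⟩ := LinearMap.exists_leftInverse_of_injective
    (Fintype.linearCombination k ![e₀, e₁]) (LinearMap.ker_eq_bot.2 hinj)
  have hgs : ∀ s, g (tup (lineTup e₀ e₁) s) = s := by
    intro s
    have := LinearMap.congr_fun hg s
    rw [LinearMap.comp_apply, Fintype.linearCombination_apply, Fin.sum_univ_two] at this
    rw [tup_lineTup]
    exact this
  have hL : ∀ v, tup (fun i : Fin (1 + 1) =>
      linForm fun m => ((LinearMap.proj i : (Fin 2 → k) →ₗ[k] k).comp g) (Pi.single m 1)) v = g v := by
    intro v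
    ext i
    rw [tup_apply, eval_linForm, sum_functional_single]
    rfl
  obtain ⟨κ, hκ, hrep⟩ := exists_morphism_of_tuples (linSet (Submodule.span k {e₀, e₁}))
    {fun i : Fin (1 + 1) =>
      linForm fun m => ((LinearMap.proj i : (Fin 2 → k) →ₗ[k] k).comp g) (Pi.single m 1)}
    (by rintro F rfl; exact ⟨1, fun i => isHomogeneous_linForm _⟩)
    (by rintro F rfl G rfl v hv - i j; rfl) (by
      intro v hv hvW
      refine ⟨_, rfl, ?_⟩
      rw [hL]
      rw [mk_mem_linSet, Submodule.mem_span_pair] at hvW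
      obtain ⟨a, b, rfl⟩ := hvW
      intro h0
      have h1 := hgs ![a, b]
      rw [tup_lineTup, Matrix.cons_val_zero, Matrix.cons_val_one] at h1
      refine hv ?_
      rw [show a = 0 from congrFun (h1.symm.trans h0) 0, show b = 0 from congrFun (h1.symm.trans h0) 1,
        zero_smul, zero_smul, add_zero])
  refine ⟨κ, hκ, fun s hs => ?_⟩
  have h1 := (hL (tup (lineTup e₀ e₁) s)).trans (hgs s)
  rw [(hrep _ rfl).2 _ (tup_lineTup_ne_zero hli hs) _ (by rw [h1]; exact hs)]
  · congr 1
  · rw [mk_mem_linSet, tup_lineTup]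
    exact Submodule.mem_span_pair.2 ⟨_, _, rfl⟩

theorem isIsoToP1_of_injOn [IsAlgClosed k] [CharZero k] {F : Set (Pr k M)} (hF : IsClosed F)
    (hinf : F.Infinite) {φ : Pr k M → Pr k N} (hφ : IsMorphismOn F φ) (hinj : InjOn φ F)
    {W : Submodule k (Fin (N + 1) → k)} (hW : finrank k W = 2) (hFW : MapsTo φ F (linSet W)) :
    IsIsoToP1 F := by
  obtain ⟨E, hE, hEF, hEinf⟩ := exists_infinite_variety hF hinf
  have hφE := hφ.mono hEF
  have hinjE := hinj.mono hEF
  have himE : φ '' E = linSet W := by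
    by_contra hne
    refine (hEinf.image hinjE) ((isCurve_linSet hW).finite_of_ssubset _ (hE.image hφE).isClosed
      (lt_of_le_of_ne ?_ hne))
    rintro _ ⟨x, hx, rfl⟩
    exact hFW (hEF hx)
  obtain rfl : E = F := by
    refine hEF.antisymm fun x hx => ?_
    obtain ⟨y, hy, hxy⟩ : φ x ∈ φ '' E := himE ▸ hFW hx
    exact hinj (hEF hy) hx hxy ▸ hy
  obtain ⟨G, e, hG, hprop, -, hbad⟩ := hE.exists_inverse_tuple hφ
    ⟨∅, isClosed_iff.1 isClosed_empty, fun h0 => by simpa using h0 hE.2.1.some_mem,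
      hinj.mono diff_subset⟩
  obtain ⟨e₀, he₀, he₀W⟩ : ∃ e₀ ∈ W, e₀ ≠ 0 := by
    refine W.exists_mem_ne_zero_of_ne_bot ?_
    rintro rfl
    simp at hW
  obtain ⟨e₁, hli, rfl⟩ := exists_basis_of_mem hW he₀W he₀
  have hpt : ∀ p ∈ E, ∃ s, ∃ hs : s ≠ 0, φ p = Projectivization.mk k (tup (lineTup e₀ e₁) s)
      (tup_lineTup_ne_zero hli hs) := by
    intro p hp
    obtain ⟨l, -, -, hl, him⟩ := exists_lineMap hli
    obtain ⟨t, -, ht⟩ : φ p ∈ l '' univ := him ▸ hFW hp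
    induction t using Projectivization.ind with
    | h s hs => exact ⟨s, hs, by rw [← ht, hl]⟩
  obtain ⟨Ψ, ψ, d, -, hΨ, hΨE, hs⟩ := exists_lift_line hF hφ hG hli hprop (by
    by_contra! h0
    refine hbad fun p hp => ⟨hp, ?_⟩
    rintro _ ⟨i, rfl⟩
    obtain ⟨s, hs, hps⟩ := hpt p hp
    rw [hps, vanishes_mk_of_isHomogeneous (hG i)]
    exact congrFun (h0 s) i) (fun s hs => by
      rw [himE, mk_mem_linSet, tup_lineTup]
      exact Submodule.mem_span_pair.2 ⟨_, _, rfl⟩)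
  obtain ⟨κ, hκ, hκs⟩ := exists_lineMap_leftInverse hli
  have hleft : ∀ t, κ (φ (Ψ t)) = t := by
    intro t
    induction t using Projectivization.ind with
    | h s hs0 => rw [(hs s hs0).2, hκs]
  refine ⟨Ψ, hΨ, ⟨fun t _ => hΨE t, (Function.LeftInverse.injective (g := κ ∘ φ) hleft).injOn, ?_⟩,
    κ ∘ φ, hφ.comp hκ hFW, hleft⟩
  intro p hp
  obtain ⟨s, hs0, hps⟩ := hpt p hp
  exact ⟨_, trivial, hinj (hΨE _) hp ((hs s hs0).2.trans hps.symm)⟩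

/-- `ρ` contracts the lines of the ruling of `φ '' X`. -/
structure IsRuling (X : Set (Pr k M)) (φ : Pr k M → Pr k N) (g : MvPolynomial (Fin (N + 1)) k)
    (ρ : Pr k M → Pr k M) : Prop where
  notMem : g ∉ coneIdeal (φ '' X)
  mor : IsMorphismOn X ρ
  mapsTo : MapsTo ρ X X
  idem : ∀ x ∈ X, ρ (ρ x) = ρ x
  eq_of_eq : ∀ x ∈ X, ∀ z ∈ X, ρ x = ρ z → φ x = φ z → x = z
  joined : ∀ x ∈ X, ∀ z ∈ X, ρ x = ρ z → ∀ v (hv : v ≠ 0) w (hw : w ≠ 0),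
    φ x = Projectivization.mk k v hv → φ z = Projectivization.mk k w hw →
      ∀ a b : k, InCone (φ '' X) (a • v + b • w)
  exists_mem : ∀ ξ : (Fin (N + 1) → k) →ₗ[k] k, IsGood (φ '' X) g ξ → ∀ x ∈ X, ∃ z ∈ X, ρ z = ρ x ∧
    φ z ∈ linSet (LinearMap.ker ξ)

namespace IsRuledMap

variable {X : Set (Pr k M)} {φ : Pr k M → Pr k N} {g : MvPolynomial (Fin (N + 1)) k}
  {ρ : Pr k M → Pr k M}

theorem exists_isRuling [IsAlgClosed k] [CharZero k] (h : IsRuledMap X φ) :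
    ∃ g ρ, IsRuling X φ g ρ ∧ (ρ '' X).Infinite ∧ ρ '' X ⊂ X := by
  obtain ⟨i, j, D, E, e, hs⟩ := h.exists_isSection
  obtain ⟨G, d, hGd, hGp, hbad⟩ := h.exists_inverse
  have hG : IsInverse X φ G d := ⟨hGd, hGp⟩
  obtain ⟨i₀, hi₀⟩ : ∃ i₀, G i₀ ∉ coneIdeal (φ '' X) := by
    by_contra! h0
    refine hbad.2 fun x hx => ⟨hx, ?_⟩
    rintro _ ⟨i, rfl⟩
    exact h0 i _ (mem_image_of_mem φ hx)
  have hg : D * G i₀ ∉ coneIdeal (φ '' X) := fun h0 =>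
    (h.variety_image.isPrime.mem_or_mem h0).elim hs.notMem hi₀
  have hgood : ∀ v : Fin (N + 1) → k, v ≠ 0 →
      ∃ ξ : (Fin (N + 1) → k) →ₗ[k] k, IsGood (φ '' X) (D * G i₀) ξ ∧ ξ v = 0 := by
    intro v hv
    obtain ⟨ξ, h1, h2, -⟩ := h.exists_isGood hg hv finite_empty (by simp)
    exact ⟨ξ, h1, h2⟩
  obtain ⟨ξ₀, hξ₀, -⟩ := hgood 1 one_ne_zero
  obtain ⟨ρ₀, hρ₀⟩ := h.exists_isProjection hs hG hξ₀
  have key : ∀ w (hw : w ≠ 0), ∃ ρ : Pr k M → Pr k M,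
      (∀ z ∈ X, φ z = Projectivization.mk k w hw → ∀ x ∈ X, ρ₀ x = ρ₀ z → ρ x = z) ∧
      ∀ x ∈ X, ∀ v (hv : v ≠ 0) w (hw : w ≠ 0), φ x = Projectivization.mk k v hv →
        φ (ρ x) = Projectivization.mk k w hw → ∀ a b : k, InCone (φ '' X) (a • v + b • w) := by
    intro w hw
    obtain ⟨ξ, hξ, hξw⟩ := hgood w hw
    obtain ⟨ρ, hρ⟩ := h.exists_isProjection hs hG hξ
    refine ⟨ρ, fun z hz hzw x hx hxz => ?_, hρ.joined⟩
    have hcomp := h.projection_comp hs hG hξ hξ₀ hρ hρ₀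
    rw [← hcomp hx, Function.comp, hxz]
    refine (hcomp hz).trans (h.projection_eq_self hs hG hξ hρ hz ?_)
    rw [hzw, mk_mem_linSet]
    exact hξw
  refine ⟨D * G i₀, ρ₀, ⟨hg, hρ₀.mor, hρ₀.mapsTo, h.projection_comp hs hG hξ₀ hξ₀ hρ₀ hρ₀, ?_, ?_, ?_⟩,
    h.infinite_image_projection hs hG hξ₀ hρ₀, ?_, fun hsub => ?_⟩
  · intro x hx z hz hxz hφ
    obtain ⟨ρ, hρ, -⟩ := key _ (Projectivization.rep_nonzero (φ z))
    rw [← hρ x hx (hφ.trans (Projectivization.mk_rep _).symm) x hx rfl]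
    exact hρ z hz (Projectivization.mk_rep _).symm x hx hxz
  · intro x hx z hz hxz v hv w hw hxv hzw
    obtain ⟨ρ, hρ, hj⟩ := key w hw
    exact hj x hx v hv w hw hxv (by rw [hρ z hz hzw x hx hxz, hzw])
  · intro ξ hξ x hx
    obtain ⟨ρ, hρ⟩ := h.exists_isProjection hs hG hξ
    exact ⟨ρ x, hρ.mapsTo hx, h.projection_comp hs hG hξ₀ hξ hρ₀ hρ hx, hρ.mem_linSet x hx⟩
  · exact hρ₀.mapsTo.image_subset
  · refine h.uncrumpled.2.1.not_subset_linSet (h.ker_ne_top hξ₀) ?_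
    rintro _ ⟨x, hx, rfl⟩
    obtain ⟨y, hy, rfl⟩ := hsub hx
    exact hρ₀.mem_linSet y hy

end IsRuledMap

namespace IsRuling

variable {X : Set (Pr k M)} {φ : Pr k M → Pr k N} {g : MvPolynomial (Fin (N + 1)) k}
  {ρ : Pr k M → Pr k M} {x : Pr k M}

theorem isClosed_fibre [Infinite k] (hr : IsRuling X φ g ρ) (h : IsRuledMap X φ) (b : Pr k M) :
    IsClosed {p | p ∈ X ∧ ρ p = b} :=
  hr.mor.isClosed_preimage h.closed (isClosed_singleton (x := b))

theorem infinite_image_fibre [IsAlgClosed k] [CharZero k] (hr : IsRuling X φ g ρ)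
    (h : IsRuledMap X φ) (hx : x ∈ X) : (φ '' {p | p ∈ X ∧ ρ p = ρ x}).Infinite := by
  intro hfin
  obtain ⟨q, hqX, hq⟩ := ((h.infinite_image subset_rfl
    (infinite_of_hasDim_two h.smooth.2.1 h.variety)).diff hfin).nonempty
  induction q using Projectivization.ind with
  | h v hv =>
    obtain ⟨ξ, hξ, -, hξQ⟩ := h.exists_isGood hr.notMem hv
      (hfin.image Projectivization.rep) (by
        rintro _ ⟨p, hp, rfl⟩ hpv
        refine hq ?_
        obtain ⟨c, hc⟩ := Submodule.mem_span_singleton.1 hpv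
        have h1 : Projectivization.mk k _ (Projectivization.rep_nonzero p) =
            Projectivization.mk k v hv := (Projectivization.mk_eq_mk_iff' k _ _ _ _).2 ⟨c, hc⟩
        rwa [← h1, Projectivization.mk_rep])
    obtain ⟨z, hz, hzx, hzξ⟩ := hr.exists_mem ξ hξ x hx
    refine hξQ _ (mem_image_of_mem _ (mem_image_of_mem φ ⟨hz, hzx⟩)) ?_
    rwa [← Projectivization.mk_rep (φ z), mk_mem_linSet] at hzξ

/-- Two points in the image of a fibre lie on a common line of `Y`. -/
theorem exists_line [Infinite k] (hr : IsRuling X φ g ρ) {y z : Pr k M} (hy : y ∈ X) (hz : z ∈ X)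
    (hyz : ρ y = ρ z) (hne : φ y ≠ φ z) :
    ∃ W ∈ lines (φ '' X), φ y ∈ linSet W ∧ φ z ∈ linSet W := by
  have hj := hr.joined y hy z hz hyz
  generalize φ y = p at *
  generalize φ z = q at *
  induction p using Projectivization.ind with
  | h v hv =>
  induction q using Projectivization.ind with
  | h w hw =>
    have hind : LinearIndependent k ![v, w] := by
      rw [LinearIndependent.pair_iff' hv]
      intro c hc
      exact hne ((Projectivization.mk_eq_mk_iff' k _ _ _ _).2 ⟨c, hc⟩).symm
    refine ⟨Submodule.span k {v, w}, ⟨finrank_span_pair_eq_two hind, fun p hp => ?_⟩, ?_, ?_⟩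
    · induction p using Projectivization.ind with
      | h u hu =>
        rw [mk_mem_linSet, Submodule.mem_span_pair] at hp
        obtain ⟨a, b, rfl⟩ := hp
        exact hj v hv w hw rfl rfl a b hu
    all_goals exact mk_mem_linSet.2 (Submodule.subset_span (by simp))

theorem subsingleton_linSet_inf_of_ne {W W' : Submodule k (Fin (N + 1) → k)} (hW : finrank k W = 2)
    (hW' : finrank k W' = 2) (hne : W ≠ W') : (linSet W ∩ linSet W').Subsingleton := by
  rintro p ⟨hp, hp'⟩ q ⟨hq, hq'⟩
  by_contra hpq
  induction p using Projectivization.ind with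
  | h v hv =>
  induction q using Projectivization.ind with
  | h w hw =>
    rw [mk_mem_linSet] at hp hp' hq hq'
    have hind : LinearIndependent k ![v, w] := by
      rw [LinearIndependent.pair_iff' hv]
      intro c hc
      exact hpq ((Projectivization.mk_eq_mk_iff' k _ _ _ _).2 ⟨c, hc⟩).symm
    have h2 := finrank_span_pair_eq_two hind
    refine hne ((Submodule.eq_of_le_of_finrank_eq ?_ (h2.trans hW.symm)).symm.trans
      (Submodule.eq_of_le_of_finrank_eq ?_ (h2.trans hW'.symm)))
    · exact Submodule.span_le.2 (by rintro _ (rfl | rfl); exacts [hp, hq])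
    · exact Submodule.span_le.2 (by rintro _ (rfl | rfl); exacts [hp', hq'])

theorem image_fibre [IsAlgClosed k] [CharZero k] (hr : IsRuling X φ g ρ)
    (h : IsRuledMap X φ) (hx : x ∈ X) :
    ∃ W : Submodule k (Fin (N + 1) → k), finrank k W = 2 ∧
      φ '' {p | p ∈ X ∧ ρ p = ρ x} = linSet W := by
  have hinf := hr.infinite_image_fibre h hx
  have hline : ∀ q, {W | W ∈ lines (φ '' X) ∧ q ∈ linSet W}.Finite := by
    intro q
    induction q using Projectivization.ind with
    | h v hv => simpa only [mk_mem_linSet] using h.finite_lines_through hv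
  obtain ⟨W, ⟨hW, -⟩, hWinf⟩ : ∃ W, (W ∈ lines (φ '' X) ∧ φ x ∈ linSet W) ∧
      (φ '' {p | p ∈ X ∧ ρ p = ρ x} ∩ linSet W).Infinite := by
    by_contra! hcon
    refine hinf ((((hline (φ x)).biUnion fun W hW => hcon W hW).insert (φ x)).subset ?_)
    rintro _ ⟨z, hz, rfl⟩
    by_cases hzx : φ z = φ x
    · exact Or.inl hzx
    · obtain ⟨W, hW, h1, h2⟩ := hr.exists_line hz.1 hx hz.2 hzx
      exact Or.inr (mem_biUnion (x := W) ⟨hW, h2⟩ ⟨mem_image_of_mem φ hz, h1⟩)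
  have hsub : φ '' {p | p ∈ X ∧ ρ p = ρ x} ⊆ linSet W := by
    rintro _ ⟨y, hy, rfl⟩
    by_contra hyW
    refine hWinf (((hline (φ y)).biUnion (t := fun W' => linSet W ∩ linSet W') fun W' hW' =>
      (subsingleton_linSet_inf_of_ne hW.1 hW'.1.1 fun h0 => hyW (h0 ▸ hW'.2)).finite).subset ?_)
    rintro _ ⟨⟨z, hz, rfl⟩, hzW⟩
    obtain ⟨W', hW', h1, h2⟩ := hr.exists_line hz.1 hy.1 (hz.2.trans hy.2.symm)
      fun h0 => hyW (h0 ▸ hzW)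
    exact mem_biUnion (x := W') ⟨hW', h2⟩ ⟨hzW, h1⟩
  refine ⟨W, hW.1, hsub.antisymm fun y hy => ?_⟩
  induction y using Projectivization.ind with
  | h v hv =>
    obtain ⟨ξ, hξ, hξv, -⟩ := h.exists_isGood hr.notMem hv finite_empty (by simp)
    obtain ⟨z, hz, hzx, hzξ⟩ := hr.exists_mem ξ hξ x hx
    have hzF := mem_image_of_mem φ (show z ∈ {p | p ∈ X ∧ ρ p = ρ x} from ⟨hz, hzx⟩)
    rw [← subsingleton_linSet_inf hW.1 (hξ.not_le W hW) (fun u hu => ⟨hsub hzF hu, hzξ hu⟩)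
      (mk_mem_linSet.2 ⟨mk_mem_linSet.1 hy, hξv⟩)]
    exact hzF

theorem isIsoToP1_fibre [IsAlgClosed k] [CharZero k] (hr : IsRuling X φ g ρ)
    (h : IsRuledMap X φ) (hx : x ∈ X) : IsIsoToP1 {p | p ∈ X ∧ ρ p = ρ x} := by
  obtain ⟨W, hW, hFW⟩ := hr.image_fibre h hx
  refine isIsoToP1_of_injOn (hr.isClosed_fibre h _) (hr.infinite_image_fibre h hx).of_image
    (h.mor.mono fun p hp => hp.1) (fun p hp q hq hpq => ?_) hW (mapsTo_iff_image_subset.2 hFW.subset)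
  exact hr.eq_of_eq p hp.1 q hq.1 (hp.2.trans hq.2.symm) hpq

end IsRuling

namespace IsRuling

variable {X : Set (Pr k M)} {φ : Pr k M → Pr k N} {g : MvPolynomial (Fin (N + 1)) k}
  {ρ : Pr k M → Pr k M}

theorem mem_span_of_mem_embTangent [Infinite k] (hr : IsRuling X φ g ρ) {v w : Fin (M + 1) → k}
    (hv : v ≠ 0) (hvB : Projectivization.mk k v hv ∈ ρ '' X)
    (hB : w ∈ embTangent (ρ '' X) (Projectivization.mk k v hv))
    (hF : w ∈ embTangent {p | p ∈ X ∧ ρ p = Projectivization.mk k v hv}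
      (Projectivization.mk k v hv)) : w ∈ Submodule.span k {v} := by
  have hBX : ρ '' X ⊆ X := hr.mapsTo.image_subset
  have hself : ∀ p ∈ ρ '' X, ρ p = p := by
    rintro _ ⟨x, hx, rfl⟩
    exact hr.idem x hx
  obtain ⟨F, hFr, hFv⟩ := isMorphismOn_iff.1 hr.mor v hv (hBX hvB)
  obtain ⟨c, hc⟩ := hFr.exists_tup_eq_smul (hBX hvB) (hself _ hvB)
  have hc0 : c ≠ 0 := fun h0 => hFv (by rw [hc, h0, zero_smul])
  rw [mem_embTangent] at hB hF
  have h1 : ∀ i j, v j * diffAt (F i) v w - v i * diffAt (F j) v w = 0 := by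
    intro i j
    have h0 := hF (v j • F i - v i • F j) (by
      refine mem_coneIdeal'.2 fun u hu hp => ?_
      obtain ⟨a, ha⟩ := hFr.exists_tup_eq_smul hp.1 hp.2
      have hi : eval u (F i) = a * v i := congrFun ha i
      have hj : eval u (F j) = a * v j := congrFun ha j
      simp only [map_sub, smul_eval, hi, hj]
      ring)
    rwa [← diffHom_apply, map_sub, map_smul, map_smul] at h0
  have h2 : ∀ i j, diffAt (F i * MvPolynomial.X j - F j * MvPolynomial.X i) v w = 0 := by
    intro i j
    refine hB _ (mem_coneIdeal'.2 fun u hu hp => ?_)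
    obtain ⟨a, ha⟩ := hFr.exists_tup_eq_smul (hBX hp) (hself _ hp)
    have hi : eval u (F i) = a * u i := congrFun ha i
    have hj : eval u (F j) = a * u j := congrFun ha j
    simp only [map_sub, map_mul, eval_X, hi, hj]
    ring
  refine mem_span_of_proportional hv fun i j => ?_
  have hX : ∀ l, diffAt (MvPolynomial.X l) v w = w l := fun l => by
    simp [diffAt_apply, pderiv_X, Pi.single_apply, apply_ite]
  have h3 := h2 i j
  rw [← diffHom_apply, map_sub, LinearMap.sub_apply, diffHom_apply, diffHom_apply, diffAt_mul,
    diffAt_mul, hX, hX, eval_X, eval_X] at h3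
  have hi : eval v (F i) = c * v i := congrFun hc i
  have hj : eval v (F j) = c * v j := congrFun hc j
  rw [hi, hj] at h3
  refine mul_left_cancel₀ hc0 ?_
  linear_combination h1 i j - h3

theorem isSmoothCurve_image [IsAlgClosed k] [CharZero k] (hr : IsRuling X φ g ρ)
    (h : IsRuledMap X φ) (hinf : (ρ '' X).Infinite) (hlt : ρ '' X ⊂ X) :
    IsSmoothCurve (ρ '' X) := by
  have hB := h.variety.image hr.mor
  refine ⟨hB, (isCurve_of_hasDim_two h.smooth.2.1 h.variety hB hinf hlt).hasDim, fun p hp => ?_⟩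
  induction p using Projectivization.ind with
  | h v hv =>
    have hX := h.smooth.2.2 _ (hlt.1 hp)
    have hle := embTangent_mono hlt.1 (Projectivization.mk k v hv)
    obtain ⟨w, hw, hwv⟩ := exists_mem_embTangent hB hinf hv hp
    have hind : LinearIndependent k ![v, w] := by
      rw [LinearIndependent.pair_iff' hv]
      rintro c rfl
      exact hwv (Submodule.smul_mem _ _ (Submodule.mem_span_singleton_self v))
    have h2 : Submodule.span k {v, w} ≤ embTangent (ρ '' X) (Projectivization.mk k v hv) :=
      Submodule.span_le.2 (by rintro _ (rfl | rfl); exacts [self_mem_embTangent hv hp, hw])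
    have h2' := Submodule.finrank_mono h2
    rw [finrank_span_pair_eq_two hind] at h2'
    have h3 := Submodule.finrank_mono hle
    by_contra hne
    have heq := Submodule.eq_of_le_of_finrank_eq hle (by omega)
    have hfix : ρ (Projectivization.mk k v hv) = Projectivization.mk k v hv := by
      obtain ⟨x, hx, hxv⟩ := hp
      rw [← hxv, hr.idem x hx]
    have hiso := hr.isIsoToP1_fibre h (hlt.1 hp)
    have hFinf := (hr.infinite_image_fibre h (hlt.1 hp)).of_image
    rw [hfix] at hiso hFinf
    obtain ⟨ψ, hψ, hbij, -⟩ := hiso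
    have hF := isCurve_univ.isVariety.image hψ
    rw [hbij.image_eq] at hF
    obtain ⟨w', hw', hw'v⟩ := exists_mem_embTangent hF hFinf hv ⟨hlt.1 hp, hfix⟩
    exact hw'v (hr.mem_span_of_mem_embTangent hv hp
      (heq ▸ embTangent_mono (fun _ hx => hx.1) _ hw') hw')

end IsRuling

end

/-- **Lemma.** If `Y = φ(X)` is ruled by lines, then `X` is a `ℙ¹`-bundle over a smooth
curve, and `φ` maps each fiber of the ruling onto a line in `ℙ^N`. -/
theorem stmt_8
    (k : Type) [Field k] [IsAlgClosed k] [CharZero k]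
    (M N : ℕ) (hN : 4 ≤ N)
    (X : Set (Pr k M)) (φ : Pr k M → Pr k N)
    (hX : IsSmoothSurface X) (hφ : Uncrumpled X φ)
    (hruled : RuledByLines (φ '' X)) :
    ∃ (m : ℕ) (B : Set (Pr k m)) (ρ : Pr k M → Pr k m),
      IsSmoothCurve B ∧ IsP1Bundle X B ρ ∧
      ∀ b ∈ B, ∃ Lb : Set (Pr k N), IsLine Lb ∧ φ '' {p | p ∈ X ∧ ρ p = b} = Lb := by
  have h : IsRuledMap X φ := ⟨hN, hX, hφ, hruled⟩
  obtain ⟨g, ρ, hr, hinf, hlt⟩ := h.exists_isRuling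
  refine ⟨M, ρ '' X, ρ, hr.isSmoothCurve_image h hinf hlt, ⟨hr.mor, rfl, ?_⟩, ?_⟩
  · rintro _ ⟨x, hx, rfl⟩
    exact hr.isIsoToP1_fibre h hx
  · rintro _ ⟨x, hx, rfl⟩
    obtain ⟨W, hW, heq⟩ := hr.image_fibre h hx
    exact ⟨_, ⟨W, hW, rfl⟩, heq⟩

end PinchPaper
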